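/- For every δ > 0 there exists a constant C(δ) > 0 such that for every intensity α ∈ (0,1/2] and all integers 1 ≤ r < R: the probability that every cluster of the frontier loop soup 𝓛^b_R intersecting B_r has Euclidean diameter strictly less than δr is at least C(δ). -/

import Mathlib

open MeasureTheory Set
open scoped ENNReal NNReal

noncomputable section

namespace RWLSPaper

open scoped Classical

/-- Vertices of the square lattice `ℤ²`. -/
abbrev Lat : Type := ℤ × ℤ

/-- The plane `ℝ²`, with the Euclidean metric. -/
abbrev Plane : Type := EuclideanSpace ℝ (Fin 2)

/-- Embedding of the lattice into the plane. -/
def emb (z : Lat) : Plane := (WithLp.equiv 2 (Fin 2 → ℝ)).symm ![(z.1 : ℝ), (z.2 : ℝ)]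

/-- Lattice adjacency: Euclidean distance one. -/
def Adj (a b : Lat) : Prop := (a.1 - b.1) ^ 2 + (a.2 - b.2) ^ 2 = 1

/-- ℓ∞ norm on the lattice. -/
def linf (a : Lat) : ℤ := max |a.1| |a.2|

/-- The box `B_R(z) = {w : |w - z|_∞ ≤ R}`. -/
def box (z : Lat) (R : ℤ) : Set Lat := {w | linf (w - z) ≤ R}

/-- Inner vertex boundary of a set of vertices. -/
def bdry (A : Set Lat) : Set Lat := {z | z ∈ A ∧ ∃ w, w ∉ A ∧ linf (z - w) = 1}

/-- A set of vertices, embedded in the plane. -/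
def embS (A : Set Lat) : Set Plane := emb '' A

/-- The boundary of the box `B_R(z)`, embedded in the plane. -/
def bdryE (z : Lat) (R : ℤ) : Set Plane := embS (bdry (box z R))

/-- The solid box `z + [-R,R]²` in the plane. -/
def boxP (z : Lat) (R : ℤ) : Set Plane :=
  {p | |p 0 - (z.1 : ℝ)| ≤ (R : ℝ) ∧ |p 1 - (z.2 : ℝ)| ≤ (R : ℝ)}

/-- Trace of a list of vertices: the vertices, together with the segments joining
consecutive ones. -/
def traceL (l : List Lat) : Set Plane :=
  (⋃ z ∈ l, {emb z}) ∪ ⋃ p ∈ l.zip l.tail, segment ℝ (emb p.1) (emb p.2)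

/-- Nearest-neighbour paths: nonempty lists of successively adjacent vertices. -/
def IsPath (l : List Lat) : Prop := l ≠ [] ∧ l.Chain' Adj

/-- Number of steps of a path. -/
def steps (l : List Lat) : ℕ := l.length - 1

/-- Paths from `z` to `w` with at least one step. -/
def PathsBetween (z w : Lat) : Set (List Lat) :=
  {l | IsPath l ∧ l.head? = some z ∧ l.getLast? = some w ∧ 2 ≤ l.length}

/-- Total mass of a set of paths under the measure giving weight `4^{-|η|}` to each
path `η`. -/
def pathMass (M : Set (List Lat)) : ℝ≥0∞ :=
  ∑' l : M, (4 : ℝ≥0∞)⁻¹ ^ steps l.1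

/-- `A` disconnects `B` from `C` in the plane: every continuous path joining a point
of `B` to a point of `C` meets `A`. -/
def Disconnects (A B C : Set Plane) : Prop :=
  ∀ γ : ℝ → Plane, ContinuousOn γ (Icc 0 1) → γ 0 ∈ B → γ 1 ∈ C →
    ∃ t ∈ Icc (0 : ℝ) 1, γ t ∈ A

/-- The set `M^{z,w}_{r,R}` of paths from `z` to `w` which intersect `∂B_R` and do
not disconnect `B_r` from `∂B_R`. -/
def MSet (z w : Lat) (r R : ℤ) : Set (List Lat) :=
  {l | l ∈ PathsBetween z w ∧ (traceL l ∩ bdryE 0 R).Nonempty ∧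
    ¬ Disconnects (traceL l) (embS (box 0 r)) (bdryE 0 R)}

/-- Nearest-neighbour walks from `u` to `v` staying in `D`. -/
def WalksIn (D : Set Lat) (u v : Lat) : Set (List Lat) :=
  {l | IsPath l ∧ l.head? = some u ∧ l.getLast? = some v ∧ ∀ x ∈ l, x ∈ D}

/-- The Green's function of simple random walk killed upon exiting `D`, through the
path-sum formula `G_D(u,v) = Σ_{η : u → v, η ⊆ D} 4^{-|η|}`. -/
def green (D : Set Lat) (u v : Lat) : ℝ≥0∞ :=
  ∑' l : WalksIn D u v, (4 : ℝ≥0∞)⁻¹ ^ steps l.1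

/-! ### Loops -/

/-- A rooted loop, encoded by its cyclic word: a nonempty list of vertices which,
cyclically, are successively adjacent. -/
structure RootedLoop where
  word : List Lat
  ne : word ≠ []
  adj : (word ++ word.take 1).Chain' Adj

/-- Rerooting (cyclic relabeling) relation on rooted loops. -/
def loopRot (l l' : RootedLoop) : Prop := ∃ k, l'.word = l.word.rotate k

/-- Unrooted loops: rooted loops modulo rerooting. -/
def ULoop : Type := Quot loopRot

/-- A representative of an unrooted loop. -/
def ULoop.out (γ : ULoop) : RootedLoop := Quot.out γ

/-- Number of steps of a loop. -/
def ULoop.steps (γ : ULoop) : ℕ := γ.out.word.length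

/-- Vertices visited by a loop. -/
def ULoop.verts (γ : ULoop) : Set Lat := {x | x ∈ γ.out.word}

/-- The trace of a loop in the plane. -/
def ULoop.trace (γ : ULoop) : Set Plane := traceL (γ.out.word ++ γ.out.word.take 1)

/-- The multiplicity `J(γ)`: the largest `j` such that `γ` is the concatenation of
`j` copies of a single loop. -/
def ULoop.mult (γ : ULoop) : ℕ :=
  sSup {j : ℕ | ∃ u : List Lat, u ≠ [] ∧ γ.out.word = (List.replicate j u).flatten}

/-- The unrooted loop measure: `ν(γ) = 4^{-|γ|} / J(γ)`. -/
def loopWeight (γ : ULoop) : ℝ≥0 := (4 : ℝ≥0)⁻¹ ^ γ.steps / (γ.mult : ℝ≥0)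

/-- Total `ν`-mass of a set of loops. -/
def nuMass (S : Set ULoop) : ℝ≥0∞ := ∑' γ : S, (loopWeight γ.1 : ℝ≥0∞)

/-- `ν(γ)` if `γ` is contained in `D`, and `0` otherwise. -/
def nuD (D : Set Lat) (γ : ULoop) : ℝ≥0 := if ULoop.verts γ ⊆ D then loopWeight γ else 0

/-! ### The random walk loop soup -/

/-- Loop configurations: multiplicity functions on unrooted loops. -/
abbrev Config : Type := ULoop → ℕ

/-- The set of loops appearing in a configuration. -/
def Config.loops (ω : Config) : Set ULoop := {γ | ω γ ≠ 0}

/-- The Poisson probability mass function with mean `r`. -/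
def poissonProb (r : ℝ≥0) (k : ℕ) : ℝ≥0∞ :=
  ENNReal.ofReal (Real.exp (-(r : ℝ)) * (r : ℝ) ^ k / k.factorial)

/-- `P` is the law of the random walk loop soup in `D` with intensity `α`: a Poisson
point process with intensity `α·ν` restricted to loops contained in `D`; equivalently,
the multiplicities of the various loops are independent, the multiplicity of a loop
`γ ⊆ D` being Poisson-distributed with mean `α ν(γ)`. -/
def IsLoopSoup (D : Set Lat) (α : ℝ) (P : Measure Config) : Prop :=
  IsProbabilityMeasure P ∧
  ∀ (s : Finset ULoop) (m : ULoop → ℕ),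
    P {ω | ∀ γ ∈ s, ω γ = m γ} = ∏ γ ∈ s, poissonProb (α.toNNReal * nuD D γ) (m γ)

/-- Decreasing events of the loop soup. -/
def DecreasingEvent (E : Set Config) : Prop :=
  ∀ ω ω' : Config, (∀ γ, ω' γ ≤ ω γ) → ω ∈ E → ω' ∈ E

/-! ### Clusters -/

/-- Two loops are adjacent when they intersect. -/
def Touches (γ γ' : ULoop) : Prop := (ULoop.verts γ ∩ ULoop.verts γ').Nonempty

/-- Connection of loops within a family `L` of loops: transitive closure of adjacency. -/
def linkedL (L : Set ULoop) : ULoop → ULoop → Prop :=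
  Relation.ReflTransGen (fun a b => a ∈ L ∧ b ∈ L ∧ Touches a b)

/-- The cluster of `γ` in `L`, as a set of loops. -/
def clusterClass (L : Set ULoop) (γ : ULoop) : Set ULoop := {γ' | γ' ∈ L ∧ linkedL L γ γ'}

/-- The subset of the plane covered by a family of loops. -/
def classTrace (K : Set ULoop) : Set Plane := ⋃ γ ∈ K, ULoop.trace γ

/-- The clusters of a loop configuration, regarded as subsets of the plane. -/
def clusters (L : Set ULoop) : Set (Set Plane) :=
  {C | ∃ γ ∈ L, C = classTrace (clusterClass L γ)}

/-- `Λ(A, L)`: the union of `A` with all the clusters of `L` meeting `A`. -/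
def LamL (A : Set Plane) (L : Set ULoop) : Set Plane :=
  A ∪ ⋃ C ∈ {C | C ∈ clusters L ∧ (C ∩ A).Nonempty}, C

/-- Connection within an arbitrary family of subsets of the plane (two members being
adjacent when they intersect). -/
def linkedS (F : Set (Set Plane)) : Set Plane → Set Plane → Prop :=
  Relation.ReflTransGen (fun a b => a ∈ F ∧ b ∈ F ∧ (a ∩ b).Nonempty)

/-- Clusters of a family of subsets of the plane. -/
def clustersS (F : Set (Set Plane)) : Set (Set Plane) :=
  {C | ∃ S ∈ F, C = ⋃ S' ∈ {S' | S' ∈ F ∧ linkedS F S S'}, S'}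

/-- `Λ(A, F)` for a family `F` of subsets of the plane. -/
def LamS (A : Set Plane) (F : Set (Set Plane)) : Set Plane :=
  A ∪ ⋃ C ∈ {C | C ∈ clustersS F ∧ (C ∩ A).Nonempty}, C

/-- The traces of a family of loops. -/
def traces (L : Set ULoop) : Set (Set Plane) := ULoop.trace '' L

/-! ### Filling, frontier, outermost clusters, crossings -/

/-- The filling of a set: the complement of the union of all unbounded connected
subsets of the complement of its closure. -/
def Fill (A : Set Plane) : Set Plane :=
  {x | ∀ C : Set Plane, C ⊆ (closure A)ᶜ → IsConnected C → x ∈ C → Bornology.IsBounded C}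

/-- The frontier of a loop: the topological boundary of the filling of its trace. -/
def loopFrontier (γ : ULoop) : Set Plane := frontier (Fill (ULoop.trace γ))

/-- The frontiers of the loops of a family. -/
def frontiers (L : Set ULoop) : Set (Set Plane) := loopFrontier '' L

/-- An outermost cluster of `L`. -/
def Outermost (L : Set ULoop) (C : Set Plane) : Prop :=
  C ∈ clusters L ∧ ∀ C' ∈ clusters L, C' ≠ C → ¬ Fill C ⊆ Fill C'

/-- `S` crosses the annulus `A_{r,R}(z)`: it meets both `∂B_r(z)` and `∂B_R(z)`. -/
def CrossesAnn (S : Set Plane) (z : Lat) (r R : ℤ) : Prop :=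
  (S ∩ bdryE z r).Nonempty ∧ (S ∩ bdryE z R).Nonempty

/-! ### Arm events -/

/-- The four-arm event: at least two distinct outermost clusters cross `A_{l,d}(z)`. -/
def fourArm (z : Lat) (l d : ℤ) (L : Set ULoop) : Prop :=
  ∃ C1 C2 : Set Plane, Outermost L C1 ∧ Outermost L C2 ∧ C1 ≠ C2 ∧
    CrossesAnn C1 z l d ∧ CrossesAnn C2 z l d

/-- The four-arm event, as a set of configurations. -/
def A4 (z : Lat) (l d : ℤ) : Set Config := {ω | fourArm z l d ω.loops}

/-- The truncated four-arm event `→𝒜(z;l,d)`. -/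
def A4trunc (z : Lat) (l d : ℤ) : Set Config :=
  {ω | fourArm z l d ω.loops ∧ LamL (embS (box z l)) ω.loops ⊆ boxP z (2 * d)}

/-- The truncated inward four-arm event `←𝒜(z;l,d)`. -/
def A4in (z : Lat) (l d : ℤ) : Set Config :=
  {ω | fourArm z l d ω.loops ∧
    LamL (embS (bdry (box z d))) ω.loops ∩ embS (box z (l / 2)) = ∅}

/-- Lattice points in the open upper half-plane `ℍ`. -/
def upperLat : Set Lat := {w | 0 < w.2}

/-- The upper part of the boundary of `B_R`, embedded in the plane. -/
def bdryEP (R : ℤ) : Set Plane := embS (bdry (box 0 R) ∩ upperLat)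

/-- `S` crosses the half-annulus `A^+_{r,R}`. -/
def CrossesAnnP (S : Set Plane) (r R : ℤ) : Prop :=
  (S ∩ bdryEP r).Nonempty ∧ (S ∩ bdryEP R).Nonempty

/-- The interior two-arm event: some outermost cluster has a frontier crossing `A_{l,d}`. -/
def A2 (l d : ℤ) : Set Config :=
  {ω | ∃ C, Outermost ω.loops C ∧ CrossesAnn (frontier (Fill C)) 0 l d}

/-- The boundary two-arm event. -/
def A2P (l d : ℤ) : Set Config :=
  {ω | ∃ C, Outermost ω.loops C ∧ CrossesAnnP (frontier (Fill C)) l d}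

/-- The boundary four-arm event. -/
def A4P (l d : ℤ) : Set Config :=
  {ω | ∃ C1 C2, Outermost ω.loops C1 ∧ Outermost ω.loops C2 ∧ C1 ≠ C2 ∧
    CrossesAnnP C1 l d ∧ CrossesAnnP C2 l d}

/-- Outward truncation condition: `Λ(B_l, ·) ⊆ B_{2d}`. -/
def TruncOut (l d : ℤ) (ω : Config) : Prop :=
  LamL (embS (box 0 l)) ω.loops ⊆ boxP 0 (2 * d)

/-- Inward truncation condition: `Λ(∂B_d, ·) ∩ B_{⌊l/2⌋} = ∅`. -/
def TruncIn (l d : ℤ) (ω : Config) : Prop :=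
  LamL (embS (bdry (box 0 d))) ω.loops ∩ embS (box 0 (l / 2)) = ∅

/-! ### Random walks and qualities -/

/-- `μ` is the law of the simple random walk on `ℤ²` started at `z`, as a measure on
`ℕ → ℤ²`. -/
def IsSRW (z : Lat) (μ : Measure (ℕ → Lat)) : Prop :=
  IsProbabilityMeasure μ ∧
  ∀ (n : ℕ) (f : ℕ → Lat), f 0 = z → (∀ i < n, Adj (f i) (f (i + 1))) →
    μ {w | ∀ i ≤ n, w i = f i} = (4 : ℝ≥0∞)⁻¹ ^ n

/-- First hitting time of a set of vertices by a walk. -/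
def hitTime (w : ℕ → Lat) (A : Set Lat) : ℕ := sInf {i | w i ∈ A}

/-- Position of a walk at its first hitting of `A`. -/
def hitPt (w : ℕ → Lat) (A : Set Lat) : Lat := w (hitTime w A)

/-- Trace of a walk, stopped at its first hitting of `A`. -/
def stoppedTrace (w : ℕ → Lat) (A : Set Lat) : Set Plane :=
  traceL ((List.range (hitTime w A + 1)).map w)

/-- The walk stays in `D` up to its first hitting of `A`. -/
def StaysIn (w : ℕ → Lat) (D A : Set Lat) : Prop := ∀ i ≤ hitTime w A, w i ∈ D

/-- `μ` is the law of the simple random walk started at `z`, conditioned to stay in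
`D` until it first hits `A`. -/
def IsCondSRW (z : Lat) (D A : Set Lat) (μ : Measure (ℕ → Lat)) : Prop :=
  ∃ ν : Measure (ℕ → Lat), IsSRW z ν ∧
    μ = (ν {w | StaysIn w D A})⁻¹ • ν.restrict {w | StaysIn w D A}

/-- Lattice ball of real radius (ℓ∞ distance). -/
def ballV (c : Lat) (ρ : ℝ) : Set Lat := {w | ((linf (w - c) : ℤ) : ℝ) ≤ ρ}

/-- Union of the stopped traces of a packet of walks. -/
def packTrace {j : ℕ} (ws : Fin j → ℕ → Lat) (A : Set Lat) : Set Plane :=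
  ⋃ i, stoppedTrace (ws i) A

/-- Union of the balls of radius `ρ` around the hitting points of a packet of walks. -/
def packBalls {j : ℕ} (ws : Fin j → ℕ → Lat) (A : Set Lat) (ρ : ℝ) : Set Plane :=
  ⋃ i, embS (ballV (hitPt (ws i) A) ρ)

/-- The frontiers of the loops of `ω` not contained in `B_r`. -/
def outerFrontiers (r : ℤ) (ω : Config) : Set (Set Plane) :=
  frontiers {γ | γ ∈ ω.loops ∧ ¬ ULoop.verts γ ⊆ box 0 r}

/-- The frontiers of the loops of `ω` meeting `B_R`. -/
def meetFrontiers (R : ℤ) (ω : Config) : Set (Set Plane) :=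
  frontiers {γ | γ ∈ ω.loops ∧ (ULoop.verts γ ∩ box 0 R).Nonempty}

/-- Quality at scale `s` for two packets of walks inside a loop soup, with initial
configuration `(Lr, V1, V2)` at scale `r`. -/
def qualityJK (Lr : Set ULoop) (V1 V2 : Set Lat) (r : ℤ) {j k : ℕ}
    (w1 : Fin j → ℕ → Lat) (w2 : Fin k → ℕ → Lat) (ω : Config) (s : ℤ) : ℝ :=
  sSup {δ : ℝ | 0 ≤ δ ∧
    LamS (embS V1 ∪ packTrace w1 (bdry (box 0 s)) ∪ packBalls w1 (bdry (box 0 s)) (δ * (s : ℝ)))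
        (traces Lr ∪ outerFrontiers r ω) ∩
      (embS V2 ∪ packTrace w2 (bdry (box 0 s)) ∪
        packBalls w2 (bdry (box 0 s)) (δ * (s : ℝ))) = ∅}

/-- Quality at scale `s` for a single pair of walks. -/
def qualityPair (Lr : Set ULoop) (V1 V2 : Set Lat) (r : ℤ)
    (w1 w2 : ℕ → Lat) (ω : Config) (s : ℤ) : ℝ :=
  qualityJK Lr V1 V2 r (fun _ : Fin 1 => w1) (fun _ : Fin 1 => w2) ω s

/-- Reversed quality at scale `s`, for two packets walking inward from `∂B_R`. -/
def qualityRev (L : Set ULoop) (V1 V2 : Set Lat) (R : ℤ) {j k : ℕ}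
    (w1 : Fin j → ℕ → Lat) (w2 : Fin k → ℕ → Lat) (ω : Config) (s : ℤ) : ℝ :=
  sSup {δ : ℝ | 0 ≤ δ ∧
    LamS (embS V1 ∪ packTrace w1 (bdry (box 0 s)) ∪ packBalls w1 (bdry (box 0 s)) (δ * (s : ℝ)))
        (traces L ∪ meetFrontiers R ω) ∩
      (embS V2 ∪ packTrace w2 (bdry (box 0 s)) ∪
        packBalls w2 (bdry (box 0 s)) (δ * (s : ℝ))) = ∅}

/-- Quality at scale `s` for one packet of walks, with non-disconnection of `U`. -/
def qualityDisc (Lr : Set ULoop) (U : Set Lat) (r : ℤ) {j : ℕ}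
    (ws : Fin j → ℕ → Lat) (ω : Config) (s : ℤ) : ℝ :=
  sSup {δ : ℝ | 0 ≤ δ ∧
    embS U ∩ Fill (LamS
      (packTrace ws (bdry (box 0 s)) ∪ packBalls ws (bdry (box 0 s)) (δ * (s : ℝ)))
      (traces Lr ∪ outerFrontiers r ω)) = ∅}

/-! ### Crossing loops and bad clusters -/

/-- Crossing loops: loops contained in `D` which cross `A_{d,k}` without
disconnecting `B_d` from `∂B_k`. -/
def crossingLoops (D : Set Lat) (d k : ℤ) : Set ULoop :=
  {γ | ULoop.verts γ ⊆ D ∧ CrossesAnn (ULoop.trace γ) 0 d k ∧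
    ¬ Disconnects (ULoop.trace γ) (embS (box 0 d)) (bdryE 0 k)}

/-- `K` is a bad cluster of `L` for the annulus `A_{l,d}`, relative to the set `CL` of
crossing loops: an outermost cluster crossing `A_{l,d}` which no longer crosses it
once its crossing loops are removed. -/
def IsBad (CL : Set ULoop) (l d : ℤ) (L : Set ULoop) (K : Set ULoop) : Prop :=
  (∃ γ ∈ L, K = clusterClass L γ) ∧
  Outermost L (classTrace K) ∧ CrossesAnn (classTrace K) 0 l d ∧
  ¬ CrossesAnn (classTrace (K \ CL)) 0 l d

/-- `E_1`: the four-arm event holds, with exactly one bad cluster. -/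
def E1 (CL : Set ULoop) (l d : ℤ) : Set Config :=
  {ω | fourArm 0 l d ω.loops ∧ ∃! K : Set ULoop, IsBad CL l d ω.loops K}

/-- `E_2`: the four-arm event holds, with at least two bad clusters. -/
def E2 (CL : Set ULoop) (l d : ℤ) : Set Config :=
  {ω | fourArm 0 l d ω.loops ∧
    ∃ K K' : Set ULoop, K ≠ K' ∧ IsBad CL l d ω.loops K ∧ IsBad CL l d ω.loops K'}

/-- Number of crossing loops of a configuration, counted with multiplicity. -/
def crossingCount (CL : Set ULoop) (ω : Config) : ℝ≥0∞ := ∑' γ : CL, (ω γ.1 : ℝ≥0∞)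

/-! ### Arcs of the square -/

/-- The square curve `{‖p‖_∞ = n}`: the closed polygonal curve through `∂B_n`. -/
def sqCurve (n : ℤ) : Set Plane := {p | max |p 0| |p 1| = (n : ℝ)}

/-- `J` is one of the two arcs of the closed curve `∂B_n` with endpoints `x` and `y`. -/
def IsArc (n : ℤ) (x y : Lat) (J : Set Plane) : Prop :=
  IsClosed J ∧ IsConnected J ∧ J ⊆ sqCurve n ∧ emb x ∈ J ∧ emb y ∈ J ∧
  IsConnected ((sqCurve n \ J) ∪ {emb x, emb y})

section Aux
open Finset (sum_powerset_insert mul_sum sum_congr sum_add_distrib sum_sub_distrib sum_mul sum_comm image_insert filter_insert prod_congr prod_const prod_le_prod sum_image sum_product sum_const card_product image_subset_image sum_insert sum_mul_sum sum_le_sum_of_subset_of_nonneg sum_filter sum_neg_distrib sum_div card_range filter_subset_filter sum_biUnion sum_fiberwise_of_maps_to sum_product' sum_nbij' sum_coe_sort prod_add_one card_univ le_sup)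
open Real (exp exp_le_one_iff exp_pos exp_sum exp_le_exp exp_neg cosh sinh cosh_sub_sinh one_le_cosh sinh_nonneg_iff exp_add measurable_exp)
open Relation (ReflTransGen)
open Metric (ball mem_ball_self diam)

notation "FLat" => Finset Lat

variable {D : FLat}

/-! ### Planar lemmas -/

lemma adj_cases {a b : Lat} (h : Adj a b) : (b.1 = a.1 + 1 ∧ b.2 = a.2) ∨ (b.1 = a.1 - 1 ∧ b.2 = a.2) ∨
    (b.1 = a.1 ∧ b.2 = a.2 + 1) ∨ (b.1 = a.1 ∧ b.2 = a.2 - 1) := by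
  unfold Adj at h
  have h1 : (a.1 - b.1) ≤ 1 := by nlinarith [sq_nonneg (a.2 - b.2)]
  have h2 : -1 ≤ (a.1 - b.1) := by nlinarith [sq_nonneg (a.2 - b.2)]
  have h3 : (a.2 - b.2) ≤ 1 := by nlinarith [sq_nonneg (a.1 - b.1)]
  have h4 : -1 ≤ (a.2 - b.2) := by nlinarith [sq_nonneg (a.1 - b.1)]
  rcases (by omega : a.1 - b.1 = -1 ∨ a.1 - b.1 = 0 ∨ a.1 - b.1 = 1) with h5 | h5 | h5 <;>
  rcases (by omega : a.2 - b.2 = -1 ∨ a.2 - b.2 = 0 ∨ a.2 - b.2 = 1) with h6 | h6 | h6 <;>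
  rw [h5, h6] at h <;> omega

lemma Adj.symm {a b : Lat} (h : Adj a b) : Adj b a := by
  unfold Adj at *; linarith [h, sq_nonneg (a.1-b.1), (by ring : (b.1-a.1)^2 = (a.1-b.1)^2),
    (by ring : (b.2-a.2)^2 = (a.2-b.2)^2)]

/-- signed crossing of the ray to the right of `v` -/
def stepC (p q v : Lat) : ℤ :=
  if p.1 = q.1 ∧ v.1 < p.1 ∧ p.2 = v.2 ∧ q.2 = v.2 + 1 then 1
  else if p.1 = q.1 ∧ v.1 < p.1 ∧ q.2 = v.2 ∧ p.2 = v.2 + 1 then -1 else 0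

/-- winding-type count of a walk about `v` -/
def wind : List Lat → Lat → ℤ
  | a :: b :: l, v => stepC a b v + wind (b :: l) v
  | _, _ => 0

@[simp] lemma wind_nil (v) : wind [] v = 0 := rfl
@[simp] lemma wind_single (a v) : wind [a] v = 0 := rfl
@[simp] lemma wind_cons (a b l v) : wind (a :: b :: l) v = stepC a b v + wind (b :: l) v := rfl

/-- the walk uses the edge -/
def hasE (l : List Lat) (a b : Lat) : Prop := (a, b) ∈ l.zip l.tail ∨ (b, a) ∈ l.zip l.tail

lemma hasE_cons {a b : Lat} {l : List Lat} {x y : Lat} :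
    hasE (a :: b :: l) x y ↔ ((x = a ∧ y = b) ∨ (x = b ∧ y = a)) ∨ hasE (b :: l) x y := by
  simp only [hasE, List.tail_cons, List.zip_cons_cons, List.mem_cons, Prod.mk.injEq]
  tauto

lemma hasE_mem {l : List Lat} {a b : Lat} (h : hasE l a b) : a ∈ l ∧ b ∈ l := by
  rcases h with h | h
  · exact ⟨(List.of_mem_zip h).1, List.mem_of_mem_tail (List.of_mem_zip h).2⟩
  · exact ⟨List.mem_of_mem_tail (List.of_mem_zip h).2, (List.of_mem_zip h).1⟩

lemma wind_horiz (l : List Lat) (x y : ℤ) (hE : ¬ hasE l (x+1, y) (x+1, y+1)) :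
    wind l (x+1, y) = wind l (x, y) := by
  induction l with
  | nil => rfl
  | cons a l ih =>
    cases l with
    | nil => rfl
    | cons b l =>
      rw [hasE_cons] at hE; push Not at hE; simp only [wind_cons]; rw [ih hE.2]; congr 1; obtain ⟨⟨h1, h2⟩, -⟩ := hE; obtain ⟨a1, a2⟩ := a
      obtain ⟨b1, b2⟩ := b; simp only [ne_eq, Prod.mk.injEq, not_and] at h1 h2; simp only [stepC]; split_ifs <;> first | rfl | (exfalso; omega)

/-- indicator of the open ray to the right at height `y+1` -/
def rayI (x y : ℤ) (u : Lat) : ℤ := if u.2 = y + 1 ∧ x < u.1 then 1 else 0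

lemma wind_vert (l : List Lat) (hl : l.IsChain Adj) (x y : ℤ)
    (hE : ¬ hasE l (x, y+1) (x+1, y+1)) (hne : l ≠ []) :
    wind l (x, y+1) = wind l (x, y) + rayI x y (l.head hne) - rayI x y (l.getLast hne) := by
  induction l with
  | nil => exact absurd rfl hne
  | cons a l ih =>
    cases l with
    | nil => simp
    | cons b l =>
      rw [hasE_cons] at hE; push Not at hE; rw [List.isChain_cons_cons] at hl; have ih' := ih hl.2 hE.2 (by simp)
      simp only [wind_cons, ih', List.head_cons, List.getLast_cons_cons]; obtain ⟨⟨h1, h2⟩, -⟩ := hE; have h3 := adj_cases hl.1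
      have key : stepC a b (x, y+1) = stepC a b (x,y) + rayI x y a - rayI x y b := by
        obtain ⟨a1, a2⟩ := a; obtain ⟨b1, b2⟩ := b; simp only [ne_eq, Prod.mk.injEq, not_and] at h1 h2; simp only at h3
        rcases h3 with ⟨rfl, rfl⟩ | ⟨rfl, rfl⟩ | ⟨rfl, rfl⟩ | ⟨rfl, rfl⟩
        · have e1 : stepC (a1, b2) (a1 + 1, b2) (x, y+1) = 0 := by simp [stepC]; try omega
          have e2 : stepC (a1, b2) (a1 + 1, b2) (x, y) = 0 := by simp [stepC]; try omega
          rw [e1, e2]; simp only [rayI]; split_ifs <;> omega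
        · have e1 : stepC (a1, b2) (a1 - 1, b2) (x, y+1) = 0 := by simp [stepC]; try omega
          have e2 : stepC (a1, b2) (a1 - 1, b2) (x, y) = 0 := by simp [stepC]; try omega
          rw [e1, e2]; simp only [rayI]; split_ifs <;> omega
        · simp only [stepC, rayI, true_and]; by_cases hx : x < b1 <;> simp only [hx, true_and, and_true, false_and, and_false, if_false]
          · split_ifs <;> omega
          · rfl
        · simp only [stepC, rayI, true_and]; by_cases hx : x < b1 <;> simp only [hx, true_and, and_true, false_and, and_false, if_false]
          · split_ifs <;> omega
          · rfl
      rw [key]; ring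

lemma wind_zero_of {l : List Lat} {v : Lat}
    (h : (∀ u ∈ l, u.1 ≤ v.1) ∨ (∀ u ∈ l, u.2 ≤ v.2) ∨ (∀ u ∈ l, v.2 < u.2)) : wind l v = 0 := by
  induction l with
  | nil => rfl
  | cons a l ih =>
    cases l with
    | nil => rfl
    | cons b l =>
      simp only [wind_cons]; rw [ih (by simp only [List.mem_cons, forall_eq_or_imp] at h ⊢; tauto)]
      have : stepC a b v = 0 := by
        simp only [List.mem_cons, forall_eq_or_imp] at h; unfold stepC; split_ifs <;> first | rfl | (exfalso; omega)
      rw [this]; rfl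

/-- crossing lemma for lattice paths -/
lemma crossing_lemma {x0 x1 y0 y1 : ℤ} {l l' : List Lat}
    (hl : l.IsChain Adj) (hl' : l'.IsChain Adj) (hne : l ≠ []) (hne' : l' ≠ [])
    (hr : ∀ u ∈ l, x0 ≤ u.1 ∧ u.1 ≤ x1 ∧ y0 ≤ u.2 ∧ u.2 ≤ y1)
    (hr' : ∀ u ∈ l', x0 ≤ u.1 ∧ u.1 ≤ x1 ∧ y0 ≤ u.2 ∧ u.2 ≤ y1)
    (hL : (l.head hne).1 = x0) (hR : (l.getLast hne).1 = x1)
    (hB : (l'.head hne').2 = y0) (hT : (l'.getLast hne').2 = y1) :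
    ∃ v ∈ l, v ∈ l' := by
  by_contra hcon
  push Not at hcon
  set e : ℤ := (l.getLast hne).2 with he
  have heR := hr _ (List.getLast_mem hne)
  let h : Lat → ℤ := fun v => wind l v - if v.2 + 1 ≤ e then 1 else 0
  have hup : ∀ x y : ℤ, (x, y+1) ∉ l → x0 ≤ x → x ≤ x1 → h (x, y+1) = h (x, y) := by
    intro x y hn h0 h1; have h2 := wind_vert l hl x y (fun hh => hn (hasE_mem hh).1) hne
    simp only [h, h2]; have e1 : rayI x y (l.head hne) = 0 := by unfold rayI; rw [if_neg]; omega
    have e2 : rayI x y (l.getLast hne) = if e = y + 1 then 1 else 0 := by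
      unfold rayI; by_cases h3 : e = y + 1
      · rw [if_pos h3, if_pos]; refine ⟨h3, ?_⟩; rcases lt_or_eq_of_le h1 with h4 | h4
        · omega
        · exfalso; apply hn
          have : (x, y+1) = l.getLast hne := Prod.ext (by simp only; omega) (by simp only; omega)
          rw [this]; exact List.getLast_mem hne
      · rw [if_neg h3, if_neg]; rintro ⟨h4, -⟩; exact h3 h4
    rw [e1, e2]; split_ifs <;> omega
  have hright : ∀ x y : ℤ, (x+1, y) ∉ l → h (x+1, y) = h (x, y) := by
    intro x y hn; simp only [h]; rw [wind_horiz l x y (fun hh => hn (hasE_mem hh).1)]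
  have hinv : ∀ (m : List Lat) (hm : m.IsChain Adj) (hmne : m ≠ []), (∀ u ∈ m, u ∉ l) →
      (∀ u ∈ m, x0 ≤ u.1 ∧ u.1 ≤ x1) → h (m.head hmne) = h (m.getLast hmne) := by
    intro m
    induction m with
    | nil => intro _ h; exact absurd rfl h
    | cons a m ih =>
      cases m with
      | nil => intros; rfl
      | cons b m =>
        intro hm hmne hdis hb; rw [List.isChain_cons_cons] at hm
        have := ih hm.2 (by simp) (fun u hu => hdis u (List.mem_cons_of_mem _ hu))
          (fun u hu => hb u (List.mem_cons_of_mem _ hu))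
        rw [List.getLast_cons_cons, ← this]; simp only [List.head_cons]; have ha := hdis a (by simp)
        have hb' := hdis b (by simp)
        have hba := hb a (by simp)
        obtain ⟨a1, a2⟩ := a; obtain ⟨b1, b2⟩ := b; simp only at hba
        rcases adj_cases hm.1 with ⟨h1, h2⟩ | ⟨h1, h2⟩ | ⟨h1, h2⟩ | ⟨h1, h2⟩ <;> simp only at h1 h2
        · subst h1 h2; exact (hright a1 b2 hb').symm
        · obtain rfl : a1 = b1 + 1 := by omega
          subst h2; exact hright b1 b2 ha
        · subst h1 h2; exact (hup b1 a2 hb' hba.1 hba.2).symm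
        · obtain rfl : a2 = b2 + 1 := by omega
          subst h1; exact hup b1 b2 ha hba.1 hba.2
  have hb := hr' _ (List.head_mem hne')
  have hfin := hinv l' hl' hne' (fun u hu hu' => hcon u hu' hu)
    (fun u hu => ⟨(hr' u hu).1, (hr' u hu).2.1⟩)
  have htop : h (l'.getLast hne') = 0 := by
    simp only [h]; rw [wind_zero_of (Or.inr (Or.inl (fun u hu => by have := hr u hu; omega))), if_neg (by omega)]
    rfl
  have hbot : h (l'.head hne') = -1 := by
    have hh : l'.head hne' = ((l'.head hne').1, (y0 - 1) + 1) := Prod.ext rfl (by simp [hB])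
    have hnm : ((l'.head hne').1, (y0 - 1) + 1) ∉ l := by rw [← hh]; intro hc; exact hcon _ hc (List.head_mem hne')
    rw [hh, hup _ _ hnm hb.1 hb.2.1]; simp only [h]
    rw [wind_zero_of (Or.inr (Or.inr (fun u hu => by have := hr u hu; simp only; omega))),
      if_pos (by omega)]
    rfl
  omega

/-! ### Finite Bernoulli product measures -/

/-- indicator of a proposition -/
def ind (P : Prop) : ℝ := if P then 1 else 0

lemma ind_true {P : Prop} (h : P) : ind P = 1 := if_pos h
lemma ind_false {P : Prop} (h : ¬ P) : ind P = 0 := if_neg h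
lemma ind_nonneg (P : Prop) : 0 ≤ ind P := by unfold ind; split_ifs <;> norm_num
lemma ind_le_one (P : Prop) : ind P ≤ 1 := by unfold ind; split_ifs <;> norm_num
lemma ind_mono {P Q : Prop} (h : P → Q) : ind P ≤ ind Q := by
  by_cases hP : P
  · rw [ind_true hP, ind_true (h hP)]
  · rw [ind_false hP]; exact ind_nonneg _
lemma ind_not (P : Prop) : ind (¬ P) = 1 - ind P := by
  by_cases hP : P
  · rw [ind_true hP, ind_false (not_not.2 hP)]; ring
  · rw [ind_false hP, ind_true hP]; ring
lemma ind_and (P Q : Prop) : ind (P ∧ Q) = ind P * ind Q := by unfold ind; by_cases h : P <;> by_cases h' : Q <;> simp [h, h']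
lemma ind_or_le (P Q : Prop) : ind (P ∨ Q) ≤ ind P + ind Q := by unfold ind; by_cases h : P <;> by_cases h' : Q <;> simp [h, h']

section Bern
variable {ι : Type*} [DecidableEq ι]

/-- expectation under independent Bernoulli sampling of a finite set -/
def Ex (p : ι → ℝ) (s : Finset ι) (f : Finset ι → ℝ) : ℝ := ∑ T ∈ s.powerset, (∏ i ∈ T, p i) * (∏ i ∈ s \ T, (1 - p i)) * f T

/-- probability under independent Bernoulli sampling of a finite set -/
def Pr (p : ι → ℝ) (s : Finset ι) (E : Finset ι → Prop) : ℝ := Ex p s (fun T => ind (E T))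

variable {p q : ι → ℝ} {s t : Finset ι} {f g : Finset ι → ℝ}

lemma Ex_empty : Ex p ∅ f = f ∅ := by simp [Ex]

lemma Ex_insert {i : ι} (hi : i ∉ s) :
    Ex p (insert i s) f = p i * Ex p s (fun T => f (insert i T)) + (1 - p i) * Ex p s f := by
  unfold Ex
  rw [sum_powerset_insert hi, add_comm, mul_sum, mul_sum]
  congr 1
  · apply sum_congr rfl
    intro T hT; have hT' := Finset.mem_powerset.1 hT; have : i ∉ T := fun h => hi (hT' h)
    rw [Finset.prod_insert this, Finset.insert_sdiff_insert, Finset.sdiff_insert_of_notMem hi]; ring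
  · apply sum_congr rfl
    intro T hT; have hT' := Finset.mem_powerset.1 hT; have : i ∉ T := fun h => hi (hT' h)
    rw [Finset.insert_sdiff_of_notMem _ this, Finset.prod_insert (by simp [hi])]
    ring

lemma Ex_congr (h : ∀ T ⊆ s, f T = g T) : Ex p s f = Ex p s g := sum_congr rfl (fun T hT => by rw [h T (Finset.mem_powerset.1 hT)])

lemma Ex_mono (hp : ∀ i, 0 ≤ p i ∧ p i ≤ 1) (h : ∀ T ⊆ s, f T ≤ g T) : Ex p s f ≤ Ex p s g := by
  apply Finset.sum_le_sum
  intro T hT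
  apply mul_le_mul_of_nonneg_left (h T (Finset.mem_powerset.1 hT))
  exact mul_nonneg (Finset.prod_nonneg fun i _ => (hp i).1)
    (Finset.prod_nonneg fun i _ => by linarith [(hp i).2])

lemma Ex_add : Ex p s (fun T => f T + g T) = Ex p s f + Ex p s g := by simp only [Ex, mul_add, sum_add_distrib]

lemma Ex_sub : Ex p s (fun T => f T - g T) = Ex p s f - Ex p s g := by simp only [Ex, mul_sub, sum_sub_distrib]

lemma Ex_mul_left (c : ℝ) : Ex p s (fun T => c * f T) = c * Ex p s f := by simp only [Ex, mul_sum]; exact sum_congr rfl (fun _ _ => by ring)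

lemma Ex_mul_right (c : ℝ) : Ex p s (fun T => f T * c) = Ex p s f * c := by simp only [Ex, sum_mul]; exact sum_congr rfl (fun _ _ => by ring)

lemma Ex_sum {κ : Type*} (K : Finset κ) (F : κ → Finset ι → ℝ) :
    Ex p s (fun T => ∑ k ∈ K, F k T) = ∑ k ∈ K, Ex p s (F k) := by
  simp only [Ex, mul_sum]; rw [sum_comm]

lemma Ex_one : Ex p s (fun _ => 1) = 1 := by
  induction s using Finset.induction_on with
  | empty => simp [Ex_empty]
  | insert i s hi ih => rw [Ex_insert hi, ih]; ring

lemma Ex_const (c : ℝ) : Ex p s (fun _ => c) = c := by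
  have := Ex_mul_left (p := p) (s := s) (f := fun _ => 1) c
  rw [Ex_one] at this; simpa using this

lemma Ex_nonneg (hp : ∀ i, 0 ≤ p i ∧ p i ≤ 1) (h : ∀ T ⊆ s, 0 ≤ f T) : 0 ≤ Ex p s f := by rw [← Ex_const (p := p) (s := s) 0]; exact Ex_mono hp h

lemma Ex_fkg (hp : ∀ i, 0 ≤ p i ∧ p i ≤ 1) (hf : Monotone f) (hg : Monotone g) :
    Ex p s f * Ex p s g ≤ Ex p s (fun T => f T * g T) := by
  induction s using Finset.induction_on generalizing f g with
  | empty => simp [Ex_empty]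
  | insert i s hi ih =>
    rw [Ex_insert hi, Ex_insert hi, Ex_insert hi]; have hf' : Monotone (fun T => f (insert i T)) := fun a b h => hf (Finset.insert_subset_insert i h)
    have hg' : Monotone (fun T => g (insert i T)) := fun a b h => hg (Finset.insert_subset_insert i h)
    have h1 := ih hf' hg'; have h0 := ih hf hg
    have a1 : Ex p s f ≤ Ex p s (fun T => f (insert i T)) := Ex_mono hp (fun T _ => hf (Finset.subset_insert _ _))
    have a2 : Ex p s g ≤ Ex p s (fun T => g (insert i T)) := Ex_mono hp (fun T _ => hg (Finset.subset_insert _ _))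
    have hpi := hp i; set A := Ex p s (fun T => f (insert i T))
    set B := Ex p s (fun T => g (insert i T))
    set a := Ex p s f; set b := Ex p s g; have e1 := mul_le_mul_of_nonneg_left h1 hpi.1
    have e0 := mul_le_mul_of_nonneg_left h0 (by linarith [hpi.2] : 0 ≤ 1 - p i)
    have e2 : 0 ≤ p i * (1 - p i) * ((A - a) * (B - b)) := mul_nonneg (mul_nonneg hpi.1 (by linarith [hpi.2])) (mul_nonneg (by linarith) (by linarith))
    nlinarith [e1, e0, e2]

lemma Ex_fkg_anti (hp : ∀ i, 0 ≤ p i ∧ p i ≤ 1) (hf : Antitone f) (hg : Antitone g) :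
    Ex p s f * Ex p s g ≤ Ex p s (fun T => f T * g T) := by
  have := Ex_fkg (s := s) hp (f := fun T => (-1) * f T) (g := fun T => (-1) * g T)
    (fun a b h => by simpa using hf h) (fun a b h => by simpa using hg h)
  rw [Ex_mul_left, Ex_mul_left] at this
  calc _ = _ := by ring
    _ ≤ _ := this
    _ = _ := Ex_congr (fun T _ => by ring)

lemma Ex_union (hd : Disjoint s t) :
    Ex p (s ∪ t) f = Ex p s (fun T => Ex p t (fun T' => f (T ∪ T'))) := by
  induction s using Finset.induction_on generalizing f with
  | empty => simp [Ex_empty]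
  | insert i s hi ih =>
    rw [Finset.disjoint_insert_left] at hd; have hi' : i ∉ s ∪ t := by simp [hi, hd.1]
    rw [Finset.insert_union, Ex_insert hi', Ex_insert hi, ih hd.2, ih hd.2]; simp only [Finset.insert_union]

/-- independence -/
lemma Ex_indep (hd : Disjoint s t) (F G : Finset ι → ℝ) (hF : ∀ T T', F (T ∪ T') = F T ∨ ¬ (T ⊆ s ∧ T' ⊆ t))
    (hG : ∀ T T', G (T ∪ T') = G T' ∨ ¬ (T ⊆ s ∧ T' ⊆ t)) :
    Ex p (s ∪ t) (fun T => F T * G T) = Ex p s F * Ex p t G := by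
  rw [Ex_union hd]
  rw [← Ex_mul_right]
  apply Ex_congr
  intro T hT
  rw [← Ex_mul_left]
  apply Ex_congr
  intro T' hT'
  rw [(hF T T').resolve_right (by simp [hT, hT']), (hG T T').resolve_right (by simp [hT, hT'])]

lemma Ex_restrict (h : s ⊆ t) (hf : ∀ T ⊆ t, f T = f (T ∩ s)) : Ex p t f = Ex p s f := by
  have : t = s ∪ (t \ s) := by rw [Finset.union_sdiff_of_subset h]
  rw [this, Ex_union Finset.disjoint_sdiff]
  apply Ex_congr
  intro T hT
  rw [Ex_congr (g := fun _ => f T), Ex_const]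
  intro T' hT'
  rw [hf _ (Finset.union_subset (hT.trans h) (hT'.trans Finset.sdiff_subset))]
  congr 1
  ext i
  simp only [Finset.mem_inter, Finset.mem_union]
  constructor
  · rintro ⟨h1 | h1, h2⟩
    · exact h1
    · exact absurd h2 (Finset.mem_sdiff.1 (hT' h1)).2
  · intro h1; exact ⟨Or.inl h1, hT h1⟩

lemma Ex_anti_p (hp : ∀ i, 0 ≤ p i ∧ p i ≤ 1) (hq : ∀ i, 0 ≤ q i ∧ q i ≤ 1)
    (hpq : ∀ i ∈ s, p i ≤ q i) (hf : Antitone f) : Ex q s f ≤ Ex p s f := by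
  induction s using Finset.induction_on generalizing f with
  | empty => simp [Ex_empty]
  | insert i s hi ih =>
    rw [Ex_insert hi, Ex_insert hi]
    have h1 := ih (fun j hj => hpq j (Finset.mem_insert_of_mem hj)) (f := fun T => f (insert i T))
      (fun a b h => hf (Finset.insert_subset_insert i h))
    have h0 := ih (fun j hj => hpq j (Finset.mem_insert_of_mem hj)) hf
    have h2 : Ex p s (fun T => f (insert i T)) ≤ Ex p s f := Ex_mono hp (fun T _ => hf (Finset.subset_insert _ _))
    have := hpq i (Finset.mem_insert_self _ _); have e1 := mul_le_mul_of_nonneg_left h1 (hq i).1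
    have e0 := mul_le_mul_of_nonneg_left h0 (by linarith [(hq i).2] : 0 ≤ 1 - q i)
    nlinarith [mul_nonneg (sub_nonneg.2 this) (sub_nonneg.2 h2)]

lemma Ex_anti_s (hp : ∀ i, 0 ≤ p i ∧ p i ≤ 1) (h : s ⊆ t) (hf : Antitone f) :
    Ex p t f ≤ Ex p s f := by
  have : t = s ∪ (t \ s) := by rw [Finset.union_sdiff_of_subset h]
  rw [this, Ex_union Finset.disjoint_sdiff]
  apply Ex_mono hp
  intro T _
  rw [← Ex_const (p := p) (s := t \ s) (f T)]
  exact Ex_mono hp (fun T' _ => hf Finset.subset_union_left)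

lemma Ex_image {κ : Type*} [DecidableEq κ] (φ : ι → κ) (hp : ∀ i, 0 ≤ p i ∧ p i ≤ 1)
    (q : κ → ℝ) (hq : ∀ i, 0 ≤ q i ∧ q i ≤ 1)
    (hpq : ∀ k ∈ s.image φ, q k ≤ 1 - ∏ i ∈ s.filter (fun i => φ i = k), (1 - p i))
    (F : Finset κ → ℝ) (hF : Antitone F) :
    Ex p s (fun T => F (T.image φ)) ≤ Ex q (s.image φ) F := by
  have hE : ∀ s : Finset ι, ∀ F : Finset κ → ℝ, Antitone F →
      Ex p s (fun T => F (T.image φ)) ≤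
        Ex (fun k => 1 - ∏ i ∈ s.filter (fun i => φ i = k), (1 - p i)) (s.image φ) F := by
    intro s
    induction s using Finset.induction_on with
    | empty => intro F _; simp [Ex_empty]
    | insert i s hi ih =>
      intro F hF; rw [Ex_insert hi]; simp only [image_insert]; set k := φ i with hk
      set Q : κ → ℝ := fun k => 1 - ∏ i ∈ s.filter (fun i => φ i = k), (1 - p i) with hQ
      set Q' : κ → ℝ := fun k => 1 - ∏ i ∈ (insert i s).filter (fun i => φ i = k), (1 - p i) with hQ'
      have hQk : Q' k = 1 - (1 - p i) * (1 - Q k) := by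
        simp only [hQ, hQ']; rw [filter_insert, if_pos rfl, Finset.prod_insert (by simp [hi])]; ring
      have hQo : ∀ j, j ≠ k → Q' j = Q j := by
        intro j hj; simp only [hQ, hQ']; rw [filter_insert, if_neg (fun h => hj (h.symm.trans hk.symm))]
      have hcongr : ∀ (u : Finset κ) (G : Finset κ → ℝ), k ∉ u → Ex Q u G = Ex Q' u G := by
        intro u G hu; unfold Ex; apply sum_congr rfl; intro T hT; have hT' := Finset.mem_powerset.1 hT; congr 2
        · exact prod_congr rfl (fun j hj => (hQo j (fun h => hu (h ▸ hT' hj))).symm)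
        · exact prod_congr rfl (fun j hj => by rw [hQo j (fun h => hu (h ▸ (Finset.mem_sdiff.1 hj).1))])
      let F' : Finset κ → ℝ := fun U => p i * F (insert k U) + (1 - p i) * F U
      have hF' : Antitone F' := by
        intro a b hab; have h1 := mul_le_mul_of_nonneg_left (hF (Finset.insert_subset_insert k hab)) (hp i).1
        have h2 := mul_le_mul_of_nonneg_left (hF hab) (by linarith [(hp i).2] : 0 ≤ 1 - p i)
        simp only [F']; linarith
      have h1 := ih F' hF'
      have h2 : Ex p s (fun T => F' (T.image φ)) =
          p i * Ex p s (fun T => F (insert k (T.image φ))) + (1 - p i) * Ex p s (fun T => F (T.image φ)) := by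
        simp only [F']; rw [Ex_add, Ex_mul_left, Ex_mul_left]
      rw [← h2]; refine h1.trans (le_of_eq ?_); by_cases hks : k ∈ s.image φ
      · rw [Finset.insert_eq_of_mem hks]; have hse : s.image φ = insert k ((s.image φ).erase k) := (Finset.insert_erase hks).symm
        have hne : k ∉ (s.image φ).erase k := Finset.notMem_erase _ _
        rw [hse, Ex_insert hne, Ex_insert hne, hcongr _ _ hne, hcongr _ _ hne, hQk]; simp only [F', Finset.insert_idem]
        rw [Ex_add, Ex_mul_left, Ex_mul_left, Ex_add, Ex_mul_left, Ex_mul_left]; ring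
      · have hQ0 : Q k = 0 := by
          simp only [hQ]; rw [Finset.filter_false_of_mem, Finset.prod_empty, sub_self]; intro j hj h; exact hks (Finset.mem_image.2 ⟨j, hj, h⟩)
        rw [Ex_insert hks, ← hcongr _ _ hks, ← hcongr _ _ hks, hQk, hQ0]; simp only [F']; rw [Ex_add, Ex_mul_left, Ex_mul_left]; ring
  refine (hE s F hF).trans (Ex_anti_p hq (fun k => ?_) hpq hF)
  have h0 : 0 ≤ ∏ i ∈ s.filter (fun i => φ i = k), (1 - p i) := Finset.prod_nonneg (fun i _ => by linarith [(hp i).2])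
  have h1 : ∏ i ∈ s.filter (fun i => φ i = k), (1 - p i) ≤ 1 := Finset.prod_le_one (fun i _ => by linarith [(hp i).2]) (fun i _ => by linarith [(hp i).1])
  constructor <;> linarith

/-! probabilities -/

lemma Pr_nonneg (hp : ∀ i, 0 ≤ p i ∧ p i ≤ 1) (E : Finset ι → Prop) : 0 ≤ Pr p s E := Ex_nonneg hp (fun _ _ => ind_nonneg _)

lemma Pr_mono (hp : ∀ i, 0 ≤ p i ∧ p i ≤ 1) {E F : Finset ι → Prop} (h : ∀ T ⊆ s, E T → F T) : Pr p s E ≤ Pr p s F := Ex_mono hp (fun T hT => ind_mono (h T hT))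

lemma Pr_not (E : Finset ι → Prop) : Pr p s (fun T => ¬ E T) = 1 - Pr p s E := by unfold Pr; simp only [ind_not]; rw [Ex_sub, Ex_one]

lemma Pr_or_le (hp : ∀ i, 0 ≤ p i ∧ p i ≤ 1) (E F : Finset ι → Prop) :
    Pr p s (fun T => E T ∨ F T) ≤ Pr p s E + Pr p s F := by
  unfold Pr; rw [← Ex_add]; exact Ex_mono hp (fun _ _ => ind_or_le _ _)

lemma Pr_exists_le {κ : Type*} (hp : ∀ i, 0 ≤ p i ∧ p i ≤ 1) (K : Finset κ)
    (E : κ → Finset ι → Prop) :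
    Pr p s (fun T => ∃ k ∈ K, E k T) ≤ ∑ k ∈ K, Pr p s (E k) := by
  unfold Pr; rw [← Ex_sum]
  apply Ex_mono hp
  intro T _
  by_cases h : ∃ k ∈ K, E k T
  · obtain ⟨k, hk, hE⟩ := h; refine (ind_le_one _).trans ?_; rw [← ind_true hE]
    exact Finset.single_le_sum (f := fun k => ind (E k T)) (fun _ _ => ind_nonneg _) hk
  · rw [ind_false h]; exact Finset.sum_nonneg (fun _ _ => ind_nonneg _)

/-- decreasing events -/
def Decr (E : Finset ι → Prop) : Prop := ∀ T T' : Finset ι, T ⊆ T' → E T' → E T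

lemma Decr.anti {E : Finset ι → Prop} (h : Decr E) : Antitone (fun T => ind (E T)) := fun T T' hT => ind_mono (h T T' hT)

lemma Pr_fkg (hp : ∀ i, 0 ≤ p i ∧ p i ≤ 1) {E F : Finset ι → Prop} (hE : Decr E) (hF : Decr F) :
    Pr p s E * Pr p s F ≤ Pr p s (fun T => E T ∧ F T) := by
  unfold Pr; simp only [ind_and]; exact Ex_fkg_anti hp hE.anti hF.anti

lemma Pr_fkg_finset {κ : Type*} (hp : ∀ i, 0 ≤ p i ∧ p i ≤ 1) (K : Finset κ)
    (E : κ → Finset ι → Prop) (hE : ∀ k ∈ K, Decr (E k)) :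
    ∏ k ∈ K, Pr p s (E k) ≤ Pr p s (fun T => ∀ k ∈ K, E k T) := by
  induction K using Finset.induction_on with
  | empty => 
    simp only [Finset.prod_empty, Finset.notMem_empty, IsEmpty.forall_iff, implies_true]; unfold Pr; simp only [ind_true trivial]; rw [Ex_one]
  | insert k K hk ih =>
    rw [Finset.prod_insert hk]; have h1 := ih (fun j hj => hE j (Finset.mem_insert_of_mem hj))
    have h2 : Decr (fun T => ∀ k ∈ K, E k T) := fun T T' h hT' j hj => hE j (Finset.mem_insert_of_mem hj) T T' h (hT' j hj)
    refine (mul_le_mul_of_nonneg_left h1 (Pr_nonneg hp _)).trans ?_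
    refine (Pr_fkg hp (hE k (Finset.mem_insert_self _ _)) h2).trans ?_
    apply Pr_mono hp
    rintro T _ ⟨h3, h4⟩ j hj; rcases Finset.mem_insert.1 hj with rfl | hj
    · exact h3
    · exact h4 j hj

/-- square root trick -/
lemma Pr_sqrt_trick {κ : Type*} (hp : ∀ i, 0 ≤ p i ∧ p i ≤ 1) (K : Finset κ)
    (E : κ → Finset ι → Prop) (hE : ∀ k ∈ K, Decr (E k)) {δ : ℝ} (hδ : 0 ≤ δ)
    (h : Pr p s (fun T => ∀ k ∈ K, E k T) < δ ^ K.card) : ∃ k ∈ K, Pr p s (E k) < δ := by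
  by_contra hcon
  push Not at hcon
  have h1 := Pr_fkg_finset (s := s) hp K E hE
  have h2 : δ ^ K.card ≤ ∏ k ∈ K, Pr p s (E k) := by
    rw [← prod_const]; exact prod_le_prod (fun _ _ => hδ) hcon
  linarith

lemma Pr_none (A : ι → Prop) :
    Pr p s (fun T => ∀ i ∈ T, ¬ A i) = ∏ i ∈ s.filter A, (1 - p i) := by
  induction s using Finset.induction_on with
  | empty => simp [Pr, Ex_empty, ind]
  | insert i s hi ih =>
    unfold Pr at ih ⊢; rw [Ex_insert hi]; by_cases hA : A i
    · rw [filter_insert, if_pos hA, Finset.prod_insert (by simp [hi]), ih]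
      rw [Ex_congr (g := fun _ => 0), Ex_const]
      · ring
      · intro T _; exact ind_false (fun h => h i (Finset.mem_insert_self _ _) hA)
    · rw [filter_insert, if_neg hA, ← ih]; rw [Ex_congr (g := fun T => ind (∀ i ∈ T, ¬ A i))]
      · ring
      · intro T _; congr 1; simp [hA]

lemma Pr_anti_s (hp : ∀ i, 0 ≤ p i ∧ p i ≤ 1) (h : s ⊆ t) {E : Finset ι → Prop} (hE : Decr E) : Pr p t E ≤ Pr p s E := Ex_anti_s hp h hE.anti

lemma Pr_restrict (h : s ⊆ t) {E : Finset ι → Prop} (hE : ∀ T ⊆ t, E T ↔ E (T ∩ s)) : Pr p t E = Pr p s E := Ex_restrict h (fun T hT => by rw [ind, ind]; simp only [hE T hT])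

lemma Pr_indep {u : Finset ι} (hs : s ⊆ u) (ht : t ⊆ u) (hd : Disjoint s t)
    {E F : Finset ι → Prop} (hE : ∀ T ⊆ u, E T ↔ E (T ∩ s)) (hF : ∀ T ⊆ u, F T ↔ F (T ∩ t)) :
    Pr p u (fun T => E T ∧ F T) = Pr p u E * Pr p u F := by
  have hst : s ∪ t ⊆ u := Finset.union_subset hs ht
  rw [Pr_restrict hs hE, Pr_restrict ht hF, Pr_restrict hst]
  · unfold Pr; simp only [ind_and]; apply Ex_indep hd
    · intro T T'; by_cases h : T ⊆ s ∧ T' ⊆ t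
      · left
        have h1 := hE (T ∪ T') ((Finset.union_subset_union h.1 h.2).trans hst)
        have h2 : (T ∪ T') ∩ s = T := by
          ext i; simp only [Finset.mem_inter, Finset.mem_union]
          refine ⟨fun ⟨h3, h4⟩ => h3.resolve_right fun h5 => Finset.disjoint_left.1 hd h4 (h.2 h5), fun h3 => ⟨Or.inl h3, h.1 h3⟩⟩
        rw [h2] at h1; simp only [ind, h1]
      · right; exact h
    · intro T T'; by_cases h : T ⊆ s ∧ T' ⊆ t
      · left
        have h1 := hF (T ∪ T') ((Finset.union_subset_union h.1 h.2).trans hst)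
        have h2 : (T ∪ T') ∩ t = T' := by
          ext i; simp only [Finset.mem_inter, Finset.mem_union]
          refine ⟨fun ⟨h3, h4⟩ => h3.resolve_left fun h5 => Finset.disjoint_left.1 hd (h.1 h5) h4, fun h3 => ⟨Or.inr h3, h.2 h3⟩⟩
        rw [h2] at h1; simp only [ind, h1]
      · right; exact h
  · intro T hT; have e1 : T ∩ (s ∪ t) ∩ s = T ∩ s := by rw [Finset.inter_assoc, Finset.union_inter_cancel_left]
    have e2 : T ∩ (s ∪ t) ∩ t = T ∩ t := by rw [Finset.inter_assoc, Finset.union_inter_cancel_right]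
    have h3 : T ∩ (s ∪ t) ⊆ u := Finset.inter_subset_left.trans hT
    rw [hE T hT, hF T hT, hE _ h3, hF _ h3, e1, e2]

end Bern

/-! ### The internal model of rooted loops -/

abbrev Dir := Bool × Bool

/-- the lattice step of a direction -/
def stp : Dir → Lat
  | (true, true) => (1, 0)
  | (false, false) => (-1, 0)
  | (true, false) => (0, 1)
  | (false, true) => (0, -1)

lemma adj_stp (z : Lat) (d : Dir) : Adj z (z + stp d) := by
  obtain ⟨a, b⟩ := d
  cases a <;> cases b <;> simp [Adj, stp]

lemma stp_inj : Function.Injective stp := by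
  rintro ⟨a, b⟩ ⟨c, d⟩ h
  cases a <;> cases b <;> cases c <;> cases d <;> simp [stp] at h ⊢

lemma exists_stp {a b : Lat} (h : Adj a b) : ∃ d, b = a + stp d := by
  obtain ⟨a1, a2⟩ := a
  obtain ⟨b1, b2⟩ := b
  rcases adj_cases h with h | h | h | h
  all_goals simp only [Prod.mk.injEq] at h
  all_goals first
    | exact ⟨(true, true), by simp [stp]; omega⟩
    | exact ⟨(false, false), by simp [stp]; omega⟩
    | exact ⟨(true, false), by simp [stp]; omega⟩
    | exact ⟨(false, true), by simp [stp]; omega⟩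

/-- vertices visited by the walk from `z` with steps `w` -/
def path : Lat → List Dir → List Lat
  | z, [] => [z]
  | z, d :: w => z :: path (z + stp d) w

/-- endpoint of the walk -/
def endp : Lat → List Dir → Lat
  | z, [] => z
  | z, d :: w => endp (z + stp d) w

@[simp] lemma path_nil (z) : path z [] = [z] := rfl
@[simp] lemma path_cons (z d w) : path z (d :: w) = z :: path (z + stp d) w := rfl
@[simp] lemma endp_nil (z) : endp z [] = z := rfl
@[simp] lemma endp_cons (z d w) : endp z (d :: w) = endp (z + stp d) w := rfl

@[simp] lemma path_ne (z w) : path z w ≠ [] := by cases w <;> simp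

lemma path_eq_cons (z w) : path z w = z :: (path z w).tail := by cases w <;> simp

@[simp] lemma path_head (z w) (h : path z w ≠ []) : (path z w).head h = z := by cases w <;> simp

@[simp] lemma path_length (z w) : (path z w).length = w.length + 1 := by
  induction w generalizing z with
  | nil => rfl
  | cons d w ih => simp [ih]

lemma path_getLast (z w) (h : path z w ≠ []) : (path z w).getLast h = endp z w := by
  induction w generalizing z with
  | nil => rfl
  | cons d w ih =>
    simp only [path_cons, endp_cons]; rw [List.getLast_cons (path_ne _ _), ih]

lemma path_chain (z w) : (path z w).IsChain Adj := by
  induction w generalizing z with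
  | nil => simp
  | cons d w ih =>
    have h := ih (z + stp d); rw [path_cons]; rw [path_eq_cons] at h ⊢; exact List.IsChain.cons_cons (adj_stp z d) h

lemma mem_path_self (z w) : z ∈ path z w := by rw [path_eq_cons]; simp

lemma endp_mem_path (z w) : endp z w ∈ path z w := by rw [← path_getLast z w (path_ne z w)]; exact List.getLast_mem _

lemma endp_append (z w w') : endp z (w ++ w') = endp (endp z w) w' := by
  induction w generalizing z with
  | nil => rfl
  | cons d w ih => simp [ih]

lemma path_append (z w w') : path z (w ++ w') = path z w ++ (path (endp z w) w').tail := by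
  induction w generalizing z with
  | nil => simp [← path_eq_cons]
  | cons d w ih => simp [ih]

lemma mem_path_append {z w w' v} : v ∈ path z (w ++ w') ↔ v ∈ path z w ∨ v ∈ path (endp z w) w' := by
  rw [path_append, List.mem_append]
  constructor
  · rintro (h | h)
    · exact Or.inl h
    · exact Or.inr (List.mem_of_mem_tail h)
  · rintro (h | h)
    · exact Or.inl h
    · rw [path_eq_cons, List.mem_cons] at h; rcases h with h | h
      · left; rw [h]; exact endp_mem_path _ _
      · exact Or.inr h

/-- all words of a given length -/
def words : ℕ → Finset (List Dir)
  | 0 => {[]}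
  | t + 1 => (Finset.univ ×ˢ words t).image (fun p : Dir × List Dir => p.1 :: p.2)

lemma mem_words {t : ℕ} {w : List Dir} : w ∈ words t ↔ w.length = t := by
  induction t generalizing w with
  | zero => simp [words]
  | succ t ih =>
    simp only [words, Finset.mem_image, Finset.mem_product, Finset.mem_univ, true_and]; constructor
    · rintro ⟨⟨d, w'⟩, h, rfl⟩; simp [ih.1 h]
    · intro h
      cases w with
      | nil => simp at h
      | cons d w' => exact ⟨(d, w'), ih.2 (by simpa using h), rfl⟩

lemma sum_words_succ {M : Type*} [AddCommMonoid M] (t : ℕ) (f : List Dir → M) :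
    ∑ w ∈ words (t + 1), f w = ∑ d : Dir, ∑ w ∈ words t, f (d :: w) := by
  simp only [words]
  rw [sum_image, sum_product]
  rintro ⟨a, b⟩ _ ⟨c, d⟩ _ h
  simpa using h

lemma sum_words_add {M : Type*} [AddCommMonoid M] (s t : ℕ) (f : List Dir → M) :
    ∑ w ∈ words (s + t), f w = ∑ w ∈ words s, ∑ w' ∈ words t, f (w ++ w') := by
  induction s generalizing f with
  | zero => simp [words]
  | succ s ih =>
    rw [show s + 1 + t = (s + t) + 1 by omega, sum_words_succ, sum_words_succ]
    apply sum_congr rfl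
    intro d _; rw [ih]; rfl

lemma card_words (t : ℕ) : (words t).card = 4 ^ t := by
  induction t with
  | zero => rfl
  | succ t ih =>
    have := sum_words_succ t (fun _ => (1 : ℕ))
    simp only [sum_const, smul_eq_mul, mul_one] at this; rw [this, ih]; simp [Dir]; ring

/-- rooted loops (root, steps) -/
abbrev Lp := Lat × List Dir

notation "FLp" => Finset Lp

def wt (l : Lp) : ℝ := (1 / 4) ^ l.2.length / l.2.length

def pr (l : Lp) : ℝ := 1 - exp (-(wt l / 2))

lemma wt_nonneg (l : Lp) : 0 ≤ wt l := by unfold wt; positivity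

lemma pr_bd (l : Lp) : 0 ≤ pr l ∧ pr l ≤ 1 := by
  unfold pr
  have := wt_nonneg l
  constructor
  · rw [sub_nonneg, exp_le_one_iff]; linarith
  · have := exp_pos (-(wt l / 2)); linarith

/-- loops of length at most `L` in `A` -/
def LS (L : ℕ) (A : FLat) : FLp :=
  (A ×ˢ (Finset.range (L + 1)).biUnion words).filter
    (fun l => l.2 ≠ [] ∧ endp l.1 l.2 = l.1 ∧ ∀ v ∈ path l.1 l.2, v ∈ A)

lemma mem_LS {L : ℕ} {A : FLat} {l : Lp} :
    l ∈ LS L A ↔ l.2 ≠ [] ∧ l.2.length ≤ L ∧ endp l.1 l.2 = l.1 ∧ ∀ v ∈ path l.1 l.2, v ∈ A := by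
  simp only [LS, Finset.mem_filter, Finset.mem_product, Finset.mem_biUnion, Finset.mem_range, mem_words]
  constructor
  · rintro ⟨⟨_, t, h1, h2⟩, h3, h4, h5⟩; exact ⟨h3, by omega, h4, h5⟩
  · rintro ⟨h1, h2, h3, h4⟩; exact ⟨⟨h4 _ (mem_path_self _ _), _, by omega, rfl⟩, h1, h3, h4⟩

lemma LS_mono {L L' : ℕ} {A A' : FLat} (h : L ≤ L') (hA : A ⊆ A') : LS L A ⊆ LS L' A' := by
  intro l; rw [mem_LS, mem_LS]
  rintro ⟨h1, h2, h3, h4⟩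
  exact ⟨h1, h2.trans h, h3, fun v hv => hA (h4 v hv)⟩

/-- rectangles -/
def Rc (x0 x1 y0 y1 : ℤ) : FLat := Finset.Icc x0 x1 ×ˢ Finset.Icc y0 y1

@[simp] lemma mem_Rc {x0 x1 y0 y1 : ℤ} {v : Lat} :
    v ∈ Rc x0 x1 y0 y1 ↔ (x0 ≤ v.1 ∧ v.1 ≤ x1) ∧ (y0 ≤ v.2 ∧ v.2 ≤ y1) := by
  simp [Rc]

/-- open edges -/
def Op (T : FLp) (a b : Lat) : Prop := ∃ l ∈ T, hasE (path l.1 l.2) a b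

lemma hasE_symm {l a b} (h : hasE l a b) : hasE l b a := Or.symm h

lemma hasE_adj {l : List Lat} (hl : l.IsChain Adj) {a b} (h : hasE l a b) : Adj a b := by
  induction l with
  | nil => simp [hasE] at h
  | cons x l ih =>
    cases l with
    | nil => simp [hasE] at h
    | cons y l =>
      rw [List.isChain_cons_cons] at hl; rw [hasE_cons] at h; rcases h with (⟨rfl, rfl⟩ | ⟨rfl, rfl⟩) | h
      · exact hl.1
      · exact hl.1.symm
      · exact ih hl.2 h

lemma Op.symm {T a b} (h : Op T a b) : Op T b a := by obtain ⟨l, hl, h⟩ := h; exact ⟨l, hl, hasE_symm h⟩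

lemma Op.adj {T a b} (h : Op T a b) : Adj a b := by obtain ⟨l, hl, h⟩ := h; exact hasE_adj (path_chain _ _) h

lemma Op.mono {T T' : FLp} (hT : T ⊆ T') {a b} (h : Op T a b) : Op T' a b := by obtain ⟨l, hl, h⟩ := h; exact ⟨l, hT hl, h⟩

/-- connection by open edges within `S` -/
def Conn (T : FLp) (S : FLat) (a b : Lat) : Prop := a ∈ S ∧ ReflTransGen (fun x y => Op T x y ∧ x ∈ S ∧ y ∈ S) a b

lemma Conn.refl {T S a} (h : a ∈ S) : Conn T S a a := ⟨h, ReflTransGen.refl⟩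

lemma Conn.right {T S a b} (h : Conn T S a b) : b ∈ S := by
  obtain ⟨h, h'⟩ := h
  rcases ReflTransGen.cases_tail h' with rfl | ⟨c, _, hc⟩
  · exact h
  · exact hc.2.2

lemma Conn.trans {T S a b c} (h : Conn T S a b) (h' : Conn T S b c) : Conn T S a c := ⟨h.1, h.2.trans h'.2⟩

lemma Conn.symm {T S a b} (h : Conn T S a b) : Conn T S b a := by
  refine ⟨h.right, ?_⟩
  have h2 := h.2
  clear h
  induction h2 with
  | refl => exact ReflTransGen.refl
  | tail _ hxy ih => exact ReflTransGen.head ⟨hxy.1.symm, hxy.2.2, hxy.2.1⟩ ih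

lemma Conn.mono {T T' : FLp} {S S' : FLat} (hT : T ⊆ T') (hS : S ⊆ S') {a b}
    (h : Conn T S a b) : Conn T' S' a b :=
  ⟨hS h.1, ReflTransGen.mono (fun x y hxy => ⟨hxy.1.mono hT, hS hxy.2.1, hS hxy.2.2⟩) _ _ h.2⟩

lemma Conn.step {T S a b} (h : Op T a b) (ha : a ∈ S) (hb : b ∈ S) : Conn T S a b := ⟨ha, ReflTransGen.single ⟨h, ha, hb⟩⟩

lemma Conn.exists_list {T S a b} (h : Conn T S a b) : ∃ l : List Lat, ∃ hne : l ≠ [], l.IsChain Adj ∧ l.head hne = a ∧ l.getLast hne = b ∧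
      ∀ u ∈ l, Conn T S a u := by
  obtain ⟨ha, h⟩ := h
  induction h using ReflTransGen.head_induction_on with
  | refl => exact ⟨[b], by simp, by simp, rfl, rfl, by simp [Conn.refl ha]⟩
  | head h1 h2 ih =>
    rename_i x y
    obtain ⟨l, hne, hc, hh, hl, hu⟩ := ih h1.2.2
    cases l with
    | nil => exact absurd rfl hne
    | cons c l =>
      simp only [List.head_cons] at hh; subst hh; refine ⟨x :: c :: l, by simp, ?_, rfl, ?_, ?_⟩
      · exact List.IsChain.cons_cons h1.1.adj hc
      · rw [List.getLast_cons (by simp), hl]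
      · intro u hu'; rw [List.mem_cons] at hu'; rcases hu' with rfl | hu'
        · exact Conn.refl ha
        · exact (Conn.step h1.1 h1.2.1 h1.2.2).trans (hu u hu')

/-- a left-right and a bottom-top connection meet -/
lemma conn_meet {T T' : FLp} {S S' : FLat} {a b c d : Lat} {x0 x1 y0 y1 : ℤ}
    (h : Conn T S a b) (h' : Conn T' S' c d) (hS : S ⊆ Rc x0 x1 y0 y1) (hS' : S' ⊆ Rc x0 x1 y0 y1)
    (ha : a.1 = x0) (hb : b.1 = x1) (hc : c.2 = y0) (hd : d.2 = y1) :
    ∃ v, Conn T S a v ∧ Conn T' S' c v := by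
  obtain ⟨l, hne, hch, h1, h2, h3⟩ := h.exists_list
  obtain ⟨l', hne', hch', h1', h2', h3'⟩ := h'.exists_list
  obtain ⟨v, hv, hv'⟩ := crossing_lemma (x0 := x0) (x1 := x1) (y0 := y0) (y1 := y1) hch hch' hne hne'
    (fun u hu => by have := hS (h3 u hu).right; rw [mem_Rc] at this; tauto)
    (fun u hu => by have := hS' (h3' u hu).right; rw [mem_Rc] at this; tauto)
    (by rw [h1, ha]) (by rw [h2, hb]) (by rw [h1', hc]) (by rw [h2', hd])
  exact ⟨v, h3 v hv, h3' v hv'⟩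

/-- left-right crossing -/
def XH (T : FLp) (x0 x1 y0 y1 : ℤ) : Prop := ∃ a b, a.1 = x0 ∧ b.1 = x1 ∧ Conn T (Rc x0 x1 y0 y1) a b

/-- bottom-top crossing -/
def XV (T : FLp) (x0 x1 y0 y1 : ℤ) : Prop := ∃ a b, a.2 = y0 ∧ b.2 = y1 ∧ Conn T (Rc x0 x1 y0 y1) a b

lemma XH.mono {T T' : FLp} (h : T ⊆ T') {x0 x1 y0 y1} (hx : XH T x0 x1 y0 y1) : XH T' x0 x1 y0 y1 := by obtain ⟨a, b, h1, h2, h3⟩ := hx; exact ⟨a, b, h1, h2, h3.mono h subset_rfl⟩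

lemma XV.mono {T T' : FLp} (h : T ⊆ T') {x0 x1 y0 y1} (hx : XV T x0 x1 y0 y1) : XV T' x0 x1 y0 y1 := by obtain ⟨a, b, h1, h2, h3⟩ := hx; exact ⟨a, b, h1, h2, h3.mono h subset_rfl⟩

/-! ### lattice symmetries -/

structure Sy where
  f : Lat ≃ Lat
  g : Dir ≃ Dir
  h : ∀ z d, f (z + stp d) = f z + stp (g d)

namespace Sy

def symm (σ : Sy) : Sy where
  f := σ.f.symm
  g := σ.g.symm
  h := by
    intro z d; rw [Equiv.symm_apply_eq, σ.h]; simp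

def act (σ : Sy) (l : Lp) : Lp := (σ.f l.1, l.2.map σ.g)

lemma act_symm (σ : Sy) (l : Lp) : σ.symm.act (σ.act l) = l := by
  obtain ⟨z, w⟩ := l
  simp [act, symm]

lemma act_inj (σ : Sy) : Function.Injective σ.act := Function.LeftInverse.injective σ.act_symm

lemma path_act (σ : Sy) (z w) : path (σ.f z) (w.map σ.g) = (path z w).map σ.f := by
  induction w generalizing z with
  | nil => rfl
  | cons d w ih => simp only [List.map_cons, path_cons, ← σ.h, ih]

lemma endp_act (σ : Sy) (z w) : endp (σ.f z) (w.map σ.g) = σ.f (endp z w) := by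
  induction w generalizing z with
  | nil => rfl
  | cons d w ih => simp only [List.map_cons, endp_cons, ← σ.h, ih]

lemma act_LS (σ : Sy) {L : ℕ} {A A' : FLat} (hA : ∀ v, v ∈ A ↔ σ.f v ∈ A') {l : Lp} :
    l ∈ LS L A ↔ σ.act l ∈ LS L A' := by
  simp only [mem_LS, act, path_act, endp_act, List.length_map, ne_eq, List.map_eq_nil_iff,
    List.mem_map, forall_exists_index, and_imp, forall_apply_eq_imp_iff₂, EmbeddingLike.apply_eq_iff_eq]
  simp only [hA]

lemma image_LS (σ : Sy) {L : ℕ} {A A' : FLat} (hA : ∀ v, v ∈ A ↔ σ.f v ∈ A') :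
    (LS L A).image σ.act = LS L A' := by
  ext l
  rw [Finset.mem_image]
  constructor
  · rintro ⟨l, hl, rfl⟩; exact (σ.act_LS hA).1 hl
  · intro hl; refine ⟨σ.symm.act l, ?_, σ.symm.act_symm l⟩; rw [σ.act_LS hA]; exact (σ.symm.act_symm l).symm ▸ hl

lemma hasE_map {l : List Lat} {a b : Lat} (f : Lat ≃ Lat) (h : hasE l a b) : hasE (l.map f) (f a) (f b) := by
  have key : (l.map f).zip (l.map f).tail = (l.zip l.tail).map (Prod.map f f) := by rw [← List.map_tail, List.zip_map]
  unfold hasE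
  rw [key]
  exact h.imp (fun h => List.mem_map.2 ⟨_, h, rfl⟩) (fun h => List.mem_map.2 ⟨_, h, rfl⟩)

lemma op (σ : Sy) {T : FLp} {a b} (h : Op T a b) : Op (T.image σ.act) (σ.f a) (σ.f b) := by
  obtain ⟨l, hl, h⟩ := h
  exact ⟨_, Finset.mem_image_of_mem _ hl, by simp only [act, path_act]; exact hasE_map _ h⟩

lemma conn (σ : Sy) {T : FLp} {S S' : FLat} (hS : ∀ v ∈ S, σ.f v ∈ S') {a b}
    (h : Conn T S a b) : Conn (T.image σ.act) S' (σ.f a) (σ.f b) := by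
  refine ⟨hS _ h.1, ?_⟩
  have h2 := h.2
  clear h
  induction h2 with
  | refl => exact ReflTransGen.refl
  | tail _ hxy ih => exact ReflTransGen.tail ih ⟨σ.op hxy.1, hS _ hxy.2.1, hS _ hxy.2.2⟩

lemma image_image (σ : Sy) (T : FLp) : (T.image σ.act).image σ.symm.act = T := by
  rw [Finset.image_image]
  have : σ.symm.act ∘ σ.act = id := by funext l; exact σ.act_symm l
  rw [this, Finset.image_id]

lemma pr_act (σ : Sy) (l : Lp) : pr (σ.act l) = pr l := by simp [pr, wt, act]

end Sy

lemma Ex_map {ι κ : Type*} [DecidableEq ι] [DecidableEq κ] (p : ι → ℝ) (q : κ → ℝ) (φ : ι → κ)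
    (hφ : Function.Injective φ) (hq : ∀ i, q (φ i) = p i) (s : Finset ι) (F : Finset κ → ℝ) :
    Ex q (s.image φ) F = Ex p s (fun T => F (T.image φ)) := by
  induction s using Finset.induction_on generalizing F with
  | empty => simp [Ex_empty]
  | insert i s hi ih =>
    rw [image_insert, Ex_insert (by simpa [hφ.eq_iff] using hi), Ex_insert hi, ih, ih, hq]
    simp only [image_insert]

lemma Pr_sy (σ : Sy) {L : ℕ} {A A' : FLat} (hA : ∀ v, v ∈ A ↔ σ.f v ∈ A')
    (E : FLp → Prop) :
    Pr pr (LS L A') E = Pr pr (LS L A) (fun T => E (T.image σ.act)) := by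
  unfold Pr
  rw [← σ.image_LS hA, Ex_map pr pr σ.act σ.act_inj σ.pr_act]

/-- transfer of the complement -/
lemma Pr_sy_not_le (σ : Sy) {L : ℕ} {A A' : FLat} (hA : ∀ v, v ∈ A ↔ σ.f v ∈ A')
    {E E' : FLp → Prop} (h : ∀ T, E T → E' (T.image σ.act)) :
    Pr pr (LS L A') (fun T => ¬ E' T) ≤ Pr pr (LS L A) (fun T => ¬ E T) := by
  rw [Pr_sy σ hA]; exact Pr_mono pr_bd (fun T _ hn hE => hn (h T hE))

/-- translation -/
def syT (a : Lat) : Sy where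
  f := Equiv.addRight a
  g := Equiv.refl _
  h := by intro z d; simp; abel

/-- swap of coordinates -/
def syS : Sy where
  f := Equiv.prodComm ℤ ℤ
  g := ⟨fun d => (d.1, !d.2), fun d => (d.1, !d.2), fun d => by simp, fun d => by simp⟩
  h := by
    rintro z ⟨a, b⟩; cases a <;> cases b <;> rfl

/-- reflection of the first coordinate -/
def syX : Sy where
  f := ⟨fun v => (-v.1, v.2), fun v => (-v.1, v.2), fun v => by simp, fun v => by simp⟩
  g := ⟨fun d => (!d.2, !d.1), fun d => (!d.2, !d.1), fun d => by simp, fun d => by simp⟩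
  h := by
    rintro z ⟨a, b⟩; cases a <;> cases b <;> simp [stp] <;> omega

/-- composition -/
def Sy.comp (σ τ : Sy) : Sy where
  f := τ.f.trans σ.f
  g := τ.g.trans σ.g
  h := by intro z d; simp [τ.h, σ.h]

@[simp] lemma syT_f (a v : Lat) : (syT a).f v = v + a := rfl
@[simp] lemma syS_f (v : Lat) : syS.f v = (v.2, v.1) := rfl
@[simp] lemma syX_f (v : Lat) : syX.f v = (-v.1, v.2) := rfl
@[simp] lemma Sy.comp_f (σ τ : Sy) (v : Lat) : (σ.comp τ).f v = σ.f (τ.f v) := rfl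

/-- reflection of the second coordinate -/
def syY : Sy := syS.comp (syX.comp syS)

@[simp] lemma syY_f (v : Lat) : syY.f v = (v.1, -v.2) := rfl

/-! ### Renormalisation of crossing probabilities -/

lemma conn_cut {T : FLp} {S : FLat} {a b : Lat} (f : Lat → ℤ)
    (hf : ∀ x y, Adj x y → |f x - f y| ≤ 1) (c : ℤ) (h : Conn T S a b) (ha : f a ≤ c) (hb : c ≤ f b) :
    ∃ a', f a' = c ∧ Conn T (S.filter (fun v => c ≤ f v)) a' b := by
  obtain ⟨haS, h⟩ := h
  induction h with
  | refl => exact ⟨a, by omega, Conn.refl (by simp [haS, hb])⟩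
  | tail h1 h2 ih =>
    rename_i u v
    by_cases hv : f v = c
    · exact ⟨v, hv, Conn.refl (by simp [h2.2.2, hb])⟩
    · have hu : c ≤ f u := by
        have := abs_le.1 (hf u v h2.1.adj); omega
      obtain ⟨a', h3, h4⟩ := ih hu; exact ⟨a', h3, h4.trans (Conn.step h2.1 (by simp [h2.2.1, hu]) (by simp [h2.2.2, hb]))⟩

lemma adj_fst {x y : Lat} (h : Adj x y) : |x.1 - y.1| ≤ 1 := by rcases adj_cases h with h | h | h | h <;> simp [h]

lemma adj_snd {x y : Lat} (h : Adj x y) : |x.2 - y.2| ≤ 1 := by rcases adj_cases h with h | h | h | h <;> simp [h]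

lemma XV.cut {T : FLp} {x0 x1 y0 y1 y0' y1' : ℤ} (h : XV T x0 x1 y0 y1)
    (h0 : y0 ≤ y0') (h1 : y0' ≤ y1') (h2 : y1' ≤ y1) : XV T x0 x1 y0' y1' := by
  obtain ⟨a, b, ha, hb, hc⟩ := h
  obtain ⟨a', ha', hc'⟩ := conn_cut (fun v => v.2) (fun x y h => adj_snd h) y0' hc (by omega) (by omega)
  obtain ⟨b', hb', hc''⟩ := conn_cut (fun v => -v.2) (fun x y h => by have := adj_snd h; rw [abs_le] at *; omega) (-y1') hc'.symm
    (by omega) (by omega)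
  refine ⟨a', b', ha', by omega, hc''.symm.mono subset_rfl ?_⟩
  intro v hv
  simp only [Finset.mem_filter, mem_Rc] at hv ⊢
  omega

/-- gluing of two horizontal crossings by a vertical one -/
lemma XH.glue {T : FLp} {x0 x1 x2 x3 y0 y1 : ℤ} (h : XH T x0 x2 y0 y1) (h' : XH T x1 x3 y0 y1)
    (hv : XV T x1 x2 y0 y1) (h01 : x0 ≤ x1) (h23 : x2 ≤ x3) : XH T x0 x3 y0 y1 := by
  obtain ⟨a, b, ha, hb, hc⟩ := h
  obtain ⟨a', b', ha', hb', hc'⟩ := h'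
  obtain ⟨c, d, h1, h2, h3⟩ := hv
  have k12 : x1 ≤ x2 := by have := mem_Rc.1 h3.1; omega
  have s1 : Rc x1 x2 y0 y1 ⊆ Rc x0 x2 y0 y1 := by intro v; simp only [mem_Rc]; omega
  have s2 : Rc x1 x2 y0 y1 ⊆ Rc x1 x3 y0 y1 := by intro v; simp only [mem_Rc]; omega
  have s3 : Rc x0 x2 y0 y1 ⊆ Rc x0 x3 y0 y1 := by intro v; simp only [mem_Rc]; omega
  have s4 : Rc x1 x3 y0 y1 ⊆ Rc x0 x3 y0 y1 := by intro v; simp only [mem_Rc]; omega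
  obtain ⟨v, v1, v2⟩ := conn_meet hc h3 subset_rfl s1 ha hb h1 h2
  obtain ⟨w, w1, w2⟩ := conn_meet hc' h3 subset_rfl s2 ha' hb' h1 h2
  refine ⟨a, b', ha, hb', ?_⟩
  exact ((v1.mono subset_rfl s3).trans ((v2.symm.trans w2).mono subset_rfl (s1.trans s3))).trans
    ((w1.symm.trans hc').mono subset_rfl s4)

/-- probability of no crossing -/
def hh (L : ℕ) (m : ℤ) : ℝ := Pr pr (LS L (Rc (-m+1) (3*m-1) (-m+1) (2*m-1))) (fun T => ¬ XH T 0 (2*m) 0 m)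

lemma decr_notXH {x0 x1 y0 y1} : Decr (fun T => ¬ XH T x0 x1 y0 y1) := fun _ _ h hn hx => hn (hx.mono h)

lemma decr_notXV {x0 x1 y0 y1} : Decr (fun T => ¬ XV T x0 x1 y0 y1) := fun _ _ h hn hx => hn (hx.mono h)

lemma hh_nonneg (L m) : 0 ≤ hh L m := Pr_nonneg pr_bd _

lemma noH {L : ℕ} {m a b : ℤ} {A : FLat} (hA : Rc (a-m+1) (a+3*m-1) (b-m+1) (b+2*m-1) ⊆ A) :
    Pr pr (LS L A) (fun T => ¬ XH T a (a+2*m) b (b+m)) ≤ hh L m := by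
  refine (Pr_anti_s pr_bd (LS_mono le_rfl hA) decr_notXH).trans ?_
  refine Pr_sy_not_le (syT (a, b)) (fun v => ?_) (fun T hT => ?_)
  · simp only [mem_Rc, syT_f, Prod.fst_add, Prod.snd_add]; omega
  · obtain ⟨c, d, h1, h2, h3⟩ := hT; refine ⟨(syT (a, b)).f c, (syT (a, b)).f d, by simp; omega, by simp; omega, (syT (a,b)).conn ?_ h3⟩
    intro v; simp only [mem_Rc, syT_f, Prod.fst_add, Prod.snd_add]; omega

lemma noV {L : ℕ} {m a b : ℤ} {A : FLat} (hA : Rc (a-m+1) (a+2*m-1) (b-m+1) (b+3*m-1) ⊆ A) :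
    Pr pr (LS L A) (fun T => ¬ XV T a (a+m) b (b+2*m)) ≤ hh L m := by
  refine (Pr_anti_s pr_bd (LS_mono le_rfl hA) decr_notXV).trans ?_
  refine Pr_sy_not_le ((syT (a, b)).comp syS) (fun v => ?_) (fun T hT => ?_)
  · simp only [mem_Rc, Sy.comp_f, syS_f, syT_f, Prod.fst_add, Prod.snd_add]; omega
  · obtain ⟨c, d, h1, h2, h3⟩ := hT
    refine ⟨((syT (a, b)).comp syS).f c, ((syT (a, b)).comp syS).f d, by simp; omega, by simp; omega,
      ((syT (a, b)).comp syS).conn ?_ h3⟩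
    intro v; simp only [mem_Rc, Sy.comp_f, syS_f, syT_f, Prod.fst_add, Prod.snd_add]; omega

/-- long rows -/
lemma noRow {L : ℕ} {m a b c : ℤ} (hm : 1 ≤ m) (hc : b - m ≤ c) (hc' : c ≤ b) (k : ℕ) {A : FLat}
    (hA : Rc (a-m+1) (a+(k+3)*m-1) (c-m+1) (c+3*m-1) ⊆ A) :
    Pr pr (LS L A) (fun T => ¬ XH T a (a+(k+2)*m) b (b+m)) ≤ (2*k+1) * hh L m := by
  induction k with
  | zero =>
    simp only [Nat.cast_zero, zero_add, mul_zero, one_mul]; refine noH (fun v hv => hA ?_)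
    simp only [mem_Rc, Nat.cast_zero] at hv ⊢; omega
  | succ k ih =>
    have hkm : 0 ≤ (k : ℤ) * m := by positivity
    have h1 := ih (fun v hv => hA (by
      simp only [mem_Rc] at hv ⊢; push_cast; constructor
      · constructor
        · omega
        · nlinarith
      · omega))
    have h2 : Pr pr (LS L A) (fun T => ¬ XH T (a + (k+1)*m) (a+(k+1)*m+2*m) b (b+m)) ≤ hh L m := by
      refine noH (fun v hv => hA ?_)
      simp only [mem_Rc] at hv ⊢; push_cast at hv ⊢; constructor
      · constructor
        · nlinarith
        · nlinarith
      · omega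
    have h3 : Pr pr (LS L A) (fun T => ¬ XV T (a + (k+1)*m) (a+(k+1)*m+m) c (c+2*m)) ≤ hh L m := by
      refine noV (fun v hv => hA ?_)
      simp only [mem_Rc] at hv ⊢; push_cast at hv ⊢; constructor
      · constructor
        · nlinarith
        · nlinarith
      · omega
    have h4 : Pr pr (LS L A) (fun T => ¬ XH T a (a+((k+1:ℕ)+2)*m) b (b+m)) ≤
        Pr pr (LS L A) (fun T => ¬ XH T a (a+(k+2)*m) b (b+m) ∨
          (¬ XH T (a + (k+1)*m) (a+(k+1)*m+2*m) b (b+m) ∨ ¬ XV T (a + (k+1)*m) (a+(k+1)*m+m) c (c+2*m))) := by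
      apply Pr_mono pr_bd
      intro T _ hn; by_contra hcon; push Not at hcon; obtain ⟨g1, g2, g3⟩ := hcon; apply hn
      have g3' := g3.cut (y0' := b) (y1' := b + m) hc' (by omega) (by omega)
      have e1 : a + ((k:ℤ)+2)*m = a + (k+1)*m + m := by ring
      have e2 : a + (((k+1:ℕ):ℤ)+2)*m = a + (k+1)*m + 2*m := by push_cast; ring
      rw [e1] at g1; rw [e2]; exact g1.glue g2 g3' (by nlinarith) (by omega)
    have h5 := Pr_or_le (s := LS L A) pr_bd (fun T => ¬ XH T a (a+(k+2)*m) b (b+m)) (fun T => (¬ XH T (a + (k+1)*m) (a+(k+1)*m+2*m) b (b+m) ∨ ¬ XV T (a + (k+1)*m) (a+(k+1)*m+m) c (c+2*m)))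
    have h6 := Pr_or_le (s := LS L A) pr_bd (fun T => ¬ XH T (a + (k+1)*m) (a+(k+1)*m+2*m) b (b+m))
      (fun T => ¬ XV T (a + (k+1)*m) (a+(k+1)*m+m) c (c+2*m))
    push_cast at *; linarith

lemma XH.sub {T : FLp} {x0 x1 y0 y1 y0' y1' : ℤ} (h : XH T x0 x1 y0' y1') (h0 : y0 ≤ y0') (h1 : y1' ≤ y1) :
    XH T x0 x1 y0 y1 := by
  obtain ⟨a, b, ha, hb, hc⟩ := h
  refine ⟨a, b, ha, hb, hc.mono subset_rfl ?_⟩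
  intro v; simp only [mem_Rc]; omega

lemma hh_two {L : ℕ} {m : ℤ} (hm : 1 ≤ m) : hh L (2*m) ≤ 5 * hh L m := by
  have h := noRow (L := L) (m := m) (a := 0) (b := 0) (c := 0) hm (by omega) le_rfl 2
    (A := Rc (-(2*m)+1) (3*(2*m)-1) (-(2*m)+1) (2*(2*m)-1)) (by
      intro v; simp only [mem_Rc]; push_cast; omega)
  have h2 : hh L (2*m) ≤ Pr pr (LS L (Rc (-(2*m)+1) (3*(2*m)-1) (-(2*m)+1) (2*(2*m)-1)))
      (fun T => ¬ XH T 0 (0 + (((2:ℕ):ℤ)+2)*m) 0 (0+m)) := by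
    apply Pr_mono pr_bd
    intro T _ hn hx; apply hn; have := hx.sub (y0 := 0) (y1 := 2*m) le_rfl (by omega)
    convert this using 1; push_cast; ring
  push_cast at *
  linarith

lemma hh_four {L : ℕ} {m : ℤ} (hm : 1 ≤ m) : hh L (4*m) ≤ (13 * hh L m) ^ 2 := by
  set u := LS L (Rc (-(4*m)+1) (3*(4*m)-1) (-(4*m)+1) (2*(4*m)-1)) with hu
  set A1 := Rc (0-m+1) (0+((6:ℕ)+3)*m-1) ((-m)-m+1) ((-m)+3*m-1) with hA1
  set A2 := Rc (0-m+1) (0+((6:ℕ)+3)*m-1) ((3*m)-m+1) ((3*m)+3*m-1) with hA2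
  have h1 := noRow (L := L) (m := m) (a := 0) (b := 0) (c := -m) hm (by omega) (by omega) 6 (A := A1) subset_rfl
  have h2 := noRow (L := L) (m := m) (a := 0) (b := 3*m) (c := 3*m) hm (by omega) (by omega) 6 (A := A2) subset_rfl
  have s1 : LS L A1 ⊆ u := LS_mono le_rfl (by intro v; simp only [hA1, mem_Rc]; push_cast; omega)
  have s2 : LS L A2 ⊆ u := LS_mono le_rfl (by intro v; simp only [hA2, mem_Rc]; push_cast; omega)
  have hd : Disjoint (LS L A1) (LS L A2) := by
    rw [Finset.disjoint_left]; intro l hl hl'; have e1 := (mem_LS.1 hl).2.2.2 _ (mem_path_self _ _)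
    have e2 := (mem_LS.1 hl').2.2.2 _ (mem_path_self _ _)
    simp only [hA1, hA2, mem_Rc] at e1 e2; omega
  set E : FLp → Prop := fun T => ¬ XH (T ∩ LS L A1) 0 (0+((6:ℕ)+2)*m) 0 (0+m) with hE
  set F : FLp → Prop := fun T => ¬ XH (T ∩ LS L A2) 0 (0+((6:ℕ)+2)*m) (3*m) (3*m+m) with hF
  have hE' : ∀ T ⊆ u, E T ↔ E (T ∩ LS L A1) := by intro T _; simp only [hE]; rw [Finset.inter_assoc, Finset.inter_self]
  have hF' : ∀ T ⊆ u, F T ↔ F (T ∩ LS L A2) := by intro T _; simp only [hF]; rw [Finset.inter_assoc, Finset.inter_self]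
  have h3 := Pr_indep (p := pr) s1 s2 hd hE' hF'
  rw [Pr_restrict s1 hE', Pr_restrict s2 hF'] at h3
  have h4 : Pr pr (LS L A1) E ≤ 13 * hh L m := by
    refine le_trans (Pr_mono pr_bd ?_) (h1.trans (by push_cast; linarith))
    intro T hT; simp only [hE]; rw [Finset.inter_eq_left.2 hT]; exact id
  have h5 : Pr pr (LS L A2) F ≤ 13 * hh L m := by
    refine le_trans (Pr_mono pr_bd ?_) (h2.trans (by push_cast; linarith))
    intro T hT; simp only [hF]; rw [Finset.inter_eq_left.2 hT]; exact id
  have h6 : hh L (4*m) ≤ Pr pr u (fun T => E T ∧ F T) := by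
    apply Pr_mono pr_bd
    intro T _ hn; refine ⟨fun hx => hn ?_, fun hx => hn ?_⟩
    · have := (hx.mono Finset.inter_subset_left).sub (y0 := 0) (y1 := 4*m) le_rfl (by omega)
      convert this using 1; push_cast; ring
    · have := (hx.mono Finset.inter_subset_left).sub (y0 := 0) (y1 := 4*m) (by omega) (by omega)
      convert this using 1; push_cast; ring
  rw [h3] at h6
  have h7 : 0 ≤ Pr pr (LS L A1) E := Pr_nonneg pr_bd _
  have h8 : 0 ≤ Pr pr (LS L A2) F := Pr_nonneg pr_bd _
  calc _ ≤ _ := h6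
    _ ≤ (13 * hh L m) * (13 * hh L m) := mul_le_mul h4 h5 h8 (h7.trans h4)
    _ = _ := by ring

/-! ### Crossing probabilities are bounded, given the one-arm estimate -/

def Incr {ι : Type*} (E : Finset ι → Prop) : Prop := ∀ T T' : Finset ι, T ⊆ T' → E T → E T'

lemma Pr_fkg_incr {ι : Type*} [DecidableEq ι] {p : ι → ℝ} {s : Finset ι}
    (hp : ∀ i, 0 ≤ p i ∧ p i ≤ 1) {E F : Finset ι → Prop} (hE : Incr E) (hF : Incr F) :
    Pr p s E * Pr p s F ≤ Pr p s (fun T => E T ∧ F T) := by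
  unfold Pr; simp only [ind_and]
  exact Ex_fkg hp (fun T T' h => ind_mono (hE T T' h)) (fun T T' h => ind_mono (hF T T' h))

lemma Pr_mem {ι : Type*} [DecidableEq ι] {p : ι → ℝ} {s : Finset ι} {i : ι} (hi : i ∈ s) :
    Pr p s (fun T => i ∈ T) = p i := by
  have h1 := Pr_none (p := p) (s := s) (fun j => j = i)
  have h2 := Pr_not (p := p) (s := s) (fun T => i ∈ T)
  have h3 : (fun T : Finset ι => ¬ i ∈ T) = (fun T => ∀ j ∈ T, ¬ j = i) := by
    funext T; apply propext
    exact ⟨fun h j hj e => h (e ▸ hj), fun h hi => h i hi rfl⟩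
  rw [h3, h1] at h2
  have h4 : s.filter (fun j => j = i) = {i} := by
    ext j; simp only [Finset.mem_filter, Finset.mem_singleton]
    exact ⟨fun h => h.2, fun h => ⟨h ▸ hi, h⟩⟩
  have h5 : ∏ j ∈ s.filter (fun j => j = i), (1 - p j) = 1 - p i := by rw [h4, Finset.prod_singleton]
  have h6 : 1 - p i = 1 - Pr p s (fun T => i ∈ T) := by
    rw [← h5]; convert h2 using 2; ext j; simp only [Finset.mem_filter]
  linarith

lemma Pr_all_mem {ι : Type*} [DecidableEq ι] {p : ι → ℝ} {s : Finset ι}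
    (hp : ∀ i, 0 ≤ p i ∧ p i ≤ 1) (U : Finset ι) (hU : U ⊆ s) :
    ∏ i ∈ U, p i ≤ Pr p s (fun T => U ⊆ T) := by
  induction U using Finset.induction_on with
  | empty =>
    simp only [Finset.prod_empty, Finset.empty_subset]; unfold Pr; simp only [ind_true trivial]; rw [Ex_one]
  | insert i U hi ih =>
    rw [Finset.prod_insert hi]; have h1 := ih (fun j hj => hU (Finset.mem_insert_of_mem hj))
    have h2 := Pr_fkg_incr (s := s) hp (E := fun T => i ∈ T) (F := fun T => U ⊆ T)
      (fun T T' h h' => h h') (fun T T' h h' => h'.trans h)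
    rw [Pr_mem (hU (Finset.mem_insert_self _ _))] at h2; have h3 := mul_le_mul_of_nonneg_left h1 (hp i).1; refine (h3.trans h2).trans (Pr_mono hp ?_)
    intro T _ h; exact Finset.insert_subset h.1 h.2

/-- reversed direction -/
def rv (d : Dir) : Dir := (!d.1, !d.2)

lemma stp_rv (d : Dir) : stp (rv d) = - stp d := by obtain ⟨a, b⟩ := d; cases a <;> cases b <;> rfl

/-- the length-two loops in a finite set of vertices -/
def twoL (A : FLat) : FLp := ((A ×ˢ (Finset.univ : Finset Dir)).filter (fun q => q.1 + stp q.2 ∈ A)).image (fun q => (q.1, [q.2, rv q.2]))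

lemma twoL_sub {A D : FLat} (h : A ⊆ D) {L : ℕ} (hL : 2 ≤ L) : twoL A ⊆ LS L D := by
  intro l hl
  simp only [twoL, Finset.mem_image, Finset.mem_filter, Finset.mem_product, Finset.mem_univ, and_true] at hl
  obtain ⟨⟨z, d⟩, ⟨h1, h2⟩, rfl⟩ := hl
  simp only at h1 h2
  rw [mem_LS]
  refine ⟨by simp, by simpa using hL, by simp [stp_rv], ?_⟩
  intro v hv
  simp [stp_rv] at hv
  rcases hv with rfl | rfl | rfl
  · exact h h1
  · exact h h2
  · exact h h1

lemma twoL_card (A : FLat) : (twoL A).card ≤ 4 * A.card := by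
  refine Finset.card_image_le.trans ((Finset.card_filter_le _ _).trans ?_)
  rw [card_product]; simp [Dir]; omega

lemma twoL_pr {A : FLat} {l : Lp} (h : l ∈ twoL A) : pr l = 1 - exp (-(1/64)) := by
  simp only [twoL, Finset.mem_image] at h
  obtain ⟨q, _, rfl⟩ := h
  simp [pr, wt]; norm_num

lemma twoL_op {A : FLat} {T : FLp} (h : twoL A ⊆ T) {v : Lat} {d : Dir} (hv : v ∈ A)
    (hd : v + stp d ∈ A) : Op T v (v + stp d) := by
  refine ⟨(v, [d, rv d]), h ?_, by left; simp⟩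
  simp only [twoL, Finset.mem_image, Finset.mem_filter, Finset.mem_product, Finset.mem_univ, and_true]
  exact ⟨(v, d), ⟨hv, hd⟩, rfl⟩

lemma twoL_horiz {A S : FLat} {T : FLp} (h : twoL A ⊆ T) (hS : A ⊆ S) (x y : ℤ) (k : ℕ)
    (hA : ∀ j : ℤ, 0 ≤ j → j ≤ k → (x + j, y) ∈ A) : Conn T S (x, y) (x + k, y) := by
  induction k with
  | zero => simpa using Conn.refl (hS (by simpa using hA 0 le_rfl (by simp)))
  | succ k ih =>
    refine (ih (fun j h1 h2 => hA j h1 (by push_cast; omega))).trans ?_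
    have h1 := hA k (by simp) (by push_cast; omega)
    have h2 := hA (k+1) (by positivity) (by push_cast; omega)
    have e : ((x + ((k+1:ℕ):ℤ), y) : Lat) = (x + k, y) + stp (true, true) := by simp [stp]; ring
    have e' : ((x + ((k:ℤ)+1), y) : Lat) = (x + k, y) + stp (true, true) := by simp [stp]; ring
    rw [e]; rw [e'] at h2; exact Conn.step (twoL_op h h1 h2) (hS h1) (hS h2)

lemma twoL_vert {A S : FLat} {T : FLp} (h : twoL A ⊆ T) (hS : A ⊆ S) (x y : ℤ) (k : ℕ)
    (hA : ∀ j : ℤ, 0 ≤ j → j ≤ k → (x, y + j) ∈ A) : Conn T S (x, y) (x, y + k) := by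
  induction k with
  | zero => simpa using Conn.refl (hS (by simpa using hA 0 le_rfl (by simp)))
  | succ k ih =>
    refine (ih (fun j h1 h2 => hA j h1 (by push_cast; omega))).trans ?_
    have h1 := hA k (by simp) (by push_cast; omega)
    have h2 := hA (k+1) (by positivity) (by push_cast; omega)
    have e : ((x, y + ((k+1:ℕ):ℤ)) : Lat) = (x, y + k) + stp (true, false) := by simp [stp]; ring
    have e' : ((x, y + ((k:ℤ)+1)) : Lat) = (x, y + k) + stp (true, false) := by simp [stp]; ring
    rw [e]; rw [e'] at h2; exact Conn.step (twoL_op h h1 h2) (hS h1) (hS h2)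

/-- chain of crossings -/
def chainEv (T : FLp) (m : ℤ) (J : ℕ) : Prop :=
  ∀ i ∈ Finset.range (J+1), XH T (2^i*m) (2^i*m + 2*(2^i*m)) 0 (0+2^i*m) ∧
    XV T (2*(2^i*m)) (2*(2^i*m) + 2^i*m) 0 (0+2*(2^i*m))

lemma chain_conn {T : FLp} {m : ℤ} (hm : 1 ≤ m) (J : ℕ) (h : chainEv T m J) (S : FLat)
    (hS : Rc 0 (4*(2^J*m)) 0 (4*(2^J*m)) ⊆ S) (a b : Lat) (ha : a.1 = 2^J*m) (hb : b.1 = 2^J*m+2*(2^J*m))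
    (hab : Conn T (Rc (2^J*m) (2^J*m + 2*(2^J*m)) 0 (0+2^J*m)) a b) :
    ∃ c : Lat, c.1 = m ∧ 0 ≤ c.2 ∧ c.2 ≤ m ∧ Conn T S c a := by
  induction J generalizing S a b with
  | zero =>
    have h1 := mem_Rc.1 hab.1; simp only [pow_zero, one_mul] at *; exact ⟨a, ha, by omega, by omega, Conn.refl (hS (by rw [mem_Rc]; omega))⟩
  | succ J ih =>
    set M : ℤ := 2^J*m with hM
    have hM1 : 1 ≤ M := by
      have : (1:ℤ) ≤ 2^J := one_le_pow₀ (by norm_num)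
      nlinarith
    have e : (2:ℤ)^(J+1)*m = 2*M := by rw [hM]; ring
    rw [e] at ha hb hab hS; obtain ⟨⟨a', b', h1, h2, h3⟩, ⟨c', d', h4, h5, h6⟩⟩ := h J (by simp)
    rw [← hM] at h1 h2 h3 h5 h6
    obtain ⟨c, q1, q2, q3, q4⟩ := ih (fun i hi => h i (by simp at hi ⊢; omega)) S (fun v hv => hS (by
      rw [mem_Rc] at *; omega)) a' b' h1 h2 h3
    obtain ⟨v, v1, v2⟩ := conn_meet h3 h6 (x0 := M) (x1 := M+2*M) (y0 := 0) (y1 := 0+2*M)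
      (by intro v; simp only [mem_Rc]; omega) (by intro v; simp only [mem_Rc]; omega) h1 h2 h4 h5
    obtain ⟨w, w1, w2⟩ := conn_meet hab h6 (x0 := 2*M) (x1 := 2*M+2*(2*M)) (y0 := 0) (y1 := 0+2*M)
      (by intro v; simp only [mem_Rc]; omega) (by intro v; simp only [mem_Rc]; omega) ha hb h4 h5
    refine ⟨c, q1, q2, q3, ?_⟩
    have s1 : Rc M (M+2*M) 0 (0+M) ⊆ S := fun v hv => hS (by simp only [mem_Rc] at *; omega)
    have s2 : Rc (2*M) (2*M+M) 0 (0+2*M) ⊆ S := fun v hv => hS (by simp only [mem_Rc] at *; omega)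
    have s3 : Rc (2*M) (2*M+2*(2*M)) 0 (0+2*M) ⊆ S := fun v hv => hS (by simp only [mem_Rc] at *; omega)
    exact ((q4.trans (v1.mono subset_rfl s1)).trans ((v2.symm.trans w2).mono subset_rfl s2)).trans
      (w1.symm.mono subset_rfl s3)

lemma hh_anti_L {L L' : ℕ} (h : L ≤ L') (m : ℤ) : hh L' m ≤ hh L m := Pr_anti_s pr_bd (LS_mono h subset_rfl) decr_notXH

lemma hh_small {L : ℕ} {m : ℤ} (hm : 1 ≤ m) (h : hh L m < 1/676) (i : ℕ) :
    hh L (2^i*m) ≤ 10/676 * (1/2)^i := by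
  have key : ∀ k : ℕ, 169 * hh L (4^k*m) ≤ (1/4)^(k+1) := by
    intro k
    induction k with
    | zero => norm_num; linarith
    | succ k ih =>
      have h1 : (1:ℤ) ≤ 4^k*m := by
        have : (1:ℤ) ≤ 4^k := one_le_pow₀ (by norm_num)
        nlinarith
      have h2 := hh_four (L := L) h1; have e : (4:ℤ)^(k+1)*m = 4*(4^k*m) := by ring
      rw [e]; have h3 := hh_nonneg L (4^k*m); have h4 : (169 * hh L (4^k*m))^2 ≤ ((1/4)^(k+1))^2 := pow_le_pow_left₀ (by positivity) ih 2
      have h5 : (((1:ℝ)/4)^(k+1))^2 ≤ (1/4)^(k+1+1) := by rw [← pow_mul]; exact pow_le_pow_of_le_one (by norm_num) (by norm_num) (by omega)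
      nlinarith
  obtain ⟨k, rfl | rfl⟩ : ∃ k, i = 2*k ∨ i = 2*k+1 := ⟨i/2, by omega⟩
  · have h1 := key k; have e : (2:ℤ)^(2*k)*m = 4^k*m := by rw [pow_mul]; norm_num
    have e2 : ((1:ℝ)/2)^(2*k) = (1/4)^k := by rw [pow_mul]; norm_num
    rw [e, e2]; rw [pow_succ] at h1; have : (0:ℝ) ≤ (1/4)^k := by positivity
    linarith
  · have h1 := key k
    have h0 : (1:ℤ) ≤ 4^k*m := by
        have : (1:ℤ) ≤ 4^k := one_le_pow₀ (by norm_num)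
        nlinarith
    have h2 := hh_two (L := L) h0; have e : (2:ℤ)^(2*k+1)*m = 2*(4^k*m) := by rw [pow_succ, pow_mul]; norm_num; ring
    have e2 : ((1:ℝ)/2)^(2*k+1) = (1/4)^k*(1/2) := by rw [pow_succ, pow_mul]; norm_num
    rw [e, e2]; rw [pow_succ] at h1; have : (0:ℝ) ≤ (1/4)^k := by positivity
    linarith

/-- the one-arm estimate -/
def OneArm : Prop := ∀ ε : ℝ, 0 < ε → ∃ N0 : ℤ, ∀ N : ℤ, N0 ≤ N → ∀ L : ℕ,
  Pr pr (LS L (Rc (-N) N (-N) N)) (fun T => ∃ b : Lat, b.1 = N ∧ Conn T (Rc (-N) N (-N) N) 0 b) ≤ ε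

lemma chain_prob {L : ℕ} {m : ℤ} (hm : 1 ≤ m) (h : hh L m < 1/676) (J : ℕ) {A : FLat}
    (hA : Rc 1 (4*(2^J*m)-1) (-(2^J*m)+1) (3*(2^J*m)-1) ⊆ A) :
    Pr pr (LS L A) (fun T => ¬ chainEv T m J) ≤ 1/16 := by
  have h1 : Pr pr (LS L A) (fun T => ¬ chainEv T m J) ≤ ∑ i ∈ Finset.range (J+1),
      Pr pr (LS L A) (fun T => ¬ XH T (2^i*m) (2^i*m + 2*(2^i*m)) 0 (0+2^i*m) ∨
        ¬ XV T (2*(2^i*m)) (2*(2^i*m) + 2^i*m) 0 (0+2*(2^i*m))) := by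
    refine le_trans (Pr_mono pr_bd ?_) (Pr_exists_le pr_bd _ _)
    intro T _ hn; unfold chainEv at hn; push Not at hn; obtain ⟨i, hi, hn⟩ := hn; exact ⟨i, hi, by tauto⟩
  refine h1.trans ?_
  have h2 : ∀ i ∈ Finset.range (J+1), Pr pr (LS L A) (fun T => ¬ XH T (2^i*m) (2^i*m + 2*(2^i*m)) 0 (0+2^i*m) ∨
        ¬ XV T (2*(2^i*m)) (2*(2^i*m) + 2^i*m) 0 (0+2*(2^i*m))) ≤ 20/676 * (1/2)^i := by
    intro i hi; have hi' : i ≤ J := by simp at hi; omega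
    have hM : (2:ℤ)^i*m ≤ 2^J*m := by
      have : (2:ℤ)^i ≤ 2^J := pow_le_pow_right₀ (by norm_num) hi'
      nlinarith
    have hM1 : 1 ≤ (2:ℤ)^i*m := by
      have : (1:ℤ) ≤ 2^i := one_le_pow₀ (by norm_num)
      nlinarith
    have h3 := noH (L := L) (m := 2^i*m) (a := 2^i*m) (b := 0) (A := A) (fun v hv => hA (by
      simp only [mem_Rc] at *; omega))
    have h4 := noV (L := L) (m := 2^i*m) (a := 2*(2^i*m)) (b := 0) (A := A) (fun v hv => hA (by
      simp only [mem_Rc] at *; omega))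
    have h5 := hh_small hm h i; refine (Pr_or_le pr_bd _ _).trans ?_; linarith
  refine (Finset.sum_le_sum h2).trans ?_
  rw [← mul_sum]
  have h3 : ∑ i ∈ Finset.range (J+1), ((1:ℝ)/2)^i ≤ 2 := by
    rw [geom_sum_eq (by norm_num)]
    have : (0:ℝ) ≤ (1/2)^(J+1) := by positivity
    rw [div_le_iff_of_neg (by norm_num)]; linarith
  linarith

lemma incr_conn {P : FLp → FLp} (hP : ∀ T T', T ⊆ T' → P T ⊆ P T') (m J) :
    Incr (fun T => chainEv (P T) m J) := fun T T' h hc i hi =>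
  ⟨(hc i hi).1.mono (hP _ _ h), (hc i hi).2.mono (hP _ _ h)⟩

lemma hh_lower (h1 : OneArm) (L : ℕ) (m : ℤ) (hm : 1 ≤ m) : 1/676 ≤ hh L m := by
  by_contra hcon
  push Not at hcon
  replace hcon := (hh_anti_L (le_max_left L 2) m).trans_lt hcon
  have hL : 2 ≤ max L 2 := le_max_right _ _
  generalize max L 2 = L at hcon hL
  clear hL
  set p2 : ℝ := 1 - exp (-(1/64)) with hp2
  have hp2' : 0 < p2 := by rw [hp2, sub_pos, Real.exp_lt_one_iff]; norm_num
  have hp2'' : p2 ≤ 1 := by rw [hp2]; have := exp_pos (-(1/64)); linarith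
  set K : ℕ := 4 * (2 * (m+1).toNat ^ 2) with hK
  set ε := p2 ^ K / 4 with hε
  obtain ⟨N0, hN0⟩ := h1 ε (by positivity)
  obtain ⟨J, hJ⟩ : ∃ J : ℕ, N0 ≤ 4*(2^J*m) := by
    refine ⟨N0.toNat, ?_⟩
    have := Nat.lt_two_pow_self (n := N0.toNat); have h2 : ((N0.toNat : ℕ) : ℤ) < 2^N0.toNat := by exact_mod_cast this
    have h3 := Int.self_le_toNat N0; have h4 : (0:ℤ) ≤ 2^N0.toNat := by positivity
    nlinarith
  set M : ℤ := 2^J*m with hM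
  have hmM : m ≤ M := by
    have : (1:ℤ) ≤ 2^J := one_le_pow₀ (by norm_num)
    nlinarith
  set N := 4*M with hN
  have harm := hN0 N hJ (max L 2)
  have hcon' := (hh_anti_L (le_max_left L 2) m).trans_lt hcon
  have hL : 2 ≤ max L 2 := le_max_right _ _
  generalize max L 2 = L at harm hcon' hL
  set D := Rc (-N) N (-N) N with hD
  set σ : Sy := (syT (N, 0)).comp syX with hσ
  have hσf : ∀ v, σ.f v = (N - v.1, v.2) := by
    intro v; simp [hσ, sub_eq_add_neg, add_comm]
  set A0 := Rc 1 (N-1) (-M+1) (3*M-1) with hA0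
  have p1 : Pr pr (LS L D) (fun T => ¬ chainEv T m J) ≤ 1/16 := by
    apply chain_prob hm hcon' J
    intro v; rw [hD, mem_Rc, mem_Rc]; omega
  have p2a : Pr pr (LS L D) (fun T => ¬ chainEv (T.image σ.act) m J) ≤ 1/16 := by
    have hA0D : A0 ⊆ D := by intro v; rw [hD, hA0, mem_Rc, mem_Rc]; omega
    refine (Pr_anti_s (t := LS L D) (s := LS L A0) pr_bd (LS_mono le_rfl hA0D) ?_).trans ?_
    · intro T T' h hn hc; exact hn (incr_conn (P := fun T => T.image σ.act) (fun T T' h => image_subset_image h) m J T T' h hc)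
    · rw [← Pr_sy σ (A := A0) (A' := A0) (fun v => by rw [hσf, hA0, mem_Rc, mem_Rc]; simp only; omega)
        (fun T => ¬ chainEv T m J)]
      exact chain_prob hm hcon' J subset_rfl
  set B1 := Rc 0 m 0 m with hB1
  set B2 := Rc (N-m) N 0 m with hB2
  set U := twoL B1 ∪ twoL B2 with hU
  have hB1D : B1 ⊆ D := by intro v; rw [hD, hB1, mem_Rc, mem_Rc]; omega
  have hB2D : B2 ⊆ D := by intro v; rw [hD, hB2, mem_Rc, mem_Rc]; omega
  have hUD : U ⊆ LS L D := Finset.union_subset (twoL_sub hB1D hL) (twoL_sub hB2D hL)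
  have p3 : p2 ^ K ≤ Pr pr (LS L D) (fun T => U ⊆ T) := by
    refine le_trans ?_ (Pr_all_mem pr_bd U hUD)
    have : ∏ i ∈ U, pr i = ∏ i ∈ U, p2 := by
      apply prod_congr rfl
      intro l hl; rw [hU, Finset.mem_union] at hl; rcases hl with hl | hl <;> exact twoL_pr hl
    rw [this, prod_const]; apply pow_le_pow_of_le_one hp2'.le hp2''; refine (Finset.card_union_le _ _).trans ?_; have c1 := twoL_card B1
    have c2 := twoL_card B2; have d1 : B1.card = (m+1).toNat ^ 2 := by rw [hB1, Rc, card_product]; simp; ring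
    have d2 : B2.card = (m+1).toNat ^ 2 := by
      rw [hB2, Rc, card_product]; simp; rw [add_comm 1 m]; ring
    rw [hK]; rw [d1] at c1; rw [d2] at c2; omega
  have p4 : 7/8 ≤ Pr pr (LS L D) (fun T => chainEv T m J ∧ chainEv (T.image σ.act) m J) := by
    have e1 := Pr_not (p := pr) (s := LS L D) (fun T => chainEv T m J ∧ chainEv (T.image σ.act) m J)
    have e2 : Pr pr (LS L D) (fun T => ¬ (chainEv T m J ∧ chainEv (T.image σ.act) m J)) ≤
      Pr pr (LS L D) (fun T => ¬ chainEv T m J ∨ ¬ chainEv (T.image σ.act) m J) :=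
      Pr_mono pr_bd (fun T _ h => by tauto)
    have e3 := Pr_or_le (s := LS L D) pr_bd (fun T => ¬ chainEv T m J) (fun T => ¬ chainEv (T.image σ.act) m J)
    linarith
  have p5 := Pr_fkg_incr (s := LS L D) pr_bd (E := fun T => chainEv T m J ∧ chainEv (T.image σ.act) m J)
    (F := fun T => U ⊆ T)
    (fun T T' h hc => ⟨incr_conn (P := fun T => T) (fun T T' h => h) m J T T' h hc.1,
      incr_conn (P := fun T => T.image σ.act) (fun T T' h => image_subset_image h) m J T T' h hc.2⟩)
    (fun T T' h hc => hc.trans h)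
  have p6 : Pr pr (LS L D) (fun T => (chainEv T m J ∧ chainEv (T.image σ.act) m J) ∧ U ⊆ T) ≤
      Pr pr (LS L D) (fun T => ∃ b : Lat, b.1 = N ∧ Conn T D 0 b) := by
    apply Pr_mono pr_bd
    rintro T - ⟨⟨hc1, hc2⟩, hUT⟩; obtain ⟨a, b, ha, hb, hab⟩ := (hc1 J (by simp)).1
    rw [← hM] at ha hb hab
    obtain ⟨c, q1, q2, q3, q4⟩ := chain_conn hm J hc1 D (by rw [← hM]; intro v; rw [hD, mem_Rc, mem_Rc]; omega) a b
      (by rw [← hM]; exact ha) (by rw [← hM]; exact hb) (by rw [← hM]; exact hab)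
    have hab' := σ.conn (S' := Rc M (M + 2*M) 0 (0+M)) (fun v hv => by rw [hσf]; rw [mem_Rc] at *; simp only; omega) hab.symm
    set D' := Rc 0 N 0 N with hD'
    obtain ⟨c', r1, r2, r3, r4⟩ := chain_conn hm J hc2 D' (by rw [← hM]) (σ.f b) (σ.f a)
      (by rw [← hM, hσf]; simp only; omega) (by rw [← hM, hσf]; simp only; omega) (by rw [← hM]; exact hab')
    have hc' : c' = σ.f (N - c'.1, c'.2) := by rw [hσf]; simp
    have r5 := σ.symm.conn (S' := D) (fun v hv => by
      have : v = σ.f (N - v.1, v.2) := by rw [hσf]; simp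
      rw [this]; rw [show σ.symm.f (σ.f (N - v.1, v.2)) = (N - v.1, v.2) from σ.f.symm_apply_apply _]
      rw [hD', mem_Rc] at hv; rw [hD, mem_Rc]; simp only; omega) r4
    rw [σ.image_image, hc', show σ.symm.f (σ.f b) = b from σ.f.symm_apply_apply _,
      show σ.symm.f (σ.f (N - c'.1, c'.2)) = (N - c'.1, c'.2) from σ.f.symm_apply_apply _] at r5
    have hmN : ((m.toNat : ℕ) : ℤ) = m := Int.toNat_of_nonneg (by omega)
    have hcN : ((c.2.toNat : ℕ) : ℤ) = c.2 := Int.toNat_of_nonneg q2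
    have u1 : twoL B1 ⊆ T := Finset.subset_union_left.trans hUT
    have u2 : twoL B2 ⊆ T := Finset.subset_union_right.trans hUT
    have t1 := twoL_horiz u1 hB1D 0 0 m.toNat (fun j j1 j2 => by rw [hB1, mem_Rc]; simp only; omega)
    have t2 := twoL_vert u1 hB1D m 0 c.2.toNat (fun j j1 j2 => by rw [hB1, mem_Rc]; simp only; omega)
    have t3 := twoL_horiz u2 hB2D (N-m) c'.2 m.toNat (fun j j1 j2 => by rw [hB2, mem_Rc]; simp only; omega)
    rw [hmN] at t1 t3; rw [hcN] at t2; have ec : c = (m, 0 + c.2) := by ext <;> simp [q1]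
    rw [ec] at q4; rw [r1] at r5; refine ⟨(N - m + m, c'.2), by simp, ?_⟩
    have t1' : Conn T D 0 (m, 0) := by rw [show ((0:ℤ) + m) = m by ring] at t1; exact t1
    exact ((t1'.trans (t2.trans q4)).trans (hab.mono subset_rfl (by
      intro v; rw [hD, mem_Rc, mem_Rc]; omega))).trans (r5.symm.trans t3)
  have p7 : 7/8 * p2^K ≤ Pr pr (LS L D) (fun T => chainEv T m J ∧ chainEv (T.image σ.act) m J) *
      Pr pr (LS L D) (fun T => U ⊆ T) := mul_le_mul p4 p3 (by positivity) (by linarith)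
  have p8 : 0 < p2^K := by positivity
  linarith

/-! ### Random walk estimates -/

/-- expectation over uniform words of length `t` -/
def EW (t : ℕ) (F : List Dir → ℝ) : ℝ := (∑ w ∈ words t, F w) * (1/4)^t

lemma EW_zero (F) : EW 0 F = F [] := by simp [EW, words]

lemma EW_succ (t : ℕ) (F) : EW (t+1) F = (∑ d : Dir, EW t (fun w => F (d :: w))) / 4 := by unfold EW; rw [sum_words_succ, ← sum_mul, pow_succ]; ring

lemma EW_add (s t : ℕ) (F) : EW (s+t) F = EW s (fun w => EW t (fun w' => F (w ++ w'))) := by unfold EW; rw [sum_words_add, ← sum_mul, pow_add]; ring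

lemma EW_mono {t : ℕ} {F G : List Dir → ℝ} (h : ∀ w, w.length = t → F w ≤ G w) : EW t F ≤ EW t G := mul_le_mul_of_nonneg_right (Finset.sum_le_sum (fun w hw => h w (mem_words.1 hw))) (by positivity)

lemma EW_congr {t : ℕ} {F G : List Dir → ℝ} (h : ∀ w, w.length = t → F w = G w) : EW t F = EW t G := by unfold EW; rw [sum_congr rfl (fun w hw => h w (mem_words.1 hw))]

lemma EW_const (t : ℕ) (c : ℝ) : EW t (fun _ => c) = c := by unfold EW; rw [sum_const, card_words]; simp [mul_comm, mul_assoc, ← mul_pow]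

lemma EW_nonneg {t : ℕ} {F : List Dir → ℝ} (h : ∀ w, w.length = t → 0 ≤ F w) : 0 ≤ EW t F := by rw [← EW_const t 0]; exact EW_mono h

lemma EW_mul_left (t : ℕ) (c : ℝ) (F) : EW t (fun w => c * F w) = c * EW t F := by unfold EW; rw [← mul_sum]; ring

lemma EW_add_fun (t : ℕ) (F G) : EW t (fun w => F w + G w) = EW t F + EW t G := by unfold EW; rw [sum_add_distrib]; ring

/-- one-dimensional simple random walk expectation -/
def S1 : ℕ → (ℤ → ℝ) → ℤ → ℝ
  | 0, f, k => f k
  | t+1, f, k => (S1 t f (k+1) + S1 t f (k-1)) / 2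

/-- killed one-dimensional walk -/
def K1 (A : ℤ → Prop) : ℕ → (ℤ → ℝ) → ℤ → ℝ
  | 0, f, k => ind (A k) * f k
  | t+1, f, k => ind (A k) * ((K1 A t f (k+1) + K1 A t f (k-1)) / 2)

def uu (z : Lat) : ℤ := z.1 + z.2
def vv (z : Lat) : ℤ := z.1 - z.2

lemma EW_prod (A A' : ℤ → Prop) (f f' : ℤ → ℝ) (t : ℕ) (z : Lat) : EW t (fun w => ind (∀ v ∈ path z w, A (uu v) ∧ A' (vv v)) * (f (uu (endp z w)) * f' (vv (endp z w)))) =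
      K1 A t f (uu z) * K1 A' t f' (vv z) := by
  induction t generalizing z with
  | zero => rw [EW_zero]; simp only [path_nil, List.mem_singleton, forall_eq, endp_nil, K1, ind_and]; ring
  | succ t ih =>
    rw [EW_succ]
    have h1 : ∀ d : Dir, EW t (fun w => ind (∀ v ∈ path z (d :: w), A (uu v) ∧ A' (vv v)) *
        (f (uu (endp z (d::w))) * f' (vv (endp z (d::w))))) = ind (A (uu z)) * ind (A' (vv z)) *
        (K1 A t f (uu (z + stp d)) * K1 A' t f' (vv (z + stp d))) := by
      intro d; rw [← ih, ← EW_mul_left]; apply EW_congr; intro w _; simp only [path_cons, List.mem_cons, forall_eq_or_imp, endp_cons, ind_and]; ring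
    simp only [h1]; rw [show (Finset.univ : Finset Dir) = {(true,true),(true,false),(false,true),(false,false)} by rfl]
    simp only [sum_insert, Finset.mem_insert, Finset.mem_singleton, Prod.mk.injEq, Bool.true_eq_false,
      Bool.false_eq_true, and_false, false_and, or_false, not_false_eq_true, and_true, and_self, Finset.sum_singleton, or_self]
    have e1 : uu (z + stp (true,true)) = uu z + 1 := by simp [uu, stp]; ring
    have e2 : uu (z + stp (true,false)) = uu z + 1 := by simp [uu, stp]; ring
    have e3 : uu (z + stp (false,true)) = uu z - 1 := by simp [uu, stp]; ring
    have e4 : uu (z + stp (false,false)) = uu z - 1 := by simp [uu, stp]; ring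
    have e5 : vv (z + stp (true,true)) = vv z + 1 := by simp [vv, stp]; ring
    have e6 : vv (z + stp (true,false)) = vv z - 1 := by simp [vv, stp]; ring
    have e7 : vv (z + stp (false,true)) = vv z + 1 := by simp [vv, stp]; ring
    have e8 : vv (z + stp (false,false)) = vv z - 1 := by simp [vv, stp]; ring
    rw [e1, e2, e3, e4, e5, e6, e7, e8]; simp only [K1]; ring

lemma S1_mono {f g : ℤ → ℝ} (h : ∀ k, f k ≤ g k) (t : ℕ) (k : ℤ) : S1 t f k ≤ S1 t g k := by
  induction t generalizing k with
  | zero => exact h k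
  | succ t ih => simp only [S1]; linarith [ih (k+1), ih (k-1)]

lemma S1_const (c : ℝ) (t : ℕ) (k : ℤ) : S1 t (fun _ => c) k = c := by
  induction t generalizing k with
  | zero => rfl
  | succ t ih => simp only [S1, ih]; ring

lemma S1_add (f g : ℤ → ℝ) (t : ℕ) (k : ℤ) : S1 t (fun x => f x + g x) k = S1 t f k + S1 t g k := by
  induction t generalizing k with
  | zero => rfl
  | succ t ih => simp only [S1, ih]; ring

lemma S1_mul (c : ℝ) (f : ℤ → ℝ) (t : ℕ) (k : ℤ) : S1 t (fun x => c * f x) k = c * S1 t f k := by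
  induction t generalizing k with
  | zero => rfl
  | succ t ih => simp only [S1, ih]; ring

lemma S1_sq (t : ℕ) (k : ℤ) : S1 t (fun x => (x:ℝ)^2) k = k^2 + t := by
  induction t generalizing k with
  | zero => simp [S1]
  | succ t ih => simp only [S1, ih]; push_cast; ring

lemma S1_four (t : ℕ) (k : ℤ) : S1 t (fun x => (x:ℝ)^4) k = k^4 + 6*t*k^2 + 3*t^2 - 2*t := by
  induction t generalizing k with
  | zero => simp [S1]
  | succ t ih => simp only [S1, ih]; push_cast; ring

lemma S1_neg (f : ℤ → ℝ) (t : ℕ) (k : ℤ) : S1 t (fun x => f (-x)) k = S1 t f (-k) := by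
  induction t generalizing k with
  | zero => rfl
  | succ t ih => simp only [S1, ih]; rw [show -(k+1) = -k-1 by ring, show -(k-1) = -k+1 by ring]; ring

lemma S1_shift (f : ℤ → ℝ) (t : ℕ) (k a : ℤ) : S1 t (fun x => f (x + a)) k = S1 t f (k + a) := by
  induction t generalizing k with
  | zero => rfl
  | succ t ih => simp only [S1, ih]; rw [show k+1+a = k+a+1 by ring, show k-1+a = k+a-1 by ring]

lemma ind_le_one' (P : Prop) : ind P ≤ 1 := by unfold ind; split_ifs <;> norm_num

lemma ind_nonneg' (P : Prop) : 0 ≤ ind P := by unfold ind; split_ifs <;> norm_num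

lemma K1_lower (c : ℤ) (lam : ℤ) (hl : 0 < lam) (f : ℤ → ℝ) (hf : ∀ k, f k ≤ 1) (t : ℕ) (k : ℤ) :
    S1 t f k - (((k:ℝ)-c)^4 + 6*t*((k:ℝ)-c)^2 + 3*t^2)/lam^4 ≤ K1 (fun x => |x - c| ≤ lam) t f k := by
  have hlr : (0:ℝ) < lam := by exact_mod_cast hl
  have hS : ∀ t k, S1 t f k ≤ 1 := fun t k => by rw [← S1_const 1 t k]; exact S1_mono hf t k
  have hout : ∀ (t : ℕ) (k : ℤ), ¬ |k - c| ≤ lam →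
      S1 t f k - (((k:ℝ)-c)^4 + 6*t*((k:ℝ)-c)^2 + 3*t^2)/lam^4 ≤ 0 := by
    intro t k hk; push Not at hk; have h1 : (lam:ℝ) < |(k:ℝ) - c| := by exact_mod_cast hk
    have h2 : (lam:ℝ)^4 ≤ ((k:ℝ)-c)^4 := by
      rw [← (by decide : Even 4).pow_abs ((k:ℝ)-c)]
      exact pow_le_pow_left₀ hlr.le h1.le 4
    have h3 : 1 ≤ (((k:ℝ)-c)^4 + 6*t*((k:ℝ)-c)^2 + 3*t^2)/lam^4 := by
      rw [le_div_iff₀ (by positivity)]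
      have : 0 ≤ 6*(t:ℝ)*((k:ℝ)-c)^2 + 3*t^2 := by positivity
      linarith
    linarith [hS t k]
  induction t generalizing k with
  | zero =>
    by_cases hk : |k - c| ≤ lam
    · simp only [K1, S1, ind_true hk]; have : 0 ≤ (((k:ℝ)-c)^4 + 6*(0:ℕ)*((k:ℝ)-c)^2 + 3*(0:ℕ)^2)/(lam:ℝ)^4 := by positivity
      linarith
    · refine (hout 0 k hk).trans ?_
      simp only [K1, ind_false hk]; simp
  | succ t ih =>
    by_cases hk : |k - c| ≤ lam
    · simp only [K1, S1, ind_true hk]; have h1 := ih (k+1); have h2 := ih (k-1); push_cast at h1 h2 ⊢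
      have h3 : (((k:ℝ)-c)^4 + 6*((t:ℝ)+1)*((k:ℝ)-c)^2 + 3*((t:ℝ)+1)^2)/(lam:ℝ)^4 =
        ((((k:ℝ)+1-c)^4 + 6*t*((k:ℝ)+1-c)^2 + 3*t^2)/(lam:ℝ)^4 +
        (((k:ℝ)-1-c)^4 + 6*t*((k:ℝ)-1-c)^2 + 3*t^2)/(lam:ℝ)^4)/2 + 2/(lam:ℝ)^4 := by
        field_simp; ring
      have h4 : (0:ℝ) ≤ 2/(lam:ℝ)^4 := by positivity
      rw [h3]; linarith
    · refine (hout (t+1) k hk).trans ?_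
      simp only [K1, ind_false hk]; simp

lemma K1_nonneg {A : ℤ → Prop} {f : ℤ → ℝ} (hf : ∀ x, 0 ≤ f x) (t : ℕ) (k : ℤ) : 0 ≤ K1 A t f k := by
  induction t generalizing k with
  | zero => exact mul_nonneg (ind_nonneg' _) (hf k)
  | succ t ih => exact mul_nonneg (ind_nonneg' _) (by linarith [ih (k+1), ih (k-1)])

lemma K1_mono {A B : ℤ → Prop} {f g : ℤ → ℝ} (hAB : ∀ x, A x → B x) (hfg : ∀ x, A x → f x ≤ g x)
    (hg : ∀ x, 0 ≤ g x) (t : ℕ) (k : ℤ) : K1 A t f k ≤ K1 B t g k := by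
  induction t generalizing k with
  | zero =>
    by_cases hA : A k
    · simp only [K1, ind_true hA, ind_true (hAB k hA)]; linarith [hfg k hA]
    · simp only [K1, ind_false hA]; rw [zero_mul]; exact mul_nonneg (ind_nonneg' _) (hg k)
  | succ t ih =>
    by_cases hA : A k
    · simp only [K1, ind_true hA, ind_true (hAB k hA)]; linarith [ih (k+1), ih (k-1)]
    · simp only [K1, ind_false hA]; rw [zero_mul]
      exact mul_nonneg (ind_nonneg' _) (by linarith [K1_nonneg (A := B) hg t (k+1), K1_nonneg (A := B) hg t (k-1)])

lemma K1_neg (A : ℤ → Prop) (f : ℤ → ℝ) (t : ℕ) (k : ℤ) :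
    K1 (fun x => A (-x)) t (fun x => f (-x)) k = K1 A t f (-k) := by
  induction t generalizing k with
  | zero => rfl
  | succ t ih => simp only [K1, ih]; rw [show -(k+1) = -k-1 by ring, show -(k-1) = -k+1 by ring]; ring

lemma K1_shift (A : ℤ → Prop) (f : ℤ → ℝ) (t : ℕ) (k a : ℤ) :
    K1 (fun x => A (x+a)) t (fun x => f (x+a)) k = K1 A t f (k+a) := by
  induction t generalizing k with
  | zero => rfl
  | succ t ih => simp only [K1, ih]; rw [show k+1+a = k+a+1 by ring, show k-1+a = k+a-1 by ring]

lemma S1_right (g : ℕ) (hg : 1 ≤ g) : 1/12 ≤ S1 (4*g^2) (fun x => ind ((g:ℤ) ≤ x)) 0 := by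
  have hgr : (1:ℝ) ≤ g := by exact_mod_cast hg
  have h1 : S1 (4*g^2) (fun x => (x:ℝ)^2) 0 ≤ S1 (4*g^2) (fun x => (g:ℝ)^2 + (1/(24*(g:ℝ)^2) * (x:ℝ)^4 +
      6*(g:ℝ)^2 * (ind ((g:ℤ) ≤ x) + ind ((g:ℤ) ≤ -x)))) 0 := by
    apply S1_mono
    intro x; by_cases hx : (g:ℤ) ≤ x ∨ (g:ℤ) ≤ -x
    · have h2 : 1 ≤ ind ((g:ℤ) ≤ x) + ind ((g:ℤ) ≤ -x) := by
        rcases hx with hx | hx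
        · rw [ind_true hx]; linarith [ind_nonneg' ((g:ℤ) ≤ -x)]
        · rw [ind_true hx]; linarith [ind_nonneg' ((g:ℤ) ≤ x)]
      have h3 : (x:ℝ)^2 ≤ 1/(24*(g:ℝ)^2) * (x:ℝ)^4 + 6*(g:ℝ)^2 := by
        have : 1/(24*(g:ℝ)^2) * (x:ℝ)^4 + 6*(g:ℝ)^2 - (x:ℝ)^2 = ((x:ℝ)^2 - 12*(g:ℝ)^2)^2/(24*(g:ℝ)^2) := by field_simp; ring
        have h4 : 0 ≤ ((x:ℝ)^2 - 12*(g:ℝ)^2)^2/(24*(g:ℝ)^2) := by positivity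
        linarith
      have h5 : 6*(g:ℝ)^2 * 1 ≤ 6*(g:ℝ)^2 * (ind ((g:ℤ) ≤ x) + ind ((g:ℤ) ≤ -x)) := mul_le_mul_of_nonneg_left h2 (by positivity)
      have : (0:ℝ) ≤ (g:ℝ)^2 := by positivity
      linarith
    · push Not at hx
      have h2 : (x:ℝ)^2 ≤ (g:ℝ)^2 := by
        apply sq_le_sq'
        · have : -(g:ℤ) ≤ x := by omega
          exact_mod_cast this
        · have : x ≤ (g:ℤ) := by omega
          exact_mod_cast this
      have h3 := ind_nonneg' ((g:ℤ) ≤ x); have h4 := ind_nonneg' ((g:ℤ) ≤ -x)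
      have : 0 ≤ 1/(24*(g:ℝ)^2) * (x:ℝ)^4 + 6*(g:ℝ)^2 * (ind ((g:ℤ) ≤ x) + ind ((g:ℤ) ≤ -x)) := by positivity
      linarith
  rw [S1_sq, S1_add, S1_const, S1_add, S1_mul, S1_mul, S1_add, S1_four,
    S1_neg (fun x => ind ((g:ℤ) ≤ x)), neg_zero] at h1
  push_cast at h1
  have e : 1/(24*(g:ℝ)^2) * (0^4 + 6*(4*(g:ℝ)^2)*0^2 + 3*(4*(g:ℝ)^2)^2 - 2*(4*(g:ℝ)^2)) = 2*(g:ℝ)^2 - 1/3 := by field_simp; ring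
  rw [e] at h1
  have hg2 : (0:ℝ) < (g:ℝ)^2 := by positivity
  by_contra hc
  push Not at hc
  have := mul_lt_mul_of_pos_left hc hg2
  linarith

lemma S1_left (t : ℕ) : 1/2 ≤ S1 t (fun x => ind (x ≤ 0)) 0 := by
  have h : S1 t (fun _ => 1) 0 ≤ S1 t (fun x => ind (x ≤ 0) + ind (-x ≤ 0)) 0 := by
    apply S1_mono
    intro x; by_cases hx : x ≤ 0
    · rw [ind_true hx]; linarith [ind_nonneg' (-x ≤ 0)]
    · rw [ind_true (show -x ≤ 0 by omega)]; linarith [ind_nonneg' (x ≤ 0)]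
  rw [S1_const, S1_add, S1_neg (fun x => ind (x ≤ 0)), neg_zero] at h
  linarith

lemma hop1 (g : ℕ) (hg : 1 ≤ g) (k : ℤ) (hk : |k| ≤ 7*g) :
    1/24 ≤ K1 (fun x => |x| ≤ 13*g) (4*g^2) (fun x => ind (|x - g| ≤ 7*g)) k := by
  have hgr : (1:ℝ) ≤ g := by exact_mod_cast hg
  have h0 := abs_le.1 hk
  have key : ∀ f : ℤ → ℝ, (∀ x, f x ≤ 1) → S1 (4*g^2) f k - 1/27 ≤ K1 (fun x => |x - k| ≤ 6*g) (4*g^2) f k := by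
    intro f hf; have := K1_lower k (6*g) (by omega) f hf (4*g^2) k
    push_cast at this; have e : (((k:ℝ)-k)^4 + 6*(4*(g:ℝ)^2)*((k:ℝ)-k)^2 + 3*(4*(g:ℝ)^2)^2)/(6*(g:ℝ))^4 = 1/27 := by field_simp; ring
    rw [e] at this; exact this
  rcases le_total k 0 with hk0 | hk0
  · have h1 := key (fun x => ind ((g:ℤ) ≤ x + (-k))) (fun x => ind_le_one' _)
    rw [S1_shift (fun x => ind ((g:ℤ) ≤ x)), add_neg_cancel] at h1
    have h2 := S1_right g hg; refine le_trans ?_ (K1_mono (A := fun x => |x - k| ≤ 6*g) (f := fun x => ind ((g:ℤ) ≤ x + (-k))) ?_ ?_ ?_ _ _)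
    · linarith
    · intro x hx; rw [abs_le] at *; omega
    · intro x hx; apply ind_mono; intro h; rw [abs_le] at *; omega
    · intro x; exact ind_nonneg' _
  · have h1 := key (fun x => ind (x + (-k) ≤ 0)) (fun x => ind_le_one' _)
    rw [S1_shift (fun x => ind (x ≤ 0)), add_neg_cancel] at h1
    have h2 := S1_left (4*g^2); refine le_trans ?_ (K1_mono (A := fun x => |x - k| ≤ 6*g) (f := fun x => ind (x + (-k) ≤ 0)) ?_ ?_ ?_ _ _)
    · linarith
    · intro x hx; rw [abs_le] at *; omega
    · intro x hx; apply ind_mono; intro h; rw [abs_le] at *; omega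
    · intro x; exact ind_nonneg' _

lemma hop1' (g : ℕ) (hg : 1 ≤ g) (c k e : ℤ) (hk : |k - c| ≤ 7*g) (he : e = 1 ∨ e = -1) :
    1/24 ≤ K1 (fun x => |x - c| ≤ 13*g) (4*g^2) (fun x => ind (|x - (c + g*e)| ≤ 7*g)) k := by
  rcases he with rfl | rfl
  · have := hop1 g hg (k + -c) (by rwa [← sub_eq_add_neg])
    rw [← K1_shift] at this; have e1 : (fun x : ℤ => |x - c| ≤ 13*g) = (fun x => |x + -c| ≤ 13*g) := by funext x; rw [sub_eq_add_neg]
    have e2 : (fun x : ℤ => ind (|x - (c + g*1)| ≤ 7*g)) = (fun x => ind (|x + -c - g| ≤ 7*g)) := by funext x; rw [show x - (c + g*1) = x + -c - g by ring]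
    rw [e1, e2]; exact this
  · have := hop1 g hg (-(k + -c)) (by rw [abs_neg]; rwa [← sub_eq_add_neg])
    rw [← K1_neg, ← K1_shift] at this
    have e1 : (fun x : ℤ => |x - c| ≤ 13*g) = (fun x => |-(x + -c)| ≤ 13*g) := by funext x; rw [abs_neg, sub_eq_add_neg]
    have e2 : (fun x : ℤ => ind (|x - (c + g*(-1))| ≤ 7*g)) = (fun x => ind (|-(x + -c) - g| ≤ 7*g)) := by funext x; rw [← abs_neg, show -(x - (c + g*(-1))) = -(x + -c) - g by ring]
    rw [e1, e2]; exact this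

lemma stay1 (g : ℕ) (hg : 1 ≤ g) (c k : ℤ) (hk : |k - c| ≤ 7*g) (r : ℕ) (hr : r ≤ 4*g^2) :
    1/24 ≤ K1 (fun x => |x - c| ≤ 13*g) r (fun _ => 1) k := by
  have hgr : (1:ℝ) ≤ g := by exact_mod_cast hg
  have h1 := K1_lower k (6*g) (by omega) (fun _ => 1) (fun _ => le_rfl) r k
  rw [S1_const] at h1
  have hr' : (r:ℝ) ≤ 4*(g:ℝ)^2 := by exact_mod_cast hr
  have e : (((k:ℝ)-k)^4 + 6*r*((k:ℝ)-k)^2 + 3*r^2)/((6*g:ℤ):ℝ)^4 ≤ 1/27 := by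
    rw [div_le_iff₀ (by positivity)]
    push_cast; have : (r:ℝ)^2 ≤ (4*(g:ℝ)^2)^2 := pow_le_pow_left₀ (by positivity) hr' 2
    nlinarith
  refine le_trans ?_ (K1_mono (A := fun x => |x - k| ≤ 6*g) (f := fun x => 1) ?_ ?_ ?_ _ _)
  · linarith
  · intro x hx; rw [abs_le] at *; omega
  · intro x hx; exact le_rfl
  · intro x; norm_num

/-- box (in diagonal coordinates) of radius `r` about the scaled centre `q` -/
def Dm (g : ℕ) (r : ℤ) (q v : Lat) : Prop := |uu v - g * uu q| ≤ r*g ∧ |vv v - g * vv q| ≤ r*g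

lemma Dm.bd {g : ℕ} {r : ℤ} {q v : Lat} (h : Dm g r q v) : |v.1 - g*q.1| ≤ r*g ∧ |v.2 - g*q.2| ≤ r*g := by
  obtain ⟨h1, h2⟩ := h
  simp only [uu, vv, mul_add, mul_sub] at h1 h2
  rw [abs_le] at *
  rw [abs_le] at *
  omega

lemma hop2 (g : ℕ) (hg : 1 ≤ g) (q z : Lat) (d : Dir) (hz : Dm g 7 q z) :
    1/576 ≤ EW (4*g^2) (fun w => ind ((∀ v ∈ path z w, Dm g 13 q v) ∧ Dm g 7 (q + stp d) (endp z w))) := by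
  have e1 : ∃ e, (e = 1 ∨ e = -1) ∧ (g:ℤ) * uu (q + stp d) = g * uu q + g * e := by
    obtain ⟨a, b⟩ := d; cases a <;> cases b
    · exact ⟨-1, Or.inr rfl, by simp [uu, stp]; ring⟩
    · exact ⟨-1, Or.inr rfl, by simp [uu, stp]; ring⟩
    · exact ⟨1, Or.inl rfl, by simp [uu, stp]; ring⟩
    · exact ⟨1, Or.inl rfl, by simp [uu, stp]; ring⟩
  have e2 : ∃ e, (e = 1 ∨ e = -1) ∧ (g:ℤ) * vv (q + stp d) = g * vv q + g * e := by
    obtain ⟨a, b⟩ := d; cases a <;> cases b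
    · exact ⟨-1, Or.inr rfl, by simp [vv, stp]; ring⟩
    · exact ⟨1, Or.inl rfl, by simp [vv, stp]; ring⟩
    · exact ⟨-1, Or.inr rfl, by simp [vv, stp]; ring⟩
    · exact ⟨1, Or.inl rfl, by simp [vv, stp]; ring⟩
  obtain ⟨e, he, e1⟩ := e1
  obtain ⟨e', he', e2⟩ := e2
  have h1 := hop1' g hg (g * uu q) (uu z) e hz.1 he
  have h2 := hop1' g hg (g * vv q) (vv z) e' hz.2 he'
  have h3 := mul_le_mul h1 h2 (by norm_num) (by linarith)
  rw [← EW_prod] at h3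
  refine le_trans (by norm_num) (h3.trans (le_of_eq ?_))
  apply EW_congr; intro w _
  rw [← ind_and, ← ind_and]
  simp only [Dm, e1, e2]

lemma stay2 (g : ℕ) (hg : 1 ≤ g) (q z : Lat) (hz : Dm g 7 q z) (r : ℕ) (hr : r ≤ 4*g^2) :
    1/576 ≤ EW r (fun w => ind (∀ v ∈ path z w, Dm g 13 q v)) := by
  have h1 := stay1 g hg (g * uu q) (uu z) hz.1 r hr
  have h2 := stay1 g hg (g * vv q) (vv z) hz.2 r hr
  have h3 := mul_le_mul h1 h2 (by norm_num) (by linarith)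
  rw [← EW_prod] at h3
  refine le_trans (by norm_num) (h3.trans (le_of_eq ?_))
  apply EW_congr; intro w _
  simp only [Dm, mul_one]

/-! ### Chains of hops and surrounding loops -/

lemma xh_of_conn {T : FLp} {S : FLat} {a b : Lat} {x0 x1 y0 y1 : ℤ} (h : Conn T S a b)
    (ha : a.1 ≤ x0) (hx : x0 ≤ x1) (hb : x1 ≤ b.1) (hS : ∀ v ∈ S, y0 ≤ v.2 ∧ v.2 ≤ y1) : XH T x0 x1 y0 y1 := by
  obtain ⟨a', ha', hc'⟩ := conn_cut (fun v => v.1) (fun x y h => adj_fst h) x0 h (by omega) (by omega)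
  obtain ⟨b', hb', hc''⟩ := conn_cut (fun v => -v.1) (fun x y h => by have := adj_fst h; rw [abs_le] at *; omega) (-x1) hc'.symm
    (by omega) (by omega)
  refine ⟨a', b', ha', by omega, hc''.symm.mono subset_rfl ?_⟩
  intro v hv
  simp only [Finset.mem_filter, mem_Rc] at hv ⊢
  have := hS v hv.1.1
  omega

lemma xv_of_conn {T : FLp} {S : FLat} {a b : Lat} {x0 x1 y0 y1 : ℤ} (h : Conn T S a b)
    (ha : a.2 ≤ y0) (hx : y0 ≤ y1) (hb : y1 ≤ b.2) (hS : ∀ v ∈ S, x0 ≤ v.1 ∧ v.1 ≤ x1) : XV T x0 x1 y0 y1 := by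
  obtain ⟨a', ha', hc'⟩ := conn_cut (fun v => v.2) (fun x y h => adj_snd h) y0 h (by omega) (by omega)
  obtain ⟨b', hb', hc''⟩ := conn_cut (fun v => -v.2) (fun x y h => by have := adj_snd h; rw [abs_le] at *; omega) (-y1) hc'.symm
    (by omega) (by omega)
  refine ⟨a', b', ha', by omega, hc''.symm.mono subset_rfl ?_⟩
  intro v hv
  simp only [Finset.mem_filter, mem_Rc] at hv ⊢
  have := hS v hv.1.1
  omega

lemma conn_path {T : FLp} {S : FLat} (w : List Dir) (z : Lat)
    (hT : ∀ a b, hasE (path z w) a b → Op T a b) (hS : ∀ v ∈ path z w, v ∈ S) : Conn T S z (endp z w) := by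
  induction w generalizing z with
  | nil => exact Conn.refl (hS z (mem_path_self _ _))
  | cons d w ih =>
    rw [endp_cons]; have e : path z (d::w) = z :: (z + stp d) :: (path (z + stp d) w).tail := by rw [path_cons, ← path_eq_cons]
    refine (Conn.step (hT z (z + stp d) ?_) (hS z (mem_path_self _ _)) (hS _ ?_)).trans (ih (z + stp d) ?_ ?_)
    · rw [e, hasE_cons]; exact Or.inl (Or.inl ⟨rfl, rfl⟩)
    · rw [e]; simp
    · intro a b hab; apply hT; rw [e, hasE_cons, ← path_eq_cons]; exact Or.inr hab
    · intro v hv; apply hS; rw [path_cons]; exact List.mem_cons_of_mem _ hv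

lemma hasE_app_right {w1 : List Dir} {z : Lat} {w2 : List Dir} {a b : Lat} (h : hasE (path (endp z w1) w2) a b) :
    hasE (path z (w1 ++ w2)) a b := by
  induction w1 generalizing z with
  | nil => exact h
  | cons d w ih =>
    rw [List.cons_append, path_cons, path_eq_cons, hasE_cons, ← path_eq_cons]; exact Or.inr (ih h)

lemma hasE_app_left {w1 : List Dir} {z : Lat} {w2 : List Dir} {a b : Lat} (h : hasE (path z w1) a b) :
    hasE (path z (w1 ++ w2)) a b := by
  induction w1 generalizing z with
  | nil => simp [hasE] at h
  | cons d w ih =>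
    rw [List.cons_append, path_cons, path_eq_cons, hasE_cons, ← path_eq_cons]
    rw [path_cons, path_eq_cons (z + stp d) w, hasE_cons, ← path_eq_cons] at h; exact h.imp_right ih

/-- walk following the chain of hops `D` on scale `g` -/
def Chn (g : ℕ) : Lat → Lat → List Dir → List Dir → Prop
  | z, q, [], w => ∀ v ∈ path z w, Dm g 13 q v
  | z, q, d :: D, w => (∀ v ∈ path z (w.take (4*g^2)), Dm g 13 q v) ∧
      Dm g 7 (q + stp d) (endp z (w.take (4*g^2))) ∧ Chn g (endp z (w.take (4*g^2))) (q + stp d) D (w.drop (4*g^2))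

lemma Chn_prob (g : ℕ) (hg : 1 ≤ g) (r : ℕ) (hr : r ≤ 4*g^2) (D : List Dir) (z q : Lat) (hz : Dm g 7 q z) :
    (1/576)^(D.length+1) ≤ EW (4*g^2*D.length + r) (fun w => ind (Chn g z q D w)) := by
  induction D generalizing z q with
  | nil => simpa [Chn] using stay2 g hg q z hz r hr
  | cons d D ih =>
    rw [List.length_cons, show 4*g^2*(D.length+1) + r = 4*g^2 + (4*g^2*D.length + r) by ring, EW_add, pow_succ]
    have h1 := mul_le_mul_of_nonneg_left (hop2 g hg q z d hz) (show (0:ℝ) ≤ (1/576)^(D.length+1) by positivity)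
    refine h1.trans ?_
    rw [← EW_mul_left]; apply EW_mono; intro w hw; by_cases hE : (∀ v ∈ path z w, Dm g 13 q v) ∧ Dm g 7 (q + stp d) (endp z w)
    · rw [ind_true hE, mul_one]; refine (ih _ _ hE.2).trans (EW_mono ?_); intro w' _; apply ind_mono; intro hC; simp only [Chn]
      rw [← hw, List.take_left, List.drop_left]; exact ⟨hE.1, hE.2, hC⟩
    · rw [ind_false hE, mul_zero]; exact EW_nonneg (fun _ _ => ind_nonneg _)

lemma Chn_split {g : ℕ} {D1 D2 : List Dir} {z q : Lat} {w : List Dir} (h : Chn g z q (D1 ++ D2) w)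
    (hz : Dm g 7 q z) : ∃ w1 w2, w = w1 ++ w2 ∧ (∀ v ∈ path z w1, ∃ q' ∈ path q D1, Dm g 13 q' v) ∧
      Dm g 7 (endp q D1) (endp z w1) ∧ Chn g (endp z w1) (endp q D1) D2 w2 := by
  induction D1 generalizing z q w with
  | nil =>
    refine ⟨[], w, rfl, ?_, hz, h⟩
    intro v hv; simp only [path_nil, List.mem_singleton] at hv; subst hv; refine ⟨q, mem_path_self _ _, ?_⟩; obtain ⟨h1, h2⟩ := hz
    constructor <;> · refine le_trans (by assumption) ?_; have : (0:ℤ) ≤ g := by omega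
                      omega
  | cons d D1 ih =>
    rw [List.cons_append] at h; obtain ⟨h1, h2, h3⟩ := h; obtain ⟨w1, w2, e, k1, k2, k3⟩ := ih h3 h2
    refine ⟨w.take (4*g^2) ++ w1, w2, ?_, ?_, ?_, ?_⟩
    · rw [List.append_assoc, ← e, List.take_append_drop]
    · intro v hv; rcases mem_path_append.1 hv with hv | hv
      · exact ⟨q, mem_path_self _ _, h1 v hv⟩
      · obtain ⟨q', hq', hd⟩ := k1 v hv; exact ⟨q', by rw [path_cons]; exact List.mem_cons_of_mem _ hq', hd⟩
    · rw [endp_append, endp_cons]; exact k2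
    · rw [endp_append, endp_cons]; exact k3

lemma Chn_mem {g : ℕ} {D : List Dir} {z q : Lat} {w : List Dir} (h : Chn g z q D w)
    (hz : Dm g 7 q z) : ∀ v ∈ path z w, ∃ q' ∈ path q D, Dm g 13 q' v := by
  obtain ⟨w1, w2, rfl, h1, h2, h3⟩ := Chn_split (D1 := D) (D2 := []) (by simpa using h) hz
  intro v hv
  rcases mem_path_append.1 hv with hv | hv
  · exact h1 v hv
  · exact ⟨_, endp_mem_path _ _, h3 v hv⟩

/-- a sub-chain gives a connection inside its tube -/
lemma Chn_conn {g : ℕ} {D D1 D2 D3 : List Dir} {z q : Lat} {w w' : List Dir} (h : Chn g z q D w)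
    (hz : Dm g 7 q z) (hD : D = D1 ++ (D2 ++ D3)) :
    ∃ a b S, Conn {(z, w ++ w')} S a b ∧ Dm g 7 (endp q D1) a ∧ Dm g 7 (endp (endp q D1) D2) b ∧
      ∀ v ∈ S, ∃ q' ∈ path (endp q D1) D2, Dm g 13 q' v := by
  subst hD
  obtain ⟨w1, w2, rfl, h1, h2, h3⟩ := Chn_split h hz
  obtain ⟨w3, w4, rfl, k1, k2, k3⟩ := Chn_split h3 h2
  refine ⟨endp z w1, endp (endp z w1) w3, (path (endp z w1) w3).toFinset, ?_, h2, k2, ?_⟩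
  · apply conn_path
    · intro a b hab; refine ⟨_, Finset.mem_singleton_self _, ?_⟩; show hasE (path z (w1 ++ (w3 ++ w4) ++ w')) a b
      rw [List.append_assoc, List.append_assoc]; exact hasE_app_right (hasE_app_left hab)
    · intro v hv; simpa using hv
  · intro v hv; exact k1 v (by simpa using hv)

lemma mem_path_rep {q v : Lat} {k : ℕ} {d : Dir} (h : v ∈ path q (List.replicate k d)) :
    ∃ j : ℕ, j ≤ k ∧ v.1 = q.1 + j * (stp d).1 ∧ v.2 = q.2 + j * (stp d).2 := by
  induction k generalizing q with
  | zero => simp at h; subst h; exact ⟨0, le_rfl, by simp, by simp⟩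
  | succ k ih =>
    rw [List.replicate_succ, path_cons, List.mem_cons] at h; rcases h with rfl | h
    · exact ⟨0, by omega, by simp, by simp⟩
    · obtain ⟨j, hj, e1, e2⟩ := ih h; refine ⟨j+1, by omega, ?_, ?_⟩
      · rw [e1]; push_cast; simp; ring
      · rw [e2]; push_cast; simp; ring

lemma endp_rep (q : Lat) (k : ℕ) (d : Dir) :
    endp q (List.replicate k d) = (q.1 + k * (stp d).1, q.2 + k * (stp d).2) := by
  induction k generalizing q with
  | zero => simp
  | succ k ih =>
    rw [List.replicate_succ, endp_cons, ih]; ext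
    · push_cast; simp; ring
    · push_cast; simp; ring

/-- the four crossings of the sides of the annulus between `N` and `3N` -/
def Surr (N : ℤ) (l : Lp) : Prop :=
  XH {l} (-(3*N)) (3*N) N (3*N) ∧ XH {l} (-(3*N)) (3*N) (-(3*N)) (-N) ∧
  XV {l} N (3*N) (-(3*N)) (3*N) ∧ XV {l} (-(3*N)) (-N) (-(3*N)) (3*N)

abbrev dR : Dir := (true, true)
abbrev dL : Dir := (false, false)
abbrev dU : Dir := (true, false)
abbrev dD : Dir := (false, true)
abbrev rp (k : ℕ) (d : Dir) : List Dir := List.replicate k d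

def ringD : List Dir := rp 136 dD ++ (rp 28 dR ++ (rp 28 dU ++ (rp 136 dL ++ (rp 28 dD ++ (rp 28 dR ++
  (rp 136 dU ++ (rp 28 dL ++ (rp 28 dD ++ rp 136 dR))))))))

lemma ringD_length : ringD.length = 712 := by simp [ringD]

lemma stp_R : stp dR = (1, 0) := rfl
lemma stp_L : stp dL = (-1, 0) := rfl
lemma stp_U : stp dU = (0, 1) := rfl
lemma stp_D : stp dD = (0, -1) := rfl

lemma ringD_tube {q : Lat} (h : q ∈ path (40, 68) ringD) : 40 ≤ linf q ∧ linf q ≤ 68 := by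
  simp only [ringD, mem_path_append, endp_append, endp_rep, stp_R, stp_L, stp_U, stp_D] at h
  unfold linf
  rcases h with h | h | h | h | h | h | h | h | h | h <;>
  · obtain ⟨j, hj, e1, e2⟩ := mem_path_rep h; simp only [stp_R, stp_L, stp_U, stp_D] at e1 e2; norm_num at e1 e2
    rw [le_max_iff, max_le_iff, le_abs, le_abs, abs_le, abs_le, e1, e2]; omega

lemma ring_surr {g : ℕ} (hg : 1 ≤ g) {D0 : List Dir} {q z : Lat} (hz : Dm g 7 q z) (hq : endp q D0 = (40, 68))
    {w w' : List Dir} (h : Chn g z q (D0 ++ ringD) w) : Surr (20*g) (z, w ++ w') := by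
  have h0 : ∀ D1 D2 D3 : List Dir, ringD = D1 ++ (D2 ++ D3) → ∀ q1 q2 : Lat, endp (40,68) D1 = q1 → endp q1 D2 = q2 →
      ∃ a b S, Conn {(z, w ++ w')} S a b ∧ Dm g 7 q1 a ∧ Dm g 7 q2 b ∧ ∀ v ∈ S, ∃ q' ∈ path q1 D2, Dm g 13 q' v := by
    intro D1 D2 D3 hD q1 q2 e1 e2
    obtain ⟨a, b, S, k1, k2, k3, k4⟩ := Chn_conn (D1 := D0 ++ D1) (D2 := D2) (D3 := D3) (w' := w') h hz (by rw [hD, List.append_assoc])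
    rw [endp_append, hq, e1] at k2 k3 k4; rw [e2] at k3; exact ⟨a, b, S, k1, k2, k3, k4⟩
  refine ⟨?_, ?_, ?_, ?_⟩
  · obtain ⟨a, b, S, h1, h2, h3, h4⟩ := h0 (rp 136 dD ++ (rp 28 dR ++ (rp 28 dU ++ (rp 136 dL ++ (rp 28 dD ++ (rp 28 dR ++
      (rp 136 dU ++ (rp 28 dL ++ (rp 28 dD))))))))) (rp 136 dR) [] (by simp only [ringD, List.append_assoc, List.append_nil]) (-68, 40) (68, 40)
        (by simp only [endp_append, endp_rep, stp_R, stp_L, stp_U, stp_D]; norm_num)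
        (by simp only [endp_rep, stp_R]; norm_num)
    have h2 := h2.bd; have h3 := h3.bd; simp only [abs_le] at h2 h3; refine xh_of_conn h1 (by omega) (by omega) (by omega) ?_
    intro v hv; obtain ⟨q', hq', hd⟩ := h4 v hv; obtain ⟨j, hj, e1, e2⟩ := mem_path_rep hq'; have hd := hd.bd
    simp only [stp_R, mul_zero, add_zero] at e2; simp only [abs_le, e2] at hd; omega
  · obtain ⟨a, b, S, h1, h2, h3, h4⟩ := h0 (rp 136 dD ++ (rp 28 dR ++ (rp 28 dU))) (rp 136 dL) (rp 28 dD ++ (rp 28 dR ++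
      (rp 136 dU ++ (rp 28 dL ++ (rp 28 dD ++ rp 136 dR))))) (by simp only [ringD, List.append_assoc]) (68, -40) (-68, -40)
        (by simp only [endp_append, endp_rep, stp_R, stp_L, stp_U, stp_D]; norm_num)
        (by simp only [endp_rep, stp_L]; norm_num)
    have h2 := h2.bd; have h3 := h3.bd; simp only [abs_le] at h2 h3; refine xh_of_conn h1.symm (by omega) (by omega) (by omega) ?_
    intro v hv; obtain ⟨q', hq', hd⟩ := h4 v hv; obtain ⟨j, hj, e1, e2⟩ := mem_path_rep hq'; have hd := hd.bd
    simp only [stp_L, mul_zero, add_zero] at e2; simp only [abs_le, e2] at hd; omega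
  · obtain ⟨a, b, S, h1, h2, h3, h4⟩ := h0 [] (rp 136 dD) (rp 28 dR ++ (rp 28 dU ++ (rp 136 dL ++ (rp 28 dD ++ (rp 28 dR ++
      (rp 136 dU ++ (rp 28 dL ++ (rp 28 dD ++ rp 136 dR)))))))) (by simp only [ringD, List.nil_append]) (40, 68) (40, -68)
        (by simp only [endp_nil])
        (by simp only [endp_rep, stp_D]; norm_num)
    have h2 := h2.bd; have h3 := h3.bd; simp only [abs_le] at h2 h3; refine xv_of_conn h1.symm (by omega) (by omega) (by omega) ?_
    intro v hv; obtain ⟨q', hq', hd⟩ := h4 v hv; obtain ⟨j, hj, e1, e2⟩ := mem_path_rep hq'; have hd := hd.bd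
    simp only [stp_D, mul_zero, add_zero] at e1; simp only [abs_le, e1] at hd; omega
  · obtain ⟨a, b, S, h1, h2, h3, h4⟩ := h0 (rp 136 dD ++ (rp 28 dR ++ (rp 28 dU ++ (rp 136 dL ++ (rp 28 dD ++ (rp 28 dR)))))) (rp 136 dU)
      (rp 28 dL ++ (rp 28 dD ++ rp 136 dR)) (by simp only [ringD, List.append_assoc]) (-40, -68) (-40, 68)
        (by simp only [endp_append, endp_rep, stp_R, stp_L, stp_U, stp_D]; norm_num)
        (by simp only [endp_rep, stp_U]; norm_num)
    have h2 := h2.bd; have h3 := h3.bd; simp only [abs_le] at h2 h3; refine xv_of_conn h1 (by omega) (by omega) (by omega) ?_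
    intro v hv; obtain ⟨q', hq', hd⟩ := h4 v hv; obtain ⟨j, hj, e1, e2⟩ := mem_path_rep hq'; have hd := hd.bd
    simp only [stp_U, mul_zero, add_zero] at e1; simp only [abs_le, e1] at hd; omega

/-- reversed word -/
def rwd (w : List Dir) : List Dir := (w.map rv).reverse

lemma rwd_length (w) : (rwd w).length = w.length := by simp [rwd]

lemma rv_rv (d : Dir) : rv (rv d) = d := by simp [rv]

lemma rwd_rwd (w) : rwd (rwd w) = w := by
  simp only [rwd, List.map_reverse, List.reverse_reverse, List.map_map]
  rw [show rv ∘ rv = id from funext rv_rv, List.map_id]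

lemma rwd_cons (d w) : rwd (d :: w) = rwd w ++ [rv d] := by simp [rwd]

lemma endp_rwd (z : Lat) (w) : endp (endp z w) (rwd w) = z := by
  induction w generalizing z with
  | nil => rfl
  | cons d w ih => rw [rwd_cons, endp_append, endp_cons z d w, ih, endp_cons, endp_nil, stp_rv]; simp

lemma mem_path_rwd {z : Lat} {w v} : v ∈ path (endp z w) (rwd w) ↔ v ∈ path z w := by
  induction w generalizing z with
  | nil => rfl
  | cons d w ih =>
    rw [rwd_cons, endp_cons, mem_path_append, ih, endp_rwd, path_cons, path_cons, path_nil, stp_rv]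
    simp only [List.mem_cons, add_neg_cancel_right, List.not_mem_nil, or_false]; have := mem_path_self (z + stp d) w; constructor
    · rintro (h | rfl | rfl)
      · exact Or.inr h
      · exact Or.inr this
      · exact Or.inl rfl
    · rintro (rfl | h)
      · exact Or.inr (Or.inr rfl)
      · exact Or.inl h

/-- Cauchy-Schwarz for closing two walks -/
lemma pair_sum (t : ℕ) (z : Lat) (P : List Dir → Prop) (V : FLat)
    (hV : ∀ w, P w → endp z w ∈ V) :
    (∑ w ∈ words t, ind (P w))^2 ≤ V.card *
      ∑ w ∈ words t, ∑ w' ∈ words t, ind (P w ∧ P w' ∧ endp z w = endp z w') := by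
  have h1 : ∑ w ∈ words t, ind (P w) = ∑ y ∈ V, ∑ w ∈ words t, ind (P w ∧ endp z w = y) := by
    rw [sum_comm]; apply sum_congr rfl; intro w _; by_cases hw : P w
    · rw [Finset.sum_eq_single (endp z w)]
      · simp [ind, hw]
      · intro y _ hy; apply ind_false; rintro ⟨_, h⟩; exact hy h.symm
      · intro h; exact absurd (hV w hw) h
    · rw [ind_false hw, Finset.sum_eq_zero]; intro y _; apply ind_false; rintro ⟨h, _⟩; exact hw h
  rw [h1]
  refine sq_sum_le_card_mul_sum_sq.trans ?_
  apply mul_le_mul_of_nonneg_left _ (by positivity)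
  have h2 : ∀ y ∈ V, (∑ w ∈ words t, ind (P w ∧ endp z w = y))^2 =
      ∑ w ∈ words t, ∑ w' ∈ words t, ind ((P w ∧ endp z w = y) ∧ (P w' ∧ endp z w' = y)) := by
    intro y _; rw [sq, sum_mul_sum]; apply sum_congr rfl; intro w _; apply sum_congr rfl; intro w' _; rw [ind_and (P w ∧ endp z w = y)]
  rw [sum_congr rfl h2, sum_comm]
  apply Finset.sum_le_sum; intro w _
  rw [sum_comm]
  apply Finset.sum_le_sum; intro w' _
  by_cases h : P w ∧ P w' ∧ endp z w = endp z w'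
  · rw [ind_true h]
    calc ∑ y ∈ V, ind ((P w ∧ endp z w = y) ∧ (P w' ∧ endp z w' = y)) ≤ ∑ y ∈ V, ind (y = endp z w) :=
          Finset.sum_le_sum (fun y _ => ind_mono (fun h => h.1.2.symm))
      _ ≤ 1 := by
          by_cases hm : endp z w ∈ V
          · rw [Finset.sum_eq_single (endp z w) (fun y _ hy => ind_false hy) (fun h => absurd hm h), ind_true rfl]
          · rw [Finset.sum_eq_zero]
            · norm_num
            · intro y hy; apply ind_false; rintro rfl; exact hm hy
  · rw [ind_false h]; apply le_of_eq; apply Finset.sum_eq_zero; intro y _; apply ind_false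
    rintro ⟨⟨h1, h2⟩, h3, h4⟩; exact h ⟨h1, h3, h2.trans h4.symm⟩

/-- lower bound for the mass of surrounding loops, as a constant -/
def cB : ℝ := (1/576:ℝ)^713

def cS : ℝ := cB^2 * (36/729) / (2*713)

lemma cB_pos : 0 < cB := by unfold cB; positivity

lemma cS_pos : 0 < cS := by unfold cS; have := cB_pos; positivity

lemma card_Rc {x0 x1 y0 y1 : ℤ} : (Rc x0 x1 y0 y1).card = (x1 + 1 - x0).toNat * (y1 + 1 - y0).toNat := by simp [Rc]

def SurrA (g : ℕ) (l : Lp) : Prop := Surr (20*g) l ∧ ∀ v ∈ path l.1 l.2, 20*g < linf v ∧ linf v ≤ 81*g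

lemma linf_le {v : Lat} {n : ℤ} : linf v ≤ n ↔ (-n ≤ v.1 ∧ v.1 ≤ n) ∧ (-n ≤ v.2 ∧ v.2 ≤ n) := by unfold linf; rw [max_le_iff, abs_le, abs_le]

lemma lt_linf {v : Lat} {n : ℤ} : n < linf v ↔ (n < v.1 ∨ n < -v.1) ∨ (n < v.2 ∨ n < -v.2) := by unfold linf; rw [lt_max_iff, lt_abs, lt_abs]

lemma linf_Dm {g : ℕ} {q v : Lat} {n m : ℤ} (h : Dm g 13 q v) (h1 : n ≤ linf q) (h2 : linf q ≤ m) (hg : 1 ≤ g) :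
    (n-13)*g ≤ linf v ∧ linf v ≤ (m+13)*g := by
  have hb := h.bd
  rw [linf_le] at h2
  have h1' : n - 1 < linf q := by omega
  rw [lt_linf] at h1'
  have hg' : (1:ℤ) ≤ g := by omega
  rw [abs_le, abs_le] at hb
  constructor
  · rw [← Int.sub_one_lt_iff, lt_linf]; rcases h1' with (h | h) | (h | h)
    · left; left; nlinarith
    · left; right; nlinarith
    · right; left; nlinarith
    · right; right; nlinarith
  · rw [linf_le]; refine ⟨⟨?_, ?_⟩, ?_, ?_⟩ <;> nlinarith

lemma surr_mass (g : ℕ) (hg : 1 ≤ g) (L : ℕ) (hL : 2*(4*g^2*713) ≤ L) :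
    cS ≤ ∑ l ∈ (LS L (Rc (-(81*g)) (81*g) (-(81*g)) (81*g))).filter (SurrA g), wt l := by
  have hgr : (1:ℝ) ≤ g := by exact_mod_cast hg
  set q0 : Lat := (40, 68) with hq0
  set B : FLat := Rc (40*g-3*g) (40*g+3*g) (68*g-3*g) (68*g+3*g) with hB
  set V : FLat := Rc (68*g-13*g) (68*g+13*g) (40*g-13*g) (40*g+13*g) with hV
  have hBz : ∀ z ∈ B, Dm g 7 q0 z := by
    intro z hz; rw [hB, mem_Rc] at hz; simp only [Dm, uu, vv, hq0, abs_le]; omega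
  have hBc : (36:ℝ) * g^2 ≤ B.card := by
    rw [hB, card_Rc]; rw [show ((40:ℤ)*g+3*g+1-(40*g-3*g)) = 6*g+1 by ring, show ((68:ℤ)*g+3*g+1-(68*g-3*g)) = 6*g+1 by ring]
    rw [show ((6:ℤ)*g+1).toNat = 6*g+1 by omega]
    push_cast; nlinarith
  have hVc : (V.card:ℝ) ≤ 729 * g^2 := by
    rw [hV, card_Rc]; rw [show ((68:ℤ)*g+13*g+1-(68*g-13*g)) = 26*g+1 by ring, show ((40:ℤ)*g+13*g+1-(40*g-13*g)) = 26*g+1 by ring]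
    rw [show ((26:ℤ)*g+1).toNat = 26*g+1 by omega]
    push_cast; nlinarith
  have hend : endp q0 ringD = (68, 40) := by simp only [hq0, ringD, endp_append, endp_rep, stp_R, stp_L, stp_U, stp_D]; norm_num
  have hVw : ∀ z ∈ B, ∀ w, Chn g z q0 ringD w → endp z w ∈ V := by
    intro z hz w hw; obtain ⟨w1, w2, rfl, h1, h2, h3⟩ := Chn_split (D1 := ringD) (D2 := []) (by simpa using hw) (hBz z hz)
    rw [endp_append]; have := (h3 _ (endp_mem_path _ w2)).bd; rw [hend] at this; simp only [abs_le] at this; rw [hV, mem_Rc]; omega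
  set I : Finset ℕ := Finset.Ico (4*g^2*712) (4*g^2*713) with hI
  obtain ⟨cc, hcc⟩ : ∃ cc, cc = cB := ⟨_, rfl⟩
  have hcc0 : 0 < cc := hcc ▸ cB_pos
  -- index set
  set X : Finset (Σ _ : ℕ, Lat × List Dir × List Dir) :=
    (I.sigma (fun t => B ×ˢ words t ×ˢ words t)).filter
      (fun x => Chn g x.2.1 q0 ringD x.2.2.1 ∧ Chn g x.2.1 q0 ringD x.2.2.2 ∧ endp x.2.1 x.2.2.1 = endp x.2.1 x.2.2.2) with hX
  set φ : (Σ _ : ℕ, Lat × List Dir × List Dir) → Lp := fun x => (x.2.1, x.2.2.1 ++ rwd x.2.2.2) with hφ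
  have hXm : ∀ x ∈ X, x.1 ∈ I ∧ x.2.1 ∈ B ∧ x.2.2.1.length = x.1 ∧ x.2.2.2.length = x.1 ∧
      Chn g x.2.1 q0 ringD x.2.2.1 ∧ Chn g x.2.1 q0 ringD x.2.2.2 ∧ endp x.2.1 x.2.2.1 = endp x.2.1 x.2.2.2 := by
    intro x hx; rw [hX, Finset.mem_filter, Finset.mem_sigma, Finset.mem_product, Finset.mem_product, mem_words, mem_words] at hx
    exact ⟨hx.1.1, hx.1.2.1, hx.1.2.2.1, hx.1.2.2.2, hx.2⟩
  have hinj : Set.InjOn φ X := by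
    intro x hx y hy hxy; have hx := hXm x hx; have hy := hXm y hy; obtain ⟨t, z, w, w'⟩ := x; obtain ⟨t', z', u, u'⟩ := y
    simp only [hφ, Prod.mk.injEq] at hxy hx hy; have hl := congrArg List.length hxy.2; simp only [List.length_append, rwd_length] at hl
    have htt : t = t' := by omega
    subst htt; obtain ⟨h1, h2⟩ := List.append_inj hxy.2 (by omega)
    have h3 : w' = u' := by rw [← rwd_rwd w', h2, rwd_rwd]
    rw [hxy.1, h1, h3]
  have hsub : X.image φ ⊆ (LS L (Rc (-(81*g)) (81*g) (-(81*g)) (81*g))).filter (SurrA g) := by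
    intro l hl; obtain ⟨x, hx, rfl⟩ := Finset.mem_image.1 hl; obtain ⟨h1, h2, h3, h4, h5, h6, h7⟩ := hXm x hx; rw [hI, Finset.mem_Ico] at h1
    have hg2 : 1 ≤ g^2 := Nat.one_le_pow _ _ hg
    have hp : ∀ v ∈ path (φ x).1 (φ x).2, 20*g < linf v ∧ linf v ≤ 81*g := by
      intro v hv
      have : ∃ q' ∈ path q0 ringD, Dm g 13 q' v := by
        simp only [hφ] at hv; rcases mem_path_append.1 hv with hv | hv
        · exact Chn_mem h5 (hBz _ h2) v hv
        · rw [h7, mem_path_rwd] at hv; exact Chn_mem h6 (hBz _ h2) v hv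
      obtain ⟨q', hq', hd⟩ := this; have := ringD_tube hq'; have := linf_Dm hd this.1 this.2 hg; omega
    rw [Finset.mem_filter, mem_LS]; refine ⟨⟨?_, ?_, ?_, ?_⟩, ?_, hp⟩
    · intro h0; have := congrArg List.length h0; simp only [hφ, List.length_append, rwd_length, List.length_nil] at this; omega
    · simp only [hφ, List.length_append, rwd_length]; omega
    · simp only [hφ, endp_append]; rw [h7, endp_rwd]
    · intro v hv; have := (hp v hv).2; rw [linf_le] at this; rw [mem_Rc]; omega
    · exact ring_surr hg (D0 := []) (hBz _ h2) rfl (by simpa using h5)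
  refine le_trans ?_ (sum_le_sum_of_subset_of_nonneg hsub (fun l _ _ => wt_nonneg l))
  rw [sum_image hinj, hX, sum_filter, Finset.sum_sigma]
  have ht : ∀ t ∈ I, cc^2 * (36/729) * (1/(2*(4*g^2*713))) ≤
      ∑ x ∈ B ×ˢ words t ×ˢ words t, if Chn g x.1 q0 ringD x.2.1 ∧ Chn g x.1 q0 ringD x.2.2 ∧ endp x.1 x.2.1 = endp x.1 x.2.2
        then wt (φ ⟨t, x⟩) else 0 := by
    intro t htI; rw [hI, Finset.mem_Ico] at htI; rw [sum_product]; have hg2 : 1 ≤ g^2 := Nat.one_le_pow _ _ hg; have ht0 : 0 < t := by omega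
    have htr : (t:ℝ) ≤ 4*g^2*713 := by exact_mod_cast htI.2.le
    have ht0r : (0:ℝ) < t := by exact_mod_cast ht0
    have hz : ∀ z ∈ B, cc^2 / (729*g^2) * (1/(2*(4*g^2*713))) ≤ ∑ y ∈ words t ×ˢ words t,
        if Chn g z q0 ringD y.1 ∧ Chn g z q0 ringD y.2 ∧ endp z y.1 = endp z y.2 then wt (φ ⟨t, (z, y)⟩) else 0 := by
      intro z hzB
      have e1 : ∑ y ∈ words t ×ˢ words t,
          (if Chn g z q0 ringD y.1 ∧ Chn g z q0 ringD y.2 ∧ endp z y.1 = endp z y.2 then wt (φ ⟨t, (z, y)⟩) else 0) =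
          (∑ w ∈ words t, ∑ w' ∈ words t, ind (Chn g z q0 ringD w ∧ Chn g z q0 ringD w' ∧ endp z w = endp z w')) *
            ((1/4)^(2*t)/(2*t)) := by
        rw [sum_product, sum_mul]; apply sum_congr rfl; intro w hw; rw [sum_mul]; apply sum_congr rfl; intro w' hw'; rw [mem_words] at hw hw'
        unfold ind; split_ifs with h
        · rw [one_mul, wt]; simp only [hφ, List.length_append, rwd_length, hw, hw']; rw [two_mul]; push_cast; ring
        · rw [zero_mul]
      rw [e1]; have h1 := pair_sum t z (Chn g z q0 ringD) V (hVw z hzB); have h2 := Chn_prob g hg (t - 4*g^2*712) (by omega) ringD z q0 (hBz z hzB)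
      rw [ringD_length, show 4*g^2*712 + (t - 4*g^2*712) = t by omega] at h2
      unfold EW at h2; set S := ∑ w ∈ words t, ind (Chn g z q0 ringD w)
      set Q := ∑ w ∈ words t, ∑ w' ∈ words t, ind (Chn g z q0 ringD w ∧ Chn g z q0 ringD w' ∧ endp z w = endp z w')
      have h2' : cc ≤ S * (1/4)^t := by rw [hcc]; exact h2
      have hQ0 : 0 ≤ Q := Finset.sum_nonneg (fun _ _ => Finset.sum_nonneg (fun _ _ => ind_nonneg _))
      have h3 : cc^2 ≤ 729*g^2 * (Q * (1/4)^(2*t)) := by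
        calc cc^2 ≤ (S * (1/4)^t)^2 := pow_le_pow_left₀ hcc0.le h2' 2
          _ = S^2 * (1/4)^(2*t) := by ring
          _ ≤ (V.card * Q) * (1/4)^(2*t) := mul_le_mul_of_nonneg_right h1 (by positivity)
          _ ≤ (729*g^2 * Q) * (1/4)^(2*t) := mul_le_mul_of_nonneg_right (mul_le_mul_of_nonneg_right hVc hQ0) (by positivity)
          _ = _ := by ring
      have h4 : cc^2 / (729*g^2) ≤ Q * (1/4)^(2*t) := by rw [div_le_iff₀ (by positivity)]; linarith
      have h5 : (1:ℝ)/(2*(4*g^2*713)) ≤ 1/(2*t) := by apply one_div_le_one_div_of_le (by positivity); linarith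
      calc _ ≤ (Q * (1/4)^(2*t)) * (1/(2*t)) := mul_le_mul h4 h5 (by positivity) (by positivity)
        _ = _ := by ring
    calc cc^2 * (36/729) * (1/(2*(4*g^2*713))) = (36*g^2) * (cc^2 / (729*g^2) * (1/(2*(4*g^2*713)))) := by
          field_simp
      _ ≤ B.card * (cc^2 / (729*g^2) * (1/(2*(4*g^2*713)))) := mul_le_mul_of_nonneg_right hBc (by positivity)
      _ = ∑ z ∈ B, (cc^2 / (729*g^2) * (1/(2*(4*g^2*713)))) := by rw [sum_const, nsmul_eq_mul]
      _ ≤ _ := Finset.sum_le_sum hz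
  calc cS = ∑ t ∈ I, cc^2 * (36/729) * (1/(2*(4*g^2*713))) := by
        rw [sum_const, hI, Nat.card_Ico, nsmul_eq_mul, show 4*g^2*713 - 4*g^2*712 = 4*g^2 by omega, cS, ← hcc]
        push_cast; field_simp
    _ ≤ _ := Finset.sum_le_sum ht

/-! ### Gluing by surrounding loops -/

lemma conn_single {l : Lp} {S S' : FLat} {c d v : Lat} (h : Conn {l} S c d) (hcd : c ≠ d) (hv : Conn {l} S' c v) :
    v ∈ path l.1 l.2 := by
  have hc : c ∈ path l.1 l.2 := by
    rcases ReflTransGen.cases_head h.2 with e | ⟨x, hx, _⟩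
    · exact absurd e hcd
    · obtain ⟨l', hl', he⟩ := hx.1; rw [Finset.mem_singleton] at hl'; subst hl'; exact (hasE_mem he).1
  rcases ReflTransGen.cases_tail hv.2 with e | ⟨x, _, hx⟩
  · rw [e]; exact hc
  · obtain ⟨l', hl', he⟩ := hx.1; rw [Finset.mem_singleton] at hl'; subst hl'; exact (hasE_mem he).2

lemma mem_path_split {z v : Lat} {w : List Dir} (h : v ∈ path z w) : ∃ w1 w2, w = w1 ++ w2 ∧ endp z w1 = v := by
  induction w generalizing z with
  | nil => simp at h; exact ⟨[], [], rfl, h.symm⟩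
  | cons d w ih =>
    rw [path_cons, List.mem_cons] at h; rcases h with rfl | h
    · exact ⟨[], d :: w, rfl, rfl⟩
    · obtain ⟨w1, w2, rfl, e⟩ := ih h; exact ⟨d :: w1, w2, rfl, e⟩

lemma path_conn {l : Lp} {T : FLp} (hl : l ∈ T) {S : FLat} (hS : ∀ v ∈ path l.1 l.2, v ∈ S) {u v : Lat} (hu : u ∈ path l.1 l.2)
    (hv : v ∈ path l.1 l.2) : Conn T S u v := by
  have key : ∀ u ∈ path l.1 l.2, Conn T S l.1 u := by
    intro u hu; obtain ⟨w1, w2, e, rfl⟩ := mem_path_split hu; apply conn_path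
    · intro a b hab; exact ⟨l, hl, by rw [e]; exact hasE_app_left hab⟩
    · intro v hv; apply hS; rw [e]; exact mem_path_append.2 (Or.inl hv)
  exact (key u hu).symm.trans (key v hv)

lemma adj_linf {x y : Lat} (h : Adj x y) : |linf x - linf y| ≤ 1 := by
  have h1 := adj_fst h
  have h2 := adj_snd h
  unfold linf
  refine (abs_max_sub_max_le_max _ _ _ _).trans (max_le ?_ ?_)
  · exact (abs_abs_sub_abs_le _ _).trans h1
  · exact (abs_abs_sub_abs_le _ _).trans h2

lemma surr_meet {N : ℤ} (hN : 1 ≤ N) {l : Lp} (hl : Surr N l) {T : FLp} {S : FLat} {a b : Lat}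
    (h : Conn T S a b) (ha : linf a ≤ N) (hb : 3*N ≤ linf b) : ∃ v ∈ path l.1 l.2, Conn T S a v := by
  obtain ⟨b', hb', hc⟩ := conn_cut (fun v => -linf v) (fun x y h => by have := adj_linf h; rw [abs_le] at *; constructor <;> linarith) (-(3*N)) h.symm (by linarith) (by linarith)
  have hab : Conn T S a b' := (hc.symm.mono subset_rfl (Finset.filter_subset _ _))
  have hb1 : linf b' = 3*N := by linarith
  have hbox : ∀ v ∈ S.filter (fun v => -(3*N) ≤ -linf v), linf v ≤ 3*N := by intro v hv; have := (Finset.mem_filter.1 hv).2; linarith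
  have hb2 := linf_le.1 hb1.le
  have hb3 := lt_linf.1 (show 3*N-1 < linf b' by omega)
  have ha2 := linf_le.1 ha
  obtain ⟨⟨c1, d1, e1, f1, g1⟩, ⟨c2, d2, e2, f2, g2⟩, ⟨c3, d3, e3, f3, g3⟩, ⟨c4, d4, e4, f4, g4⟩⟩ := hl
  rcases hb3 with (h3 | h3) | (h3 | h3)
  · obtain ⟨a', ha', k⟩ := conn_cut (fun v => v.1) (fun x y h => adj_fst h) N hc.symm (by omega) (by omega)
    obtain ⟨v, v1, v2⟩ := conn_meet (x0 := N) (x1 := 3*N) (y0 := -(3*N)) (y1 := 3*N) k g3 (by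
      intro v hv; have h1 := Finset.mem_filter.1 hv; have h2 := linf_le.1 (hbox v h1.1); rw [mem_Rc]; omega) (subset_rfl) ha' (by omega) e3 f3
    refine ⟨v, conn_single g3 (by rintro rfl; omega) v2, hab.trans ?_⟩
    exact (k.symm.trans v1).mono subset_rfl ((Finset.filter_subset _ _).trans (Finset.filter_subset _ _))
  · obtain ⟨a', ha', k⟩ := conn_cut (fun v => -v.1) (fun x y h => by have := adj_fst h; rw [abs_le] at *; omega) N hc.symm (by omega) (by omega)
    obtain ⟨v, v1, v2⟩ := conn_meet (x0 := -(3*N)) (x1 := -N) (y0 := -(3*N)) (y1 := 3*N) k.symm g4 (by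
      intro v hv; have h1 := Finset.mem_filter.1 hv; have h2 := linf_le.1 (hbox v h1.1); rw [mem_Rc]; omega) (subset_rfl) (by omega) (by omega) e4 f4
    refine ⟨v, conn_single g4 (by rintro rfl; omega) v2, hab.trans ?_⟩
    exact v1.mono subset_rfl ((Finset.filter_subset _ _).trans (Finset.filter_subset _ _))
  · obtain ⟨a', ha', k⟩ := conn_cut (fun v => v.2) (fun x y h => adj_snd h) N hc.symm (by omega) (by omega)
    obtain ⟨v, v1, v2⟩ := conn_meet (x0 := -(3*N)) (x1 := 3*N) (y0 := N) (y1 := 3*N) g1 k subset_rfl (by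
      intro v hv; have h1 := Finset.mem_filter.1 hv; have h2 := linf_le.1 (hbox v h1.1); rw [mem_Rc]; omega) e1 f1 ha' (by omega)
    refine ⟨v, conn_single g1 (by rintro rfl; omega) v1, hab.trans ?_⟩
    exact (k.symm.trans v2).mono subset_rfl ((Finset.filter_subset _ _).trans (Finset.filter_subset _ _))
  · obtain ⟨a', ha', k⟩ := conn_cut (fun v => -v.2) (fun x y h => by have := adj_snd h; rw [abs_le] at *; omega) N hc.symm (by omega) (by omega)
    obtain ⟨v, v1, v2⟩ := conn_meet (x0 := -(3*N)) (x1 := 3*N) (y0 := -(3*N)) (y1 := -N) g2 k.symm subset_rfl (by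
      intro v hv; have h1 := Finset.mem_filter.1 hv; have h2 := linf_le.1 (hbox v h1.1); rw [mem_Rc]; omega) e2 f2 (by omega) (by omega)
    refine ⟨v, conn_single g2 (by rintro rfl; omega) v1, hab.trans ?_⟩
    exact v2.mono subset_rfl ((Finset.filter_subset _ _).trans (Finset.filter_subset _ _))

/-- translated loop -/
abbrev tr (c : Lat) (l : Lp) : Lp := (syT (-c)).act l

lemma mem_path_tr {c : Lat} {l : Lp} {v : Lat} : v ∈ path (tr c l).1 (tr c l).2 ↔ v + c ∈ path l.1 l.2 := by
  unfold tr Sy.act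
  rw [Sy.path_act, List.mem_map]
  constructor
  · rintro ⟨x, hx, rfl⟩; simpa [syT] using hx
  · intro h; exact ⟨v + c, h, by simp [syT]⟩

lemma surr_meet_at {N : ℤ} (hN : 1 ≤ N) {l : Lp} {c : Lat} (hl : Surr N (tr c l)) {T : FLp} {S : FLat} {a b : Lat}
    (h : Conn T S a b) (ha : linf (a - c) ≤ N) (hb : 3*N ≤ linf (b - c)) : ∃ v ∈ path l.1 l.2, Conn T S a v := by
  have h1 := (syT (-c)).conn (S' := S.image (syT (-c)).f) (fun v hv => Finset.mem_image_of_mem _ hv) h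
  obtain ⟨v, hv, k⟩ := surr_meet hN hl h1 (by simpa [syT, sub_eq_add_neg] using ha) (by simpa [syT, sub_eq_add_neg] using hb)
  refine ⟨v + c, mem_path_tr.1 hv, ?_⟩
  have h2 := (syT (-c)).symm.conn (S' := S) (fun v hv => by
    obtain ⟨x, hx, rfl⟩ := Finset.mem_image.1 hv; show (syT (-c)).f.symm _ ∈ S; rwa [Equiv.symm_apply_apply]) k
  rw [Sy.image_image] at h2
  convert h2 using 1
  · show a = (syT (-c)).f.symm ((syT (-c)).f a)
    rw [Equiv.symm_apply_apply]
  · show v + c = (syT (-c)).f.symm v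
    rw [Equiv.eq_symm_apply]; simp [syT]

lemma surr_glue {N : ℤ} (hN : 1 ≤ N) {l : Lp} {c : Lat} (hl : Surr N (tr c l)) {T : FLp} {S : FLat} {a b a' b' : Lat}
    (hT : l ∈ T) (hS : ∀ v ∈ path l.1 l.2, v ∈ S)
    (h : Conn T S a b) (ha : linf (a - c) ≤ N) (hb : 3*N ≤ linf (b - c))
    (h' : Conn T S a' b') (ha' : linf (a' - c) ≤ N) (hb' : 3*N ≤ linf (b' - c)) : Conn T S a a' := by
  obtain ⟨v, hv, k⟩ := surr_meet_at hN hl h ha hb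
  obtain ⟨v', hv', k'⟩ := surr_meet_at hN hl h' ha' hb'
  exact (k.trans (path_conn hT hS hv hv')).trans k'.symm

/-- existence of a surrounding loop at one of `J` scales -/
def HasS (c : Lat) (b J : ℕ) (T : FLp) : Prop := ∃ l ∈ T, ∃ k < J, SurrA (5^k*b) (tr c l)

lemma prod_none (s : FLp) : ∏ i ∈ s, (1 - pr i) = exp (-((∑ l ∈ s, wt l)/2)) := by
  have : ∀ i ∈ s, 1 - pr i = exp (-(wt i / 2)) := by intro i _; unfold pr; ring
  rw [prod_congr rfl this, ← exp_sum, sum_neg_distrib, sum_div]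

lemma hasS_prob0 (b J : ℕ) (hb : 1 ≤ b) (L : ℕ) (hL : 2*(4*(5^J*b)^2*713) ≤ L) {M : ℤ} (hM : 81*(5^J*b) ≤ M) :
    Pr pr (LS L (Rc (-M) M (-M) M)) (fun T => ¬ HasS 0 b J T) ≤ exp (-(J*cS/2)) := by
  have e : (fun T : FLp => ¬ HasS 0 b J T) = (fun T => ∀ i ∈ T, ¬ (∃ k < J, SurrA (5^k*b) (tr 0 i))) := by funext T; simp only [HasS, not_exists, not_and]
  have tr0 : ∀ l, tr 0 l = l := by intro l; unfold tr Sy.act syT; simp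
  rw [e, Pr_none, prod_none]
  simp only [tr0]
  apply exp_le_exp.2
  have h1 : ∀ k < J, 5^k*b ≤ 5^J*b := fun k hk => Nat.mul_le_mul_right _ (Nat.pow_le_pow_right (by norm_num) hk.le)
  have hdis : ((Finset.range J : Finset ℕ) : Set ℕ).PairwiseDisjoint (fun k => (LS L (Rc (-M) M (-M) M)).filter (SurrA (5^k*b))) := by
    have key : ∀ k k' : ℕ, k < k' → ∀ l, SurrA (5^k*b) l → SurrA (5^k'*b) l → False := by
      intro k k' hk l h h'; have h2 := (h.2 l.1 (mem_path_self _ _)).2; have h3 := (h'.2 l.1 (mem_path_self _ _)).1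
      have h4 : 5*(5^k*b) ≤ 5^k'*b := by
        calc 5*(5^k*b) = 5^(k+1)*b := by ring
          _ ≤ _ := Nat.mul_le_mul_right _ (Nat.pow_le_pow_right (by norm_num) hk)
      omega
    intro k _ k' _ hkk; rw [Function.onFun, Finset.disjoint_left]; intro l hl hl'; rcases lt_or_gt_of_ne hkk with h | h
    · exact key k k' h l (Finset.mem_filter.1 hl).2 (Finset.mem_filter.1 hl').2
    · exact key k' k h l (Finset.mem_filter.1 hl').2 (Finset.mem_filter.1 hl).2
  have h2 : J*cS ≤ ∑ l ∈ (LS L (Rc (-M) M (-M) M)).filter (fun l => ∃ k < J, SurrA (5^k*b) l), wt l := by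
    calc J*cS = ∑ k ∈ Finset.range J, cS := by rw [sum_const, card_range, nsmul_eq_mul]
      _ ≤ ∑ k ∈ Finset.range J, ∑ l ∈ (LS L (Rc (-M) M (-M) M)).filter (SurrA (5^k*b)), wt l := by
          apply Finset.sum_le_sum
          intro k hk; have hk := h1 k (Finset.mem_range.1 hk); refine (surr_mass (5^k*b) (Nat.mul_pos (by positivity) hb) L ?_).trans ?_
          · refine le_trans ?_ hL
            gcongr
          · apply sum_le_sum_of_subset_of_nonneg
            · apply filter_subset_filter
              apply LS_mono le_rfl
              intro v; simp only [mem_Rc]; have : ((5^k*b:ℕ):ℤ) ≤ ((5^J*b:ℕ):ℤ) := by exact_mod_cast hk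
              push_cast at this ⊢; omega
            · intro l _ _; exact wt_nonneg l
      _ = ∑ l ∈ (Finset.range J).biUnion (fun k => (LS L (Rc (-M) M (-M) M)).filter (SurrA (5^k*b))), wt l := by rw [sum_biUnion hdis]
      _ ≤ _ := by
          apply sum_le_sum_of_subset_of_nonneg
          · intro l hl; obtain ⟨k, hk, hl⟩ := Finset.mem_biUnion.1 hl; rw [Finset.mem_filter] at hl ⊢; exact ⟨hl.1, k, Finset.mem_range.1 hk, hl.2⟩
          · intro l _ _; exact wt_nonneg l
  linarith

lemma decr_hasS (c b J) : Decr (fun T => ¬ HasS c b J T) := by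
  intro T T' h hn ⟨l, hl, hk⟩
  exact hn ⟨l, h hl, hk⟩

lemma hasS_prob (c : Lat) (b J : ℕ) (hb : 1 ≤ b) (L : ℕ) (hL : 2*(4*(5^J*b)^2*713) ≤ L) {M : ℤ} (hM : 81*(5^J*b) ≤ M)
    {A : FLat} (hA : Rc (c.1-M) (c.1+M) (c.2-M) (c.2+M) ⊆ A) :
    Pr pr (LS L A) (fun T => ¬ HasS c b J T) ≤ exp (-(J*cS/2)) := by
  refine (Pr_anti_s pr_bd (LS_mono le_rfl hA) (decr_hasS c b J)).trans ?_
  refine le_trans ?_ (hasS_prob0 b J hb L hL hM)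
  refine Pr_sy_not_le (syT c) (fun v => by simp only [mem_Rc, syT, Equiv.coe_addRight, Prod.fst_add, Prod.snd_add]; omega) ?_
  rintro T ⟨l, hl, k, hk, h⟩
  refine ⟨(syT c).act l, Finset.mem_image_of_mem _ hl, k, hk, ?_⟩
  have : tr c ((syT c).act l) = tr 0 l := by unfold tr Sy.act syT; simp
  rw [this]; exact h

/-! ### Non-crossing of rectangles in the easy direction -/

/-- segment-to-segment connection across the strip `[x0,x1] × [y0,y1]` -/
def Seg (T : FLp) (x0 x1 y0 y1 b s t : ℤ) : Prop := ∃ u v : Lat, u.1 = x0 ∧ v.1 = x1 ∧ (s ≤ u.2 ∧ u.2 ≤ s + b) ∧ (t ≤ v.2 ∧ v.2 ≤ t + b) ∧ Conn T (Rc x0 x1 y0 y1) u v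

lemma decr_seg {x0 x1 y0 y1 b s t} : Decr (fun T => ¬ Seg T x0 x1 y0 y1 b s t) := by
  rintro T T' h hn ⟨u, v, h1, h2, h3, h4, h5⟩
  exact hn ⟨u, v, h1, h2, h3, h4, h5.mono h subset_rfl⟩

lemma exists_block (b : ℕ) (hb : 1 ≤ b) (y : ℤ) (m : ℕ) (hm : 1 ≤ m) (h0 : 0 ≤ y) (h1 : y ≤ m*b) :
    ∃ i ∈ Finset.range m, (i*b:ℤ) ≤ y ∧ y ≤ i*b + b := by
  have hb' : (0:ℤ) < b := by omega
  by_cases h : y = m*b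
  · refine ⟨m-1, by simp; omega, ?_⟩
    have : ((m-1:ℕ):ℤ) = m - 1 := by omega
    rw [this, h]; constructor <;> nlinarith
  · have h2 := Int.emod_add_mul_ediv y b; have h3 := Int.emod_nonneg y hb'.ne'; have h4 := Int.emod_lt_of_pos y hb'
    have h5 : 0 ≤ y / b := Int.ediv_nonneg h0 hb'.le
    have h6 : y / b < m := by
      apply Int.ediv_lt_of_lt_mul hb'
      omega
    refine ⟨(y/b).toNat, by simp; omega, ?_⟩
    rw [Int.toNat_of_nonneg h5]; constructor <;> linarith [mul_comm (y/b) (b:ℤ)]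

lemma xh_seg {T : FLp} {n : ℤ} {b m : ℕ} (hb : 1 ≤ b) (hm : 1 ≤ m) (hn : 3*n = m*b) (h : XH T 0 n 0 (3*n)) :
    ∃ k ∈ Finset.range m ×ˢ Finset.range m, Seg T 0 n 0 (3*n) b (k.1*b) (k.2*b) := by
  obtain ⟨u, v, hu, hv, hc⟩ := h
  have h1 := mem_Rc.1 hc.1
  have h2 := mem_Rc.1 hc.right
  obtain ⟨i, hi, hi'⟩ := exists_block b hb u.2 m hm (by omega) (by omega)
  obtain ⟨j, hj, hj'⟩ := exists_block b hb v.2 m hm (by omega) (by omega)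
  exact ⟨(i,j), Finset.mem_product.2 ⟨hi, hj⟩, u, v, hu, hv, hi', hj', hc⟩

lemma strip_even {L : ℕ} {n x y b s t : ℤ} {A : FLat} (hA : Rc (x-n) (x+2*n) (y-n) (y+4*n) ⊆ A) : Pr pr (LS L A) (fun T => ¬ Seg T x (x+n) y (y+3*n) b (y+s) (y+t)) ≤
      Pr pr (LS L (Rc (-n) (2*n) (-n) (4*n))) (fun T => ¬ Seg T 0 n 0 (3*n) b s t) := by
  refine (Pr_anti_s pr_bd (LS_mono le_rfl hA) decr_seg).trans ?_
  refine Pr_sy_not_le (syT (x,y)) (fun v => by simp only [mem_Rc, syT, Equiv.coe_addRight, Prod.fst_add, Prod.snd_add]; omega) ?_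
  rintro T ⟨u, v, h1, h2, h3, h4, h5⟩
  refine ⟨u + (x,y), v + (x,y), by simp [h1], by simp [h2]; ring, by simp; omega, by simp; omega, ?_⟩
  refine (syT (x,y)).conn ?_ h5
  intro v; simp only [mem_Rc, syT, Equiv.coe_addRight, Prod.fst_add, Prod.snd_add]; omega

lemma strip_odd {L : ℕ} {n x y b s t : ℤ} {A : FLat} (hA : Rc (x-n) (x+2*n) (y-n) (y+4*n) ⊆ A) : Pr pr (LS L A) (fun T => ¬ Seg T x (x+n) y (y+3*n) b (y+t) (y+s)) ≤
      Pr pr (LS L (Rc (-n) (2*n) (-n) (4*n))) (fun T => ¬ Seg T 0 n 0 (3*n) b s t) := by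
  refine (Pr_anti_s pr_bd (LS_mono le_rfl hA) decr_seg).trans ?_
  have hf : ∀ v, ((syT (x+n,y)).comp syX).f v = (-v.1 + (x+n), v.2 + y) := by intro v; simp [syT, syX, Sy.comp]
  refine Pr_sy_not_le ((syT (x+n,y)).comp syX) (fun v => by rw [hf]; simp only [mem_Rc]; omega) ?_
  rintro T ⟨u, v, h1, h2, h3, h4, h5⟩
  have h6 := ((syT (x+n,y)).comp syX).conn (S' := Rc x (x+n) y (y+3*n)) (by intro v; rw [hf]; simp only [mem_Rc]; omega) h5
  refine ⟨_, _, ?_, ?_, ?_, ?_, h6.symm⟩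
  · rw [hf]; simp only; omega
  · rw [hf]; simp only; omega
  · rw [hf]; simp only; omega
  · rw [hf]; simp only; omega

lemma zigzag {T : FLp} {b J : ℕ} (hb : 1 ≤ b) {n y0 : ℤ} (hy0 : y0 = 81*(5^J*b)) (hn : 2*y0 ≤ n) (s : ℕ → ℤ)
    (hs : ∀ k, 0 ≤ s k ∧ s k ≤ 3*n)
    (h1 : ∀ k : ℕ, k < 8 → Seg T (k*n) (k*n+n) y0 (y0+3*n) b (y0 + s k) (y0 + s (k+1)))
    (h2 : ∀ k : ℕ, k < 7 → HasS ((k+1:ℕ)*n, y0 + s (k+1)) b J T) : XH T 0 (2*(4*n)) 0 (4*n) := by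
  have hJ : (1:ℤ) ≤ 5^J := one_le_pow₀ (by norm_num)
  have hbz : (1:ℤ) ≤ b := by omega
  have hJb : (b:ℤ) ≤ 5^J*b := by nlinarith
  set S := Rc 0 (2*(4*n)) 0 (4*n) with hS
  have key : ∀ k : ℕ, k < 8 → ∃ u0 u v : Lat, u0.1 = 0 ∧ u.1 = k*n ∧ v.1 = k*n+n ∧ (y0 + s (k+1) ≤ v.2 ∧ v.2 ≤ y0 + s (k+1) + b) ∧
      Conn T S u0 v ∧ Conn T S u v := by
    intro k
    induction k with
    | zero =>
      intro hk; obtain ⟨u, v, e1, e2, e3, e4, e5⟩ := h1 0 hk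
      have h6 := e5.mono subset_rfl (show Rc (((0:ℕ):ℤ)*n) (((0:ℕ):ℤ)*n+n) y0 (y0+3*n) ⊆ S by intro v; rw [hS]; simp only [mem_Rc]; push_cast; omega)
      exact ⟨u, u, v, by simpa using e1, e1, e2, e4, h6, h6⟩
    | succ k ih =>
      intro hk; obtain ⟨u0, u, v, i1, i2, i3, i4, i5, i6⟩ := ih (by omega)
      obtain ⟨u', v', e1, e2, e3, e4, e5⟩ := h1 (k+1) hk; obtain ⟨l, hl, j, hj, hsur⟩ := h2 k (by omega)
      have hkn : (k:ℤ)*n ≤ 6*n := by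
        have : (k:ℤ) ≤ 6 := by omega
        nlinarith
      have hkn0 : 0 ≤ (k:ℤ)*n := by
        have : (0:ℤ) ≤ n := by omega
        positivity
      have hk1 : ((k+1:ℕ):ℤ)*n = k*n+n := by push_cast; ring
      have h6 := e5.mono subset_rfl (show Rc (((k+1:ℕ):ℤ)*n) (((k+1:ℕ):ℤ)*n+n) y0 (y0+3*n) ⊆ S by intro v; rw [hS, hk1]; simp only [mem_Rc]; omega)
      have hj1 : ((5^j*b:ℕ):ℤ)*5 ≤ 5^J*b := by
        have : 5^j*b*5 ≤ 5^J*b := by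
          calc 5^j*b*5 = 5^(j+1)*b := by ring
            _ ≤ _ := Nat.mul_le_mul_right _ (Nat.pow_le_pow_right (by norm_num) hj)
        exact_mod_cast this
      have hj2 : (b:ℤ) ≤ ((5^j*b:ℕ):ℤ) := by
        have : b ≤ 5^j*b := Nat.le_mul_of_pos_left _ (by positivity)
        exact_mod_cast this
      rw [hk1] at e1 e2 hsur; have hsk := hs (k+1)
      have hg := surr_glue (N := 20*((5^j*b:ℕ):ℤ)) (by omega) hsur.1 (S := S) hl (by
          intro x hx; have h7 := (hsur.2 (x - (k*n+n, y0 + s (k+1))) (mem_path_tr.2 (by simpa using hx))).2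
          rw [linf_le] at h7; simp only [Prod.fst_sub, Prod.snd_sub] at h7; rw [hS, mem_Rc]; omega)
        (a := v) (b := u) i6.symm (by rw [linf_le]; simp only [Prod.fst_sub, Prod.snd_sub]; omega)
        (by rw [← Int.sub_one_lt_iff, lt_linf]; simp only [Prod.fst_sub, Prod.snd_sub]; omega)
        (a' := u') (b' := v') h6 (by rw [linf_le]; simp only [Prod.fst_sub, Prod.snd_sub]; omega)
        (by rw [← Int.sub_one_lt_iff, lt_linf]; simp only [Prod.fst_sub, Prod.snd_sub]; omega)
      exact ⟨u0, u', v', i1, by rw [hk1]; exact e1, by rw [hk1]; exact e2, e4, (i5.trans hg).trans h6, h6⟩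
  obtain ⟨u0, u, v, e1, e2, e3, e4, e5, e6⟩ := key 7 (by norm_num)
  exact ⟨u0, v, e1, by rw [e3]; push_cast; ring, e5⟩

lemma easy_cross (h1 : OneArm) : ∃ c : ℝ, 0 < c ∧ ∃ M : ℕ, 1 ≤ M ∧ ∀ b : ℕ, 1 ≤ b → ∀ L : ℕ, ∀ n : ℤ, n = (2*M)*b →
    c ≤ Pr pr (LS L (Rc (-n) (2*n) (-n) (4*n))) (fun T => ¬ XH T 0 n 0 (3*n)) := by
  obtain ⟨J, hJ⟩ : ∃ J : ℕ, exp (-(J*cS/2)) ≤ 1/20000 := by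
    obtain ⟨J, hJ⟩ := exists_nat_ge (Real.log 20000 * 2 / cS); refine ⟨J, ?_⟩; rw [div_le_iff₀ cS_pos] at hJ
    rw [show (1/20000:ℝ) = exp (-Real.log 20000) by rw [exp_neg, Real.exp_log (by norm_num)]; norm_num]
    apply exp_le_exp.2; linarith
  set M : ℕ := 100*5^J with hM
  set m : ℕ := 3*(2*M) with hm
  have hM1 : 1 ≤ M := by have : 0 < 5^J := by positivity
                         omega
  refine ⟨(1/20000)^((Finset.range m ×ˢ Finset.range m).card), by positivity, M, hM1, ?_⟩
  intro b hb L0 n hn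
  set L := max L0 (2*(4*(5^J*b)^2*713)) with hL
  refine le_trans ?_ (Pr_anti_s pr_bd (LS_mono (le_max_left L0 (2*(4*(5^J*b)^2*713))) subset_rfl) decr_notXH)
  rw [← hL]
  by_contra hcon
  push Not at hcon
  have hnm : 3*n = (m:ℕ)*b := by rw [hm, hn]; push_cast; ring
  obtain ⟨⟨i, j⟩, hij, hp⟩ := Pr_sqrt_trick pr_bd (Finset.range m ×ˢ Finset.range m)
    (fun k T => ¬ Seg T 0 n 0 (3*n) b (k.1*b) (k.2*b)) (fun _ _ => decr_seg) (δ := 1/20000) (by norm_num) (by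
      refine lt_of_le_of_lt (Pr_mono pr_bd ?_) hcon
      intro T _ hT hX; obtain ⟨k, hk, hs⟩ := xh_seg hb (by omega) hnm hX
      exact hT k hk hs)
  rw [Finset.mem_product, Finset.mem_range, Finset.mem_range] at hij
  simp only at hp hij
  set y0 : ℤ := 81*(5^J*b) with hy0
  have hbz : (1:ℤ) ≤ b := by omega
  have hy1 : 1 ≤ y0 := by
    have : (1:ℤ) ≤ 5^J := one_le_pow₀ (by norm_num)
    nlinarith
  have hny : n = 200*(5^J*b) := by rw [hn, hM]; push_cast; ring
  have hyn : 2*y0 ≤ n := by rw [hny, hy0] at *; linarith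
  have hib : (i:ℤ)*b ≤ 3*n := by
    rw [hnm]; have : (i:ℤ) ≤ m := by omega
    nlinarith
  have hjb : (j:ℤ)*b ≤ 3*n := by
    rw [hnm]; have : (j:ℤ) ≤ m := by omega
    nlinarith
  set s : ℕ → ℤ := fun k => if k % 2 = 0 then i*b else j*b with hs
  have hs0 : ∀ k, 0 ≤ s k ∧ s k ≤ 3*n := by
    intro k; simp only [hs]; split_ifs
    · exact ⟨by positivity, hib⟩
    · exact ⟨by positivity, hjb⟩
  have hlow := hh_lower h1 L (4*n) (by omega)
  set A := Rc (-(4*n)+1) (3*(4*n)-1) (-(4*n)+1) (2*(4*n)-1) with hA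
  have hup : hh L (4*n) ≤ ∑ k ∈ Finset.range 8, Pr pr (LS L A) (fun T => ¬ Seg T (k*n) (k*n+n) y0 (y0+3*n) b (y0 + s k) (y0 + s (k+1))) +
      ∑ k ∈ Finset.range 7, Pr pr (LS L A) (fun T => ¬ HasS ((k+1:ℕ)*n, y0 + s (k+1)) b J T) := by
    refine le_trans ?_ (add_le_add (Pr_exists_le pr_bd _ _) (Pr_exists_le pr_bd _ _))
    refine le_trans ?_ (Pr_or_le pr_bd _ _)
    unfold hh; apply Pr_mono pr_bd; intro T _ hT; by_contra hc; push Not at hc; apply hT; refine zigzag hb hy0 hyn s hs0 ?_ ?_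
    · intro k hk; exact hc.1 k (Finset.mem_range.2 hk)
    · intro k hk; exact hc.2 k (Finset.mem_range.2 hk)
  have hb1 : ∀ k ∈ Finset.range 8, Pr pr (LS L A) (fun T => ¬ Seg T (k*n) (k*n+n) y0 (y0+3*n) b (y0 + s k) (y0 + s (k+1))) ≤ 1/20000 := by
    intro k hk; rw [Finset.mem_range] at hk
    have hkn : (k:ℤ)*n ≤ 7*n := by
      have : (k:ℤ) ≤ 7 := by omega
      nlinarith
    have hkn0 : 0 ≤ (k:ℤ)*n := by
      have : (0:ℤ) ≤ n := by omega
      positivity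
    have hAs : Rc (k*n-n) (k*n+2*n) (y0-n) (y0+4*n) ⊆ A := by intro v; rw [hA]; simp only [mem_Rc]; omega
    by_cases hk2 : k % 2 = 0
    · have e1 : s k = i*b := by simp only [hs, if_pos hk2]
      have e2 : s (k+1) = j*b := by simp only [hs]; rw [if_neg (by omega)]
      rw [e1, e2]; exact (strip_even hAs).trans hp.le
    · have e1 : s k = j*b := by simp only [hs, if_neg hk2]
      have e2 : s (k+1) = i*b := by simp only [hs]; rw [if_pos (by omega)]
      rw [e1, e2]; exact (strip_odd hAs).trans hp.le
  have hb2 : ∀ k ∈ Finset.range 7, Pr pr (LS L A) (fun T => ¬ HasS ((k+1:ℕ)*n, y0 + s (k+1)) b J T) ≤ 1/20000 := by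
    intro k hk; rw [Finset.mem_range] at hk
    have hkn : (k:ℤ)*n ≤ 6*n := by
      have : (k:ℤ) ≤ 6 := by omega
      nlinarith
    have hkn0 : 0 ≤ (k:ℤ)*n := by
      have : (0:ℤ) ≤ n := by omega
      positivity
    have hk1 : ((k+1:ℕ):ℤ)*n = k*n+n := by push_cast; ring
    have hsk := hs0 (k+1); refine (hasS_prob _ b J hb L (le_max_right _ _) (M := y0) le_rfl ?_).trans hJ
    intro v; rw [hA]; simp only [mem_Rc, hk1]; omega
  have h3 := Finset.sum_le_sum hb1
  have h4 := Finset.sum_le_sum hb2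
  rw [sum_const, card_range] at h3 h4
  rw [nsmul_eq_mul] at h3 h4
  have h5 : ((8:ℕ):ℝ) * (1/20000) = 1/2500 := by norm_num
  have h6 : ((7:ℕ):ℝ) * (1/20000) = 7/20000 := by norm_num
  rw [h5] at h3
  rw [h6] at h4
  have h7 := hlow.trans (hup.trans (add_le_add h3 h4))
  norm_num at h7

/-! ### Component decomposition of multiplicative polymer systems -/

/-- connectivity generated by a family of objects with supports -/
def gC {O : Type} (sp : O → FLat) (T : Finset O) : Lat → Lat → Prop := ReflTransGen (fun a b => ∃ o ∈ T, a ∈ sp o ∧ b ∈ sp o)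

def cmp {O : Type} (sp : O → FLat) (T : Finset O) (A : FLat) (x : Lat) : FLat := A.filter (gC sp T x)

def UU {O : Type} (sp : O → FLat) (U : Finset O) (A : FLat) : Finset O := U.filter (fun o => sp o ⊆ A)

def ZZ {O : Type} (sp : O → FLat) (U : Finset O) (F : Finset O → ℝ) (A : FLat) : ℝ := ∑ T ∈ (UU sp U A).powerset, F T

def aa {O : Type} (sp : O → FLat) (U : Finset O) (F : Finset O → ℝ) (x : Lat) (K : FLat) : ℝ := ∑ T ∈ (UU sp U K).powerset.filter (fun T => cmp sp T K x = K), F T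

lemma gC.mono {O : Type} {sp : O → FLat} {T T' : Finset O} (h : T ⊆ T') {a b} (hc : gC sp T a b) : gC sp T' a b := ReflTransGen.mono (fun _ _ ⟨o, ho, h1⟩ => ⟨o, h ho, h1⟩) _ _ hc

lemma mem_UU {O : Type} {sp : O → FLat} {U : Finset O} {A o} : o ∈ UU sp U A ↔ o ∈ U ∧ sp o ⊆ A := by simp [UU]

lemma cmp_split {O : Type} {sp : O → FLat} {U T : Finset O} {A K : FLat} {x : Lat} (hT : T ⊆ UU sp U A)
    (h : cmp sp T A x = K) : ∀ o ∈ T, (∃ a ∈ sp o, a ∈ K) → sp o ⊆ K := by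
  rintro o ho ⟨a, ha, haK⟩ b hb
  subst h
  rw [cmp, Finset.mem_filter] at haK ⊢
  exact ⟨(mem_UU.1 (hT ho)).2 hb, haK.2.tail ⟨o, ho, ha, hb⟩⟩

lemma cmp_self {O : Type} {sp : O → FLat} {U T : Finset O} {A K : FLat} {x : Lat} (hT : T ⊆ UU sp U A)
    (hx : x ∈ A) (h : cmp sp T A x = K) : cmp sp (T.filter (fun o => sp o ⊆ K)) K x = K := by
  have key : ∀ y, gC sp T x y → y ∈ K ∧ gC sp (T.filter (fun o => sp o ⊆ K)) x y := by
    intro y hy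
    induction hy with
    | refl => exact ⟨by rw [← h, cmp, Finset.mem_filter]; exact ⟨hx, .refl⟩, .refl⟩
    | @tail b c _ hbc ih =>
      obtain ⟨o, ho, hb, hc⟩ := hbc; have h2 := cmp_split hT h o ho ⟨b, hb, ih.1⟩; exact ⟨h2 hc, ih.2.tail ⟨o, Finset.mem_filter.2 ⟨ho, h2⟩, hb, hc⟩⟩
  ext y
  rw [cmp, Finset.mem_filter]
  refine ⟨fun h => h.1, fun hy => ⟨hy, ?_⟩⟩
  rw [← h, cmp, Finset.mem_filter] at hy
  exact (key y hy.2).2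

lemma cmp_join {O : Type} {sp : O → FLat} {U T₁ T₂ : Finset O} {A K : FLat} {x : Lat} (hK : K ⊆ A) (hx : x ∈ K)
    (h1 : T₁ ⊆ UU sp U K) (h2 : T₂ ⊆ UU sp U (A \ K)) (h : cmp sp T₁ K x = K) : cmp sp (T₁ ∪ T₂) A x = K := by
  have key : ∀ y, gC sp (T₁ ∪ T₂) x y → y ∈ K := by
    intro y hy
    induction hy with
    | refl => exact hx
    | @tail b c _ hbc ih =>
      obtain ⟨o, ho, hb, hc⟩ := hbc; rcases Finset.mem_union.1 ho with ho | ho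
      · exact (mem_UU.1 (h1 ho)).2 hc
      · exact absurd ih (Finset.mem_sdiff.1 ((mem_UU.1 (h2 ho)).2 hb)).2
  ext y
  rw [cmp, Finset.mem_filter]
  refine ⟨fun h => key y h.2, fun hy => ⟨hK hy, ?_⟩⟩
  rw [← h, cmp, Finset.mem_filter] at hy
  exact hy.2.mono Finset.subset_union_left

lemma cmp_sum {O : Type} {sp : O → FLat} {U : Finset O} {F : Finset O → ℝ} {A : FLat} {x : Lat} (hx : x ∈ A)
    (hne : ∀ o ∈ U, (sp o).Nonempty)
    (hF : ∀ K, K ⊆ A → ∀ T₁ T₂, T₁ ⊆ UU sp U K → T₂ ⊆ UU sp U (A \ K) → F (T₁ ∪ T₂) = F T₁ * F T₂) (g : FLat → ℝ) :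
    ∑ T ∈ (UU sp U A).powerset, F T * g (cmp sp T A x) =
      ∑ K ∈ A.powerset.filter (x ∈ ·), g K * (aa sp U F x K * ZZ sp U F (A \ K)) := by
  rw [← sum_fiberwise_of_maps_to (s := (UU sp U A).powerset) (t := A.powerset.filter (x ∈ ·)) (g := fun T => cmp sp T A x)]
  · apply sum_congr rfl
    intro K hK; rw [Finset.mem_filter, Finset.mem_powerset] at hK; rw [aa, ZZ, sum_mul_sum, ← sum_product' (f := fun T1 T2 => F T1 * F T2), mul_sum]
    symm
    refine sum_nbij' (fun p => p.1 ∪ p.2) (fun T => (T.filter (fun o => sp o ⊆ K), T.filter (fun o => sp o ⊆ A \ K)))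
      ?_ ?_ ?_ ?_ ?_
    · rintro ⟨T1, T2⟩ h; simp only [Finset.mem_product, Finset.mem_filter, Finset.mem_powerset] at h ⊢
      refine ⟨Finset.union_subset ?_ ?_, cmp_join hK.1 hK.2 h.1.1 h.2 h.1.2⟩
      · intro o ho; exact mem_UU.2 ⟨(mem_UU.1 (h.1.1 ho)).1, (mem_UU.1 (h.1.1 ho)).2.trans hK.1⟩
      · intro o ho; exact mem_UU.2 ⟨(mem_UU.1 (h.2 ho)).1, (mem_UU.1 (h.2 ho)).2.trans Finset.sdiff_subset⟩
    · intro T h; simp only [Finset.mem_product, Finset.mem_filter, Finset.mem_powerset] at h ⊢; refine ⟨⟨?_, cmp_self h.1 hx h.2⟩, ?_⟩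
      · intro o ho; rw [Finset.mem_filter] at ho; exact mem_UU.2 ⟨(mem_UU.1 (h.1 ho.1)).1, ho.2⟩
      · intro o ho; rw [Finset.mem_filter] at ho; exact mem_UU.2 ⟨(mem_UU.1 (h.1 ho.1)).1, ho.2⟩
    · rintro ⟨T1, T2⟩ h; simp only [Finset.mem_product, Finset.mem_filter, Finset.mem_powerset] at h
      have hd : ∀ o ∈ U, sp o ⊆ K → sp o ⊆ A \ K → False := by
        intro o ho h1 h2; obtain ⟨a, ha⟩ := hne o ho; exact (Finset.mem_sdiff.1 (h2 ha)).2 (h1 ha)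
      have e1 : ∀ o ∈ T1, o ∈ U ∧ sp o ⊆ K := fun o ho => mem_UU.1 (h.1.1 ho)
      have e2 : ∀ o ∈ T2, o ∈ U ∧ sp o ⊆ A \ K := fun o ho => mem_UU.1 (h.2 ho)
      refine Prod.ext ?_ ?_
      · ext o
        simp only [Finset.mem_filter, Finset.mem_union]; constructor
        · rintro ⟨h1 | h1, h2⟩
          · exact h1
          · exact (hd o (e2 o h1).1 h2 (e2 o h1).2).elim
        · intro h1; exact ⟨.inl h1, (e1 o h1).2⟩
      · ext o
        simp only [Finset.mem_filter, Finset.mem_union]; constructor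
        · rintro ⟨h1 | h1, h2⟩
          · exact (hd o (e1 o h1).1 (e1 o h1).2 h2).elim
          · exact h1
        · intro h1; exact ⟨.inr h1, (e2 o h1).2⟩
    · intro T h; simp only [Finset.mem_filter, Finset.mem_powerset] at h; ext o; simp only [Finset.mem_filter, Finset.mem_union]; constructor
      · rintro (h1 | h1) <;> exact h1.1
      · intro ho; by_cases hc : ∃ a ∈ sp o, a ∈ K
        · exact .inl ⟨ho, cmp_split h.1 h.2 o ho hc⟩
        · push Not at hc
          exact .inr ⟨ho, fun a ha => Finset.mem_sdiff.2 ⟨(mem_UU.1 (h.1 ho)).2 ha, hc a ha⟩⟩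
    · rintro ⟨T1, T2⟩ h; simp only [Finset.mem_product, Finset.mem_filter, Finset.mem_powerset] at h
      rw [hF K hK.1 T1 T2 h.1.1 h.2, cmp_join hK.1 hK.2 h.1.1 h.2 h.1.2, mul_comm]
  · intro T _; simp only [Finset.mem_filter, Finset.mem_powerset, cmp]; exact ⟨Finset.filter_subset _ _, hx, .refl⟩

lemma rec_tendsto {x : Lat} {Z a : ℕ → FLat → ℝ} {Z' a' : FLat → ℝ}
    (h0 : ∀ L, Z L ∅ = 1) (h0' : Z' ∅ = 1)
    (hr : ∀ L A, A ⊆ D → x ∈ A → Z L A = ∑ K ∈ A.powerset.filter (x ∈ ·), a L K * Z L (A \ K))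
    (hr' : ∀ A, A ⊆ D → x ∈ A → Z' A = ∑ K ∈ A.powerset.filter (x ∈ ·), a' K * Z' (A \ K))
    (hZ : ∀ A, A ⊆ D → Filter.Tendsto (fun L => Z L A) Filter.atTop (nhds (Z' A))) :
    ∀ K, K ⊆ D → x ∈ K → Filter.Tendsto (fun L => a L K) Filter.atTop (nhds (a' K)) := by
  intro K
  induction K using Finset.strongInduction with
  | H K ih =>
    intro hK hx; have hmem : K ∈ K.powerset.filter (x ∈ ·) := by simp [hx]
    have e : ∀ (Z a : FLat → ℝ), Z ∅ = 1 → Z K = ∑ K' ∈ K.powerset.filter (x ∈ ·), a K' * Z (K \ K') →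
        a K = Z K - ∑ K' ∈ (K.powerset.filter (x ∈ ·)).erase K, a K' * Z (K \ K') := by
      intro Z a h0 h; rw [← Finset.add_sum_erase _ _ hmem, Finset.sdiff_self, h0, mul_one] at h; linarith
    rw [e Z' a' h0' (hr' K hK hx)]; simp_rw [fun L => e (Z L) (a L) (h0 L) (hr L K hK hx)]
    refine (hZ K hK).sub (tendsto_finset_sum _ ?_)
    intro K' hK'; rw [Finset.mem_erase, Finset.mem_filter, Finset.mem_powerset] at hK'
    exact (ih K' (hK'.2.1.ssubset_of_ne hK'.1) (hK'.2.1.trans hK) hK'.2.2).mul (hZ _ (Finset.sdiff_subset.trans hK))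

/-! ### Sign averages: Griffiths positivity and comparison with the FK expansion -/

abbrev Sg (D : FLat) := ↥D → ℤˣ

def sg (σ : Sg D) (v : Lat) : ℝ := if h : v ∈ D then (((σ ⟨v, h⟩ : ℤˣ) : ℤ) : ℝ) else 1

lemma sg_mul (σ τ : Sg D) (v : Lat) : sg (σ * τ) v = sg σ v * sg τ v := by unfold sg; split_ifs <;> simp

lemma sg_cases (σ : Sg D) (v : Lat) : sg σ v = 1 ∨ sg σ v = -1 := by
  unfold sg; split_ifs with h
  · rcases Int.units_eq_one_or (σ ⟨v, h⟩) with h | h <;> simp [h]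
  · simp

lemma sg2_cases (σ : Sg D) (v w : Lat) : sg σ v * sg σ w = 1 ∨ sg σ v * sg σ w = -1 := by rcases sg_cases σ v with h | h <;> rcases sg_cases σ w with h' | h' <;> simp [h, h']

def GK (Q : Sg D → ℝ) : Prop := ∀ η : List Lat, 0 ≤ ∑ σ, Q σ * (η.map (sg σ)).prod

lemma GK.nonneg {Q : Sg D → ℝ} (h : GK Q) : 0 ≤ ∑ σ, Q σ := by simpa using h []

lemma GK.one : GK (fun _ : Sg D => 1) := by
  intro η
  simp only [one_mul]
  have hm : ∀ σ τ : Sg D, (η.map (sg (σ*τ))).prod = (η.map (sg σ)).prod * (η.map (sg τ)).prod := by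
    intro σ τ
    induction η with
    | nil => simp
    | cons a η ih => simp only [List.map_cons, List.prod_cons, ih, sg_mul]; ring
  have hc : ∀ σ : Sg D, (η.map (sg σ)).prod = 1 ∨ (η.map (sg σ)).prod = -1 := by
    intro σ; clear hm
    induction η with
    | nil => simp
    | cons a η ih =>
      simp only [List.map_cons, List.prod_cons]; rcases ih with h | h <;> rcases sg_cases σ a with h' | h' <;> simp [h, h']
  by_cases h : ∃ τ : Sg D, (η.map (sg τ)).prod = -1
  · obtain ⟨τ, hτ⟩ := h
    have h1 : ∑ σ : Sg D, (η.map (sg σ)).prod = ∑ σ : Sg D, (η.map (sg (τ * σ))).prod := (Equiv.sum_comp (Equiv.mulLeft τ) (fun σ : Sg D => (η.map (sg σ)).prod)).symm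
    simp_rw [hm, hτ] at h1
    rw [← mul_sum] at h1; linarith
  · push Not at h
    apply Finset.sum_nonneg
    intro σ _; rcases hc σ with h' | h'
    · rw [h']; norm_num
    · exact absurd h' (h σ)

lemma GK.mul {Q : Sg D → ℝ} (h : GK Q) {u v : ℝ} (hu : 0 ≤ u) (hv : 0 ≤ v) (a b : Lat) :
    GK (fun σ => Q σ * (u + v * (sg σ a * sg σ b))) := by
  intro η
  have e : ∑ σ, Q σ * (u + v * (sg σ a * sg σ b)) * (η.map (sg σ)).prod =
      u * ∑ σ, Q σ * (η.map (sg σ)).prod + v * ∑ σ, Q σ * ((a::b::η).map (sg σ)).prod := by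
    rw [mul_sum, mul_sum, ← sum_add_distrib]; apply sum_congr rfl; intro σ _; simp only [List.map_cons, List.prod_cons]; ring
  rw [e]
  exact add_nonneg (mul_nonneg hu (h η)) (mul_nonneg hv (h _))

abbrev Ed := Lat × Lat

/-- edge spin -/
def es (σ : Sg D) (e : Ed) : ℝ := sg σ e.1 * sg σ e.2

lemma GK.prod {Q : Sg D → ℝ} (h : GK Q) {u v : Ed → ℝ} (hu : ∀ e, 0 ≤ u e) (hv : ∀ e, 0 ≤ v e)
    (ω : Finset Ed) : GK (fun σ => Q σ * ∏ e ∈ ω, (u e + v e * es σ e)) := by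
  induction ω using Finset.induction_on generalizing Q with
  | empty => simpa using h
  | insert e ω he ih =>
    have := ih (h.mul (hu e) (hv e) e.1 e.2); simp_rw [Finset.prod_insert he, ← mul_assoc]; exact this

lemma gk_prod_mono {Q : Sg D → ℝ} (h : GK Q) {u v u' v' : Ed → ℝ} (hu : ∀ e, 0 ≤ u e) (hv : ∀ e, 0 ≤ v e)
    (hu' : ∀ e, u e ≤ u' e) (hv' : ∀ e, v e ≤ v' e) (ω : Finset Ed) :
    ∑ σ, Q σ * ∏ e ∈ ω, (u e + v e * es σ e) ≤ ∑ σ, Q σ * ∏ e ∈ ω, (u' e + v' e * es σ e) := by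
  induction ω using Finset.induction_on generalizing Q with
  | empty => simp
  | insert e ω he ih =>
    simp_rw [Finset.prod_insert he, ← mul_assoc]
    refine (ih (h.mul (hu e) (hv e) e.1 e.2)).trans ?_
    have h1 := ((h.mul (sub_nonneg.2 (hu' e)) (sub_nonneg.2 (hv' e)) e.1 e.2).prod (fun e => (hu e).trans (hu' e))
      (fun e => (hv e).trans (hv' e)) ω).nonneg
    rw [← sub_nonneg, ← sum_sub_distrib]; refine h1.trans (le_of_eq ?_); apply sum_congr rfl; intro σ _; unfold es; ring

lemma exp_es (J : ℝ) (σ : Sg D) (e : Ed) : exp (J * es σ e) = cosh J + sinh J * es σ e := by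
  rcases sg2_cases σ e.1 e.2 with h | h <;> rw [es, h]
  · rw [mul_one, mul_one, Real.cosh_add_sinh]
  · rw [mul_neg, mul_one, mul_neg, mul_one, ← sub_eq_add_neg, cosh_sub_sinh]

lemma fk_step {J : Ed → ℝ} (hJ : ∀ e, 0 ≤ J e) (E : Finset Ed) {Q : Sg D → ℝ} (hQ : GK Q)
    {f : Finset Ed → ℝ} (hf : Monotone f) :
    ∑ ω ∈ E.powerset, f ω * ∑ σ, Q σ * ∏ e ∈ ω, (exp (J e * es σ e) - 1) ≤
    ∑ ω ∈ E.powerset, f ω * ((∑ σ, Q σ * ∏ e ∈ ω, (sinh (J e) + sinh (J e) * es σ e)) * ∏ e ∈ E \ ω, exp (-J e)) := by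
  induction E using Finset.induction_on generalizing Q f with
  | empty => simp
  | insert e E he ih =>
    have hch : 0 ≤ cosh (J e) - 1 := sub_nonneg.2 (one_le_cosh _)
    have hsh : ∀ e, 0 ≤ sinh (J e) := fun e => sinh_nonneg_iff.2 (hJ e)
    have hQ' := hQ.mul hch (hsh e) e.1 e.2
    have hf' : Monotone (fun ω => f (insert e ω)) := fun a b hab => hf (Finset.insert_subset_insert e hab)
    rw [sum_powerset_insert he, sum_powerset_insert he]
    have e1 : ∑ t ∈ E.powerset, f (insert e t) * ∑ σ, Q σ * ∏ e ∈ insert e t, (exp (J e * es σ e) - 1) =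
        ∑ t ∈ E.powerset, f (insert e t) * ∑ σ, (Q σ * ((cosh (J e) - 1) + sinh (J e) * (sg σ e.1 * sg σ e.2))) *
          ∏ e ∈ t, (exp (J e * es σ e) - 1) := by
      apply sum_congr rfl; intro t ht
      congr 1; apply sum_congr rfl; intro σ _
      rw [Finset.prod_insert (fun h => he (Finset.mem_powerset.1 ht h)), exp_es, es]; ring
    rw [e1]; refine (add_le_add (ih hQ hf) (ih hQ' hf')).trans ?_; rw [← sum_add_distrib, ← sum_add_distrib]; apply Finset.sum_le_sum; intro t ht
    have het : e ∉ t := fun h => he (Finset.mem_powerset.1 ht h)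
    have d1 : insert e E \ t = insert e (E \ t) := Finset.insert_sdiff_of_notMem _ het
    have d2 : insert e E \ insert e t = E \ t := by
      ext a; simp only [Finset.mem_sdiff, Finset.mem_insert]
      constructor
      · rintro ⟨h1 | h1, h2⟩
        · exact absurd (.inl h1) h2
        · exact ⟨h1, fun h => h2 (.inr h)⟩
      · rintro ⟨h1, h2⟩; exact ⟨.inr h1, fun h => h.elim (fun h => he (h ▸ h1)) h2⟩
    rw [d1, d2, Finset.prod_insert (fun h => he (Finset.mem_sdiff.1 h).1)]
    have hP := (hQ.prod hsh hsh t).nonneg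
    have hE : 0 ≤ ∏ e ∈ E \ t, exp (-J e) := Finset.prod_nonneg fun _ _ => (exp_pos _).le
    have e2 : ∑ σ, Q σ * ∏ e ∈ insert e t, (sinh (J e) + sinh (J e) * es σ e) =
        ∑ σ, (Q σ * ((cosh (J e) - 1) + sinh (J e) * (sg σ e.1 * sg σ e.2))) * ∏ e ∈ t, (sinh (J e) + sinh (J e) * es σ e)
        + (1 - exp (-J e)) * ∑ σ, Q σ * ∏ e ∈ t, (sinh (J e) + sinh (J e) * es σ e) := by
      rw [mul_sum, ← sum_add_distrib]; apply sum_congr rfl; intro σ _; rw [Finset.prod_insert het, ← cosh_sub_sinh]; unfold es; ring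
    rw [e2]; have hx : exp (-J e) ≤ 1 := exp_le_one_iff.2 (by linarith [hJ e])
    have hm : f t ≤ f (insert e t) := hf (Finset.subset_insert _ _)
    have := mul_nonneg (mul_nonneg (sub_nonneg.2 hm) (sub_nonneg.2 hx)) (mul_nonneg hP hE); nlinarith

def spE (e : Ed) : FLat := {e.1, e.2}

lemma fk_bound {J : Ed → ℝ} (hJ : ∀ e, 0 ≤ J e) (E : Finset Ed) (x y : Lat) : ∑ ω ∈ E.powerset.filter (fun ω => gC spE ω x y), ∑ σ : Sg D, ∏ e ∈ ω, (exp (J e * es σ e) - 1) ≤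
      ∑ σ : Sg D, sg σ x * sg σ y * ∏ e ∈ E, exp (J e * es σ e) := by
  have hsh : ∀ e, 0 ≤ sinh (J e) := fun e => sinh_nonneg_iff.2 (hJ e)
  have h1 := fk_step hJ E (D := D) GK.one (f := fun ω => if gC spE ω x y then 1 else 0) (by
    intro a b hab; simp only; split_ifs with h h' h'
    · exact le_rfl
    · exact absurd (h.mono hab) h'
    · norm_num
    · exact le_rfl)
  rw [sum_filter]
  simp only [one_mul, ite_mul, zero_mul] at h1
  refine h1.trans ?_
  have e3 : ∀ σ : Sg D, ∏ e ∈ E, exp (J e * es σ e) =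
      ∑ ω ∈ E.powerset, (∏ e ∈ ω, (sinh (J e) + sinh (J e) * es σ e)) * ∏ e ∈ E \ ω, exp (-J e) := by
    intro σ; rw [← Finset.prod_add]; apply prod_congr rfl; intro e _; rw [exp_es, ← cosh_sub_sinh]; ring
  simp_rw [e3, mul_sum]
  rw [sum_comm]
  apply Finset.sum_le_sum
  intro ω _
  have hE : 0 ≤ ∏ e ∈ E \ ω, exp (-J e) := Finset.prod_nonneg fun _ _ => (exp_pos _).le
  simp_rw [← mul_assoc]
  rw [← sum_mul]
  split_ifs with h
  · refine mul_le_mul_of_nonneg_right (Finset.sum_le_sum ?_) hE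
    intro σ _; by_cases hz : ∏ e ∈ ω, (sinh (J e) + sinh (J e) * es σ e) = 0
    · rw [hz]; simp
    · replace hz := Finset.prod_ne_zero_iff.1 hz
      have key : sg σ x = sg σ y := by
        clear h1
        induction h with
        | refl => rfl
        | @tail b c _ hbc ih =>
          rw [ih]; obtain ⟨e, he, hb, hc⟩ := hbc
          have h2 : es σ e = 1 := by
            rcases sg2_cases σ e.1 e.2 with h3 | h3
            · exact h3
            · exfalso; apply hz e he; rw [es, h3]; ring
          have h3 : sg σ e.1 = sg σ e.2 := by
            unfold es at h2; rcases sg_cases σ e.1 with h4 | h4 <;> rcases sg_cases σ e.2 with h5 | h5 <;> rw [h4, h5] at h2 ⊢ <;> norm_num at h2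
          simp only [spE, Finset.mem_insert, Finset.mem_singleton] at hb hc; rcases hb with rfl | rfl <;> rcases hc with rfl | rfl <;> simp [h3]
      have : sg σ x * sg σ y = 1 := by rw [key]; rcases sg_cases σ y with h4 | h4 <;> rw [h4] <;> norm_num
      rw [this, one_mul]
  · refine mul_nonneg ?_ hE
    have := (GK.one (D := D)).prod hsh hsh ω [x, y]
    simp only [one_mul, List.map_cons, List.map_nil, List.prod_cons, List.prod_nil, mul_one] at this; refine this.trans (le_of_eq ?_)
    apply sum_congr rfl; intro σ _; ring

/-! ### Gaussian integrals on a finite piece of the lattice -/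

def EE (D : FLat) : Finset Ed := (D ×ˢ D).filter (fun e => e.2 = e.1 + (1,0) ∨ e.2 = e.1 + (0,1))

lemma mem_EE {e : Ed} : e ∈ EE D ↔ (e.1 ∈ D ∧ e.2 ∈ D) ∧ (e.2 = e.1 + (1,0) ∨ e.2 = e.1 + (0,1)) := by simp [EE]

lemma UU_EE {D A : FLat} (h : A ⊆ D) : UU spE (EE D) A = EE A := by
  ext e
  rw [mem_UU, mem_EE, mem_EE, spE, Finset.insert_subset_iff, Finset.singleton_subset_iff]
  constructor
  · rintro ⟨⟨_, h1⟩, h2⟩; exact ⟨h2, h1⟩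
  · rintro ⟨h1, h2⟩; exact ⟨⟨⟨h h1.1, h h1.2⟩, h2⟩, h1⟩

lemma sum_EE (A : FLat) (k : Lat → Lat → ℝ) :
    ∑ e ∈ EE A, (k e.1 e.2 + k e.2 e.1) = ∑ a ∈ A, ∑ b ∈ A, if Adj a b then k a b else 0 := by
  rw [← sum_product' (f := fun a b => if Adj a b then k a b else 0), ← sum_filter, sum_add_distrib]
  have hd : Disjoint (EE A) ((EE A).image Prod.swap) := by
    rw [Finset.disjoint_left]; rintro ⟨⟨a1, a2⟩, ⟨b1, b2⟩⟩ h h'; rw [Finset.mem_image] at h'; obtain ⟨⟨⟨c1, c2⟩, ⟨d1, d2⟩⟩, h1, h2⟩ := h'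
    rw [mem_EE] at h h1; simp only [Prod.swap, Prod.mk.injEq, Prod.mk_add_mk] at h h1 h2; omega
  have hu : (A ×ˢ A).filter (fun x => Adj x.1 x.2) = EE A ∪ (EE A).image Prod.swap := by
    ext ⟨⟨a1, a2⟩, ⟨b1, b2⟩⟩
    simp only [Finset.mem_filter, Finset.mem_product, Finset.mem_union, Finset.mem_image, mem_EE, Prod.exists, Prod.swap, Prod.mk.injEq, Prod.mk_add_mk]
    constructor
    · rintro ⟨⟨h1, h2⟩, h3⟩; rcases adj_cases h3 with h | h | h | h <;> simp only [Prod.mk.injEq] at h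
      all_goals first
        | exact .inl ⟨⟨h1, h2⟩, by omega⟩
        | exact .inr ⟨b1, b2, a1, a2, ⟨⟨h2, h1⟩, by omega⟩, by simp⟩
    · rintro (⟨⟨h1, h2⟩, h3⟩ | ⟨c1, c2, d1, d2, ⟨⟨h1, h2⟩, h3⟩, ⟨rfl, rfl⟩, rfl, rfl⟩)
      · refine ⟨⟨h1, h2⟩, ?_⟩
        simp only [Adj]; rcases h3 with ⟨rfl, rfl⟩ | ⟨rfl, rfl⟩ <;> ring
      · refine ⟨⟨h2, h1⟩, ?_⟩
        simp only [Adj]; rcases h3 with ⟨rfl, rfl⟩ | ⟨rfl, rfl⟩ <;> ring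
  rw [hu, Finset.sum_union hd, sum_image (fun _ _ _ _ h => Prod.swap_injective h)]
  rfl

lemma sum_adj_le (A : FLat) (a : Lat) (f : Lat → ℝ) (hf : ∀ d, 0 ≤ f (a + stp d)) :
    ∑ b ∈ A, (if Adj a b then f b else 0) ≤ ∑ d : Dir, f (a + stp d) := by
  rw [← sum_filter, ← sum_image (s := Finset.univ) (g := fun d => a + stp d) (fun x _ y _ h => stp_inj (add_left_cancel h))]
  apply sum_le_sum_of_subset_of_nonneg
  · intro b hb; rw [Finset.mem_filter] at hb; obtain ⟨d, hd⟩ := exists_stp hb.2; rw [Finset.mem_image]; exact ⟨d, Finset.mem_univ _, hd.symm⟩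
  · intro b hb _; rw [Finset.mem_image] at hb; obtain ⟨d, _, rfl⟩ := hb; exact hf d

abbrev Fd (D : FLat) := ↥D → ℝ

def ex (φ : Fd D) (v : Lat) : ℝ := if h : v ∈ D then φ ⟨v, h⟩ else 0

def JJ (φ : Fd D) (e : Ed) : ℝ := ex φ e.1 * ex φ e.2 / 4

def n2 (φ : Fd D) : ℝ := ∑ i, φ i ^ 2

def gw (φ : Fd D) : ℝ := exp (-(n2 φ / 2))

lemma n2_ex (φ : Fd D) : n2 φ = ∑ a ∈ D, ex φ a ^ 2 := by
  rw [← sum_coe_sort D, n2]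
  apply sum_congr rfl; intro i _
  simp [ex]

lemma n2_nonneg (φ : Fd D) : 0 ≤ n2 φ := Finset.sum_nonneg fun _ _ => sq_nonneg _

lemma ex_sq_le (φ : Fd D) (v : Lat) : ex φ v ^ 2 ≤ n2 φ := by
  by_cases h : v ∈ D
  · rw [n2_ex]; exact Finset.single_le_sum (f := fun a => ex φ a ^ 2) (fun _ _ => sq_nonneg _) h
  · have : ex φ v = 0 := by simp [ex, h]
    rw [this]; simpa using n2_nonneg φ

lemma dom_c (D : FLat) : ∃ c : ℝ, 0 < c ∧ ∀ φ : Fd D, ∑ e ∈ EE D, |JJ φ e| ≤ (1/2 - c) * n2 φ := by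
  set M : ℝ := 1 + ∑ v ∈ D, (|(v.1:ℝ)| + 1)^2 with hM
  have hMv : ∀ v ∈ D, (|(v.1:ℝ)| + 1)^2 ≤ M - 1 := by
    intro v hv; rw [hM]; have := Finset.single_le_sum (f := fun v : Lat => (|(v.1:ℝ)| + 1)^2) (fun _ _ => sq_nonneg _) hv
    linarith
  have hM1 : 1 ≤ M := by
    have : 0 ≤ ∑ v ∈ D, (|(v.1:ℝ)| + 1)^2 := Finset.sum_nonneg fun _ _ => sq_nonneg _
    linarith
  set h : Lat → ℝ := fun v => M - (v.1:ℝ)^2 with hh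
  have hpos : ∀ v ∈ D, 0 < h v := by
    intro v hv; have h1 := hMv v hv; simp only [hh]; nlinarith [abs_nonneg (v.1:ℝ), sq_abs (v.1:ℝ)]
  have hle : ∀ v, h v ≤ M := fun v => by simp only [hh]; nlinarith [sq_nonneg (v.1:ℝ)]
  have hnb : ∀ v ∈ D, ∀ d, 0 ≤ h (v + stp d) := by
    intro v hv d; have h1 := hMv v hv
    have h2 : |((v + stp d).1:ℝ)| ≤ |(v.1:ℝ)| + 1 := by
      rw [Prod.fst_add]; push_cast; refine (abs_add_le _ _).trans ?_
      have : |((stp d).1:ℝ)| ≤ 1 := by obtain ⟨a, b⟩ := d; cases a <;> cases b <;> simp [stp]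
      linarith
    simp only [hh]; nlinarith [abs_nonneg ((v + stp d).1:ℝ), sq_abs ((v + stp d).1:ℝ)]
  have hsum : ∀ v, ∑ d : Dir, h (v + stp d) = 4 * h v - 2 := by
    intro v; simp only [hh, Fintype.sum_prod_type, Fintype.sum_bool, stp, Prod.fst_add]; push_cast; ring
  refine ⟨1/(4*M), by positivity, fun φ => ?_⟩
  set x : Lat → ℝ := fun v => |ex φ v| with hx
  have h1 : ∑ e ∈ EE D, |JJ φ e| ≤ ∑ e ∈ EE D, (x e.1^2 * (h e.2 / h e.1) / 8 + x e.2^2 * (h e.1 / h e.2) / 8) := by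
    apply Finset.sum_le_sum
    intro e he; rw [mem_EE] at he; have p1 := hpos _ he.1.1; have p2 := hpos _ he.1.2; rw [JJ, abs_div, abs_mul]; have e0 : |(4:ℝ)| = 4 := by norm_num
    rw [e0]
    have e1 : x e.1^2 * (h e.2 / h e.1) / 8 + x e.2^2 * (h e.1 / h e.2) / 8 =
        (x e.1 * x e.2)/4 + (x e.1 * h e.2 - x e.2 * h e.1)^2 / (8 * h e.1 * h e.2) := by
      field_simp; ring
    rw [e1]; have : 0 ≤ (x e.1 * h e.2 - x e.2 * h e.1)^2 / (8 * h e.1 * h e.2) := by positivity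
    linarith
  refine h1.trans ?_
  rw [sum_EE D (fun a b => x a^2 * (h b / h a) / 8), n2_ex, mul_sum]
  apply Finset.sum_le_sum
  intro a ha
  have pa := hpos a ha
  have h2 : ∑ b ∈ D, (if Adj a b then x a^2 * (h b / h a) / 8 else 0) ≤ x a^2 / h a / 8 * (4 * h a - 2) := by
    rw [← hsum a]; refine le_trans (le_of_eq ?_) (mul_le_mul_of_nonneg_left (sum_adj_le D a h (hnb a ha)) (by positivity))
    rw [mul_sum]; apply sum_congr rfl; intro b _; split_ifs
    · field_simp
    · simp
  refine h2.trans ?_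
  have h3 : x a ^ 2 = ex φ a ^ 2 := by simp [hx, sq_abs]
  rw [h3]
  have h4 : ex φ a ^ 2 / h a / 8 * (4 * h a - 2) = (1/2 - 1/(4*h a)) * ex φ a^2 := by field_simp; ring
  rw [h4]
  apply mul_le_mul_of_nonneg_right _ (sq_nonneg _)
  have := one_div_le_one_div_of_le (by positivity : 0 < 4 * h a) (by linarith [hle a] : 4 * h a ≤ 4 * M)
  linarith

lemma exp_n2 (a : ℝ) (φ : Fd D) : exp (-(a * n2 φ)) = ∏ i, exp (-a * φ i ^ 2) := by
  rw [← exp_sum, n2, mul_sum, ← sum_neg_distrib]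
  congr 1; apply sum_congr rfl; intro i _; ring

lemma int_exp_n2 {a : ℝ} (ha : 0 < a) : Integrable (fun φ : Fd D => exp (-(a * n2 φ))) := by
  simp_rw [exp_n2]
  exact Integrable.fintype_prod (f := fun (_ : ↥D) (x : ℝ) => exp (-a * x^2)) (fun _ => integrable_exp_neg_mul_sq ha)

lemma ex_meas (v : Lat) : Measurable (fun φ : Fd D => ex φ v) := by
  unfold ex; split_ifs
  · exact measurable_pi_apply _
  · exact measurable_const

lemma JJ_meas (e : Ed) : Measurable (fun φ : Fd D => JJ φ e) := ((ex_meas _).mul (ex_meas _)).div_const _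

lemma gw_meas : Measurable (fun φ : Fd D => gw φ) := by unfold gw n2; fun_prop

lemma gw_pos (φ : Fd D) : 0 < gw φ := exp_pos _

/-- domination criterion for integrability -/
lemma int_dom {g : Fd D → ℝ} (hm : Measurable g) {C : ℝ} (hC : 0 ≤ C) (u v : Lat)
    (h : ∀ φ, |g φ| ≤ C * (1 + |ex φ u * ex φ v|) * exp (∑ e ∈ EE D, |JJ φ e|) * gw φ) : Integrable g := by
  obtain ⟨c, hc, hd⟩ := dom_c D
  refine Integrable.mono' ((int_exp_n2 (D := D) (a := c/2) (by positivity)).const_mul (C * (1 + 2/c))) hm.aestronglyMeasurable (Filter.Eventually.of_forall fun φ => ?_)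
  rw [Real.norm_eq_abs]
  refine (h φ).trans ?_
  have h1 : |ex φ u * ex φ v| ≤ n2 φ := by
    rw [abs_mul]; nlinarith [ex_sq_le φ u, ex_sq_le φ v, sq_abs (ex φ u), sq_abs (ex φ v), sq_nonneg (|ex φ u| - |ex φ v|)]
  have h2 : 1 + n2 φ ≤ (1 + 2/c) * exp (c/2 * n2 φ) := by
    have := Real.add_one_le_exp (c/2 * n2 φ); have h3 : (1 + 2/c) * (c/2 * n2 φ + 1) = 1 + n2 φ + (c/2 * n2 φ + 2/c) := by field_simp; ring
    have h4 := n2_nonneg φ; have : (1 + 2/c) * (c/2 * n2 φ + 1) ≤ (1 + 2/c) * exp (c/2 * n2 φ) := mul_le_mul_of_nonneg_left this (by positivity)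
    have : 0 ≤ c/2 * n2 φ + 2/c := by positivity
    linarith
  have h5 : exp (∑ e ∈ EE D, |JJ φ e|) * gw φ ≤ exp (-(c * n2 φ)) := by
    rw [gw, ← exp_add]; apply exp_le_exp.2; have := hd φ; linarith
  calc C * (1 + |ex φ u * ex φ v|) * exp (∑ e ∈ EE D, |JJ φ e|) * gw φ
      = C * ((1 + |ex φ u * ex φ v|) * (exp (∑ e ∈ EE D, |JJ φ e|) * gw φ)) := by ring
    _ ≤ C * (((1 + 2/c) * exp (c/2 * n2 φ)) * exp (-(c * n2 φ))) := by
        apply mul_le_mul_of_nonneg_left _ hC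
        apply mul_le_mul (by linarith) h5 (mul_nonneg (exp_pos _).le (gw_pos _).le) (by positivity)
    _ = C * (1 + 2/c) * exp (-(c/2 * n2 φ)) := by rw [mul_assoc (1+2/c), ← exp_add]; rw [← mul_assoc]; congr 2; ring

/-- factorization over disjoint sets of coordinates -/
lemma fact_p (p : ↥D → Prop) (F₁ F₂ : Fd D → ℝ) (h1 : ∀ φ ψ : Fd D, (∀ i, p i → φ i = ψ i) → F₁ φ = F₁ ψ)
    (h2 : ∀ φ ψ : Fd D, (∀ i, ¬ p i → φ i = ψ i) → F₂ φ = F₂ ψ) :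
    (∫ φ : Fd D, F₁ φ * F₂ φ * gw φ) * (∫ φ : Fd D, gw φ) = (∫ φ : Fd D, F₁ φ * gw φ) * (∫ φ : Fd D, F₂ φ * gw φ) := by
  let G₁ : ({i // p i} → ℝ) → ℝ := fun ψ => F₁ (fun i => if h : p i then ψ ⟨i, h⟩ else 0)
  let G₂ : ({i // ¬ p i} → ℝ) → ℝ := fun ψ => F₂ (fun i => if h : p i then 0 else ψ ⟨i, h⟩)
  let g₁ : ({i // p i} → ℝ) → ℝ := fun ψ => exp (-((∑ i, ψ i^2)/2))
  let g₂ : ({i // ¬ p i} → ℝ) → ℝ := fun ψ => exp (-((∑ i, ψ i^2)/2))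
  have key : ∀ (H₁ : ({i // p i} → ℝ) → ℝ) (H₂ : ({i // ¬ p i} → ℝ) → ℝ),
      ∫ φ : Fd D, H₁ (fun i => φ i) * H₂ (fun i => φ i) * gw φ = (∫ ψ, H₁ ψ * g₁ ψ) * ∫ ψ, H₂ ψ * g₂ ψ := by
    intro H₁ H₂; rw [← integral_prod_mul]; have hv := volume_preserving_piEquivPiSubtypeProd (fun _ : ↥D => ℝ) p
    rw [← Measure.volume_eq_prod, ← hv.integral_comp' (g := fun z : ({i // p i} → ℝ) × ({i // ¬ p i} → ℝ) => H₁ z.1 * g₁ z.1 * (H₂ z.2 * g₂ z.2))]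
    congr 1; ext φ
    have e : gw φ = g₁ (fun i => φ i) * g₂ (fun i => φ i) := by
      simp only [gw, g₁, g₂, n2]; rw [← exp_add, ← Fintype.sum_subtype_add_sum_subtype p (fun i => φ i ^ 2)]
      congr 1; ring
    rw [e]; simp only [MeasurableEquiv.piEquivPiSubtypeProd, Equiv.piEquivPiSubtypeProd, MeasurableEquiv.coe_mk, Equiv.coe_fn_mk]; ring
  have e1 : ∀ φ, F₁ φ = G₁ (fun i => φ i) := fun φ => h1 _ _ (fun i hi => by simp [hi])
  have e2 : ∀ φ, F₂ φ = G₂ (fun i => φ i) := fun φ => h2 _ _ (fun i hi => by simp [hi])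
  have k1 := key G₁ G₂
  have k2 := key G₁ (fun _ => 1)
  have k3 := key (fun _ => 1) G₂
  have k4 := key (fun _ => 1) (fun _ => 1)
  simp only [one_mul, mul_one] at k2 k3 k4
  simp_rw [e1, e2]
  rw [k1, k2, k3, k4]; ring

/-! ### The partition function as a loop mass -/

open Matrix in
lemma sym_diag {ι : Type} [Fintype ι] [DecidableEq ι] (W : Matrix ι ι ℝ) (hW : W.IsHermitian) :
    ∃ (U : Matrix ι ι ℝ) (lam : ι → ℝ), Uᵀ * U = 1 ∧ W = U * Matrix.diagonal lam * Uᵀ := by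
  refine ⟨hW.eigenvectorUnitary, hW.eigenvalues, ?_, ?_⟩
  · have := Unitary.coe_star_mul_self hW.eigenvectorUnitary; rw [Matrix.star_eq_conjTranspose, Matrix.conjTranspose_eq_transpose_of_trivial] at this
    exact this
  · have := hW.spectral_theorem; rw [Unitary.conjStarAlgAut_apply] at this
    rw [Matrix.star_eq_conjTranspose, Matrix.conjTranspose_eq_transpose_of_trivial] at this; exact this

/-- the walk matrix restricted to `A` -/
def WA (D A : FLat) : Matrix ↥D ↥D ℝ := Matrix.of fun i j => if i.1 ∈ A ∧ j.1 ∈ A ∧ Adj i.1 j.1 then 1/4 else 0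

lemma WA_herm (D A : FLat) : (WA D A).IsHermitian := by
  ext i j
  simp only [Matrix.conjTranspose_apply, WA, Matrix.of_apply, star_trivial]
  have : (j.1 ∈ A ∧ i.1 ∈ A ∧ Adj j.1 i.1) ↔ (i.1 ∈ A ∧ j.1 ∈ A ∧ Adj i.1 j.1) := ⟨fun h => ⟨h.2.1, h.1, h.2.2.symm⟩, fun h => ⟨h.2.1, h.1, h.2.2.symm⟩⟩
  simp only [this]

lemma sum_sub {D A : FLat} (hA : A ⊆ D) (f : Lat → ℝ) : ∑ i : ↥D, (if i.1 ∈ A then f i.1 else 0) = ∑ a ∈ A, f a := by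
  rw [sum_coe_sort D (fun a => if a ∈ A then f a else 0), ← sum_filter]
  congr 1; ext a; simp only [Finset.mem_filter]
  exact ⟨fun h => h.2, fun h => ⟨hA h, h⟩⟩

lemma JJ_quad {D A : FLat} (hA : A ⊆ D) (φ : Fd D) : ∑ e ∈ EE A, JJ φ e = (φ ⬝ᵥ (WA D A).mulVec φ)/2 := by
  have h1 := sum_EE A (fun a b => ex φ a * ex φ b / 4)
  have h2 : ∑ e ∈ EE A, (ex φ e.1 * ex φ e.2 / 4 + ex φ e.2 * ex φ e.1 / 4) = 2 * ∑ e ∈ EE A, JJ φ e := by rw [mul_sum]; apply sum_congr rfl; intro e _; unfold JJ; ring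
  rw [h2] at h1
  have h3 : φ ⬝ᵥ (WA D A).mulVec φ = ∑ a ∈ A, ∑ b ∈ A, if Adj a b then ex φ a * ex φ b / 4 else 0 := by
    rw [← sum_sub hA]; simp only [dotProduct, Matrix.mulVec]; apply sum_congr rfl; intro i _; split_ifs with hi
    · rw [← sum_sub hA, mul_sum]; apply sum_congr rfl; intro j _; simp only [WA, Matrix.of_apply, hi, true_and]
      by_cases hj : j.1 ∈ A <;> by_cases hij : Adj i.1 j.1 <;> simp [hj, hij, ex]
      ring
    · simp [WA, hi]
  rw [h3]; linarith

def ZG (D A : FLat) : ℝ := (∫ φ : Fd D, exp (∑ e ∈ EE A, JJ φ e) * gw φ) / ∫ φ : Fd D, gw φ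

open Matrix in
lemma ZG_diag {D A : FLat} (hA : A ⊆ D) : ∃ lam : ↥D → ℝ, (∀ i, |lam i| < 1) ∧ (∀ t, ((WA D A)^t).trace = ∑ i, lam i^t) ∧
    ZG D A = exp (∑ i, -Real.log (1 - lam i) / 2) := by
  obtain ⟨U, lam, hU, hW⟩ := sym_diag (WA D A) (WA_herm D A)
  have hU' : U * Uᵀ = 1 := mul_eq_one_comm.1 hU
  have hquad : ∀ ψ : Fd D, (U *ᵥ ψ) ⬝ᵥ (WA D A *ᵥ (U *ᵥ ψ)) = ∑ i, lam i * ψ i^2 := by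
    intro ψ
    rw [Matrix.mulVec_mulVec, hW, Matrix.mul_assoc, hU, Matrix.mul_one, ← Matrix.mulVec_mulVec, Matrix.dotProduct_mulVec,
      Matrix.vecMul_mulVec, hU, Matrix.vecMul_one]
    simp only [dotProduct, Matrix.mulVec_diagonal]; apply sum_congr rfl; intro i _; ring
  have hn2 : ∀ ψ : Fd D, n2 (D := D) (U *ᵥ ψ) = n2 ψ := by
    intro ψ; have h1 : ∀ χ : Fd D, n2 χ = χ ⬝ᵥ χ := fun χ => by simp only [n2, dotProduct, sq]
    rw [h1, h1, Matrix.dotProduct_mulVec, Matrix.vecMul_mulVec, hU, Matrix.vecMul_one]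
  have hlam : ∀ i, |lam i| < 1 := by
    intro i; obtain ⟨c, hc, hd⟩ := dom_c D; have h1 := hd (U *ᵥ (Pi.single i 1)); rw [hn2] at h1
    have h2 : n2 (D := D) (Pi.single i 1) = 1 := by simp [n2, Pi.single_apply]
    have h3 := hquad (Pi.single i 1); have h4 : ∑ j, lam j * (Pi.single i 1 : Fd D) j^2 = lam i := by simp [Pi.single_apply]
    rw [h4] at h3; have h5 := JJ_quad hA (U *ᵥ (Pi.single i 1)); rw [h3] at h5
    have h6 : |∑ e ∈ EE A, JJ (D := D) (U *ᵥ (Pi.single i 1)) e| ≤ ∑ e ∈ EE D, |JJ (D := D) (U *ᵥ (Pi.single i 1)) e| := by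
      refine (Finset.abs_sum_le_sum_abs _ _).trans (sum_le_sum_of_subset_of_nonneg ?_ (fun _ _ _ => abs_nonneg _))
      intro e he; rw [mem_EE] at he ⊢; exact ⟨⟨hA he.1.1, hA he.1.2⟩, he.2⟩
    rw [h5, abs_div] at h6; rw [h2] at h1; have : |(2:ℝ)| = 2 := by norm_num
    rw [this] at h6; linarith
  refine ⟨lam, hlam, ?_, ?_⟩
  · intro t
    have : (WA D A)^t = U * (Matrix.diagonal lam)^t * Uᵀ := by
      induction t with
      | zero => simp [hU']
      | succ t ih =>
        rw [pow_succ, ih, pow_succ]; conv_lhs => rw [hW]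
        calc U * diagonal lam ^ t * Uᵀ * (U * diagonal lam * Uᵀ) = U * diagonal lam ^ t * (Uᵀ * U) * diagonal lam * Uᵀ := by
              simp only [Matrix.mul_assoc]
          _ = _ := by rw [hU, Matrix.mul_one, Matrix.mul_assoc U]
    rw [this, Matrix.trace_mul_comm, ← Matrix.mul_assoc, hU, Matrix.one_mul, Matrix.diagonal_pow, Matrix.trace_diagonal]; simp
  · have hc : ∀ F : Fd D → ℝ, Measurable F → ∫ φ, F φ = ∫ ψ : Fd D, F (U *ᵥ ψ) := by
      intro F hF
      have hd : U.det * U.det = 1 := by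
        have := congrArg Matrix.det hU; rwa [Matrix.det_mul, Matrix.det_transpose, Matrix.det_one] at this
      have hd0 : U.det ≠ 0 := by intro h; rw [h] at hd; simp at hd
      have hd1 : |U.det| = 1 := by
        have h : |U.det| * |U.det| = 1 := by rw [← abs_mul, hd, abs_one]
        nlinarith [abs_nonneg U.det]
      have hm := Real.map_matrix_volume_pi_eq_smul_volume_pi hd0; rw [abs_inv, hd1, inv_one, ENNReal.ofReal_one, one_smul] at hm
      conv_lhs => rw [← hm]
      rw [integral_map]
      · simp only [Matrix.toLin'_apply]
      · exact (LinearMap.continuous_of_finiteDimensional (Matrix.toLin' U)).measurable.aemeasurable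
      · exact hF.aestronglyMeasurable
    have hl : ∀ i, 0 < 1 - lam i := by intro i; have := hlam i; rw [abs_lt] at this; linarith
    have hmE : Measurable (fun φ : Fd D => exp (∑ e ∈ EE A, JJ φ e) * gw φ) := by
      refine Measurable.mul (measurable_exp.comp ?_) gw_meas
      exact Finset.measurable_sum _ (fun e _ => JJ_meas e)
    have h1 : ∫ φ : Fd D, exp (∑ e ∈ EE A, JJ φ e) * gw φ = ∏ i : ↥D, √(Real.pi / ((1 - lam i)/2)) := by
      rw [hc _ hmE]
      have : ∀ ψ : Fd D, exp (∑ e ∈ EE A, JJ (D := D) (U *ᵥ ψ) e) * gw (D := D) (U *ᵥ ψ) = ∏ i, exp (-((1 - lam i)/2) * ψ i^2) := by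
        intro ψ; rw [JJ_quad hA, hquad, gw, hn2, ← exp_add, ← exp_sum]; congr 1; rw [n2, sum_div, sum_div, ← sum_neg_distrib, ← sum_add_distrib]
        apply sum_congr rfl; intro i _; ring
      simp_rw [this]
      rw [integral_fintype_prod_volume_eq_prod (fun (i : ↥D) (x : ℝ) => exp (-((1 - lam i)/2) * x^2))]
      apply prod_congr rfl; intro i _
      exact integral_gaussian _
    have h2 : ∫ φ : Fd D, gw φ = ∏ i : ↥D, √(Real.pi / (1/2)) := by
      have : ∀ ψ : Fd D, gw ψ = ∏ i, exp (-(1/2) * ψ i^2) := by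
        intro ψ; rw [gw, ← exp_sum, n2, sum_div, ← sum_neg_distrib]; congr 1; apply sum_congr rfl; intro i _; ring
      simp_rw [this]
      rw [integral_fintype_prod_volume_eq_prod (fun (i : ↥D) (x : ℝ) => exp (-(1/2) * x^2))]
      apply prod_congr rfl; intro i _
      exact integral_gaussian _
    rw [ZG, h1, h2, ← Finset.prod_div_distrib, exp_sum]; apply prod_congr rfl; intro i _; rw [← Real.sqrt_div (by have := hl i; positivity)]
    rw [show Real.pi / ((1 - lam i)/2) / (Real.pi/(1/2)) = (1 - lam i)⁻¹ by have := (hl i).ne'; have := Real.pi_ne_zero; field_simp]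
    rw [show -Real.log (1 - lam i) / 2 = Real.log (1 - lam i)⁻¹ / 2 by rw [Real.log_inv], Real.exp_half,
      Real.exp_log (inv_pos.2 (hl i))]

lemma WA_pow {D A : FLat} (hA : A ⊆ D) (t : ℕ) (i j : ↥D) (hi : i.1 ∈ A) :
    ((WA D A)^t) i j = ∑ w ∈ words t, if (∀ v ∈ path i.1 w, v ∈ A) ∧ endp i.1 w = j.1 then (1/4:ℝ)^t else 0 := by
  induction t generalizing i with
  | zero =>
    simp only [words, Finset.sum_singleton, pow_zero, path_nil, endp_nil, List.mem_singleton, forall_eq, hi, true_and, Matrix.one_apply,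
      Subtype.ext_iff]
  | succ t ih =>
    rw [pow_succ', Matrix.mul_apply, sum_words_succ]
    have h1 : ∀ k : ↥D, WA D A i k * ((WA D A)^t) k j = if k.1 ∈ A then (if Adj i.1 k.1 then (∑ w ∈ words t, if (∀ v ∈ path k.1 w, v ∈ A) ∧ endp k.1 w = j.1 then (1/4:ℝ)^(t+1) else 0) else 0) else 0 := by
      intro k; by_cases hk : k.1 ∈ A
      · rw [ih k hk]; simp only [WA, Matrix.of_apply, hi, hk, true_and, if_true]; split_ifs with ha
        · rw [mul_sum]; apply sum_congr rfl; intro w _; split_ifs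
          · rw [pow_succ']
          · simp
        · simp
      · simp [WA, hk]
    simp_rw [h1]
    rw [sum_sub hA (fun k => if Adj i.1 k then (∑ w ∈ words t, if (∀ v ∈ path k w, v ∈ A) ∧ endp k w = j.1 then (1/4:ℝ)^(t+1) else 0) else 0),
      ← sum_filter]
    have h2 : ∑ d : Dir, ∑ w ∈ words t, (if (∀ v ∈ path i.1 (d::w), v ∈ A) ∧ endp i.1 (d::w) = j.1 then (1/4:ℝ)^(t+1) else 0) =
        ∑ k ∈ Finset.univ.image (fun d => i.1 + stp d), ∑ w ∈ words t, if (∀ v ∈ path k w, v ∈ A) ∧ endp k w = j.1 then (1/4:ℝ)^(t+1) else 0 := by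
      rw [sum_image (fun x _ y _ h => stp_inj (add_left_cancel h))]
      apply sum_congr rfl; intro d _
      apply sum_congr rfl; intro w _
      simp [hi]
    first
      | rw [h2]
      | (rw [sum_comm]; rw [h2])
    apply Finset.sum_subset
    · intro k hk; rw [Finset.mem_filter] at hk; obtain ⟨d, hd⟩ := exists_stp hk.2; rw [Finset.mem_image]; exact ⟨d, Finset.mem_univ _, hd.symm⟩
    · intro k hk hk'; rw [Finset.mem_image] at hk; obtain ⟨d, _, rfl⟩ := hk; apply Finset.sum_eq_zero; intro w _; rw [if_neg]; intro h; apply hk'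
      rw [Finset.mem_filter]; exact ⟨h.1 _ (mem_path_self _ _), adj_stp _ _⟩

lemma mass_LS {D A : FLat} (hA : A ⊆ D) (L : ℕ) :
    ∑ l ∈ LS L A, wt l = ∑ t ∈ Finset.range (L+1), ((WA D A)^t).trace / t := by
  have h0 : ∀ t ∈ Finset.range (L+1), ((WA D A)^t).trace / t = ∑ z ∈ A, ∑ w ∈ words t,
      if (w ≠ [] ∧ endp z w = z ∧ ∀ v ∈ path z w, v ∈ A) then wt (z,w) else 0 := by
    intro t _; rcases Nat.eq_zero_or_pos t with rfl | ht
    · simp [words]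
    · rw [Matrix.trace, ← sum_sub hA, sum_div]; apply sum_congr rfl; intro i _; rw [Matrix.diag_apply]; split_ifs with hi
      · rw [WA_pow hA t i i hi, sum_div]; apply sum_congr rfl; intro w hw; have hl := mem_words.1 hw
        have hne : w ≠ [] := by rintro rfl; simp at hl; omega
        by_cases hc : (∀ v ∈ path i.1 w, v ∈ A) ∧ endp i.1 w = i.1
        · rw [if_pos hc, if_pos ⟨hne, hc.2, hc.1⟩, wt, hl]
        · rw [if_neg hc, if_neg (fun h => hc ⟨h.2.2, h.2.1⟩)]; simp
      · obtain ⟨s, rfl⟩ : ∃ s, t = s+1 := ⟨t-1, by omega⟩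
        rw [pow_succ', Matrix.mul_apply, Finset.sum_eq_zero]
        · simp
        · intro k _; simp [WA, hi]
  rw [sum_congr rfl h0, sum_comm]
  rw [LS, sum_filter, sum_product]
  apply sum_congr rfl; intro z _
  rw [sum_biUnion]
  intro s _ t _ hst
  rw [Function.onFun, Finset.disjoint_left]
  intro w hs ht
  exact hst ((mem_words.1 hs).symm.trans (mem_words.1 ht))

lemma mass_tendsto {D A : FLat} (hA : A ⊆ D) :
    Filter.Tendsto (fun L => exp ((∑ l ∈ LS L A, wt l)/2)) Filter.atTop (nhds (ZG D A)) := by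
  obtain ⟨lam, h1, h2, h3⟩ := ZG_diag hA
  rw [h3]
  refine (Real.continuous_exp.tendsto _).comp ?_
  have h4 : ∀ L, (∑ l ∈ LS L A, wt l)/2 = ∑ i, (∑ n ∈ Finset.range L, lam i^(n+1)/((n:ℝ)+1))/2 := by
    intro L; rw [mass_LS hA, ← sum_div, sum_comm]; congr 1; rw [Finset.sum_range_succ']; simp only [h2, Nat.cast_zero, div_zero, add_zero]
    apply sum_congr rfl; intro n _
    rw [sum_div]; push_cast; rfl
  simp_rw [h4]
  apply tendsto_finset_sum
  intro i _
  exact ((Real.hasSum_pow_div_log_of_abs_lt_one (h1 i)).tendsto_sum_nat).div_const 2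

/-! ### From the loop soup to the random-cluster expansion of the free field -/

def spL (l : Lp) : FLat := (path l.1 l.2).toFinset

def FL (T : FLp) : ℝ := ∏ l ∈ T, (exp (wt l / 2) - 1)

lemma Pr_FL (s : FLp) (E : FLp → Prop) :
    Pr pr s E = (∑ T ∈ s.powerset, FL T * ind (E T)) / exp ((∑ l ∈ s, wt l)/2) := by
  unfold Pr Ex
  rw [sum_div]
  apply sum_congr rfl; intro T hT
  rw [Finset.mem_powerset] at hT
  have h1 : exp ((∑ l ∈ s, wt l)/2) = (∏ l ∈ s \ T, exp (wt l/2)) * ∏ l ∈ T, exp (wt l/2) := by rw [Finset.prod_sdiff hT, ← exp_sum, sum_div]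
  have h2 : ∏ i ∈ s \ T, (1 - pr i) = (∏ l ∈ s \ T, exp (wt l/2))⁻¹ := by
    rw [← Finset.prod_inv_distrib]; apply prod_congr rfl; intro l _; rw [pr, ← exp_neg]; ring
  have h3 : ∏ i ∈ T, pr i = FL T * (∏ l ∈ T, exp (wt l/2))⁻¹ := by
    rw [FL, ← Finset.prod_inv_distrib, ← Finset.prod_mul_distrib]; apply prod_congr rfl; intro l _
    rw [pr, exp_neg, sub_mul, mul_inv_cancel₀ (exp_pos _).ne', one_mul]
  rw [h1, h2, h3]
  field_simp

lemma UU_LS {D A : FLat} (h : A ⊆ D) (L : ℕ) : UU spL (LS L D) A = LS L A := by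
  ext l
  rw [mem_UU, mem_LS, mem_LS]
  have : spL l ⊆ A ↔ ∀ v ∈ path l.1 l.2, v ∈ A := by simp [spL, Finset.subset_iff]
  rw [this]
  exact ⟨fun h' => ⟨h'.1.1, h'.1.2.1, h'.1.2.2.1, h'.2⟩, fun h' => ⟨⟨h'.1, h'.2.1, h'.2.2.1, fun v hv => h (h'.2.2.2 v hv)⟩, h'.2.2.2⟩⟩

lemma ZZ_LS {D A : FLat} (h : A ⊆ D) (L : ℕ) : ZZ spL (LS L D) FL A = exp ((∑ l ∈ LS L A, wt l)/2) := by
  rw [ZZ, UU_LS h, sum_div, exp_sum]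
  unfold FL
  rw [← prod_add_one]
  apply prod_congr rfl; intro l _; ring

lemma UU_disj {O : Type} {sp : O → FLat} {U : Finset O} (hne : ∀ o ∈ U, (sp o).Nonempty) {A K : FLat} {T₁ T₂ : Finset O}
    (h1 : T₁ ⊆ UU sp U K) (h2 : T₂ ⊆ UU sp U (A \ K)) : Disjoint T₁ T₂ := by
  rw [Finset.disjoint_left]
  intro o ho ho'
  have a := mem_UU.1 (h1 ho); have b := mem_UU.1 (h2 ho')
  obtain ⟨v, hv⟩ := hne o a.1
  exact (Finset.mem_sdiff.1 (b.2 hv)).2 (a.2 hv)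

def FM (D : FLat) (ω : Finset Ed) : ℝ := (∫ φ : Fd D, (∏ e ∈ ω, (exp (JJ φ e) - 1)) * gw φ) / ∫ φ : Fd D, gw φ

lemma int_gw_pos (D : FLat) : 0 < ∫ φ : Fd D, gw φ := by
  refine integral_pos_of_integrable_nonneg_nonzero (x := 0) ?_ ?_ (fun φ => (gw_pos φ).le) (gw_pos _).ne'
  · unfold gw n2; fun_prop
  · have := int_exp_n2 (D := D) (a := 1/2) (by norm_num)
    refine this.congr (Filter.Eventually.of_forall fun φ => ?_)
    simp only [gw]; congr 1; ring

lemma abs_prod_exp_le {ω : Finset Ed} (h : ω ⊆ EE D) (J : Ed → ℝ) :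
    |∏ e ∈ ω, (exp (J e) - 1)| ≤ exp (∑ e ∈ EE D, |J e|) := by
  rw [Finset.abs_prod]
  calc ∏ e ∈ ω, |exp (J e) - 1| ≤ ∏ e ∈ ω, exp (|J e|) := by
        apply prod_le_prod (fun _ _ => abs_nonneg _)
        intro e _; rw [abs_le]; have h1 := exp_le_exp.2 (le_abs_self (J e)); have h2 := exp_pos (J e); have h3 := Real.one_le_exp (abs_nonneg (J e))
        constructor <;> linarith
    _ = exp (∑ e ∈ ω, |J e|) := by rw [exp_sum]
    _ ≤ _ := exp_le_exp.2 (sum_le_sum_of_subset_of_nonneg h (fun _ _ _ => abs_nonneg _))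

lemma FM_int {ω : Finset Ed} (h : ω ⊆ EE D) : Integrable (fun φ : Fd D => (∏ e ∈ ω, (exp (JJ φ e) - 1)) * gw φ) := by
  refine int_dom (C := 1) ?_ zero_le_one 0 0 ?_
  · refine Measurable.mul (Finset.measurable_prod _ fun e _ => ?_) gw_meas
    exact (measurable_exp.comp (JJ_meas e)).sub_const 1
  · intro φ; rw [abs_mul, abs_of_pos (gw_pos φ)]; refine mul_le_mul_of_nonneg_right ?_ (gw_pos φ).le; have := abs_prod_exp_le h (fun e => JJ φ e)
    have h2 := abs_nonneg (ex φ 0 * ex φ 0); nlinarith [exp_pos (∑ e ∈ EE D, |JJ φ e|)]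

lemma ZZ_FM {D A : FLat} (h : A ⊆ D) : ZZ spE (EE D) (FM D) A = ZG D A := by
  have hs : EE A ⊆ EE D := by
    intro e he; rw [mem_EE] at he ⊢; exact ⟨⟨h he.1.1, h he.1.2⟩, he.2⟩
  rw [ZZ, UU_EE h, ZG]
  unfold FM
  rw [← sum_div, ← integral_finset_sum _ (fun ω hω => FM_int ((Finset.mem_powerset.1 hω).trans hs))]
  congr 1
  congr 1; ext φ
  rw [← sum_mul, ← prod_add_one, exp_sum]
  congr 1
  apply prod_congr rfl; intro e _; ring

lemma JJ_congr {φ ψ : Fd D} {e : Ed} (h : ∀ i : ↥D, i.1 ∈ spE e → φ i = ψ i) : JJ φ e = JJ ψ e := by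
  have : ∀ v ∈ spE e, ex φ v = ex ψ v := by
    intro v hv; unfold ex; split_ifs with hd
    · exact h ⟨v, hd⟩ hv
    · rfl
  unfold JJ; rw [this e.1 (by simp [spE]), this e.2 (by simp [spE])]

lemma FM_mul {D K A : FLat} {T₁ T₂ : Finset Ed} (h1 : T₁ ⊆ UU spE (EE D) K) (h2 : T₂ ⊆ UU spE (EE D) (A \ K)) :
    FM D (T₁ ∪ T₂) = FM D T₁ * FM D T₂ := by
  have hd : Disjoint T₁ T₂ := UU_disj (fun o _ => ⟨o.1, by simp [spE]⟩) h1 h2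
  have := fact_p (D := D) (fun i => i.1 ∈ K) (fun φ => ∏ e ∈ T₁, (exp (JJ φ e) - 1)) (fun φ => ∏ e ∈ T₂, (exp (JJ φ e) - 1))
    (by
      intro φ ψ h; apply prod_congr rfl; intro e he; rw [JJ_congr (φ := φ) (ψ := ψ) (fun i hi => h i ((mem_UU.1 (h1 he)).2 hi))])
    (by
      intro φ ψ h; apply prod_congr rfl; intro e he
      rw [JJ_congr (φ := φ) (ψ := ψ) (fun i hi => h i (Finset.mem_sdiff.1 ((mem_UU.1 (h2 he)).2 hi)).2)])
  have hp := (int_gw_pos D).ne'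
  unfold FM
  simp_rw [Finset.prod_union hd]
  rw [div_mul_div_comm, ← this]
  field_simp

lemma spL_ne (l : Lp) : (spL l).Nonempty := ⟨l.1, by simp [spL, mem_path_self]⟩

lemma soup_limit {x : Lat} (hx : x ∈ D) (S : FLat) (L : ℕ) : Pr pr (LS L D) (fun T => ∃ y ∈ S, y ∈ D ∧ gC spL T x y) ≤
      (∑ ω ∈ (EE D).powerset, FM D ω * ind (∃ y ∈ S, y ∈ D ∧ gC spE ω x y)) / ZG D D := by
  have hFL : ∀ L A K, K ⊆ A → ∀ T₁ T₂, T₁ ⊆ UU spL (LS L D) K → T₂ ⊆ UU spL (LS L D) (A \ K) → FL (T₁ ∪ T₂) = FL T₁ * FL T₂ := by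
    intro L A K _ T₁ T₂ h1 h2; unfold FL; rw [Finset.prod_union (UU_disj (fun o _ => spL_ne o) h1 h2)]
  have hFM : ∀ A K, K ⊆ A → ∀ T₁ T₂, T₁ ⊆ UU spE (EE D) K → T₂ ⊆ UU spE (EE D) (A \ K) → FM D (T₁ ∪ T₂) = FM D T₁ * FM D T₂ := by intro A K _ T₁ T₂ h1 h2; exact FM_mul h1 h2
  have hneE : ∀ o ∈ EE D, (spE o).Nonempty := fun o _ => ⟨o.1, by simp [spE]⟩
  have hneL : ∀ L, ∀ o ∈ LS L D, (spL o).Nonempty := fun L o _ => spL_ne o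
  have hZ : ∀ A, A ⊆ D → Filter.Tendsto (fun L => ZZ spL (LS L D) FL A) Filter.atTop (nhds (ZZ spE (EE D) (FM D) A)) := by
    intro A hA; rw [ZZ_FM hA]; simp_rw [ZZ_LS hA]; exact mass_tendsto hA
  have ha := rec_tendsto (D := D) (x := x) (Z := fun L => ZZ spL (LS L D) FL) (a := fun L => aa spL (LS L D) FL x)
    (Z' := ZZ spE (EE D) (FM D)) (a' := aa spE (EE D) (FM D) x)
    (by
      intro L; show ZZ spL (LS L D) FL ∅ = 1; rw [ZZ_LS (Finset.empty_subset _)]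
      have : LS L ∅ = ∅ := by
        apply Finset.eq_empty_of_forall_notMem; intro l hl
        have := (mem_LS.1 hl).2.2.2 l.1 (mem_path_self _ _); simp at this
      rw [this]; simp)
    (by
      rw [ZZ_FM (Finset.empty_subset _), ZG]; have : EE ∅ = ∅ := by simp [EE]
      rw [this]; simp [(int_gw_pos D).ne'])
    (by
      intro L A hA hxA
      have := cmp_sum (U := LS L D) hxA (hneL L) (F := FL) (fun K hK T₁ T₂ h1 h2 => by convert hFL L A K hK T₁ T₂ h1 h2) (fun _ => 1)
      simp only [mul_one, one_mul] at this; exact this)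
    (by
      intro A hA hxA; have := cmp_sum (U := EE D) hxA hneE (F := FM D) (fun K hK T₁ T₂ h1 h2 => by convert hFM A K hK T₁ T₂ h1 h2) (fun _ => 1)
      simp only [mul_one, one_mul] at this; exact this) hZ
  set g : FLat → ℝ := fun K => ind (∃ y ∈ S, y ∈ K) with hg
  have hgL : ∀ {O : Type} (sp : O → FLat) (T : Finset O), g (cmp sp T D x) = ind (∃ y ∈ S, y ∈ D ∧ gC sp T x y) := by intro O sp T; simp only [hg, cmp, Finset.mem_filter]
  have hlim : Filter.Tendsto (fun L => Pr pr (LS L D) (fun T => ∃ y ∈ S, y ∈ D ∧ gC spL T x y)) Filter.atTop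
      (nhds ((∑ ω ∈ (EE D).powerset, FM D ω * ind (∃ y ∈ S, y ∈ D ∧ gC spE ω x y)) / ZG D D)) := by
    have e1 : ∀ L, Pr pr (LS L D) (fun T => ∃ y ∈ S, y ∈ D ∧ gC spL T x y) =
        (∑ K ∈ D.powerset.filter (x ∈ ·), g K * (aa spL (LS L D) FL x K * ZZ spL (LS L D) FL (D \ K))) / ZZ spL (LS L D) FL D := by
      intro L
      rw [Pr_FL, ← cmp_sum (U := LS L D) hx (hneL L) (F := FL) (fun K hK T₁ T₂ h1 h2 => by convert hFL L D K hK T₁ T₂ h1 h2) g, UU_LS (Finset.Subset.refl D), ZZ_LS (Finset.Subset.refl D)]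
      congr 1; apply sum_congr rfl; intro T _; rw [hgL]
    have e2 : (∑ ω ∈ (EE D).powerset, FM D ω * ind (∃ y ∈ S, y ∈ D ∧ gC spE ω x y)) =
        ∑ K ∈ D.powerset.filter (x ∈ ·), g K * (aa spE (EE D) (FM D) x K * ZZ spE (EE D) (FM D) (D \ K)) := by
      rw [← cmp_sum (U := EE D) hx hneE (F := FM D) (fun K hK T₁ T₂ h1 h2 => by convert hFM D K hK T₁ T₂ h1 h2) g, UU_EE (Finset.Subset.refl D)]
      apply sum_congr rfl; intro ω _; rw [hgL]
    simp_rw [e1]; rw [e2, ← ZZ_FM (Finset.Subset.refl D)]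
    refine Filter.Tendsto.div ?_ (hZ D (Finset.Subset.refl D)) ?_
    · apply tendsto_finset_sum; intro K hK
      rw [Finset.mem_filter, Finset.mem_powerset] at hK; exact ((ha K hK.1 hK.2).mul (hZ _ Finset.sdiff_subset)).const_mul _
    · rw [ZZ_FM (Finset.Subset.refl D)]; obtain ⟨lam, _, _, h3⟩ := ZG_diag (Finset.Subset.refl D); rw [h3]; exact (exp_pos _).ne'
  refine ge_of_tendsto hlim ?_
  filter_upwards [Filter.eventually_ge_atTop L] with L' hL'
  have hdec : Decr (fun T : FLp => ¬ ∃ y ∈ S, y ∈ D ∧ gC spL T x y) := by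
    intro T T' hT h hc; apply h; obtain ⟨y, hy, hyD, hc⟩ := hc; exact ⟨y, hy, hyD, hc.mono hT⟩
  have := Pr_anti_s (fun i => pr_bd i) (LS_mono hL' (Finset.Subset.refl D)) hdec
  rw [Pr_not, Pr_not] at this
  linarith

/-! ### Sign symmetrization -/

def sm (σ : Sg D) (φ : Fd D) : Fd D := fun i => sg σ i.1 * φ i

def ab (φ : Fd D) : Fd D := fun i => |φ i|

def wD (φ : Fd D) : ℝ := exp (∑ e ∈ EE D, JJ φ e) * gw φ

lemma ex_sm (σ : Sg D) (φ : Fd D) (v : Lat) : ex (sm σ φ) v = sg σ v * ex φ v := by unfold ex sm; split_ifs <;> simp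

lemma ex_ab (φ : Fd D) (v : Lat) : ex (ab φ) v = |ex φ v| := by unfold ex ab; split_ifs <;> simp

lemma JJ_sm (σ : Sg D) (φ : Fd D) (e : Ed) : JJ (sm σ φ) e = JJ φ e * es σ e := by unfold JJ es; rw [ex_sm, ex_sm]; ring

lemma JJ_ab (φ : Fd D) (e : Ed) : JJ (ab φ) e = |JJ φ e| := by unfold JJ; rw [ex_ab, ex_ab, abs_div, abs_mul]; norm_num

lemma sg_sq (σ : Sg D) (v : Lat) : sg σ v * sg σ v = 1 := by rcases sg_cases σ v with h | h <;> rw [h] <;> norm_num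

lemma gw_sm (σ : Sg D) (φ : Fd D) : gw (sm σ φ) = gw φ := by
  unfold gw n2 sm
  congr 3; apply sum_congr rfl; intro i _
  rw [mul_pow, sq (sg σ _), sg_sq, one_mul]

lemma gw_ab (φ : Fd D) : gw (ab φ) = gw φ := by
  unfold gw n2 ab
  congr 3; apply sum_congr rfl; intro i _
  exact sq_abs _

lemma sm_sm (σ τ : Sg D) (φ : Fd D) : sm σ (sm τ φ) = sm (σ * τ) φ := by ext i; unfold sm; rw [sg_mul]; ring

lemma sm_invol (σ : Sg D) : Function.Involutive (sm σ) := by intro φ; ext i; unfold sm; rw [← mul_assoc, sg_sq, one_mul]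

lemma exists_ab (φ : Fd D) : ∃ τ : Sg D, sm τ (ab φ) = φ := by
  refine ⟨fun i => if 0 ≤ φ i then 1 else -1, ?_⟩
  ext i; unfold sm ab sg
  simp only [i.2, dif_pos, Subtype.coe_eta]
  split_ifs with h
  · simp [abs_of_nonneg h]
  · push Not at h; simp [abs_of_neg h]

lemma sm_meas (σ : Sg D) : Measurable (sm σ) := by unfold sm; fun_prop

lemma ab_meas : Measurable (ab (D := D)) := by unfold ab; fun_prop

lemma sm_mp (σ : Sg D) : MeasurePreserving (sm σ) (volume : Measure (Fd D)) volume := by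
  have : ∀ i : ↥D, MeasurePreserving (fun x : ℝ => sg σ i.1 * x) volume volume := by
    intro i; rcases sg_cases σ i.1 with h | h
    · simp only [h, one_mul]; exact MeasurePreserving.id _
    · simp only [h, neg_one_mul]; exact Measure.measurePreserving_neg _
  exact volume_preserving_pi this

lemma int_sm (σ : Sg D) (F : Fd D → ℝ) : ∫ φ, F (sm σ φ) = ∫ φ, F φ := (sm_mp σ).integral_comp (MeasurableEquiv.ofInvolutive (sm σ) (sm_invol σ) (sm_meas σ)).measurableEmbedding F

def nS (D : FLat) : ℝ := (Fintype.card (Sg D) : ℝ)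

lemma nS_pos (D : FLat) : 0 < nS D := by unfold nS; exact_mod_cast Fintype.card_pos

lemma sum_ab (F : Fd D → ℝ) (φ : Fd D) : ∑ σ, F (sm σ φ) = ∑ σ, F (sm σ (ab φ)) := by
  obtain ⟨τ, hτ⟩ := exists_ab φ
  rw [← Equiv.sum_comp (Equiv.mulRight τ) (fun σ => F (sm σ (ab φ)))]
  apply sum_congr rfl; intro σ _
  rw [Equiv.coe_mulRight, ← sm_sm, hτ]

lemma int_sym {F : Fd D → ℝ} (hF : Integrable F) : ∫ φ, ∑ σ, F (sm σ (ab φ)) = nS D * ∫ φ, F φ := by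
  simp_rw [← sum_ab]
  rw [integral_finset_sum]
  · simp_rw [int_sm]
    rw [sum_const, nsmul_eq_mul, nS, card_univ]
  · intro σ _; exact (sm_mp σ).integrable_comp_of_integrable hF

/-- symmetrized edge weights -/
def Aw (ω : Finset Ed) (φ : Fd D) : ℝ := ∑ σ : Sg D, ∏ e ∈ ω, (exp (JJ (ab φ) e * es σ e) - 1)

lemma JJ_ab_nonneg (φ : Fd D) (e : Ed) : 0 ≤ JJ (ab φ) e := by rw [JJ_ab]; exact abs_nonneg _

lemma Aw_eq (ω : Finset Ed) (φ : Fd D) :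
    Aw ω φ = ∑ σ : Sg D, 1 * ∏ e ∈ ω, ((cosh (JJ (ab φ) e) - 1) + sinh (JJ (ab φ) e) * es σ e) := by
  unfold Aw
  apply sum_congr rfl; intro σ _
  rw [one_mul]; apply prod_congr rfl; intro e _
  rw [exp_es]; ring

lemma Aw_nonneg (ω : Finset Ed) (φ : Fd D) : 0 ≤ Aw ω φ := by
  rw [Aw_eq]
  exact (GK.one.prod (u := fun e => cosh (JJ (ab φ) e) - 1) (v := fun e => sinh (JJ (ab φ) e))
    (fun e => by linarith [one_le_cosh (JJ (ab φ) e)]) (fun e => sinh_nonneg_iff.2 (JJ_ab_nonneg φ e)) ω).nonneg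

lemma Aw_mono (ω : Finset Ed) {φ ψ : Fd D} (h : ∀ i, |φ i| ≤ |ψ i|) : Aw ω φ ≤ Aw ω ψ := by
  have hex : ∀ v, |ex φ v| ≤ |ex ψ v| := by
    intro v; unfold ex; split_ifs with hv
    · exact h _
    · exact le_refl _
  have hJ : ∀ e, JJ (ab φ) e ≤ JJ (ab ψ) e := by
    intro e; unfold JJ; rw [ex_ab, ex_ab, ex_ab, ex_ab]; have := mul_le_mul (hex e.1) (hex e.2) (abs_nonneg _) (abs_nonneg _); linarith
  rw [Aw_eq, Aw_eq]
  exact gk_prod_mono GK.one (u := fun e => cosh (JJ (ab φ) e) - 1) (v := fun e => sinh (JJ (ab φ) e))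
    (u' := fun e => cosh (JJ (ab ψ) e) - 1) (v' := fun e => sinh (JJ (ab ψ) e))
    (fun e => by linarith [one_le_cosh (JJ (ab φ) e)]) (fun e => sinh_nonneg_iff.2 (JJ_ab_nonneg φ e))
    (fun e => by
      have : cosh (JJ (ab φ) e) ≤ cosh (JJ (ab ψ) e) := by rw [Real.cosh_le_cosh, abs_of_nonneg (JJ_ab_nonneg φ e), abs_of_nonneg (JJ_ab_nonneg ψ e)]; exact hJ e
      simpa using this) (fun e => Real.sinh_le_sinh.2 (hJ e)) ω

lemma Aw_meas (ω : Finset Ed) : Measurable (fun φ : Fd D => Aw ω φ) := by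
  unfold Aw
  refine Finset.measurable_sum _ fun σ _ => Finset.measurable_prod _ fun e _ => ?_
  exact (measurable_exp.comp (((JJ_meas e).comp ab_meas).mul_const _)).sub_const 1

/-- total symmetrized weight -/
def Etot (φ : Fd D) : ℝ := ∑ σ : Sg D, ∏ e ∈ EE D, exp (JJ (ab φ) e * es σ e)

lemma sum_Aw (φ : Fd D) : ∑ ω ∈ (EE D).powerset, Aw ω φ = Etot φ := by
  unfold Aw Etot
  rw [sum_comm]
  apply sum_congr rfl; intro σ _
  rw [← prod_add_one]
  apply prod_congr rfl; intro e _; ring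

lemma Etot_le (φ : Fd D) : Etot φ ≤ nS D * exp (∑ e ∈ EE D, |JJ φ e|) := by
  unfold Etot nS
  rw [← card_univ, ← nsmul_eq_mul, ← sum_const]
  apply Finset.sum_le_sum; intro σ _
  rw [exp_sum]
  apply prod_le_prod (fun _ _ => (exp_pos _).le)
  intro e _
  rw [exp_le_exp, JJ_ab]
  rcases sg2_cases σ e.1 e.2 with h | h <;> rw [es, h]
  · simp
  · have := abs_nonneg (JJ φ e); linarith

lemma wD_sm (σ : Sg D) (φ : Fd D) : wD (sm σ (ab φ)) = (∏ e ∈ EE D, exp (JJ (ab φ) e * es σ e)) * gw φ := by unfold wD; rw [gw_sm, gw_ab, exp_sum]; simp_rw [JJ_sm]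

lemma wD_meas : Measurable (fun φ : Fd D => wD φ) := Measurable.mul (measurable_exp.comp (Finset.measurable_sum _ (fun e _ => JJ_meas e))) gw_meas

lemma wD_pos (φ : Fd D) : 0 < wD φ := mul_pos (exp_pos _) (gw_pos _)

lemma wD_le (φ : Fd D) : wD φ ≤ exp (∑ e ∈ EE D, |JJ φ e|) * gw φ := by
  unfold wD
  refine mul_le_mul_of_nonneg_right (exp_le_exp.2 (Finset.sum_le_sum fun e _ => le_abs_self _)) (gw_pos φ).le

lemma wD_int2 (u v : Lat) : Integrable (fun φ : Fd D => ex φ u * ex φ v * wD φ) := by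
  refine int_dom (C := 1) (((ex_meas u).mul (ex_meas v)).mul wD_meas) zero_le_one u v (fun φ => ?_)
  rw [abs_mul, abs_of_pos (wD_pos φ), one_mul, mul_assoc]
  exact mul_le_mul (by linarith) (wD_le φ) (wD_pos φ).le (by positivity)

lemma wD_int : Integrable (fun φ : Fd D => wD φ) := by
  refine int_dom (C := 1) wD_meas zero_le_one 0 0 (fun φ => ?_)
  rw [abs_of_pos (wD_pos φ), one_mul, mul_assoc]
  have h := abs_nonneg (ex φ 0 * ex φ 0)
  have h2 : 0 < exp (∑ e ∈ EE D, |JJ φ e|) * gw φ := mul_pos (exp_pos _) (gw_pos _)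
  nlinarith [wD_le φ]

lemma Zw_pos (D : FLat) : 0 < ∫ φ : Fd D, wD φ := integral_pos_of_integrable_nonneg_nonzero (x := 0) (by unfold wD gw n2 JJ ex; refine Continuous.mul (Real.continuous_exp.comp (continuous_finset_sum _ fun e _ => ?_)) (by fun_prop); split_ifs <;> fun_prop) wD_int (fun φ => (wD_pos φ).le) (wD_pos _).ne'

lemma ind_meas (x : Lat) (t c : ℝ) : Measurable (fun φ : Fd D => ind (|ex φ x - c| < t)) := by
  unfold ind
  refine Measurable.ite ?_ measurable_const measurable_const
  exact measurableSet_lt (((ex_meas x).sub_const c).abs) measurable_const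

lemma wD_int_ind (x : Lat) (t c : ℝ) : Integrable (fun φ : Fd D => ind (|ex φ x - c| < t) * wD φ) := by
  refine Integrable.mono' wD_int ((ind_meas x t c).mul wD_meas).aestronglyMeasurable (Filter.Eventually.of_forall fun φ => ?_)
  rw [Real.norm_eq_abs, abs_of_nonneg (mul_nonneg (ind_nonneg _) (wD_pos φ).le)]
  have := ind_le_one (|ex φ x - c| < t); nlinarith [wD_pos φ]

/-- removal of a factor by shifting the corresponding coordinate -/
lemma shift_bd {f : Fd D → ℝ} (h0 : ∀ φ, 0 ≤ f φ) (hm : ∀ φ ψ : Fd D, (∀ i, |φ i| ≤ |ψ i|) → f φ ≤ f ψ) {y : Lat} (hy : y ∈ D)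
    (hi : Integrable (fun φ => f φ * gw φ)) (hi' : Integrable (fun φ => |ex φ y| * f φ * gw φ)) :
    ∫ φ, f φ * gw φ ≤ 11 * ∫ φ, |ex φ y| * f φ * gw φ := by
  set G : Fd D → ℝ := fun φ => |ex φ y| * f φ * gw φ with hG
  have hG0 : ∀ φ, 0 ≤ G φ := fun φ => mul_nonneg (mul_nonneg (abs_nonneg _) (h0 φ)) (gw_pos φ).le
  let u : Fd D := Pi.single ⟨y, hy⟩ 1
  have hexy : ∀ φ : Fd D, ex φ y = φ ⟨y, hy⟩ := fun φ => by simp [ex, hy]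
  have hu : ∀ (φ : Fd D) (s : ℝ), ex (φ + s • u) y = ex φ y + s := by intro φ s; rw [hexy, hexy]; simp [u]
  have hn : ∀ (φ : Fd D) (s : ℝ), n2 (φ + s • u) = n2 φ + (2 * s * ex φ y + s^2) := by
    intro φ s
    have h1 : ∀ i, (φ + s • u) i ^ 2 = φ i^2 + (if i = ⟨y, hy⟩ then (2 * s * ex φ y + s^2) else 0) := by
      intro i; by_cases h : i = ⟨y, hy⟩
      · subst h; rw [hexy]; simp [u]; ring
      · simp [u, h]
    unfold n2; simp_rw [h1]; rw [sum_add_distrib]; simp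
  have key : ∀ (φ : Fd D) (s : ℝ), |s| = 1 → |ex φ y| ≤ 1 → 0 ≤ s * ex φ y → f φ * gw φ ≤ 5 * G (φ + s • u) := by
    intro φ s hs h1 h2; have hs2 : s^2 = 1 := by rw [← sq_abs, hs]; norm_num
    have e1 : gw φ ≤ 5 * gw (φ + s • u) := by
      unfold gw; rw [hn, hs2]
      have : exp (-(n2 φ/2)) = exp (s * ex φ y + 1/2) * exp (-((n2 φ + (2*s*ex φ y + 1))/2)) := by rw [← exp_add]; congr 1; ring
      rw [this]; refine mul_le_mul_of_nonneg_right ?_ (exp_pos _).le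
      have h3 : s * ex φ y ≤ 1 := by
        calc s * ex φ y ≤ |s * ex φ y| := le_abs_self _
          _ ≤ 1 := by rw [abs_mul, hs, one_mul]; exact h1
      calc exp (s * ex φ y + 1/2) ≤ exp (3/2) := exp_le_exp.2 (by linarith)
        _ ≤ 5 := by
          have h4 := Real.exp_one_lt_d9; have h5 : exp (3/2) ^ 2 = exp 1 ^ 3 := by rw [← Real.exp_nat_mul, ← Real.exp_nat_mul]; norm_num
          have h6 : exp 1 ^ 3 ≤ 2.7182818286^3 := pow_le_pow_left₀ (exp_pos _).le h4.le 3
          have h7 := exp_pos (3/2); nlinarith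
    have e2 : f φ ≤ f (φ + s • u) := by
      apply hm; intro i
      by_cases h : i = ⟨y, hy⟩
      · subst h; have a1 := hu φ s; rw [hexy, hexy] at a1; rw [a1]; rw [hexy] at h2; apply sq_le_sq.1; nlinarith
      · simp [u, h]
    have e3 : 1 ≤ |ex (φ + s • u) y| := by rw [hu, ← sq_le_sq₀ (by norm_num) (abs_nonneg _), sq_abs]; nlinarith [sq_nonneg (ex φ y)]
    have p1 := h0 φ; have p2 := gw_pos (φ + s • u)
    calc f φ * gw φ ≤ f (φ + s • u) * (5 * gw (φ + s • u)) := mul_le_mul e2 e1 (gw_pos _).le (h0 _)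
      _ = 5 * (1 * f (φ + s • u) * gw (φ + s • u)) := by ring
      _ ≤ 5 * G (φ + s • u) := by
        simp only [hG]; have := h0 (φ + s • u); gcongr
  have hpt : ∀ φ, f φ * gw φ ≤ G φ + 5 * G (φ + (1:ℝ) • u) + 5 * G (φ + (-1:ℝ) • u) := by
    intro φ; have a1 := hG0 φ; have a2 := hG0 (φ + (1:ℝ) • u); have a3 := hG0 (φ + (-1:ℝ) • u); rcases le_total 1 |ex φ y| with h | h
    · have : f φ * gw φ ≤ G φ := by
        simp only [hG]; have b := mul_nonneg (h0 φ) (gw_pos φ).le; rw [mul_assoc]; nlinarith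
      linarith
    · rcases le_total 0 (ex φ y) with h2 | h2
      · have := key φ 1 (by simp) h (by linarith); linarith
      · have := key φ (-1) (by simp) h (by linarith); linarith
  have i1 : Integrable (fun φ => G (φ + (1:ℝ) • u)) := hi'.comp_add_right _
  have i2 : Integrable (fun φ => G (φ + (-1:ℝ) • u)) := hi'.comp_add_right _
  have i3 : Integrable (fun φ => G φ + 5 * G (φ + (1:ℝ) • u)) := hi'.add (i1.const_mul 5)
  calc ∫ φ, f φ * gw φ ≤ ∫ φ, (G φ + 5 * G (φ + (1:ℝ) • u) + 5 * G (φ + (-1:ℝ) • u)) :=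
        integral_mono hi (i3.add (i2.const_mul 5)) hpt
    _ = 11 * ∫ φ, G φ := by
        rw [integral_add i3 (i2.const_mul 5), integral_add hi' (i1.const_mul 5), integral_const_mul, integral_const_mul,
          integral_add_right_eq_self, integral_add_right_eq_self]
        ring

def By (x y : Lat) (φ : Fd D) : ℝ := ∑ ω ∈ (EE D).powerset.filter (fun ω => gC spE ω x y), Aw ω φ

lemma By_nonneg (x y : Lat) (φ : Fd D) : 0 ≤ By x y φ := Finset.sum_nonneg fun ω _ => Aw_nonneg ω φ

lemma By_le (x y : Lat) (φ : Fd D) : By x y φ ≤ nS D * exp (∑ e ∈ EE D, |JJ φ e|) := by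
  refine le_trans ?_ ((sum_Aw φ).le.trans (Etot_le φ))
  exact sum_le_sum_of_subset_of_nonneg (Finset.filter_subset _ _) (fun _ _ _ => Aw_nonneg _ _)

lemma By_meas (x y : Lat) : Measurable (fun φ : Fd D => By x y φ) := by unfold By; exact Finset.measurable_sum _ fun ω _ => Aw_meas ω

lemma By_int1 (x y : Lat) : Integrable (fun φ : Fd D => |ex φ x| * By x y φ * gw φ) := by
  refine int_dom (C := nS D) (((ex_meas x).abs.mul (By_meas x y)).mul gw_meas) (nS_pos D).le x x (fun φ => ?_)
  have h1 := By_nonneg x y φ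
  rw [abs_of_nonneg (mul_nonneg (mul_nonneg (abs_nonneg _) h1) (gw_pos φ).le)]
  refine mul_le_mul_of_nonneg_right ?_ (gw_pos φ).le
  have h2 : |ex φ x| ≤ 1 + |ex φ x * ex φ x| := by rw [abs_mul]; nlinarith [sq_nonneg (|ex φ x| - 1), abs_nonneg (ex φ x)]
  calc |ex φ x| * By x y φ ≤ (1 + |ex φ x * ex φ x|) * (nS D * exp (∑ e ∈ EE D, |JJ φ e|)) :=
        mul_le_mul h2 (By_le x y φ) h1 (by positivity)
    _ = _ := by ring

lemma By_int2 (x y : Lat) : Integrable (fun φ : Fd D => |ex φ y| * (|ex φ x| * By x y φ) * gw φ) := by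
  refine int_dom (C := nS D) (((ex_meas y).abs.mul ((ex_meas x).abs.mul (By_meas x y))).mul gw_meas) (nS_pos D).le x y (fun φ => ?_)
  have h1 := By_nonneg x y φ
  rw [abs_of_nonneg (mul_nonneg (mul_nonneg (abs_nonneg _) (mul_nonneg (abs_nonneg _) h1)) (gw_pos φ).le)]
  refine mul_le_mul_of_nonneg_right ?_ (gw_pos φ).le
  calc |ex φ y| * (|ex φ x| * By x y φ) = |ex φ x * ex φ y| * By x y φ := by rw [abs_mul]; ring
    _ ≤ (1 + |ex φ x * ex φ y|) * (nS D * exp (∑ e ∈ EE D, |JJ φ e|)) := mul_le_mul (by linarith) (By_le x y φ) h1 (by positivity)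
    _ = _ := by ring

lemma By_fk (x y : Lat) (φ : Fd D) : |ex φ y| * (|ex φ x| * By x y φ) * gw φ ≤
    ∑ σ, (fun φ : Fd D => ex φ x * ex φ y * wD φ) (sm σ (ab φ)) := by
  have h := fk_bound (D := D) (J := JJ (ab φ)) (JJ_ab_nonneg φ) (EE D) x y
  have h1 : ∑ σ, (fun φ : Fd D => ex φ x * ex φ y * wD φ) (sm σ (ab φ)) =
      (|ex φ x| * |ex φ y| * gw φ) * ∑ σ : Sg D, sg σ x * sg σ y * ∏ e ∈ EE D, exp (JJ (ab φ) e * es σ e) := by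
    rw [mul_sum]; apply sum_congr rfl; intro σ _; simp only [wD_sm, ex_sm, ex_ab]; ring
  rw [h1]
  calc |ex φ y| * (|ex φ x| * By x y φ) * gw φ = (|ex φ x| * |ex φ y| * gw φ) * By x y φ := by ring
    _ ≤ _ := mul_le_mul_of_nonneg_left h (mul_nonneg (mul_nonneg (abs_nonneg _) (abs_nonneg _)) (gw_pos φ).le)

lemma int_sum_sm {F : Fd D → ℝ} (hF : Integrable F) : Integrable (fun φ => ∑ σ, F (sm σ (ab φ))) := by
  simp_rw [← sum_ab]
  exact integrable_finset_sum _ fun σ _ => (sm_mp σ).integrable_comp_of_integrable hF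

lemma By_bound (x : Lat) {y : Lat} (hy : y ∈ D) :
    ∫ φ : Fd D, |ex φ x| * By x y φ * gw φ ≤ 11 * (nS D * ∫ φ : Fd D, ex φ x * ex φ y * wD φ) := by
  refine (shift_bd (f := fun φ => |ex φ x| * By x y φ) (fun φ => mul_nonneg (abs_nonneg _) (By_nonneg x y φ)) ?_ hy (By_int1 x y) (By_int2 x y)).trans ?_
  · intro φ ψ h
    have hex : ∀ v, |ex φ v| ≤ |ex ψ v| := by
      intro v; unfold ex; split_ifs with hv
      · exact h _
      · exact le_refl _
    exact mul_le_mul (hex x) (Finset.sum_le_sum fun ω _ => Aw_mono ω h) (By_nonneg x y φ) (abs_nonneg _)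
  · rw [← int_sym (wD_int2 x y)]; exact mul_le_mul_of_nonneg_left (integral_mono (By_int2 x y) (int_sum_sm (wD_int2 x y)) (By_fk x y)) (by norm_num)

lemma cov_nonneg (x y : Lat) : 0 ≤ ∫ φ : Fd D, ex φ x * ex φ y * wD φ := by
  have h : 0 ≤ nS D * ∫ φ : Fd D, ex φ x * ex φ y * wD φ := by
    rw [← int_sym (wD_int2 x y)]; refine integral_nonneg fun φ => le_trans ?_ (By_fk x y φ)
    exact mul_nonneg (mul_nonneg (abs_nonneg _) (mul_nonneg (abs_nonneg _) (By_nonneg x y φ))) (gw_pos φ).le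
  exact nonneg_of_mul_nonneg_right h (nS_pos D)

lemma arm_bound {x : Lat} {S : FLat} (hS : S ⊆ D) {t : ℝ} (ht : 0 < t) : (∑ ω ∈ (EE D).powerset, FM D ω * ind (∃ y ∈ S, y ∈ D ∧ gC spE ω x y)) / ZG D D ≤
      ((∫ φ : Fd D, ind (|ex φ x - 0| < t) * wD φ) + 11 / t * ∑ y ∈ S, ∫ φ : Fd D, ex φ x * ex φ y * wD φ) / ∫ φ : Fd D, wD φ := by
  have hA : ∀ ω ∈ (EE D).powerset, nS D * (∫ φ : Fd D, (∏ e ∈ ω, (exp (JJ φ e) - 1)) * gw φ) = ∫ φ : Fd D, Aw ω φ * gw φ := by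
    intro ω hω; rw [← int_sym (FM_int (Finset.mem_powerset.1 hω))]; congr 1; ext φ; rw [Aw, sum_mul]; apply sum_congr rfl; intro σ _
    rw [gw_sm, gw_ab]; simp_rw [JJ_sm]
  have hAi : ∀ ω ∈ (EE D).powerset, Integrable (fun φ : Fd D => Aw ω φ * gw φ) := by
    intro ω hω; have := int_sum_sm (FM_int (Finset.mem_powerset.1 hω)); refine this.congr (Filter.Eventually.of_forall fun φ => ?_)
    show _ = Aw ω φ * gw φ
    rw [Aw, sum_mul]; apply sum_congr rfl; intro σ _; rw [gw_sm, gw_ab]; simp_rw [JJ_sm]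
  have hZ : ZG D D = (∫ φ : Fd D, wD φ) / ∫ φ : Fd D, gw φ := rfl
  have hg := int_gw_pos D
  have e1 : (∑ ω ∈ (EE D).powerset, FM D ω * ind (∃ y ∈ S, y ∈ D ∧ gC spE ω x y)) / ZG D D =
      (∑ ω ∈ (EE D).powerset, (∫ φ : Fd D, (∏ e ∈ ω, (exp (JJ φ e) - 1)) * gw φ) * ind (∃ y ∈ S, y ∈ D ∧ gC spE ω x y)) / ∫ φ : Fd D, wD φ := by
    have : ∑ ω ∈ (EE D).powerset, FM D ω * ind (∃ y ∈ S, y ∈ D ∧ gC spE ω x y) =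
        (∑ ω ∈ (EE D).powerset, (∫ φ : Fd D, (∏ e ∈ ω, (exp (JJ φ e) - 1)) * gw φ) * ind (∃ y ∈ S, y ∈ D ∧ gC spE ω x y)) / ∫ φ : Fd D, gw φ := by
      rw [sum_div]; apply sum_congr rfl; intro ω _; rw [FM]; ring
    rw [this, hZ, div_div_div_cancel_right₀ hg.ne']
  rw [e1]
  refine div_le_div_of_nonneg_right ?_ (Zw_pos D).le
  refine le_of_mul_le_mul_left ?_ (nS_pos D)
  have e2 : nS D * ∑ ω ∈ (EE D).powerset, (∫ φ : Fd D, (∏ e ∈ ω, (exp (JJ φ e) - 1)) * gw φ) * ind (∃ y ∈ S, y ∈ D ∧ gC spE ω x y) =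
      ∫ φ : Fd D, ∑ ω ∈ (EE D).powerset, Aw ω φ * gw φ * ind (∃ y ∈ S, y ∈ D ∧ gC spE ω x y) := by
    rw [integral_finset_sum _ (fun ω hω => (hAi ω hω).mul_const _), mul_sum]
    apply sum_congr rfl; intro ω hω
    rw [← mul_assoc, hA ω hω, integral_mul_const]
  rw [e2]
  set F2 : Fd D → ℝ := fun φ => ind (|ex φ x - 0| < t) * wD φ with hF2
  have hF2i : Integrable F2 := wD_int_ind x t 0
  have hF2s : ∀ φ, ∑ σ, F2 (sm σ (ab φ)) = ind (|ex φ x - 0| < t) * (Etot φ * gw φ) := by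
    intro φ; rw [Etot, sum_mul, mul_sum]; apply sum_congr rfl; intro σ _; simp only [hF2, wD_sm, ex_sm, ex_ab, sub_zero]; congr 2
    rcases sg_cases σ x with h | h <;> rw [h] <;> simp
  have hpt : ∀ φ : Fd D, ∑ ω ∈ (EE D).powerset, Aw ω φ * gw φ * ind (∃ y ∈ S, y ∈ D ∧ gC spE ω x y) ≤
      ∑ σ, F2 (sm σ (ab φ)) + 1/t * ∑ y ∈ S, |ex φ x| * By x y φ * gw φ := by
    intro φ; rw [hF2s]
    have hBn : 0 ≤ ∑ y ∈ S, |ex φ x| * By x y φ * gw φ := Finset.sum_nonneg fun y _ => mul_nonneg (mul_nonneg (abs_nonneg _) (By_nonneg x y φ)) (gw_pos φ).le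
    by_cases h : |ex φ x - 0| < t
    · rw [ind_true h, one_mul, ← sum_Aw, sum_mul]
      have : ∑ ω ∈ (EE D).powerset, Aw ω φ * gw φ * ind (∃ y ∈ S, y ∈ D ∧ gC spE ω x y) ≤ ∑ ω ∈ (EE D).powerset, Aw ω φ * gw φ := by
        apply Finset.sum_le_sum; intro ω _
        have h1 := ind_le_one (∃ y ∈ S, y ∈ D ∧ gC spE ω x y); have h2 := mul_nonneg (Aw_nonneg ω φ) (gw_pos φ).le; nlinarith
      have h3 : 0 ≤ 1/t * ∑ y ∈ S, |ex φ x| * By x y φ * gw φ := by positivity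
      linarith
    · rw [ind_false h, zero_mul, zero_add]; rw [sub_zero] at h; push Not at h
      have h1 : ∑ ω ∈ (EE D).powerset, Aw ω φ * gw φ * ind (∃ y ∈ S, y ∈ D ∧ gC spE ω x y) ≤ ∑ y ∈ S, By x y φ * gw φ := by
        have : ∀ y ∈ S, By x y φ * gw φ = ∑ ω ∈ (EE D).powerset, Aw ω φ * gw φ * ind (gC spE ω x y) := by
          intro y _; rw [By, sum_filter, sum_mul]; apply sum_congr rfl; intro ω _; unfold ind; split_ifs <;> simp
        rw [sum_congr rfl this, sum_comm]; apply Finset.sum_le_sum; intro ω _; rw [← mul_sum]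
        refine mul_le_mul_of_nonneg_left ?_ (mul_nonneg (Aw_nonneg ω φ) (gw_pos φ).le)
        by_cases hc : ∃ y ∈ S, y ∈ D ∧ gC spE ω x y
        · rw [ind_true hc]; obtain ⟨y, hy, _, hg⟩ := hc; rw [← ind_true hg]
          exact Finset.single_le_sum (f := fun y => ind (gC spE ω x y)) (fun _ _ => ind_nonneg _) hy
        · rw [ind_false hc]; exact Finset.sum_nonneg fun _ _ => ind_nonneg _
      refine h1.trans ?_
      rw [mul_sum]; apply Finset.sum_le_sum; intro y _; have h2 := mul_nonneg (By_nonneg x y φ) (gw_pos φ).le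
      have h3 : 1 ≤ 1/t * |ex φ x| := by rw [one_div, ← div_eq_inv_mul, le_div_iff₀ ht]; linarith
      calc By x y φ * gw φ = 1 * (By x y φ * gw φ) := by ring
        _ ≤ (1/t * |ex φ x|) * (By x y φ * gw φ) := mul_le_mul_of_nonneg_right h3 h2
        _ = _ := by ring
  have i1 := int_sum_sm hF2i
  have i2 : Integrable (fun φ : Fd D => ∑ y ∈ S, |ex φ x| * By x y φ * gw φ) := integrable_finset_sum _ fun y _ => By_int1 x y
  calc _ ≤ ∫ φ : Fd D, (∑ σ, F2 (sm σ (ab φ)) + 1/t * ∑ y ∈ S, |ex φ x| * By x y φ * gw φ) :=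
        integral_mono (integrable_finset_sum _ fun ω hω => (hAi ω hω).mul_const _) (i1.add (i2.const_mul _)) hpt
    _ = nS D * (∫ φ, F2 φ) + 1/t * ∑ y ∈ S, ∫ φ : Fd D, |ex φ x| * By x y φ * gw φ := by rw [integral_add i1 (i2.const_mul _), int_sym hF2i, integral_const_mul, integral_finset_sum _ fun y _ => By_int1 x y]
    _ ≤ nS D * (∫ φ, F2 φ) + 1/t * ∑ y ∈ S, 11 * (nS D * ∫ φ : Fd D, ex φ x * ex φ y * wD φ) := by
        gcongr with y hy
        exact By_bound x (hS hy)
    _ = _ := by rw [← mul_sum, ← mul_sum]; ring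

/-! ### Covariance sum and small balls for the free field -/

def qq (φ : Fd D) : ℝ := ∑ e ∈ EE D, JJ φ e - n2 φ / 2

def bq (φ f : Fd D) : ℝ := ∑ a ∈ D, ex φ a * ((∑ b ∈ D, if Adj a b then ex f b / 4 else 0) - ex f a)

lemma wD_qq (φ : Fd D) : wD φ = exp (qq φ) := by unfold wD gw qq; rw [← exp_add]; rfl

lemma ex_add (φ f : Fd D) (s : ℝ) (v : Lat) : ex (φ + s • f) v = ex φ v + s * ex f v := by unfold ex; split_ifs <;> simp

lemma qq_add (φ f : Fd D) (s : ℝ) : qq (φ + s • f) = qq φ + s * bq φ f + s^2 * qq f := by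
  have h1 := sum_EE D (fun a b => ex φ a * ex f b / 4)
  have h2 : bq φ f = ∑ e ∈ EE D, (ex φ e.1 * ex f e.2 / 4 + ex φ e.2 * ex f e.1 / 4) - ∑ a ∈ D, ex φ a * ex f a := by
    rw [h1, bq, ← sum_sub_distrib]; apply sum_congr rfl; intro a _; rw [mul_sub, mul_sum]; congr 1; apply sum_congr rfl; intro b _; split_ifs <;> ring
  rw [h2]
  unfold qq
  simp_rw [n2_ex]
  unfold JJ
  simp_rw [ex_add]
  rw [mul_sub, mul_sum, mul_sum, mul_sub, mul_sum, sum_div, sum_div, sum_div, mul_sum]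
  have e1 : ∑ e ∈ EE D, (ex φ e.1 + s * ex f e.1) * (ex φ e.2 + s * ex f e.2) / 4 = ∑ e ∈ EE D, ex φ e.1 * ex φ e.2 / 4 +
      ∑ e ∈ EE D, s * (ex φ e.1 * ex f e.2 / 4 + ex φ e.2 * ex f e.1 / 4) + ∑ e ∈ EE D, s^2 * (ex f e.1 * ex f e.2 / 4) := by
    rw [← sum_add_distrib, ← sum_add_distrib]; apply sum_congr rfl; intro e _; ring
  have e2 : ∑ a ∈ D, (ex φ a + s * ex f a)^2/2 = ∑ a ∈ D, ex φ a^2/2 + ∑ a ∈ D, s * (ex φ a * ex f a) + ∑ a ∈ D, s^2 * (ex f a^2/2) := by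
    rw [← sum_add_distrib, ← sum_add_distrib]; apply sum_congr rfl; intro e _; ring
  rw [e1, e2]; ring

lemma wD_add (φ f : Fd D) (s : ℝ) : wD (φ + s • f) = wD φ * exp (s * bq φ f + s^2 * qq f) := by rw [wD_qq, wD_qq, qq_add, ← exp_add]; congr 1; ring

lemma bq_int (x : Lat) (f : Fd D) : Integrable (fun φ : Fd D => ex φ x * (wD φ * bq φ f)) ∧ ∫ φ : Fd D, ex φ x * (wD φ * bq φ f) =
      ∑ a ∈ D, ((∑ b ∈ D, if Adj a b then ex f b / 4 else 0) - ex f a) * ∫ φ : Fd D, ex φ x * ex φ a * wD φ := by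
  have h : ∀ φ : Fd D, ex φ x * (wD φ * bq φ f) = ∑ a ∈ D, ((∑ b ∈ D, if Adj a b then ex f b / 4 else 0) - ex f a) * (ex φ x * ex φ a * wD φ) := by intro φ; rw [bq, mul_sum, mul_sum]; apply sum_congr rfl; intro a _; ring
  simp_rw [h]
  refine ⟨integrable_finset_sum _ fun a _ => (wD_int2 x a).const_mul _, ?_⟩
  rw [integral_finset_sum _ fun a _ => (wD_int2 x a).const_mul _]
  apply sum_congr rfl; intro a _; rw [integral_const_mul]

lemma cov_ibp {x : Lat} (f : Fd D) :
    ∫ φ : Fd D, ex φ x * (wD φ * bq φ f) = - (ex f x * ∫ φ : Fd D, wD φ) := by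
  have i1 : Integrable (fun φ : Fd D => ex φ x * wD φ) := by
    refine int_dom (C := 1) ((ex_meas x).mul wD_meas) zero_le_one x x (fun φ => ?_)
    rw [abs_mul, abs_of_pos (wD_pos φ), one_mul, mul_assoc]; refine mul_le_mul ?_ (wD_le φ) (wD_pos φ).le (by positivity)
    rw [abs_mul]; nlinarith [sq_nonneg (|ex φ x| - 1), abs_nonneg (ex φ x)]
  have := integral_bilinear_hasLineDerivAt_right_eq_neg_left_of_integrable (μ := (volume : Measure (Fd D))) (f := fun φ : Fd D => ex φ x)
    (f' := fun _ => ex f x) (g := fun φ => wD φ) (g' := fun φ => wD φ * bq φ f) (v := f) (B := ContinuousLinearMap.mul ℝ ℝ)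
    (by simpa using wD_int.const_mul (ex f x)) (by simpa using (bq_int x f).1) (by simpa using i1)
    (by
      intro φ _; show HasDerivAt (fun s : ℝ => ex (φ + s • f) x) _ 0
      simp_rw [ex_add]
      simpa using ((hasDerivAt_id (0:ℝ)).mul_const (ex f x)).const_add (ex φ x))
    (by
      intro φ _; show HasDerivAt (fun s : ℝ => wD (φ + s • f)) _ 0
      simp_rw [wD_add]
      have h1 : HasDerivAt (fun s : ℝ => s * bq φ f + s^2 * qq f) (bq φ f) 0 := by
        have := ((hasDerivAt_id (0:ℝ)).mul_const (bq φ f)).add ((hasDerivAt_pow 2 (0:ℝ)).mul_const (qq f))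
        simp at this; exact this
      have h2 := (h1.exp).const_mul (wD φ)
      simpa using h2)
  simp only [ContinuousLinearMap.mul_apply'] at this
  rw [this, integral_const_mul]

lemma deg_le (D : FLat) (a : Lat) : ∑ b ∈ D, (if Adj a b then (1:ℝ) / 4 else 0) ≤ 1 := by
  refine (sum_adj_le D a (fun _ => (1:ℝ)/4) (fun _ => by norm_num)).trans ?_
  simp [sum_const, card_univ]

lemma cov_sum {x : Lat} (hx : x ∈ D) {S : FLat} (hS : S ⊆ D)
    (hd : ∀ y ∈ S, ∑ b ∈ D, (if Adj y b then (1:ℝ) / 4 else 0) ≤ 3/4) :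
    ∑ y ∈ S, ∫ φ : Fd D, ex φ x * ex φ y * wD φ ≤ 4 * ∫ φ : Fd D, wD φ := by
  have h1 := cov_ibp (D := D) (x := x) (fun _ => 1)
  rw [(bq_int x _).2] at h1
  have h2 : ∀ v ∈ D, ex (D := D) (fun _ => 1) v = 1 := fun v hv => by simp [ex, hv]
  rw [h2 x hx, one_mul] at h1
  have h3 : ∑ a ∈ D, (1 - ∑ b ∈ D, if Adj a b then (1:ℝ) / 4 else 0) * ∫ φ : Fd D, ex φ x * ex φ a * wD φ = ∫ φ : Fd D, wD φ := by
    rw [← neg_inj, ← h1, ← sum_neg_distrib]; apply sum_congr rfl; intro a ha; rw [h2 a ha, ← neg_mul, neg_sub]; congr 2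
    apply sum_congr rfl; intro b hb; rw [h2 b hb]
  rw [← h3, mul_sum]
  calc ∑ y ∈ S, ∫ φ : Fd D, ex φ x * ex φ y * wD φ ≤ ∑ a ∈ S, 4 * ((1 - ∑ b ∈ D, if Adj a b then (1:ℝ) / 4 else 0) * ∫ φ : Fd D, ex φ x * ex φ a * wD φ) := by
        apply Finset.sum_le_sum; intro y hy
        have := hd y hy; have := cov_nonneg (D := D) x y; nlinarith
    _ ≤ _ := by
        apply sum_le_sum_of_subset_of_nonneg hS
        intro a _ _; have := deg_le D a; have := cov_nonneg (D := D) x a; have : 0 ≤ (1 - ∑ b ∈ D, if Adj a b then (1:ℝ) / 4 else 0) := by linarith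
        positivity

lemma disj_ind (p t : ℝ) (ht : 0 < t) (s : Finset ℤ) : ∑ j ∈ s, ind (|p - 2*t*j| < t) ≤ 1 := by
  by_cases h : ∃ j ∈ s, |p - 2*t*j| < t
  · obtain ⟨j, hj, hj'⟩ := h; rw [Finset.sum_eq_single_of_mem j hj, ind_true hj']; intro k _ hk; rw [ind_false]; intro hk'; apply hk
    rw [abs_lt] at hj' hk'; have h1 : (k:ℝ) - j < 1 := by by_contra hc; push Not at hc; nlinarith
    have h2 : (j:ℝ) - k < 1 := by by_contra hc; push Not at hc; nlinarith
    have h1' : k - j < 1 := by exact_mod_cast h1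
    have h2' : j - k < 1 := by exact_mod_cast h2
    omega
  · push Not at h
    rw [Finset.sum_eq_zero]
    · norm_num
    · intro j hj; rw [ind_false (not_lt.2 (h j hj))]

lemma small_ball {x : Lat} (f : Fd D) (hf : ex f x = 1) {t η : ℝ} (ht : 0 < t) (hη : -η ≤ qq f) (hη0 : 0 ≤ η) (J : ℕ) :
    (2*J+1) * exp (-((2*t*J)^2*η)) * ∫ φ : Fd D, ind (|ex φ x - 0| < t) * wD φ ≤ ∫ φ : Fd D, wD φ := by
  set I : ℤ → ℝ := fun j => ∫ φ : Fd D, ind (|ex φ x - 2*t*j| < t) * wD φ with hI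
  have hI0 : I 0 = ∫ φ : Fd D, ind (|ex φ x - 0| < t) * wD φ := by simp [hI]
  have hsh : ∀ j : ℤ, I j = ∫ φ : Fd D, ind (|ex φ x - 0| < t) * wD (φ + (2*t*j) • f) := by
    intro j; simp only [hI]; rw [← integral_add_right_eq_self (μ := (volume : Measure (Fd D))) _ ((2*t*j) • f)]; congr 1; ext φ
    rw [ex_add, hf]; congr 3; ring_nf
  have hshi : ∀ j : ℤ, Integrable (fun φ : Fd D => ind (|ex φ x - 0| < t) * wD (φ + (2*t*j) • f)) := by
    intro j; have := (wD_int_ind (D := D) x t (2*t*j)).comp_add_right ((2*t*j) • f); refine this.congr (Filter.Eventually.of_forall fun φ => ?_)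
    show ind (|ex (φ + (2*t*j) • f) x - 2*t*j| < t) * wD (φ + (2*t*j) • f) = ind (|ex φ x - 0| < t) * wD (φ + (2*t*j) • f)
    rw [ex_add, hf]; congr 3; ring_nf
  have hpair : ∀ j ∈ Finset.Icc (-(J:ℤ)) J, 2 * (exp (-((2*t*J)^2*η)) * I 0) ≤ I j + I (-j) := by
    intro j hj; rw [hI0, hsh j, hsh (-j), ← integral_add (hshi j) (hshi (-j)), ← integral_const_mul, ← integral_const_mul]
    refine integral_mono (((wD_int_ind x t 0).const_mul _).const_mul _) ((hshi j).add (hshi (-j))) (fun φ => ?_)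
    simp only; rw [wD_add, wD_add, ← mul_add, ← mul_add]; have h1 := ind_nonneg (|ex φ x - 0| < t); have h2 := wD_pos φ
    have h3 : 2 * exp (-((2*t*J)^2*η)) ≤ exp (2*t*j * bq φ f + (2*t*j)^2 * qq f) + exp (2*t*(-j : ℤ) * bq φ f + (2*t*(-j:ℤ))^2 * qq f) := by
      push_cast
      have a1 : exp (2*t*j * bq φ f + (2*t*j)^2 * qq f) + exp (2*t*(-j) * bq φ f + (2*t*(-j))^2 * qq f) =
          2 * (cosh (2*t*j*bq φ f) * exp ((2*t*j)^2 * qq f)) := by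
        rw [exp_add, exp_add, Real.cosh_eq]; ring_nf
      rw [a1]
      have a2 : exp (-((2*t*J)^2*η)) ≤ exp ((2*t*j)^2 * qq f) := by
        rw [exp_le_exp]
        have hj2 : (j:ℝ)^2 ≤ (J:ℝ)^2 := by
          rw [Finset.mem_Icc] at hj; have b1 : (-(J:ℝ)) ≤ j := by exact_mod_cast hj.1
          have b2 : (j:ℝ) ≤ J := by exact_mod_cast hj.2
          exact sq_le_sq' b1 b2
        have b3 : (2*t*j)^2 * η ≤ (2*t*J)^2*η := by
          refine mul_le_mul_of_nonneg_right ?_ hη0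
          rw [mul_pow, mul_pow (2*t)]; exact mul_le_mul_of_nonneg_left hj2 (sq_nonneg _)
        nlinarith [sq_nonneg (2*t*j)]
      have a3 := one_le_cosh (2*t*j*bq φ f); have a4 := exp_pos ((2*t*j)^2 * qq f); nlinarith
    calc 2 * (exp (-((2*t*J)^2*η)) * (ind (|ex φ x - 0| < t) * wD φ)) = (ind (|ex φ x - 0| < t) * wD φ) * (2 * exp (-((2*t*J)^2*η))) := by ring
      _ ≤ (ind (|ex φ x - 0| < t) * wD φ) * (exp (2*t*j * bq φ f + (2*t*j)^2 * qq f) + exp (2*t*(-j : ℤ) * bq φ f + (2*t*(-j:ℤ))^2 * qq f)) := mul_le_mul_of_nonneg_left h3 (mul_nonneg h1 h2.le)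
      _ = _ := by ring
  have hsum : ∑ j ∈ Finset.Icc (-(J:ℤ)) J, I j ≤ ∫ φ : Fd D, wD φ := by
    simp only [hI]; rw [← integral_finset_sum _ fun j _ => wD_int_ind x t _]
    refine integral_mono (integrable_finset_sum _ fun j _ => wD_int_ind x t _) wD_int (fun φ => ?_)
    simp only; rw [← sum_mul]; have := disj_ind (ex φ x) t ht (Finset.Icc (-(J:ℤ)) J); nlinarith [wD_pos φ]
  have hneg : ∑ j ∈ Finset.Icc (-(J:ℤ)) J, I (-j) = ∑ j ∈ Finset.Icc (-(J:ℤ)) J, I j := by refine sum_nbij' (fun j => -j) (fun j => -j) ?_ ?_ ?_ ?_ ?_ <;> intro j hj <;> simp at hj ⊢ <;> omega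
  have h := Finset.sum_le_sum hpair
  rw [sum_const, sum_add_distrib, hneg, nsmul_eq_mul, Int.card_Icc] at h
  have hc : (((J:ℤ) + 1 - -(J:ℤ)).toNat : ℝ) = 2*J+1 := by
    have : ((J:ℤ) + 1 - -(J:ℤ)).toNat = 2*J+1 := by omega
    rw [this]; push_cast; ring
  rw [hc] at h
  rw [← hI0]
  nlinarith

/-! ### The one-arm estimate -/

lemma energy (f : Fd D) (h : ∀ a ∈ D, ex f a ≠ 0 → ∀ d, a + stp d ∈ D) :
    -(∑ a ∈ D, ∑ b ∈ D, if Adj a b then (ex f a - ex f b)^2/16 else 0) ≤ qq f := by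
  have h1 := sum_EE D (fun a b => (ex f a - ex f b)^2/16)
  have h2 := sum_EE D (fun a b => ex f a ^ 2 / 8)
  have h3 : n2 f / 2 ≤ ∑ a ∈ D, ∑ b ∈ D, if Adj a b then ex f a ^2/8 else 0 := by
    rw [n2_ex, sum_div]; apply Finset.sum_le_sum; intro a ha; by_cases h0 : ex f a = 0
    · simp [h0]
    rw [← sum_filter]
    have e1 : ∑ b ∈ Finset.univ.image (fun d : Dir => a + stp d), ex f a ^2/8 = ex f a ^ 2/2 := by
      rw [sum_image (fun x _ y _ h => stp_inj (add_left_cancel h))]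
      simp [card_univ]; ring
    rw [← e1]; apply sum_le_sum_of_subset_of_nonneg
    · intro b hb; rw [Finset.mem_image] at hb; obtain ⟨d, _, rfl⟩ := hb; rw [Finset.mem_filter]; exact ⟨h a ha h0 d, adj_stp a d⟩
    · intros; positivity
  rw [← h1]
  rw [← h2] at h3
  have h4 : ∑ e ∈ EE D, ((ex f e.1 - ex f e.2)^2/16 + (ex f e.2 - ex f e.1)^2/16) = ∑ e ∈ EE D, (ex f e.1^2/8 + ex f e.2^2/8) - ∑ e ∈ EE D, JJ f e := by
    rw [← sum_sub_distrib]; apply sum_congr rfl; intro e _; unfold JJ; ring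
  rw [h4]; unfold qq; linarith

def Hm (k : ℕ) : ℝ := ∑ i ∈ Finset.range k, 1/((i:ℝ)+1)

lemma Hm_succ (k : ℕ) : Hm (k+1) = Hm k + 1/((k:ℝ)+1) := Finset.sum_range_succ _ _

lemma Hm_mono {a b : ℕ} (h : a ≤ b) : Hm a ≤ Hm b := sum_le_sum_of_subset_of_nonneg (Finset.range_mono h) (fun _ _ _ => by positivity)

lemma Hm_one {N : ℕ} (h : 1 ≤ N) : 1 ≤ Hm N := by refine le_trans (le_of_eq ?_) (Hm_mono h); simp [Hm]

lemma shell (N : ℕ) : ∑ a ∈ Rc (-N) N (-N) N, 1/(((linf a).toNat:ℝ)+1)^2 ≤ 8 * Hm (N+1) := by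
  induction N with
  | zero =>
    have : Rc (-((0:ℕ):ℤ)) ((0:ℕ):ℤ) (-((0:ℕ):ℤ)) ((0:ℕ):ℤ) = {((0:ℤ),(0:ℤ))} := by ext ⟨a, b⟩; simp; omega
    rw [this]; simp [linf, Hm]
  | succ N ih =>
    have hs : Rc (-N) N (-N) N ⊆ Rc (-((N+1:ℕ):ℤ)) ((N+1:ℕ):ℤ) (-((N+1:ℕ):ℤ)) ((N+1:ℕ):ℤ) := by intro v; simp only [mem_Rc]; push_cast; intro h; omega
    rw [← Finset.sum_sdiff hs, Hm_succ]
    have hc : ((Rc (-((N+1:ℕ):ℤ)) ((N+1:ℕ):ℤ) (-((N+1:ℕ):ℤ)) ((N+1:ℕ):ℤ) \ Rc (-N) N (-N) N).card : ℝ) = 8*N+8 := by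
      rw [Finset.cast_card_sdiff hs, card_Rc, card_Rc]; have e1 : (((N+1:ℕ):ℤ) + 1 - -((N+1:ℕ):ℤ)).toNat = 2*N+3 := by omega
      have e2 : ((N:ℤ) + 1 - -(N:ℤ)).toNat = 2*N+1 := by omega
      rw [e1, e2]; push_cast; ring
    have h1 : ∑ a ∈ Rc (-((N+1:ℕ):ℤ)) ((N+1:ℕ):ℤ) (-((N+1:ℕ):ℤ)) ((N+1:ℕ):ℤ) \ Rc (-N) N (-N) N, 1/(((linf a).toNat:ℝ)+1)^2
        = (8*N+8) * (1/((N:ℝ)+2)^2) := by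
      rw [← hc, ← nsmul_eq_mul]; apply Finset.sum_eq_card_nsmul; intro a ha; rw [Finset.mem_sdiff, mem_Rc, mem_Rc, ← linf_le, ← linf_le] at ha
      have : (linf a).toNat = N+1 := by omega
      rw [this]; push_cast; ring_nf
    rw [h1]
    have h2 : (8*N+8) * (1/((N:ℝ)+2)^2) ≤ 8 * (1/(((N+1:ℕ):ℝ)+1)) := by
      push_cast; rw [show (N:ℝ)+1+1 = N+2 by ring, mul_one_div, mul_one_div, div_le_div_iff₀ (by positivity) (by positivity)]
      have : (0:ℝ) ≤ N := Nat.cast_nonneg N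
      nlinarith
    linarith

lemma linf_nn (a : Lat) : 0 ≤ linf a := le_trans (abs_nonneg a.1) (le_max_left _ _)

lemma Hm_diff {a b : Lat} (h : Adj a b) : |Hm (linf a).toNat - Hm (linf b).toNat| ≤ 2/(((linf a).toNat:ℝ)+1) := by
  have h1 := adj_linf h
  have ha := linf_nn a
  have hb := linf_nn b
  rw [abs_le] at h1
  generalize hn : (linf a).toNat = n
  generalize hm : (linf b).toNat = m
  have : m = n ∨ m = n + 1 ∨ n = m + 1 := by omega
  rcases this with rfl | rfl | rfl
  · simp; positivity
  · rw [Hm_succ, abs_sub_comm, add_sub_cancel_left, abs_of_nonneg (by positivity)]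
    gcongr; norm_num
  · rw [Hm_succ, add_sub_cancel_left, abs_of_nonneg (by positivity)]
    push_cast; rw [div_le_div_iff₀ (by positivity) (by positivity)]
    have : (0:ℝ) ≤ m := Nat.cast_nonneg m
    linarith

def fH (N : ℕ) : Fd (Rc (-N) N (-N) N) := fun v => 1 - Hm (linf v.1).toNat / Hm N

lemma fH_energy {N : ℕ} (hN : 1 ≤ N) : -(16 / Hm N) ≤ qq (fH N) := by
  have hH := Hm_one hN
  have hex : ∀ a ∈ Rc (-N) N (-N) N, ex (fH N) a = 1 - Hm (linf a).toNat / Hm N := fun a ha => by simp only [ex, ha, fH, dif_pos]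
  refine le_trans ?_ (energy (fH N) ?_)
  · rw [neg_le_neg_iff]
    have h1 : ∀ a ∈ Rc (-N) N (-N) N, (∑ b ∈ Rc (-N) N (-N) N, if Adj a b then (ex (fH N) a - ex (fH N) b)^2/16 else 0) ≤ 1/(((linf a).toNat:ℝ)+1)^2 / Hm N^2 := by
      intro a ha; refine le_trans (b := ∑ b ∈ Rc (-N) N (-N) N, if Adj a b then (2/(((linf a).toNat:ℝ)+1)/Hm N)^2/16 else 0) ?_ ?_
      · apply Finset.sum_le_sum
        intro b hb; split_ifs with hab
        · rw [hex a ha, hex b hb]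
          have e : (1 - Hm (linf a).toNat / Hm N - (1 - Hm (linf b).toNat / Hm N))^2 = (|Hm (linf a).toNat - Hm (linf b).toNat| / Hm N)^2 := by rw [div_pow, sq_abs, ← div_pow]; ring
          rw [e]; have := Hm_diff hab; gcongr
        · exact le_rfl
      · refine le_trans (sum_adj_le _ a (fun _ => (2/(((linf a).toNat:ℝ)+1)/Hm N)^2/16) (fun _ => by positivity)) ?_
        apply le_of_eq
        simp only [sum_const, card_univ, Fintype.card_prod, Fintype.card_bool, nsmul_eq_mul]; push_cast; field_simp; norm_num
    refine le_trans (Finset.sum_le_sum h1) ?_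
    rw [← sum_div]; have h2 := shell N
    have h3 : Hm (N+1) ≤ 2 * Hm N := by
      rw [Hm_succ]
      have : 1/((N:ℝ)+1) ≤ 1 := by
        rw [div_le_one (by positivity)]; have : (0:ℝ) ≤ N := Nat.cast_nonneg N
        linarith
      linarith
    rw [div_le_div_iff₀ (by positivity) (by positivity)]
    nlinarith
  · intro a ha h0 d; rw [hex a ha] at h0
    have h1 : linf a < N := by
      have h2 : linf a ≤ N := by rw [linf_le]; simpa using ha
      rcases h2.lt_or_eq with h | h
      · exact h
      · exfalso; apply h0; rw [h]; simp; rw [div_self (by positivity), sub_self]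
    have h2 := adj_linf (adj_stp a d); rw [abs_le] at h2; rw [mem_Rc, ← linf_le]; omega

lemma one_arm : OneArm := by
  intro ε hε
  set t : ℝ := 88/ε with ht
  have ht0 : 0 < t := by positivity
  obtain ⟨J, hJ⟩ := exists_nat_ge (2/ε)
  have hlim := Real.tendsto_sum_range_one_div_nat_succ_atTop
  rw [Filter.tendsto_atTop_atTop] at hlim
  obtain ⟨N1, hN1⟩ := hlim (32*(2*t*J)^2)
  refine ⟨max 1 (N1:ℤ), fun N hN L => ?_⟩
  lift N to ℕ using (by omega)
  have hN0 : 1 ≤ N := by omega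
  have hHN : 32*(2*t*J)^2 ≤ Hm N := hN1 N (by omega)
  have hH1 := Hm_one hN0
  set D := Rc (-(N:ℤ)) N (-(N:ℤ)) N with hD
  have hx : (0:Lat) ∈ D := by rw [hD, mem_Rc]; simp
  set S := D.filter (fun v : Lat => v.1 = (N:ℤ)) with hS
  have hSD : S ⊆ D := Finset.filter_subset _ _
  have h1 : Pr pr (LS L D) (fun T => ∃b:Lat, b.1=N ∧ Conn T D 0 b) ≤ Pr pr (LS L D) (fun T => ∃ y ∈ S, y ∈ D ∧ gC spL T 0 y) := by
    apply Pr_mono (fun l => pr_bd l)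
    rintro T hT ⟨b, hb, hc⟩; have hbD := hc.right; refine ⟨b, Finset.mem_filter.2 ⟨hbD, hb⟩, hbD, ?_⟩; refine ReflTransGen.mono ?_ _ _ hc.2
    rintro u v ⟨⟨l, hl, he⟩, _, _⟩; refine ⟨l, hl, ?_, ?_⟩
    · exact List.mem_toFinset.2 (hasE_mem he).1
    · exact List.mem_toFinset.2 (hasE_mem he).2
  refine h1.trans ((soup_limit hx S L).trans ((arm_bound hSD ht0).trans ?_))
  have hZ := Zw_pos D
  rw [div_le_iff₀ hZ]
  have h2 := cov_sum hx hSD (by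
    intro y hy; rw [hS, Finset.mem_filter] at hy
    have := sum_adj_le D y (fun b => if b.1 ≤ N then (1/4:ℝ) else 0) (fun _ => by split_ifs <;> norm_num)
    refine le_trans (le_of_eq ?_) (this.trans ?_)
    · apply sum_congr rfl
      intro b hb; rw [hD, mem_Rc] at hb; rw [if_pos hb.1.2]
    · rw [Fintype.sum_prod_type]; have := hy.2; simp [stp, this]; norm_num)
  have h3 := small_ball (x := 0) (fH N) (by
    unfold ex; rw [dif_pos hx]; simp [fH, linf, Hm]) ht0 (fH_energy hN0) (by positivity) J
  have hexp : (1:ℝ)/2 ≤ exp (-((2*t*J)^2*(16/Hm N))) := by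
    have e : (2*t*J)^2*(16/Hm N) ≤ 1/2 := by rw [← mul_div_assoc, div_le_iff₀ (by positivity)]; linarith
    have := Real.add_one_le_exp (-((2*t*J)^2*(16/Hm N))); linarith
  set I := ∫ φ : Fd D, ind (|ex φ 0 - 0| < t) * wD φ with hI
  set Z := ∫ φ : Fd D, wD φ with hZd
  have hI0 : 0 ≤ I := by apply integral_nonneg; intro φ; exact mul_nonneg (ind_nonneg _) (wD_pos φ).le
  have h4 : 2/ε * I ≤ Z := by
    refine le_trans (mul_le_mul_of_nonneg_right ?_ hI0) h3
    nlinarith [Nat.cast_nonneg (α := ℝ) J]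
  have h5 : I ≤ ε/2 * Z := by rw [div_mul_eq_mul_div, div_le_iff₀ hε] at h4; linarith
  have h6 : 11/t * ∑ y ∈ S, ∫ φ : Fd D, ex φ 0 * ex φ y * wD φ ≤ 11/t*(4*Z) := by gcongr
  have h7 : 11/t*(4*Z) = ε/2*Z := by rw [ht]; field_simp; ring
  linarith

/-! ### Non-disconnection decay for random walk -/

lemma Conn.mono_op {T T' : FLp} {S : FLat} (hT : ∀ a b, Op T a b → Op T' a b) {a b}
    (h : Conn T S a b) : Conn T' S a b :=
  ⟨h.1, ReflTransGen.mono (fun x y hxy => ⟨hT x y hxy.1, hxy.2⟩) _ _ h.2⟩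

lemma Surr.mono {N : ℤ} {l l' : Lp} (h : ∀ a b, hasE (path l.1 l.2) a b → hasE (path l'.1 l'.2) a b) (hs : Surr N l) : Surr N l' := by
  have hT : ∀ a b, Op {l} a b → Op {l'} a b := by
    rintro a b ⟨k, hk, he⟩; rw [Finset.mem_singleton] at hk; subst hk; exact ⟨l', Finset.mem_singleton_self _, h a b he⟩
  obtain ⟨⟨a1, b1, h1, h2, h3⟩, ⟨a2, b2, h4, h5, h6⟩, ⟨a3, b3, h7, h8, h9⟩, ⟨a4, b4, h10, h11, h12⟩⟩ := hs
  exact ⟨⟨a1, b1, h1, h2, h3.mono_op hT⟩, ⟨a2, b2, h4, h5, h6.mono_op hT⟩, ⟨a3, b3, h7, h8, h9.mono_op hT⟩, ⟨a4, b4, h10, h11, h12.mono_op hT⟩⟩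

def NR (g0 : ℕ) (l : Lp) : Prop := ∀ g : ℕ, 4*g0 ≤ g → ¬ Surr (20*g) l

def Hit (g0 : ℕ) (x : Lat) (w : List Dir) : Prop := ∃ u, u <+: w ∧ linf (endp x u) ≤ 60*g0 ∧ NR g0 (x, u)

lemma hit_app {g0 : ℕ} {x : Lat} {w w' : List Dir} (h : Hit g0 x w) : Hit g0 x (w ++ w') := by
  obtain ⟨u, h1, h2⟩ := h
  exact ⟨u, h1.trans (List.prefix_append _ _), h2⟩

lemma hit_cons {g0 : ℕ} {x : Lat} {d : Dir} {w : List Dir} (hx : 60*g0 < linf x) (h : Hit g0 x (d :: w)) : Hit g0 (x + stp d) w := by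
  obtain ⟨u, h1, h2, h3⟩ := h
  cases u with
  | nil => simp at h2; omega
  | cons e u =>
    obtain ⟨rfl, h1'⟩ := List.cons_prefix_cons.1 h1; refine ⟨u, h1', by simpa using h2, ?_⟩
    intro g hg hs; refine h3 g hg (hs.mono ?_); intro a b hab; exact hasE_app_right (w1 := [e]) (by simpa using hab)

lemma decay_split {g0 : ℕ} {ρ : ℤ} (hρ : 60*g0 ≤ ρ) {θ : ℝ} (hθ : ∀ T x, ρ ≤ linf x → EW T (fun w => ind (Hit g0 x w)) ≤ θ)
    (T s : ℕ) (x : Lat) (hx : ρ ≤ linf x) (R : List Dir → Prop) (hR : ∀ w, R w → ∀ v ∈ path x w, ρ < linf v) :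
    EW (s+T) (fun w => ind (Hit g0 x w ∧ ¬ R (w.take s))) ≤ θ * EW s (fun w => ind (¬ R w)) := by
  induction s generalizing x R with
  | zero =>
    rw [EW_zero, Nat.zero_add]; simp only [List.take_zero]; by_cases h : R []
    · rw [ind_false (by simpa using h)]
      simp only [h, not_true_eq_false, and_false]; rw [ind_false id, EW_const]; simp
    · rw [ind_true h, mul_one]; refine le_trans (EW_mono (fun w _ => ind_mono And.left)) (hθ T x hx)
  | succ s ih =>
    rcases hx.lt_or_eq with hlt | heq
    · rw [show s + 1 + T = (s+T)+1 by ring, EW_succ, EW_succ, mul_div_assoc', mul_sum]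
      apply div_le_div_of_nonneg_right _ (by norm_num)
      apply Finset.sum_le_sum
      intro d _; have h1 := adj_linf (adj_stp x d); rw [abs_le] at h1
      refine le_trans (EW_mono (fun w _ => ind_mono ?_)) (ih (x + stp d) (by omega) (fun w => R (d :: w)) ?_)
      · rintro ⟨h2, h3⟩; exact ⟨hit_cons (by omega) h2, by simpa using h3⟩
      · intro w hw v hv; exact hR _ hw v (by rw [path_cons]; exact List.mem_cons_of_mem _ hv)
    · have hn : ∀ w, ¬ R w := fun w hw => by
        have := hR w hw x (mem_path_self _ _); omega
      have e : EW (s+1) (fun w => ind (¬ R w)) = 1 := by rw [EW_congr (fun w _ => ind_true (hn w)), EW_const]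
      rw [e, mul_one]; exact le_trans (EW_mono (fun w _ => ind_mono And.left)) (hθ _ x hx)

def cR : ℝ := (1/576:ℝ)^1200

lemma cR_pos : 0 < cR := by unfold cR; positivity

lemma cR_lt : cR < 1 := by unfold cR; exact pow_lt_one₀ (by norm_num) (by norm_num) (by norm_num)

lemma exists_D0 {q : Lat} (hq : linf q = 60) : ∃ D0 : List Dir, D0.length ≤ 400 ∧ endp q D0 = (40, 68) ∧ ∀ v ∈ path q D0, 40 ≤ linf v := by
  have h1 : linf q ≤ 60 := by omega
  have h2 : 59 < linf q := by omega
  rw [linf_le] at h1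
  rw [lt_linf] at h2
  obtain ⟨a, b⟩ := q
  simp only at h1 h2
  have hl : ∀ v : Lat, (39 < v.1 ∨ 39 < -v.1) ∨ (39 < v.2 ∨ 39 < -v.2) → 40 ≤ linf v := fun v hv => by rw [← lt_linf] at hv; omega
  rcases h2 with (h | h) | (h | h)
  · refine ⟨rp (68-b).toNat dU ++ rp 20 dL, by simp; omega, ?_, ?_⟩
    · simp only [endp_append, endp_rep, stp_U, stp_L, Prod.mk.injEq]; omega
    · intro v hv; simp only [mem_path_append, endp_rep, stp_U, stp_L] at hv; apply hl; rcases hv with hv | hv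
      · obtain ⟨j, hj, e1, e2⟩ := mem_path_rep hv; simp only [stp_U] at e1 e2; omega
      · obtain ⟨j, hj, e1, e2⟩ := mem_path_rep hv; simp only [stp_L] at e1 e2; omega
  · refine ⟨rp (68-b).toNat dU ++ rp 100 dR, by simp; omega, ?_, ?_⟩
    · simp only [endp_append, endp_rep, stp_U, stp_R, Prod.mk.injEq]; omega
    · intro v hv; simp only [mem_path_append, endp_rep, stp_U, stp_R] at hv; apply hl; rcases hv with hv | hv
      · obtain ⟨j, hj, e1, e2⟩ := mem_path_rep hv; simp only [stp_U] at e1 e2; omega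
      · obtain ⟨j, hj, e1, e2⟩ := mem_path_rep hv; simp only [stp_R] at e1 e2; omega
  · refine ⟨rp 8 dU ++ (rp (a-40).toNat dL ++ rp (40-a).toNat dR), by simp; omega, ?_, ?_⟩
    · simp only [endp_append, endp_rep, stp_U, stp_R, stp_L, Prod.mk.injEq]; omega
    · intro v hv; simp only [mem_path_append, endp_append, endp_rep, stp_U, stp_R, stp_L] at hv; apply hl; rcases hv with hv | hv | hv
      · obtain ⟨j, hj, e1, e2⟩ := mem_path_rep hv; simp only [stp_U] at e1 e2; omega
      · obtain ⟨j, hj, e1, e2⟩ := mem_path_rep hv; simp only [stp_L] at e1 e2; omega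
      · obtain ⟨j, hj, e1, e2⟩ := mem_path_rep hv; simp only [stp_R] at e1 e2; omega
  · refine ⟨rp (60-a).toNat dR ++ (rp 128 dU ++ rp 20 dL), by simp; omega, ?_, ?_⟩
    · simp only [endp_append, endp_rep, stp_U, stp_R, stp_L, Prod.mk.injEq]; omega
    · intro v hv; simp only [mem_path_append, endp_append, endp_rep, stp_U, stp_R, stp_L] at hv; apply hl; rcases hv with hv | hv | hv
      · obtain ⟨j, hj, e1, e2⟩ := mem_path_rep hv; simp only [stp_R] at e1 e2; omega
      · obtain ⟨j, hj, e1, e2⟩ := mem_path_rep hv; simp only [stp_U] at e1 e2; omega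
      · obtain ⟨j, hj, e1, e2⟩ := mem_path_rep hv; simp only [stp_L] at e1 e2; omega

lemma exists_q {g : ℕ} (hg : 1 ≤ g) {x : Lat} (hx : linf x = 60*g) : ∃ q : Lat, linf q = 60 ∧ Dm g 7 q x := by
  have hg' : (0:ℤ) < g := by omega
  have h1 := Int.mul_ediv_add_emod x.1 g
  have h2 := Int.mul_ediv_add_emod x.2 g
  have m1 := Int.emod_nonneg x.1 hg'.ne'
  have m2 := Int.emod_nonneg x.2 hg'.ne'
  have m3 := Int.emod_lt_of_pos x.1 hg'
  have m4 := Int.emod_lt_of_pos x.2 hg'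
  refine ⟨(x.1 / g, x.2 / g), ?_, ?_⟩
  · have h3 : linf x ≤ 60*g := hx.le
    have h4 : 60*g-1 < linf x := by omega
    rw [linf_le] at h3; rw [lt_linf] at h4; apply le_antisymm
    · rw [linf_le]; refine ⟨⟨?_, ?_⟩, ?_, ?_⟩ <;> dsimp only
      · rw [Int.le_ediv_iff_mul_le hg']; omega
      · apply Int.lt_add_one_iff.1; rw [Int.ediv_lt_iff_lt_mul hg']; omega
      · rw [Int.le_ediv_iff_mul_le hg']; omega
      · apply Int.lt_add_one_iff.1; rw [Int.ediv_lt_iff_lt_mul hg']; omega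
    · apply Int.le_of_sub_one_lt
      rw [lt_linf]; dsimp only; rcases h4 with (h | h) | (h | h)
      · left; left
        have : (60:ℤ) ≤ x.1/g := by rw [Int.le_ediv_iff_mul_le hg']; omega
        omega
      · left; right
        have : x.1/g < -60+1 := by rw [Int.ediv_lt_iff_lt_mul hg']; omega
        omega
      · right; left
        have : (60:ℤ) ≤ x.2/g := by rw [Int.le_ediv_iff_mul_le hg']; omega
        omega
      · right; right
        have : x.2/g < -60+1 := by rw [Int.ediv_lt_iff_lt_mul hg']; omega
        omega
  · simp only [Dm, uu, vv, abs_le, mul_add, mul_sub]; omega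

lemma decay_step {g0 g : ℕ} (hg0 : 1 ≤ g0) (hg : 4*g0 ≤ g) {ρ : ℤ} (hρ0 : 60*g0 ≤ ρ) (hρ : ρ < 27*g) {θ : ℝ} (hθ0 : 0 ≤ θ)
    (hθ : ∀ T x, ρ ≤ linf x → EW T (fun w => ind (Hit g0 x w)) ≤ θ) :
    ∀ T x, 60*g ≤ linf x → EW T (fun w => ind (Hit g0 x w)) ≤ (1-cR)*θ := by
  have hnn : 0 ≤ (1-cR)*θ := mul_nonneg (by linarith [cR_lt]) hθ0
  intro T
  induction T with
  | zero =>
    intro x hx; rw [EW_zero, ind_false]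
    · exact hnn
    · rintro ⟨u, h1, h2, _⟩; rw [List.prefix_nil.1 h1] at h2; simp at h2; omega
  | succ T ih =>
    intro x hx; rcases hx.lt_or_eq with hlt | heq
    · rw [EW_succ, div_le_iff₀ (by norm_num)]
      calc _ ≤ ∑ d : Dir, (1-cR)*θ := by
            apply Finset.sum_le_sum
            intro d _; have h1 := adj_linf (adj_stp x d); rw [abs_le] at h1
            exact le_trans (EW_mono (fun w _ => ind_mono (hit_cons (by omega)))) (ih (x + stp d) (by omega))
        _ = _ := by simp [card_univ]; ring
    · have hg1 : 1 ≤ g := by omega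
      obtain ⟨q, hq, hD⟩ := exists_q hg1 heq.symm; obtain ⟨D0, hl, he, ht⟩ := exists_D0 hq; set s := 4*g^2*(D0++ringD).length + 0 with hs
      set R : List Dir → Prop := fun w => Chn g x q (D0 ++ ringD) w with hRd
      have hR : ∀ w, R w → ∀ v ∈ path x w, 27*g ≤ linf v := by
        intro w hw v hv; obtain ⟨q', hq', hv'⟩ := Chn_mem hw hD v hv
        have h40 : 40 ≤ linf q' := by
          rw [mem_path_append, he] at hq'; rcases hq' with h | h
          · exact ht _ h
          · exact (ringD_tube h).1
        have := (linf_Dm hv' h40 le_rfl hg1).1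
        omega
      have h1 : EW (T+1) (fun w => ind (Hit g0 x w)) ≤ EW (s+(T+1)) (fun w => ind (Hit g0 x w ∧ ¬ R (w.take s))) := by
        have e1 : EW (T+1) (fun w => ind (Hit g0 x w)) = EW ((T+1)+s) (fun w => ind (Hit g0 x (w.take (T+1)))) := by
          rw [EW_add (T+1) s]; apply EW_congr; intro w hw; rw [EW_congr (G := fun _ => ind (Hit g0 x w)), EW_const]
          intro w' _; rw [← hw, List.take_left]
        rw [e1, add_comm s]; apply EW_mono; intro w hw; apply ind_mono; intro h
        have h' : Hit g0 x w := by rw [← List.take_append_drop (T+1) w]; exact hit_app h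
        refine ⟨h', fun hr => ?_⟩
        obtain ⟨u, h2, h3, h4⟩ := h'; rcases List.prefix_or_prefix_of_prefix h2 (List.take_prefix s w) with h5 | h5
        · obtain ⟨u', hu'⟩ := h5; have := hR _ hr (endp x u) (by rw [← hu', mem_path_append]; exact Or.inl (endp_mem_path _ _))
          omega
        · obtain ⟨u', hu'⟩ := h5; refine h4 g hg ?_; rw [← hu']; exact ring_surr hg1 hD he hr
      refine h1.trans ((decay_split hρ0 hθ (T+1) s x (by omega) R (fun w hw v hv => by have := hR w hw v hv; omega)).trans ?_)
      rw [mul_comm θ]; apply mul_le_mul_of_nonneg_right _ hθ0; have h2 := Chn_prob g hg1 0 (by omega) (D0 ++ ringD) x q hD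
      have h3 : EW s (fun w => ind (¬ R w)) + EW s (fun w => ind (R w)) = 1 := by
        rw [← EW_add_fun, ← EW_const s 1]; apply EW_congr; intro w _; rw [ind_not]; ring
      have h4 : cR ≤ (1/576:ℝ)^((D0++ringD).length+1) := by
        unfold cR; apply pow_le_pow_of_le_one (by norm_num) (by norm_num)
        rw [List.length_append, ringD_length]; omega
      linarith

lemma decay (g0 : ℕ) (hg0 : 1 ≤ g0) (j : ℕ) : ∀ T x, 60*(4^j*g0 : ℕ) ≤ linf x → EW T (fun w => ind (Hit g0 x w)) ≤ (1-cR)^j := by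
  induction j with
  | zero =>
    intro T x _; rw [pow_zero, ← EW_const T 1]; exact EW_mono (fun w _ => ind_le_one _)
  | succ j ih =>
    have h4 : 1 ≤ 4^j := Nat.one_le_pow _ _ (by norm_num)
    have hge : g0 ≤ 4^j*g0 := Nat.le_mul_of_pos_left _ h4
    rw [pow_succ' (1-cR)]; refine decay_step hg0 (ρ := 60*(4^j*g0:ℕ)) ?_ ?_ ?_ (pow_nonneg (by linarith [cR_lt]) j) ih
    · rw [pow_succ, mul_comm (4^j), mul_assoc]; omega
    · omega
    · rw [pow_succ, mul_comm (4^j) 4, mul_assoc]; omega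

/-! ### Mass of large loops which do not disconnect -/

lemma cb_bound (n : ℕ) : Nat.centralBinom n ^ 2 * (2*n+1) ≤ 16^n := by
  induction n with
  | zero => simp
  | succ n ih =>
    have h := Nat.succ_mul_centralBinom_succ n
    have h2 : (n+1)^2 * (Nat.centralBinom (n+1) ^ 2 * (2*(n+1)+1)) ≤ (n+1)^2 * 16^(n+1) := by
      calc (n+1)^2 * (Nat.centralBinom (n+1) ^ 2 * (2*(n+1)+1)) = ((n+1) * Nat.centralBinom (n+1))^2 * (2*n+3) := by ring
        _ = (Nat.centralBinom n ^ 2 * (2*n+1)) * (4*(2*n+1)*(2*n+3)) := by rw [h]; ring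
        _ ≤ 16^n * (16*(n+1)^2) := by apply Nat.mul_le_mul ih; nlinarith
        _ = _ := by ring
    exact Nat.le_of_mul_le_mul_left h2 (by positivity)

lemma mid_bound (t i : ℕ) : (t.choose i)^2 * (t+1) ≤ 4^t := by
  refine le_trans (Nat.mul_le_mul_right _ (Nat.pow_le_pow_left (Nat.choose_le_middle i t) 2)) ?_
  rcases Nat.even_or_odd' t with ⟨n, rfl | rfl⟩
  · rw [Nat.mul_div_cancel_left _ (by norm_num), ← Nat.centralBinom_eq_two_mul_choose, pow_mul]
    exact cb_bound n
  · have h1 : (2*n+1)/2 = n := by omega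
    rw [h1]; have h2 := cb_bound (n+1)
    rw [Nat.centralBinom_eq_two_mul_choose, show 2*(n+1) = (2*n+1)+1 by ring, Nat.choose_succ_succ', Nat.choose_symm_half] at h2
    rw [pow_succ 16] at h2; rw [pow_succ 4, pow_mul]; norm_num; nlinarith

lemma S1_pt (t : ℕ) (y k : ℤ) : 0 ≤ S1 t (fun x => ind (x = y)) k ∧ (k > y + t → S1 t (fun x => ind (x = y)) k = 0) ∧
    (∀ i : ℕ, k = y + t - 2*i → S1 t (fun x => ind (x = y)) k = (t.choose i : ℝ) / 2^t) ∧
    ((k - y - t) % 2 = 1 → S1 t (fun x => ind (x = y)) k = 0) := by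
  induction t generalizing k with
  | zero =>
    simp only [S1]; refine ⟨ind_nonneg _, fun h => ind_false (by omega), fun i hi => ?_, fun h => ind_false (by omega)⟩
    cases i with
    | zero => rw [ind_true (by simpa using hi)]; simp
    | succ i => rw [ind_false (by push_cast at hi; omega)]; simp
  | succ t ih =>
    simp only [S1]; obtain ⟨a1, a2, a3, a4⟩ := ih (k+1); obtain ⟨b1, b2, b3, b4⟩ := ih (k-1); push_cast
    refine ⟨by linarith, fun h => ?_, fun i hi => ?_, fun h => ?_⟩
    · rw [a2 (by omega), b2 (by omega)]; simp
    · cases i with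
      | zero => rw [a2 (by omega), b3 0 (by push_cast at *; omega)]; simp; ring
      | succ i => rw [a3 i (by push_cast at *; omega), b3 (i+1) (by push_cast at *; omega), Nat.choose_succ_succ']; push_cast; ring
    · rw [a4 (by omega), b4 (by omega)]; simp

lemma S1_pt_sq (t : ℕ) (y k : ℤ) : (S1 t (fun x => ind (x = y)) k)^2 * (t+1) ≤ 1 := by
  obtain ⟨h0, h1, h2, h3⟩ := S1_pt t y k
  by_cases hp : (k - y - t) % 2 = 1
  · rw [h3 hp]; simp
  by_cases hk : k > y + t
  · rw [h1 hk]; simp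
  rw [h2 ((y + t - k)/2).toNat (by omega), div_pow, ← pow_mul, mul_comm t 2, pow_mul, div_mul_eq_mul_div, div_le_one (by positivity)]
  have := mid_bound t ((y + t - k)/2).toNat
  norm_num
  exact_mod_cast this

lemma K1_true (t : ℕ) (f : ℤ → ℝ) (k : ℤ) : K1 (fun _ => True) t f k = S1 t f k := by
  induction t generalizing k with
  | zero => simp [K1, S1, ind]
  | succ t ih => simp [K1, S1, ih, ind]

lemma kernel (t : ℕ) (x y : Lat) : EW t (fun w => ind (endp x w = y)) ≤ 1/(t+1) := by
  have h := EW_prod (fun _ => True) (fun _ => True) (fun a => ind (a = uu y)) (fun a => ind (a = vv y)) t x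
  rw [K1_true, K1_true] at h
  have h1 : EW t (fun w => ind (endp x w = y)) ≤ S1 t (fun a => ind (a = uu y)) (uu x) * S1 t (fun a => ind (a = vv y)) (vv x) := by
    rw [← h]; apply EW_mono; intro w _; rw [ind_true (P := ∀ v ∈ path x w, True ∧ True) (fun _ _ => ⟨trivial, trivial⟩), one_mul, ← ind_and]
    apply ind_mono; rintro rfl; exact ⟨rfl, rfl⟩
  refine h1.trans ?_
  have h2 := S1_pt_sq t (uu y) (uu x)
  have h3 := S1_pt_sq t (vv y) (vv x)
  set a := S1 t (fun a => ind (a = uu y)) (uu x)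
  set b := S1 t (fun a => ind (a = vv y)) (vv x)
  rw [le_div_iff₀ (by positivity)]
  have : (0:ℝ) < t+1 := by positivity
  nlinarith [mul_nonneg this.le (sq_nonneg (a-b))]

lemma K1_le_one {A : ℤ → Prop} (t : ℕ) (k : ℤ) : K1 A t (fun _ => 1) k ≤ 1 := by
  have := K1_mono (A := A) (B := fun _ => True) (f := fun _ => 1) (g := fun _ => 1) (fun _ _ => trivial) (fun _ _ => le_rfl) (fun _ => by norm_num) t k
  rw [K1_true, S1_const] at this; exact this

lemma disp (T : ℕ) (x : Lat) (a : ℕ) (ha : 1 ≤ a) : EW T (fun w => ind (∃ v ∈ path x w, (a:ℤ) < linf (v - x))) ≤ 6*T^2/(a:ℝ)^4 := by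
  have h := EW_prod (fun k => |k - uu x| ≤ a) (fun k => |k - vv x| ≤ a) (fun _ => 1) (fun _ => 1) T x
  have h1 := K1_lower (uu x) a (by omega) (fun _ => 1) (fun _ => le_rfl) T (uu x)
  have h2 := K1_lower (vv x) a (by omega) (fun _ => 1) (fun _ => le_rfl) T (vv x)
  rw [S1_const] at h1 h2
  have h3 := K1_le_one (A := fun k => |k - uu x| ≤ a) T (uu x)
  have h4 := K1_le_one (A := fun k => |k - vv x| ≤ a) T (vv x)
  set K := K1 (fun k => |k - uu x| ≤ a) T (fun _ => 1) (uu x)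
  set K' := K1 (fun k => |k - vv x| ≤ a) T (fun _ => 1) (vv x)
  have h5 : EW T (fun w => ind (∃ v ∈ path x w, (a:ℤ) < linf (v - x))) ≤ 1 - K*K' := by
    rw [← h]
    have e : EW T (fun w => ind (∃ v ∈ path x w, (a:ℤ) < linf (v - x))) + EW T (fun w => ind (∀ v ∈ path x w, |uu v - uu x| ≤ a ∧ |vv v - vv x| ≤ a) * (1*1)) ≤ 1 := by
      rw [← EW_add_fun]; refine le_trans (EW_mono (G := fun _ => (1:ℝ)) ?_) (EW_const T 1).le
      intro w _; rw [one_mul, mul_one]; by_cases hh : ∀ v ∈ path x w, |uu v - uu x| ≤ a ∧ |vv v - vv x| ≤ a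
      · rw [ind_true hh, ind_false]
        · norm_num
        · rintro ⟨v, hv, hl⟩; have := hh v hv; rw [lt_linf] at hl; simp only [uu, vv, abs_le, Prod.fst_sub, Prod.snd_sub] at this hl; omega
      · rw [ind_false hh]; linarith [ind_le_one (∃ v ∈ path x w, (a:ℤ) < linf (v - x))]
    linarith
  have hc : ((a:ℤ):ℝ) = (a:ℝ) := by norm_num
  rw [hc, sub_self] at h1 h2
  have e6 : (0^4 + 6*(T:ℝ)*0^2+3*T^2)/(a:ℝ)^4 = (6*T^2/(a:ℝ)^4)/2 := by ring
  rw [e6] at h1 h2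
  nlinarith [mul_nonneg (sub_nonneg.2 h3) (sub_nonneg.2 h4)]

lemma EW_rwd (t : ℕ) (F : List Dir → ℝ) : EW t (fun w => F (rwd w)) = EW t F := by
  unfold EW; congr 1
  refine sum_nbij' rwd rwd ?_ ?_ ?_ ?_ ?_
  · intro w hw; rw [mem_words] at *; rw [rwd_length, hw]
  · intro w hw; rw [mem_words] at *; rw [rwd_length, hw]
  · intro w _; exact rwd_rwd w
  · intro w _; exact rwd_rwd w
  · intro w _; rfl

lemma EW_comm (s t : ℕ) (F : List Dir → List Dir → ℝ) : EW s (fun w => EW t (fun w' => F w w')) = EW t (fun w' => EW s (fun w => F w w')) := by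
  unfold EW; simp_rw [sum_mul]; rw [sum_comm]
  apply sum_congr rfl; intro w _; apply sum_congr rfl; intro w' _; ring

lemma half_sum (x : Lat) (T T' : ℕ) (Ψ : List Dir → Prop) (B : List Dir → Prop)
    (hB : ∀ w w', w.length = T → w'.length = T' → endp x (w ++ w') = x → B (w ++ w') → Ψ w ∨ Ψ (rwd w')) :
    EW (T+T') (fun w => ind (endp x w = x ∧ B w)) ≤ EW T (fun w => ind (Ψ w)) * (1/(T'+1)) + EW T' (fun w => ind (Ψ w)) * (1/(T+1)) := by
  have hr : ∀ w w', endp x (w ++ w') = x → endp x (rwd w') = endp x w := by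
    intro w w' h; rw [endp_append] at h; have := endp_rwd (endp x w) w'; rwa [h] at this
  have h1 : EW (T+T') (fun w => ind (endp x w = x ∧ B w)) ≤
      EW T (fun w => EW T' (fun w' => ind (Ψ w) * ind (endp (endp x w) w' = x))) +
      EW T (fun w => EW T' (fun w' => ind (Ψ (rwd w')) * ind (endp x w = endp x (rwd w')))) := by
    rw [EW_add, ← EW_add_fun]; apply EW_mono; intro w hw; rw [← EW_add_fun]; apply EW_mono; intro w' hw'; rw [← ind_and, ← ind_and]
    refine le_trans (ind_mono ?_) (ind_or_le _ _)
    rintro ⟨h, hb⟩; rcases hB w w' hw hw' h hb with h2 | h2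
    · left; exact ⟨h2, by rw [← endp_append]; exact h⟩
    · right; exact ⟨h2, (hr w w' h).symm⟩
  refine h1.trans (add_le_add ?_ ?_)
  · rw [mul_comm, ← EW_mul_left]; apply EW_mono; intro w _; rw [EW_mul_left, mul_comm]; exact mul_le_mul_of_nonneg_right (kernel _ _ _) (ind_nonneg _)
  · have e : ∀ w : List Dir, EW T' (fun w' => ind (Ψ (rwd w')) * ind (endp x w = endp x (rwd w'))) = EW T' (fun w' => ind (Ψ w') * ind (endp x w = endp x w')) :=
      fun w => EW_rwd T' (fun w' => ind (Ψ w') * ind (endp x w = endp x w'))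
    simp_rw [e]
    rw [EW_comm, mul_comm, ← EW_mul_left]; apply EW_mono; intro w _; rw [EW_mul_left, mul_comm]
    exact mul_le_mul_of_nonneg_right (kernel _ _ _) (ind_nonneg _)

lemma hasE_app_iff {w1 : List Dir} {z : Lat} {w2 : List Dir} {a b : Lat} :
    hasE (path z (w1 ++ w2)) a b ↔ hasE (path z w1) a b ∨ hasE (path (endp z w1) w2) a b := by
  refine ⟨fun h => ?_, fun h => h.elim hasE_app_left hasE_app_right⟩
  induction w1 generalizing z with
  | nil => exact Or.inr h
  | cons d w ih =>
    rw [List.cons_append, path_cons, path_eq_cons (z + stp d) (w ++ w2), hasE_cons, ← path_eq_cons] at h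
    rw [path_cons, path_eq_cons (z + stp d) w, hasE_cons, ← path_eq_cons]; rcases h with h | h
    · exact Or.inl (Or.inl h)
    · rcases ih h with h | h
      · exact Or.inl (Or.inr h)
      · exact Or.inr (by simpa using h)

lemma hasE_rwd {z : Lat} {w : List Dir} {a b : Lat} (h : hasE (path (endp z w) (rwd w)) a b) : hasE (path z w) a b := by
  induction w generalizing z with
  | nil => exact h
  | cons d w ih =>
    rw [rwd_cons, endp_cons, hasE_app_iff, endp_rwd] at h; rw [path_cons, path_eq_cons (z + stp d) w, hasE_cons, ← path_eq_cons]; rcases h with h | h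
    · exact Or.inr (ih h)
    · rw [path_cons, path_nil, hasE_cons, stp_rv, add_neg_cancel_right] at h; rcases h with h | h
      · exact Or.inl h.symm
      · simp [hasE] at h

def Bad (g0 : ℕ) (l : Lp) : Prop := (∃ u ∈ path l.1 l.2, linf u ≤ 60*g0) ∧
  (∃ u ∈ path l.1 l.2, ∃ v ∈ path l.1 l.2, 2*g0 < linf (u - v)) ∧ NR g0 l

lemma linf_tri (a b c : Lat) : linf (a - c) ≤ linf (a - b) + linf (b - c) := by
  have h1 : linf (a-b) ≤ linf (a-b) := le_rfl
  have h2 : linf (b-c) ≤ linf (b-c) := le_rfl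
  rw [linf_le] at *
  simp only [Prod.fst_sub, Prod.snd_sub] at *
  omega

lemma linf_symm (a b : Lat) : linf (a - b) = linf (b - a) := by unfold linf; simp only [Prod.fst_sub, Prod.snd_sub]; rw [abs_sub_comm, abs_sub_comm a.2]

lemma bad_half_hit {g0 : ℕ} {x : Lat} {w w' : List Dir} (hl : endp x (w ++ w') = x) (hb : Bad g0 (x, w ++ w')) :
    Hit g0 x w ∨ Hit g0 x (rwd w') := by
  obtain ⟨⟨u, hu, hu'⟩, _, hn⟩ := hb
  have hr : endp (endp x w) w' = x := by rw [← endp_append]; exact hl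
  have key : ∀ v, (∀ a b, hasE (path x v) a b → hasE (path x (w ++ w')) a b) → u ∈ path x v → Hit g0 x v := by
    intro v hv hu; obtain ⟨w1, w2, rfl, rfl⟩ := mem_path_split hu; refine ⟨w1, List.prefix_append _ _, hu', ?_⟩; intro g hg hs
    exact hn g hg (hs.mono (fun a b hab => hv a b (hasE_app_left hab)))
  simp only at hu
  rw [mem_path_append] at hu
  rcases hu with h | h
  · left; exact key w (fun a b => hasE_app_left) h
  · right
    apply key
    · intro a b hab; apply hasE_app_right; apply hasE_rwd; rw [hr]; exact hab
    · rw [← mem_path_rwd, hr] at h; exact h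

lemma bad_half_disp {g0 : ℕ} {x : Lat} {w w' : List Dir} (hl : endp x (w ++ w') = x) (hb : Bad g0 (x, w ++ w')) :
    (∃ v ∈ path x w, (g0:ℤ) < linf (v - x)) ∨ ∃ v ∈ path x (rwd w'), (g0:ℤ) < linf (v - x) := by
  obtain ⟨_, ⟨u, hu, v, hv, huv⟩, _⟩ := hb
  have hr : endp (endp x w) w' = x := by rw [← endp_append]; exact hl
  have key : ∀ v ∈ path x (w ++ w'), (g0:ℤ) < linf (v - x) → (∃ v ∈ path x w, (g0:ℤ) < linf (v - x)) ∨ ∃ v ∈ path x (rwd w'), (g0:ℤ) < linf (v - x) := by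
    intro v hv h; rw [mem_path_append] at hv; rcases hv with h' | h'
    · exact Or.inl ⟨v, h', h⟩
    · right; refine ⟨v, ?_, h⟩; rw [← mem_path_rwd, hr] at h'; exact h'
  have h1 := linf_tri u x v
  rw [linf_symm x v] at h1
  by_cases h2 : (g0:ℤ) < linf (u - x)
  · exact key u hu h2
  · exact key v hv (by omega)

def kap : ℝ := Real.sqrt (1 - cR)

lemma kap_sq : kap^2 = 1 - cR := Real.sq_sqrt (by linarith [cR_lt])
lemma kap_pos : 0 < kap := Real.sqrt_pos.2 (by linarith [cR_lt])
lemma kap_lt : kap < 1 := by have := kap_sq; have := cR_pos; have := kap_pos; nlinarith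

lemma perx {g0 : ℕ} (hg0 : 1 ≤ g0) (x : Lat) (j : ℕ) (hj : j = 0 ∨ (1 ≤ j ∧ 60*(4^j*g0 : ℕ) ≤ linf x)) (L : ℕ) :
    ∑ n ∈ Finset.Ioo 0 (L+1), EW n (fun w => ind (endp x w = x ∧ Bad g0 (x, w))) / n ≤ 32*kap^j/((4^j*g0:ℕ):ℝ)^2 := by
  set G : ℕ := 4^j*g0 with hG
  have hG1 : 1 ≤ G := Nat.mul_pos (pow_pos (by norm_num) _) hg0
  have hGr : (1:ℝ) ≤ G := by exact_mod_cast hG1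
  have kp := kap_pos
  have hΨ : ∃ Ψ : List Dir → Prop, (∀ w w', endp x (w ++ w') = x → Bad g0 (x, w ++ w') → Ψ w ∨ Ψ (rwd w')) ∧
      (∀ T, EW T (fun w => ind (Ψ w)) ≤ kap^(2*j)) ∧ ∀ T : ℕ, EW T (fun w => ind (Ψ w)) ≤ 6*T^2/(G:ℝ)^4 := by
    rcases hj with rfl | ⟨hj1, hj⟩
    · have : G = g0 := by rw [hG]; ring
      refine ⟨fun w => ∃ v ∈ path x w, (g0:ℤ) < linf (v - x), fun w w' h hb => bad_half_disp h hb, fun T => ?_, fun T => ?_⟩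
      · rw [mul_zero, pow_zero, ← EW_const T 1]; exact EW_mono (fun w _ => ind_le_one _)
      · rw [this]; exact disp T x g0 hg0
    · refine ⟨fun w => Hit g0 x w, fun w w' h hb => bad_half_hit h hb, fun T => ?_, fun T => ?_⟩
      · rw [pow_mul, kap_sq]; exact decay g0 hg0 j T x hj
      · refine le_trans (EW_mono (fun w _ => ind_mono ?_)) (disp T x G hG1)
        rintro ⟨u, ⟨u', rfl⟩, h2, _⟩; refine ⟨endp x u, by rw [mem_path_append]; exact Or.inl (endp_mem_path _ _), ?_⟩
        have h3 := linf_tri x (endp x u) 0; rw [sub_zero, sub_zero, linf_symm] at h3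
        have h4 : 4*g0 ≤ G := by
          rw [hG]; apply Nat.mul_le_mul_right
          calc 4 = 4^1 := by norm_num
            _ ≤ 4^j := Nat.pow_le_pow_right (by norm_num) hj1
        omega
  obtain ⟨Ψ, h1, h2, h3⟩ := hΨ
  have hn : ∀ n : ℕ, 1 ≤ n → ∀ b : ℝ, 0 ≤ b → (∀ T ≤ n, EW T (fun w => ind (Ψ w)) ≤ b) →
      EW n (fun w => ind (endp x w = x ∧ Bad g0 (x, w))) / n ≤ 4*b*((n:ℝ)^2)⁻¹ := by
    intro n hn b hb hT; have hnr : (1:ℝ) ≤ n := by exact_mod_cast hn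
    have h4 := half_sum x (n/2) (n-n/2) Ψ (fun w => Bad g0 (x, w)) (fun w w' _ _ => h1 w w')
    rw [show n/2 + (n-n/2) = n by omega] at h4
    have key : ∀ T T' : ℕ, n ≤ 2*(T+1) → T' ≤ n → EW T' (fun w => ind (Ψ w)) * (1/((T:ℝ)+1)) ≤ b*(2/n) := by
      intro T T' h h'; apply mul_le_mul (hT T' h') _ (by positivity) hb
      rw [div_le_div_iff₀ (by positivity) (by positivity)]
      have : (n:ℝ) ≤ 2*(T+1) := by exact_mod_cast h
      linarith
    have h5 := key (n/2) (n-n/2) (by omega) (by omega)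
    have h6 := key (n-n/2) (n/2) (by omega) (by omega)
    rw [div_le_iff₀ (by positivity)]
    have e : 4*b*((n:ℝ)^2)⁻¹*n = b*(2/n) + b*(2/n) := by field_simp; ring
    rw [e]; linarith
  set K : ℝ := kap^j*(G:ℝ)^2 with hK
  have hKp : 0 < K := by positivity
  set M := ⌊K⌋₊ with hM
  have hMK : (M:ℝ) ≤ K := Nat.floor_le hKp.le
  have hMK' : K < M + 1 := Nat.lt_floor_add_one K
  have hle : ∀ n ∈ Finset.Ioo 0 (L+1), EW n (fun w => ind (endp x w = x ∧ Bad g0 (x, w))) / n ≤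
      (if n ∈ Finset.Ioc 0 M then 24/(G:ℝ)^4 else 0) + (if n ∈ Finset.Ioo M (L+1) then 4*kap^(2*j)*((n:ℝ)^2)⁻¹ else 0) := by
    intro n hnL; rw [Finset.mem_Ioo] at hnL; have hnr : (1:ℝ) ≤ n := by exact_mod_cast hnL.1
    by_cases hc : n ≤ M
    · rw [if_pos (by simp; omega), if_neg (by simp; omega), add_zero]
      refine (hn n hnL.1 (6*n^2/(G:ℝ)^4) (by positivity) (fun T hT => (h3 T).trans ?_)).trans (le_of_eq ?_)
      · have : (T:ℝ) ≤ n := by exact_mod_cast hT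
        gcongr
      · field_simp; norm_num
    · rw [if_neg (by simp; omega), if_pos (by simp; omega), zero_add]
      exact hn n hnL.1 (kap^(2*j)) (by positivity) (fun T _ => h2 T)
  refine (Finset.sum_le_sum hle).trans ?_
  rw [sum_add_distrib, ← sum_filter, ← sum_filter]
  have s1 : ∑ n ∈ (Finset.Ioo 0 (L+1)).filter (fun n => n ∈ Finset.Ioc 0 M), 24/(G:ℝ)^4 ≤ 24*kap^j/(G:ℝ)^2 := by
    refine (sum_le_sum_of_subset_of_nonneg (t := Finset.Ioc 0 M) (fun n hn => (Finset.mem_filter.1 hn).2) (fun _ _ _ => by positivity)).trans ?_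
    rw [sum_const, Nat.card_Ioc, nsmul_eq_mul, Nat.sub_zero]
    calc (M:ℝ)*(24/(G:ℝ)^4) ≤ K*(24/(G:ℝ)^4) := by gcongr
      _ = _ := by rw [hK]; field_simp
  have s2 : ∑ n ∈ (Finset.Ioo 0 (L+1)).filter (fun n => n ∈ Finset.Ioo M (L+1)), 4*kap^(2*j)*((n:ℝ)^2)⁻¹ ≤ 8*kap^j/(G:ℝ)^2 := by
    refine (sum_le_sum_of_subset_of_nonneg (t := Finset.Ioo M (L+1)) (fun n hn => (Finset.mem_filter.1 hn).2) (fun _ _ _ => by positivity)).trans ?_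
    rw [← mul_sum]; have := sum_Ioo_inv_sq_le (α := ℝ) M (L+1)
    calc _ ≤ 4*kap^(2*j)*(2/((M:ℝ)+1)) := by gcongr
      _ ≤ 4*kap^(2*j)*(2/K) := by gcongr
      _ = _ := by rw [hK, pow_mul, ← pow_mul, mul_comm 2 j, pow_mul]; field_simp; ring
  calc _ ≤ 24*kap^j/(G:ℝ)^2 + 8*kap^j/(G:ℝ)^2 := add_le_add s1 s2
    _ = _ := by ring

lemma exists_j (g0 : ℕ) (hg0 : 1 ≤ g0) (x : Lat) : ∃ j : ℕ, (j = 0 ∨ (1 ≤ j ∧ 60*(4^j*g0 : ℕ) ≤ linf x)) ∧ linf x ≤ 240*(4^j*g0:ℕ) := by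
  have hex : ∃ j : ℕ, linf x ≤ 240*(4^j*g0:ℕ) := by
    refine ⟨(linf x).toNat, ?_⟩
    have h1 : (linf x).toNat < 4^(linf x).toNat := Nat.lt_pow_self (by norm_num)
    have h2 : 4^(linf x).toNat ≤ 4^(linf x).toNat*g0 := Nat.le_mul_of_pos_right _ hg0
    omega
  refine ⟨Nat.find hex, ?_, Nat.find_spec hex⟩
  rcases Nat.eq_zero_or_pos (Nat.find hex) with h | h
  · exact Or.inl h
  · right
    refine ⟨h, ?_⟩
    have h1 := Nat.find_min hex (m := Nat.find hex - 1) (by omega)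
    obtain ⟨k, hk⟩ : ∃ k, Nat.find hex = k+1 := ⟨_, (Nat.succ_pred_eq_of_pos h).symm⟩; rw [hk] at h1 ⊢; simp only [Nat.add_sub_cancel, not_le] at h1
    rw [pow_succ, mul_comm (4^k), mul_assoc]; push_cast at *; linarith

lemma mass_split (Q : Lp → Prop) (s : FLp) (X : FLat) (hX : ∀ l ∈ s, l.1 ∈ X) (hs : ∀ l ∈ s, l.2 ≠ [] ∧ endp l.1 l.2 = l.1 ∧ Q l) :
    ∑ l ∈ s, wt l ≤ ∑ x ∈ X, ∑ n ∈ Finset.Ioo 0 (s.sup (fun l => l.2.length) + 1), EW n (fun w => ind (endp x w = x ∧ Q (x, w))) / n := by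
  set L := s.sup (fun l => l.2.length) with hL
  have e : ∀ x n, EW n (fun w => ind (endp x w = x ∧ Q (x, w))) / n = ∑ w ∈ words n, ind (endp x w = x ∧ Q (x, w)) * wt (x, w) := by
    intro x n; unfold EW; rw [mul_div_assoc, sum_mul]; apply sum_congr rfl; intro w hw; rw [mem_words] at hw; unfold wt; simp only [hw]
  simp_rw [e]
  rw [← sum_fiberwise_of_maps_to (t := X) (g := Prod.fst) hX]
  apply Finset.sum_le_sum
  intro x _
  rw [← sum_fiberwise_of_maps_to (t := Finset.Ioo 0 (L+1)) (g := fun l : Lp => l.2.length)]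
  · apply Finset.sum_le_sum
    intro n _
    rw [← sum_image (s := words n) (g := fun w => ((x, w) : Lp)) (f := fun l : Lp => ind (endp l.1 l.2 = l.1 ∧ Q l) * wt l)
      (fun a _ b _ h => (Prod.mk.inj h).2)]
    refine le_trans (le_of_eq ?_) (sum_le_sum_of_subset_of_nonneg (s := (s.filter (fun l => l.1 = x)).filter (fun l => l.2.length = n)) ?_ ?_)
    · apply sum_congr rfl
      intro l hl; rw [Finset.mem_filter, Finset.mem_filter] at hl; rw [ind_true (hs l hl.1.1).2, one_mul]
    · intro l hl; rw [Finset.mem_filter, Finset.mem_filter] at hl; rw [Finset.mem_image]; exact ⟨l.2, mem_words.2 hl.2, by rw [← hl.1.2]⟩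
    · intro l _ _; exact mul_nonneg (ind_nonneg _) (wt_nonneg l)
  · intro l hl; rw [Finset.mem_filter] at hl; rw [Finset.mem_Ioo]
    refine ⟨List.length_pos_of_ne_nil (hs l hl.1).1, Nat.lt_succ_of_le (le_sup (f := fun l : Lp => l.2.length) hl.1)⟩

def C1 : ℝ := 32*481^2/(1-kap)

lemma C1_pos : 0 < C1 := by unfold C1; have := kap_lt; apply div_pos (by norm_num); linarith

lemma bad_mass (g0 : ℕ) (hg0 : 1 ≤ g0) (s : FLp) (hs : ∀ l ∈ s, l.2 ≠ [] ∧ endp l.1 l.2 = l.1 ∧ Bad g0 l) :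
    ∑ l ∈ s, wt l ≤ C1 := by
  set X := s.image Prod.fst with hX
  set L := s.sup (fun l => l.2.length) with hL
  choose jf hj1 hj2 using exists_j g0 hg0
  set J := X.sup jf + 1 with hJ
  have kp := kap_pos
  have kl := kap_lt
  have h1 := mass_split (Bad g0) s X (fun l hl => Finset.mem_image_of_mem _ hl) hs
  rw [← hL] at h1
  refine h1.trans ((Finset.sum_le_sum (fun x _ => perx hg0 x (jf x) (hj1 x) L)).trans ?_)
  rw [← sum_fiberwise_of_maps_to (t := Finset.range J) (g := jf)
    (fun x hx => Finset.mem_range.2 (Nat.lt_succ_of_le (le_sup (f := jf) hx)))]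
  have h2 : ∀ j ∈ Finset.range J, ∑ x ∈ X.filter (fun x => jf x = j), 32*kap^(jf x)/((4^(jf x)*g0:ℕ):ℝ)^2 ≤ 32*481^2*kap^j := by
    intro j _; set G : ℕ := 4^j*g0 with hG; have hG1 : 1 ≤ G := Nat.mul_pos (pow_pos (by norm_num) _) hg0
    have hGr : (1:ℝ) ≤ G := by exact_mod_cast hG1
    have hsub : X.filter (fun x => jf x = j) ⊆ Rc (-(240*G)) (240*G) (-(240*G)) (240*G) := by
      intro x hx; rw [Finset.mem_filter] at hx; have := hj2 x; rw [hx.2, linf_le] at this; rw [mem_Rc]; exact this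
    have hcard : ((X.filter (fun x => jf x = j)).card : ℝ) ≤ (481*G)^2 := by
      have h := Finset.card_le_card hsub; rw [card_Rc, show ((240:ℤ)*G+1- -(240*G)).toNat = 480*G+1 by omega] at h
      have h' : ((X.filter (fun x => jf x = j)).card : ℝ) ≤ (480*G+1)*(480*G+1) := by exact_mod_cast h
      nlinarith
    calc _ = ∑ x ∈ X.filter (fun x => jf x = j), 32*kap^j/(G:ℝ)^2 := by
          apply sum_congr rfl
          intro x hx; rw [(Finset.mem_filter.1 hx).2]
      _ ≤ (481*G)^2*(32*kap^j/(G:ℝ)^2) := by rw [sum_const, nsmul_eq_mul]; gcongr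
      _ = _ := by field_simp
  refine (Finset.sum_le_sum h2).trans ?_
  rw [← mul_sum]
  unfold C1
  rw [le_div_iff₀ (by linarith), mul_assoc]
  have hg := geom_sum_mul kap J
  have : 0 ≤ kap^J := by positivity
  nlinarith

/-! ### faces, and the frontier of a surrounding loop -/

def dbl (w : List Dir) : List Dir := w.flatMap (fun d => [d, d])

lemma dbl_mem (w : List Dir) (z c v : Lat) (h : v ∈ path (z + z + c) (dbl w)) :
    (∃ u ∈ path z w, v = u + u + c) ∨ (∃ a b, hasE (path z w) a b ∧ v = a + b + c) := by
  induction w generalizing z with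
  | nil => left; exact ⟨z, by simp, by simpa [dbl] using h⟩
  | cons d w ih =>
    have e : path z (d::w) = z :: (z + stp d) :: (path (z + stp d) w).tail := by rw [path_cons, ← path_eq_cons]
    have e2 : dbl (d :: w) = d :: d :: dbl w := by simp [dbl]
    rw [e2, path_cons, path_cons, List.mem_cons, List.mem_cons] at h; rcases h with h | h | h
    · left; exact ⟨z, mem_path_self _ _, h⟩
    · right
      refine ⟨z, z + stp d, ?_, by rw [h]; abel⟩
      rw [e, hasE_cons]; tauto
    · rw [show z + z + c + stp d + stp d = (z + stp d) + (z + stp d) + c by abel] at h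
      rcases ih _ h with ⟨u, hu, h⟩ | ⟨a, b, hab, h⟩
      · left; exact ⟨u, by rw [path_cons]; exact List.mem_cons_of_mem _ hu, h⟩
      · right; refine ⟨a, b, ?_, h⟩
        rw [e, hasE_cons, ← path_eq_cons]; right; exact hab

lemma dbl_hasE (w : List Dir) (z c a b : Lat) (h : hasE (path z w) a b) :
    hasE (path (z + z + c) (dbl w)) (a + a + c) (a + b + c) ∧ hasE (path (z + z + c) (dbl w)) (a + b + c) (b + b + c) := by
  induction w generalizing z with
  | nil => simp [hasE] at h
  | cons d w ih =>
    have e : path z (d::w) = z :: (z + stp d) :: (path (z + stp d) w).tail := by rw [path_cons, ← path_eq_cons]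
    have e2 : path (z+z+c) (dbl (d :: w)) = (z+z+c) :: (z+z+c+stp d) :: (z+z+c+stp d+stp d) :: (path (z+z+c+stp d+stp d) (dbl w)).tail := by rw [show dbl (d :: w) = d :: d :: dbl w by simp [dbl], path_cons, path_cons, ← path_eq_cons]
    rw [e, hasE_cons, ← path_eq_cons] at h; rw [e2, hasE_cons, hasE_cons, hasE_cons, hasE_cons, ← path_eq_cons]
    rcases h with (⟨rfl, rfl⟩ | ⟨rfl, rfl⟩) | h
    · have i1 : a + (a + stp d) + c = a + a + c + stp d := by abel
      have i2 : a + stp d + (a + stp d) + c = a + a + c + stp d + stp d := by abel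
      rw [i1, i2]; tauto
    · have i1 : b + stp d + b + c = b + b + c + stp d := by abel
      have i2 : b + stp d + (b + stp d) + c = b + b + c + stp d + stp d := by abel
      rw [i1, i2]; tauto
    · rw [show z + z + c + stp d + stp d = (z + stp d) + (z + stp d) + c by abel]
      have := ih _ h; exact ⟨Or.inr (Or.inr this.1), Or.inr (Or.inr this.2)⟩

def dbL (l : Lp) : Lp := (l.1 + l.1 + 0, dbl l.2)

lemma dbL_conn {l : Lp} {S S' : FLat} (hS : ∀ a ∈ S, ∀ b ∈ S, Adj a b ∨ a = b → a + b ∈ S') {a b : Lat} (h : Conn {l} S a b) :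
    Conn {dbL l} S' (a + a) (b + b) := by
  refine ⟨hS a h.1 a h.1 (Or.inr rfl), ?_⟩
  have h2 := h.2
  clear h
  induction h2 with
  | refl => exact ReflTransGen.refl
  | tail h1 h2 ih =>
    rename_i x y
    have hadj := h2.1.adj; obtain ⟨⟨l', hl', he⟩, hx, hy⟩ := h2; rw [Finset.mem_singleton] at hl'; subst hl'; have := dbl_hasE _ _ 0 _ _ he
    rw [add_zero, add_zero, add_zero, add_zero] at this
    have q : ∀ u v, hasE (path (l'.1 + l'.1) (dbl l'.2)) u v → Op {dbL l'} u v := fun u v h => ⟨_, Finset.mem_singleton_self _, by simpa [dbL] using h⟩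
    exact (ih.tail ⟨q _ _ this.1, hS x hx x hx (Or.inr rfl), hS x hx y hy (Or.inl hadj)⟩).tail
      ⟨q _ _ this.2, hS x hx y hy (Or.inl hadj), hS y hy y hy (Or.inr rfl)⟩

lemma dbL_surr {N : ℤ} {l : Lp} (h : Surr N l) : Surr (2*N) (dbL l) := by
  have hS : ∀ x0 x1 y0 y1 x0' x1' y0' y1' : ℤ, x0' = 2*x0 → x1' = 2*x1 → y0' = 2*y0 → y1' = 2*y1 →
      ∀ a ∈ Rc x0 x1 y0 y1, ∀ b ∈ Rc x0 x1 y0 y1, Adj a b ∨ a = b → a + b ∈ Rc x0' x1' y0' y1' := by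
    intro x0 x1 y0 y1 x0' x1' y0' y1' e1 e2 e3 e4 a ha b hb _; rw [mem_Rc] at *; simp only [Prod.fst_add, Prod.snd_add]; omega
  obtain ⟨⟨a1, b1, h1, h2, h3⟩, ⟨a2, b2, h4, h5, h6⟩, ⟨a3, b3, h7, h8, h9⟩, ⟨a4, b4, h10, h11, h12⟩⟩ := h
  refine ⟨⟨_, _, ?_, ?_, dbL_conn (hS _ _ _ _ _ _ _ _ ?_ ?_ ?_ ?_) h3⟩, ⟨_, _, ?_, ?_, dbL_conn (hS _ _ _ _ _ _ _ _ ?_ ?_ ?_ ?_) h6⟩,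
    ⟨_, _, ?_, ?_, dbL_conn (hS _ _ _ _ _ _ _ _ ?_ ?_ ?_ ?_) h9⟩, ⟨_, _, ?_, ?_, dbL_conn (hS _ _ _ _ _ _ _ _ ?_ ?_ ?_ ?_) h12⟩⟩ <;>
  (try simp only [Prod.fst_add, Prod.snd_add]) <;> omega

/-- two adjacent faces not separated by an edge of `l` -/
def FA (l : Lp) (f f' : Lat) : Prop := Adj f f' ∧ ∀ a b, hasE (path l.1 l.2) a b → a + b ≠ f + f' + (1, 1)

lemma FA.symm {l : Lp} {f f' : Lat} (h : FA l f f') : FA l f' f := ⟨h.1.symm, fun a b hab => by rw [add_comm f']; exact h.2 a b hab⟩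

lemma fa_word {l : Lp} {f f' : Lat} (h : ReflTransGen (FA l) f f') :
    ∃ w, endp f w = f' ∧ ∀ a b, hasE (path f w) a b → FA l a b := by
  induction h with
  | refl => exact ⟨[], rfl, fun a b h => by simp [hasE] at h⟩
  | tail h1 h2 ih =>
    obtain ⟨w, hw, hE⟩ := ih; obtain ⟨d, hd⟩ := exists_stp h2.1; refine ⟨w ++ [d], by rw [endp_append, hw]; exact hd.symm, fun a b h => ?_⟩
    rw [hasE_app_iff] at h; rcases h with h | h
    · exact hE a b h
    · rw [hw, path_cons, path_nil, hasE_cons, ← hd] at h; rcases h with (⟨rfl, rfl⟩ | ⟨rfl, rfl⟩) | h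
      · exact h2
      · exact h2.symm
      · simp [hasE] at h

lemma adj_odd {a b : Lat} (h : Adj a b) : (a.1 + b.1 + a.2 + b.2) % 2 = 1 := by rcases adj_cases h with h | h | h | h <;> omega

lemma face_block0 {N : ℤ} (hN : 1 ≤ N) {l : Lp} (hl : Surr N l) {f f' : Lat} (h : ReflTransGen (FA l) f f')
    (h1 : -N ≤ f.1 ∧ f.1 < N) (h2 : -N ≤ f.2 ∧ f.2 < N) :
    (-(3*N) ≤ f'.1 ∧ f'.1 < 3*N) ∧ -(3*N) ≤ f'.2 ∧ f'.2 < 3*N := by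
  by_contra hcon
  obtain ⟨w, rfl, hE⟩ := fa_word h
  set k : Lp := (f + f + (1,1), dbl w) with hk
  have hend : endp f w + endp f w + (1,1) ∈ path k.1 k.2 := by
    have key : ∀ (w : List Dir) (f : Lat), endp f w + endp f w + (1,1) = endp (f + f + (1,1)) (dbl w) := by
      intro w
      induction w with
      | nil => intro f; rfl
      | cons d w ih =>
        intro f; rw [show dbl (d :: w) = d :: d :: dbl w by simp [dbl], endp_cons, endp_cons, endp_cons, ih]
        congr 1; abel
    rw [key]; exact endp_mem_path _ _
  have hc : Conn {k} (path k.1 k.2).toFinset (f + f + (1,1)) (endp f w + endp f w + (1,1)) := path_conn (Finset.mem_singleton_self _) (fun v hv => List.mem_toFinset.2 hv) (mem_path_self _ _) hend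
  obtain ⟨v, hv, hcv⟩ := surr_meet (N := 2*N) (by omega) (dbL_surr hl) hc
    (by rw [linf_le]; simp only [Prod.fst_add, Prod.snd_add]; omega)
    (by
      have : 3*(2*N) - 1 < linf (endp f w + endp f w + (1,1)) := by rw [lt_linf]; simp only [Prod.fst_add, Prod.snd_add]; omega
      omega)
  have hv2 := List.mem_toFinset.1 hcv.right
  rcases dbl_mem _ _ _ _ hv2 with ⟨u, hu, e⟩ | ⟨a, b, hab, e⟩ <;>
  rcases dbl_mem _ _ _ _ hv with ⟨u', hu', e'⟩ | ⟨a', b', hab', e'⟩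
  · rw [e] at e'; have := congrArg Prod.fst e'; simp at this; omega
  · have o := adj_odd (hasE_adj (path_chain _ _) hab'); rw [e] at e'
    have j1 := congrArg Prod.fst e'; have j2 := congrArg Prod.snd e'; simp at j1 j2; omega
  · have o := adj_odd (hE _ _ hab).1; rw [e] at e'; have j1 := congrArg Prod.fst e'; have j2 := congrArg Prod.snd e'; simp at j1 j2; omega
  · apply (hE _ _ hab).2 _ _ hab'
    rw [← e, e', add_zero]

lemma hasE_tr {c : Lat} {l : Lp} {a b : Lat} : hasE (path (tr c l).1 (tr c l).2) a b ↔ hasE (path l.1 l.2) (a + c) (b + c) := by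
  have e : path (tr c l).1 (tr c l).2 = (path l.1 l.2).map (syT (-c)).f := by unfold tr Sy.act; rw [Sy.path_act]
  constructor
  · intro h; have h2 := Sy.hasE_map (syT (-c)).f.symm h; rw [e, List.map_map] at h2; simpa [syT] using h2
  · intro h; rw [e]; simpa [syT] using Sy.hasE_map (syT (-c)).f h

lemma face_block {N : ℤ} (hN : 1 ≤ N) {l : Lp} {c : Lat} (hl : Surr N (tr c l)) {f f' : Lat} (h : ReflTransGen (FA l) f f')
    (h1 : -N ≤ f.1 - c.1 ∧ f.1 - c.1 < N) (h2 : -N ≤ f.2 - c.2 ∧ f.2 - c.2 < N) :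
    (-(3*N) ≤ f'.1 - c.1 ∧ f'.1 - c.1 < 3*N) ∧ -(3*N) ≤ f'.2 - c.2 ∧ f'.2 - c.2 < 3*N := by
  have : ReflTransGen (FA (tr c l)) (f - c) (f' - c) := by
    refine ReflTransGen.lift (fun x => x - c) ?_ _ _ h
    intro a b hab; refine ⟨by simpa [Adj] using hab.1, fun x y hxy e => ?_⟩
    rw [hasE_tr] at hxy; apply hab.2 _ _ hxy; have e : x + y = a - c + (b - c) + (1, 1) := e; have : x + c + (y + c) = (x + y) + (c + c) := by abel
    rw [this, e]; generalize ((1, 1) : Lat) = o; abel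
  exact face_block0 hN hl this h1 h2

/-! ### planar topology of traces -/

lemma emb_0 (z : Lat) : emb z 0 = z.1 := by simp [emb]
lemma emb_1 (z : Lat) : emb z 1 = z.2 := by simp [emb]

lemma seg_sub {a b : Lat} {p : Plane} (h : p ∈ segment ℝ (emb a) (emb b)) :
    (((min a.1 b.1 : ℤ) : ℝ) ≤ p 0 ∧ p 0 ≤ ((max a.1 b.1 : ℤ) : ℝ)) ∧ (((min a.2 b.2 : ℤ) : ℝ) ≤ p 1 ∧ p 1 ≤ ((max a.2 b.2 : ℤ) : ℝ)) := by
  obtain ⟨s, t, hs, ht, hst, rfl⟩ := h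
  simp only [PiLp.add_apply, PiLp.smul_apply, smul_eq_mul, emb_0, emb_1]
  have key : ∀ x y : ℤ, ((min x y : ℤ) : ℝ) ≤ s*x+t*y ∧ s*x+t*y ≤ ((max x y : ℤ) : ℝ) := by
    intro x y; have h1 : ((min x y : ℤ) : ℝ) ≤ x := by exact_mod_cast min_le_left x y
    have h2 : ((min x y : ℤ) : ℝ) ≤ y := by exact_mod_cast min_le_right x y
    have h3 : (x:ℝ) ≤ ((max x y : ℤ) : ℝ) := by exact_mod_cast le_max_left x y
    have h4 : (y:ℝ) ≤ ((max x y : ℤ) : ℝ) := by exact_mod_cast le_max_right x y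
    have : s = 1 - t := by linarith
    subst this; constructor <;> nlinarith
  exact ⟨key _ _, key _ _⟩

lemma seg_mem {a b : Lat} (hab : Adj a b) {p : Plane} (h0 : ((min a.1 b.1 : ℤ) : ℝ) ≤ p 0 ∧ p 0 ≤ ((max a.1 b.1 : ℤ) : ℝ))
    (h1 : ((min a.2 b.2 : ℤ) : ℝ) ≤ p 1 ∧ p 1 ≤ ((max a.2 b.2 : ℤ) : ℝ)) : p ∈ segment ℝ (emb a) (emb b) := by
  have key : ∀ t : ℝ, 0 ≤ t → t ≤ 1 → (1-t)*a.1 + t*b.1 = p 0 → (1-t)*a.2+t*b.2 = p 1 → p ∈ segment ℝ (emb a) (emb b) := by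
    intro t ht0 ht1 e0 e1; refine ⟨1-t, t, by linarith, ht0, by ring, ?_⟩
    ext i
    fin_cases i
    · simpa [emb_0] using e0
    · simpa [emb_1] using e1
  rcases adj_cases hab with ⟨e1, e2⟩ | ⟨e1, e2⟩ | ⟨e1, e2⟩ | ⟨e1, e2⟩ <;>
  rw [e1] at h0 <;> rw [e2] at h1 <;> rw [e1, e2] at key <;> simp at h0 h1
  all_goals first
    | (apply key (p 0 - a.1) <;> push_cast <;> nlinarith [h0.1, h0.2, h1.1, h1.2])
    | (apply key (p 0 - b.1) <;> push_cast <;> nlinarith [h0.1, h0.2, h1.1, h1.2])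
    | (apply key (a.1 - p 0) <;> push_cast <;> nlinarith [h0.1, h0.2, h1.1, h1.2])
    | (apply key (p 1 - a.2) <;> push_cast <;> nlinarith [h0.1, h0.2, h1.1, h1.2])
    | (apply key (a.2 - p 1) <;> push_cast <;> nlinarith [h0.1, h0.2, h1.1, h1.2])

def Tr (l : Lp) : Set Plane := {p | ∃ a b, hasE (path l.1 l.2) a b ∧ p ∈ segment ℝ (emb a) (emb b)}

lemma Tr_eq (l : Lp) : Tr l = ⋃ q ∈ (path l.1 l.2).zip (path l.1 l.2).tail, segment ℝ (emb q.1) (emb q.2) := by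
  ext p
  simp only [Tr, hasE, mem_setOf_eq, mem_iUnion, exists_prop]
  constructor
  · rintro ⟨a, b, h | h, hp⟩
    · exact ⟨(a, b), h, hp⟩
    · exact ⟨(b, a), h, by rwa [segment_symm]⟩
  · rintro ⟨⟨a, b⟩, h, hp⟩; exact ⟨a, b, Or.inl h, hp⟩

lemma Tr_closed (l : Lp) : IsClosed (Tr l) := by
  rw [Tr_eq]
  apply Set.Finite.isClosed_biUnion (s := {q | q ∈ (path l.1 l.2).zip (path l.1 l.2).tail}) (List.finite_toSet _)
  intro q _
  rw [← convexHull_pair]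
  exact (Set.Finite.isCompact_convexHull ℝ (Set.toFinite {emb q.1, emb q.2})).isClosed

lemma Tr_meet {l l' : Lp} {p : Plane} (h : p ∈ Tr l) (h' : p ∈ Tr l') : ∃ v, v ∈ path l.1 l.2 ∧ v ∈ path l'.1 l'.2 := by
  obtain ⟨a, b, hab, hp⟩ := h
  obtain ⟨c, d, hcd, hp'⟩ := h'
  have A1 := adj_cases (hasE_adj (path_chain _ _) hab)
  have A2 := adj_cases (hasE_adj (path_chain _ _) hcd)
  have s1 := seg_sub hp
  have s2 := seg_sub hp'
  have i1 : min a.1 b.1 ≤ max c.1 d.1 := by exact_mod_cast s1.1.1.trans s2.1.2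
  have i2 : min c.1 d.1 ≤ max a.1 b.1 := by exact_mod_cast s2.1.1.trans s1.1.2
  have i3 : min a.2 b.2 ≤ max c.2 d.2 := by exact_mod_cast s1.2.1.trans s2.2.2
  have i4 : min c.2 d.2 ≤ max a.2 b.2 := by exact_mod_cast s2.2.1.trans s1.2.2
  have key : (a.1 = c.1 ∧ a.2 = c.2) ∨ (a.1 = d.1 ∧ a.2 = d.2) ∨ (b.1 = c.1 ∧ b.2 = c.2) ∨ (b.1 = d.1 ∧ b.2 = d.2) := by rcases A1 with ⟨e1, e2⟩ | ⟨e1, e2⟩ | ⟨e1, e2⟩ | ⟨e1, e2⟩ <;> rcases A2 with ⟨e3, e4⟩ | ⟨e3, e4⟩ | ⟨e3, e4⟩ | ⟨e3, e4⟩ <;> omega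
  have ma := hasE_mem hab
  have mc := hasE_mem hcd
  rcases key with h | h | h | h
  · exact ⟨a, ma.1, by rw [Prod.ext h.1 h.2]; exact mc.1⟩
  · exact ⟨a, ma.1, by rw [Prod.ext h.1 h.2]; exact mc.2⟩
  · exact ⟨b, ma.2, by rw [Prod.ext h.1 h.2]; exact mc.1⟩
  · exact ⟨b, ma.2, by rw [Prod.ext h.1 h.2]; exact mc.2⟩

lemma Tr_near {l : Lp} {p : Plane} (h : p ∈ Tr l) : ∃ v ∈ path l.1 l.2, |p 0 - v.1| ≤ 1 ∧ |p 1 - v.2| ≤ 1 := by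
  obtain ⟨a, b, hab, hp⟩ := h
  have A1 := adj_cases (hasE_adj (path_chain _ _) hab)
  have s1 := seg_sub hp
  refine ⟨a, (hasE_mem hab).1, ?_, ?_⟩ <;> rw [abs_le] <;>
  rcases A1 with ⟨e1, e2⟩ | ⟨e1, e2⟩ | ⟨e1, e2⟩ | ⟨e1, e2⟩ <;> rw [e1, e2] at s1 <;> simp at s1 <;> constructor <;>
  linarith [s1.1.1, s1.1.2, s1.2.1, s1.2.2]

lemma Tr_lat {l : Lp} {z : Lat} (h : emb z ∈ Tr l) : z ∈ path l.1 l.2 := by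
  obtain ⟨a, b, hab, hp⟩ := h
  have A1 := adj_cases (hasE_adj (path_chain _ _) hab)
  have s1 := seg_sub hp
  rw [emb_0, emb_1] at s1
  have i1 : min a.1 b.1 ≤ z.1 := by exact_mod_cast s1.1.1
  have i2 : z.1 ≤ max a.1 b.1 := (Int.cast_le (R := ℝ)).1 s1.1.2
  have i3 : min a.2 b.2 ≤ z.2 := by exact_mod_cast s1.2.1
  have i4 : z.2 ≤ max a.2 b.2 := (Int.cast_le (R := ℝ)).1 s1.2.2
  have key : (z.1 = a.1 ∧ z.2 = a.2) ∨ (z.1 = b.1 ∧ z.2 = b.2) := by rcases A1 with ⟨e1, e2⟩ | ⟨e1, e2⟩ | ⟨e1, e2⟩ | ⟨e1, e2⟩ <;> omega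
  rcases key with h | h
  · rw [Prod.ext h.1 h.2]; exact (hasE_mem hab).1
  · rw [Prod.ext h.1 h.2]; exact (hasE_mem hab).2

def fl (x : Plane) : Lat := (⌊x 0⌋, ⌊x 1⌋)

lemma floor_near (x : Plane) (i : Fin 2) : ∀ᶠ y : Plane in nhds x, ⌊y i⌋ = ⌊x i⌋ ∨ (⌊y i⌋ = ⌊x i⌋ - 1 ∧ x i = ⌊x i⌋) := by
  have hc : Filter.Tendsto (fun y : Plane => y i) (nhds x) (nhds (x i)) := (by fun_prop : Continuous (fun y : Plane => y i)).tendsto x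
  have h1 : ∀ᶠ y : Plane in nhds x, y i < ⌊x i⌋ + 1 := hc.eventually_lt_const (Int.lt_floor_add_one _)
  by_cases hx : x i = ⌊x i⌋
  · have h2 : ∀ᶠ y : Plane in nhds x, (⌊x i⌋:ℝ) - 1 < y i := hc.eventually_const_lt (by linarith)
    filter_upwards [h1, h2] with y h1 h2
    by_cases h : (⌊x i⌋ : ℝ) ≤ y i
    · left; rw [Int.floor_eq_iff]; exact ⟨h, h1⟩
    · right; refine ⟨?_, hx⟩
      rw [Int.floor_eq_iff]; push_cast; constructor <;> linarith
  · have h2 : ∀ᶠ y : Plane in nhds x, (⌊x i⌋:ℝ) < y i := hc.eventually_const_lt (lt_of_le_of_ne (Int.floor_le _) (Ne.symm hx))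
    filter_upwards [h1, h2] with y h1 h2
    left; rw [Int.floor_eq_iff]; exact ⟨h2.le, h1⟩

lemma fl_H {l : Lp} {x : Plane} (hx : x ∉ Tr l) {i j : ℤ} (h0 : x 0 = i) (h1 : (j:ℝ) ≤ x 1 ∧ x 1 ≤ j + 1) :
    FA l (i, j) (i - 1, j) := by
  refine ⟨by simp [Adj], fun a b hab e => hx ⟨a, b, hab, ?_⟩⟩
  have hadj := hasE_adj (path_chain _ _) hab
  have e1 := congrArg Prod.fst e; have e2 := congrArg Prod.snd e; simp at e1 e2
  have k1 : min a.1 b.1 = i ∧ max a.1 b.1 = i := by rcases adj_cases hadj with h | h | h | h <;> omega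
  have k2 : min a.2 b.2 = j ∧ max a.2 b.2 = j + 1 := by rcases adj_cases hadj with h | h | h | h <;> omega
  apply seg_mem hadj
  · rw [k1.1, k1.2, h0]; simp
  · rw [k2.1, k2.2]; push_cast; exact h1

lemma fl_V {l : Lp} {x : Plane} (hx : x ∉ Tr l) {i j : ℤ} (h0 : x 1 = j) (h1 : (i:ℝ) ≤ x 0 ∧ x 0 ≤ i + 1) :
    FA l (i, j) (i, j - 1) := by
  refine ⟨by simp [Adj], fun a b hab e => hx ⟨a, b, hab, ?_⟩⟩
  have hadj := hasE_adj (path_chain _ _) hab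
  have e1 := congrArg Prod.fst e; have e2 := congrArg Prod.snd e; simp at e1 e2
  have k1 : min a.2 b.2 = j ∧ max a.2 b.2 = j := by rcases adj_cases hadj with h | h | h | h <;> omega
  have k2 : min a.1 b.1 = i ∧ max a.1 b.1 = i + 1 := by rcases adj_cases hadj with h | h | h | h <;> omega
  apply seg_mem hadj
  · rw [k2.1, k2.2]; push_cast; exact h1
  · rw [k1.1, k1.2, h0]; simp

lemma fl_near {l : Lp} {x : Plane} (hx : x ∉ Tr l) : ∀ᶠ y in nhds x, ReflTransGen (FA l) (fl x) (fl y) := by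
  filter_upwards [floor_near x 0, floor_near x 1] with y h0 h1
  have f0 := Int.floor_le (x 0); have f0' := (Int.lt_floor_add_one (x 0)).le
  have f1 := Int.floor_le (x 1); have f1' := (Int.lt_floor_add_one (x 1)).le
  unfold fl
  rcases h0 with h0 | ⟨h0, e0⟩ <;> rcases h1 with h1 | ⟨h1, e1⟩ <;> rw [h0, h1]
  · exact .single (fl_V hx e1 ⟨f0, f0'⟩)
  · exact .single (fl_H hx e0 ⟨f1, f1'⟩)
  · refine (ReflTransGen.single (fl_H hx e0 ⟨f1, f1'⟩)).tail (fl_V hx e1 ⟨?_, ?_⟩)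
    · push_cast; linarith
    · push_cast; linarith

lemma fl_conn {l : Lp} {C : Set Plane} (hC : C ⊆ (Tr l)ᶜ) (hc : IsConnected C) {p q : Plane} (hp : p ∈ C) (hq : q ∈ C) :
    ReflTransGen (FA l) (fl p) (fl q) := by
  refine hc.2.induction₂ (fun x y => ReflTransGen (FA l) (fl x) (fl y)) ?_ ?_ ?_ hp hq
  · intro x hx; exact (fl_near (hC hx)).filter_mono nhdsWithin_le_nhds
  · intro x y z hx hy hz h1 h2; exact h1.trans h2
  · intro x y hx hy h; haveI : Std.Symm (FA l) := ⟨fun _ _ h => h.symm⟩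
    exact (ReflTransGen.symmetric (r := FA l)).symm _ _ h

lemma fill_surr {N : ℤ} (hN : 1 ≤ N) {l : Lp} {c : Lat} (hl : Surr N (tr c l)) {p : Plane} (h0 : |p 0 - c.1| < N) (h1 : |p 1 - c.2| < N) :
    p ∈ Fill (Tr l) := by
  intro C hC hcon hp
  rw [(Tr_closed l).closure_eq] at hC
  rw [abs_lt] at h0 h1
  have g : ∀ (i : Fin 2) (z : ℤ), -(N:ℝ) < p i - z → p i - z < N → -N ≤ ⌊p i⌋ - z ∧ ⌊p i⌋ - z < N := by
    intro i z h1 h2; constructor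
    · have : -N + z ≤ ⌊p i⌋ := by rw [Int.le_floor]; push_cast; linarith
      omega
    · have : ⌊p i⌋ < N + z := by rw [Int.floor_lt]; push_cast; linarith
      omega
  refine (Metric.isBounded_closedBall (x := emb c) (r := 10*N)).subset ?_
  intro q hq
  have := face_block hN hl (fl_conn hC hcon hp hq) (g 0 _ h0.1 h0.2) (g 1 _ h1.1 h1.2)
  unfold fl at this
  simp only at this
  obtain ⟨⟨a1, a2⟩, a3, a4⟩ := this
  have g2 : ∀ (i : Fin 2) (z : ℤ), -(3*N) ≤ ⌊q i⌋ - z → ⌊q i⌋ - z < 3*N → |q i - z| ≤ 3*N := by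
    intro i z h1 h2; rw [abs_le]; constructor
    · have : -(3*N) + z ≤ ⌊q i⌋ := by omega
      rw [Int.le_floor] at this; push_cast at this; linarith
    · have : ⌊q i⌋ < 3*N + z := by omega
      rw [Int.floor_lt] at this; push_cast at this; linarith
  have b0 := g2 0 _ a1 a2
  have b1 := g2 1 _ a3 a4
  rw [Metric.mem_closedBall, EuclideanSpace.dist_eq, Fin.sum_univ_two, emb_0, emb_1, Real.dist_eq, Real.dist_eq]
  have hN' : (1:ℝ) ≤ N := by exact_mod_cast hN
  rw [Real.sqrt_le_left (by linarith)]
  nlinarith [abs_nonneg (q 0 - c.1), abs_nonneg (q 1 - c.2)]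

lemma frontier_avoid {N : ℤ} (hN : 1 ≤ N) {l : Lp} {c : Lat} (hl : Surr N (tr c l)) {p : Plane} (h0 : |p 0 - c.1| < N) (h1 : |p 1 - c.2| < N) :
    p ∉ frontier (Fill (Tr l)) := by
  intro hp
  have hU : IsOpen {p : Plane | |p 0 - c.1| < N ∧ |p 1 - c.2| < N} :=
    (isOpen_lt (f := fun p : Plane => |p 0 - c.1|) (by fun_prop) continuous_const).inter
      (isOpen_lt (f := fun p : Plane => |p 1 - c.2|) (by fun_prop) continuous_const)
  exact hp.2 (mem_interior.2 ⟨_, fun q hq => fill_surr hN hl hq.1 hq.2, hU, h0, h1⟩)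

lemma frontier_sub (l : Lp) : frontier (Fill (Tr l)) ⊆ Tr l := by
  intro x hx
  by_contra hxl
  obtain ⟨ε, hε, hb⟩ := Metric.isOpen_iff.1 (Tr_closed l).isOpen_compl x hxl
  have hcb : IsConnected (ball x ε) := ⟨⟨x, mem_ball_self hε⟩, (convex_ball x ε).isPreconnected⟩
  have hall : ∀ y ∈ ball x ε, ∀ z ∈ ball x ε, y ∈ Fill (Tr l) → z ∈ Fill (Tr l) := by
    intro y hy z hz hyF C hC hc hzC; rw [(Tr_closed l).closure_eq] at hC
    have := hyF (C ∪ ball x ε) (by rw [(Tr_closed l).closure_eq]; exact union_subset hC hb)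
      (IsConnected.union ⟨z, hzC, hz⟩ hc hcb) (Or.inr hy)
    exact this.subset subset_union_left
  by_cases hF : x ∈ Fill (Tr l)
  · exact hx.2 (mem_interior.2 ⟨_, fun z hz => hall x (mem_ball_self hε) z hz hF, Metric.isOpen_ball, mem_ball_self hε⟩)
  · obtain ⟨y, hy, hyF⟩ := Metric.mem_closure_iff.1 hx.1 ε hε
    exact hF (hall y (by rw [Metric.mem_ball, dist_comm]; exact hyF) x (mem_ball_self hε) hy)

/-! ### unrooted loops and their rootings -/

def cy (W : List Lat) : List Lat := W ++ W.take 1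

lemma hasE_concat (l : List Lat) (u v a b : Lat) :
    hasE (l ++ [u] ++ [v]) a b ↔ hasE (l ++ [u]) a b ∨ ((a = u ∧ b = v) ∨ (a = v ∧ b = u)) := by
  induction l with
  | nil =>
    have : ¬ hasE [v] a b := by simp [hasE]
    have : ¬ hasE [u] a b := by simp [hasE]
    simp only [List.nil_append, List.cons_append]; rw [hasE_cons]; tauto
  | cons x l ih =>
    cases l with
    | nil =>
      simp only [List.nil_append, List.cons_append] at *; rw [hasE_cons, hasE_cons, hasE_cons]; tauto
    | cons y l =>
      simp only [List.cons_append] at *; rw [hasE_cons, hasE_cons, ih]; tauto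

lemma cy_rot1 (W : List Lat) (a b : Lat) : hasE (cy (W.rotate 1)) a b ↔ hasE (cy W) a b := by
  rcases W with _ | ⟨x, _ | ⟨y, V⟩⟩
  · simp
  · simp
  · have e1 : cy ((x :: y :: V).rotate 1) = (y :: V) ++ [x] ++ [y] := by simp [cy]
    have e2 : cy (x :: y :: V) = x :: y :: (V ++ [x]) := by simp [cy]
    rw [e1, e2, hasE_concat, hasE_cons, List.cons_append]; tauto

lemma cy_rot (W : List Lat) (k : ℕ) (a b : Lat) : hasE (cy (W.rotate k)) a b ↔ hasE (cy W) a b := by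
  induction k with
  | zero => simp
  | succ k ih => rw [← List.rotate_rotate, cy_rot1, ih]

lemma chain_of_hasE {l : List Lat} (h : ∀ a b, hasE l a b → Adj a b) : l.IsChain Adj := by
  induction l with
  | nil => simp
  | cons x l ih =>
    cases l with
    | nil => simp
    | cons y l =>
      rw [List.isChain_cons_cons]; refine ⟨h x y (by rw [hasE_cons]; tauto), ih (fun a b hab => h a b (by rw [hasE_cons]; tauto))⟩

lemma path_of_chain (L : List Lat) (hne : L ≠ []) (h : L.IsChain Adj) : ∃ l : Lp, path l.1 l.2 = L := by
  induction L with
  | nil => exact absurd rfl hne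
  | cons x L ih =>
    cases L with
    | nil => exact ⟨(x, []), rfl⟩
    | cons y L =>
      rw [List.isChain_cons_cons] at h; obtain ⟨⟨z, w⟩, hl⟩ := ih (by simp) h.2
      obtain ⟨d, hd⟩ := exists_stp h.1
      have : z = y := by
        have e := path_eq_cons z w; simp only at hl; rw [hl] at e; simp at e; exact e.symm
      subst this; refine ⟨(x, d :: w), ?_⟩; simp only [path_cons]; rw [← hd]; simp only at hl; rw [hl]

def Cl (l : Lp) : Prop := l.2 ≠ [] ∧ endp l.1 l.2 = l.1

def wd (l : Lp) : List Lat := (path l.1 l.2).dropLast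

lemma wd_len (l : Lp) : (wd l).length = l.2.length := by simp [wd]

lemma wd_cy {l : Lp} (h : Cl l) : cy (wd l) = path l.1 l.2 := by
  obtain ⟨z, w⟩ := l
  obtain ⟨h1, h2⟩ := h
  simp only at h1 h2
  obtain ⟨d, w, rfl⟩ := List.exists_cons_of_ne_nil h1
  have e := List.dropLast_append_getLast (path_ne z (d :: w))
  rw [path_getLast, h2] at e
  unfold cy wd
  simp only
  conv_rhs => rw [← e]
  congr 1
  rw [path_cons, List.dropLast_cons_of_ne_nil (path_ne _ _)]
  simp

lemma wd_ne {l : Lp} (h : Cl l) : wd l ≠ [] := by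
  intro e
  have := wd_len l
  rw [e] at this
  exact h.1 (List.length_eq_zero_iff.1 this.symm)

lemma exists_lp {W : List Lat} (hne : W ≠ []) (h : (cy W).IsChain Adj) : ∃ l : Lp, path l.1 l.2 = cy W ∧ Cl l ∧ wd l = W := by
  obtain ⟨l, hl⟩ := path_of_chain (cy W) (by simp [cy, hne]) h
  obtain ⟨x, V, rfl⟩ := List.exists_cons_of_ne_nil hne
  have hw : wd l = x :: V := by unfold wd; rw [hl]; simp [cy, List.dropLast_cons_of_ne_nil]
  refine ⟨l, hl, ⟨?_, ?_⟩, hw⟩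
  · intro e; have := wd_len l; rw [hw, e] at this; simp at this
  · have h1 := path_getLast l.1 l.2 (path_ne _ _); have h2 := path_head l.1 l.2 (path_ne _ _); rw [← h1]; conv_rhs => rw [← h2]
    simp only [hl]; simp [cy]

lemma dflt_ok : (cy [((0:ℤ),(0:ℤ)), (1,0)]).IsChain Adj := by simp [cy, Adj]

def mkU (ρ : RootedLoop) : ULoop := Quot.mk _ ρ

def toU (l : Lp) : ULoop :=
  if h : Cl l then mkU ⟨wd l, wd_ne h, by rw [← cy, wd_cy h]; exact path_chain _ _⟩
  else mkU ⟨[((0:ℤ),(0:ℤ)), (1,0)], by simp, dflt_ok⟩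

def cyc (γ : ULoop) : Cycle Lat := Quot.lift (fun ρ : RootedLoop => (ρ.word : Cycle Lat)) (by
  rintro a b ⟨k, hk⟩
  exact Quotient.sound ⟨k, hk.symm⟩) γ

lemma cyc_toU {l : Lp} (h : Cl l) : cyc (toU l) = (wd l : Cycle Lat) := by unfold toU; rw [dif_pos h]; rfl

lemma cyc_out (γ : ULoop) : cyc γ = (γ.out.word : Cycle Lat) := by
  conv_lhs => rw [← Quot.out_eq γ]
  rfl

lemma toU_rot {l : Lp} (h : Cl l) : ∃ k, (ULoop.out (toU l)).word.rotate k = wd l := by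
  have := (cyc_out (toU l)).symm.trans (cyc_toU h)
  exact Quotient.exact this

lemma toU_of {l : Lp} (h : Cl l) {γ : ULoop} {k : ℕ} (hk : wd l = γ.out.word.rotate k) : toU l = γ := by
  unfold toU; rw [dif_pos h]
  exact (Quot.sound (r := loopRot) ⟨k, hk⟩).symm.trans (Quot.out_eq γ)

lemma toU_hasE {l : Lp} (h : Cl l) (a b : Lat) : hasE (path l.1 l.2) a b ↔ hasE (cy (ULoop.out (toU l)).word) a b := by
  obtain ⟨k, hk⟩ := toU_rot h
  rw [← wd_cy h, ← hk, cy_rot]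

lemma toU_len {l : Lp} (h : Cl l) : (ULoop.out (toU l)).word.length = l.2.length := by
  obtain ⟨k, hk⟩ := toU_rot h
  rw [← wd_len, ← hk, List.length_rotate]

lemma mem_edge {z v : Lat} {w : List Dir} (hw : w ≠ []) (h : v ∈ path z w) : ∃ b, hasE (path z w) v b := by
  induction w generalizing z with
  | nil => exact absurd rfl hw
  | cons d w ih =>
    have e : path z (d::w) = z :: (z + stp d) :: (path (z + stp d) w).tail := by rw [path_cons, ← path_eq_cons]
    rw [path_cons, List.mem_cons] at h; rcases h with rfl | h
    · exact ⟨v + stp d, by rw [e, hasE_cons]; tauto⟩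
    · cases w with
      | nil =>
        simp at h; subst h
        exact ⟨z, by rw [e, hasE_cons]; tauto⟩
      | cons d' w' =>
        obtain ⟨b, hb⟩ := ih (by simp) h
        exact ⟨b, by rw [e, hasE_cons, ← path_eq_cons]; tauto⟩

lemma toU_mem {l l' : Lp} (h : Cl l) (h' : Cl l') (e : toU l = toU l') {v : Lat} (hv : v ∈ path l.1 l.2) : v ∈ path l'.1 l'.2 := by
  obtain ⟨b, hb⟩ := mem_edge h.1 hv
  rw [toU_hasE h, e, ← toU_hasE h'] at hb
  exact (hasE_mem hb).1

lemma toU_surj (γ : ULoop) : ∃ l, Cl l ∧ toU l = γ ∧ path l.1 l.2 = cy γ.out.word := by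
  obtain ⟨l, h1, h2, h3⟩ := exists_lp γ.out.ne γ.out.adj
  exact ⟨l, h2, toU_of h2 (k := 0) (by rw [h3, List.rotate_zero]), h1⟩

lemma trace_eq {l : Lp} (h : Cl l) : ULoop.trace (toU l) = Tr l := by
  obtain ⟨l', h', e, hp⟩ := toU_surj (toU l)
  have e2 : Tr l = Tr l' := by
    unfold Tr; ext p; simp only [mem_setOf_eq, toU_hasE h, toU_hasE h', e]
  rw [e2]
  unfold ULoop.trace traceL
  rw [← cy, ← hp, ← Tr_eq]
  apply Set.union_eq_self_of_subset_left
  intro p hpp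
  simp only [mem_iUnion, mem_singleton_iff, exists_prop] at hpp
  obtain ⟨z, hz, rfl⟩ := hpp
  obtain ⟨b, hb⟩ := mem_edge h'.1 hz
  exact ⟨z, b, hb, left_mem_segment ℝ _ _⟩

lemma comm_pow (q : ℕ) (A B : List Lat) (hA : A ≠ []) (hB : B.length = q * A.length) (h : A ++ B = B ++ A) :
    B = (List.replicate q A).flatten := by
  induction q generalizing B with
  | zero => simp at hB; simp [hB]
  | succ q ih =>
    have h1 : A <+: B := by
      apply List.prefix_of_prefix_length_le (l₃ := A ++ B) (List.prefix_append _ _)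
      · rw [h]; exact List.prefix_append _ _
      · rw [hB]; nlinarith
    obtain ⟨B', rfl⟩ := h1; rw [List.append_assoc, List.append_cancel_left_eq] at h; rw [List.replicate_succ, List.flatten_cons, ← ih B' _ h]
    rw [List.length_append] at hB; linarith

lemma mult_ge {γ : ULoop} {p : ℕ} (hp : 0 < p) (hr : γ.out.word.rotate p = γ.out.word) (hmin : ∀ m, 0 < m → m < p → γ.out.word.rotate m ≠ γ.out.word) :
    γ.out.word.length ≤ p * γ.mult ∧ 0 < γ.mult ∧ p ≤ γ.out.word.length := by
  set W := γ.out.word with hW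
  have hn : 0 < W.length := List.length_pos_of_ne_nil γ.out.ne
  have hmul : ∀ k, W.rotate (p*k) = W := by
    intro k
    induction k with
    | zero => simp
    | succ k ih => rw [mul_add, mul_one, ← List.rotate_rotate, ih, hr]
  have hmod : W.rotate (W.length % p) = W := by
    have h1 : W.rotate (p * (W.length / p) + W.length % p) = W := by rw [Nat.div_add_mod, List.rotate_length]
    rwa [← List.rotate_rotate, hmul] at h1
  have hdvd : p ∣ W.length := by
    by_contra hnd
    have h0 : 0 < W.length % p := Nat.pos_of_ne_zero (fun h => hnd (Nat.dvd_of_mod_eq_zero h))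
    exact hmin _ h0 (Nat.mod_lt _ hp) hmod
  have hple := Nat.le_of_dvd hn hdvd
  obtain ⟨q, hq⟩ := hdvd
  have hq0 : q ≠ 0 := by rintro rfl; omega
  obtain ⟨q, rfl⟩ := Nat.exists_eq_succ_of_ne_zero hq0
  have hAB : W.take p ++ W.drop p = W := List.take_append_drop _ _
  have hBA : W.drop p ++ W.take p = W := by rw [← List.rotate_eq_drop_append_take hple]; exact hr
  have hl : (W.take p).length = p := by rw [List.length_take]; omega
  have hrep : W = (List.replicate (q+1) (W.take p)).flatten := by
    have := comm_pow q (W.take p) (W.drop p) (by intro e; rw [e] at hl; simp at hl; omega)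
      (by rw [List.length_drop, hl, hq, Nat.succ_eq_add_one]; rw [Nat.mul_comm p, Nat.add_mul]; omega) (hAB.trans hBA.symm)
    rw [List.replicate_succ, List.flatten_cons, ← this, hAB]
  have hm : q + 1 ≤ γ.mult := by
    apply le_csSup
    · refine ⟨W.length, ?_⟩
      rintro j ⟨u, hu, e⟩; have : W.length = j * u.length := by rw [← hW] at e; rw [e]; simp
      have hu' := List.length_pos_of_ne_nil hu
      nlinarith
    · exact ⟨W.take p, by intro e; rw [e] at hl; simp at hl; omega, hrep⟩
  refine ⟨?_, by omega, hple⟩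
  rw [hq]; exact Nat.mul_le_mul_left _ hm

lemma weight_le {L : ℕ} {A : FLat} {l : Lp} (hl : l ∈ LS L A) :
    (loopWeight (toU l) : ℝ) ≤ ∑ l' ∈ (LS L A).filter (fun l' => toU l' = toU l), wt l' := by
  rw [mem_LS] at hl
  have hcl : Cl l := ⟨hl.1, hl.2.2.1⟩
  set γ := toU l with hγ
  set W := γ.out.word with hW
  have hn : 0 < W.length := List.length_pos_of_ne_nil γ.out.ne
  have hex : ∃ p, 0 < p ∧ W.rotate p = W := ⟨W.length, hn, List.rotate_length W⟩
  have hp := Nat.find_spec hex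
  have hmin : ∀ m, 0 < m → m < Nat.find hex → W.rotate m ≠ W := fun m h0 h1 e => Nat.find_min hex h1 ⟨h0, e⟩
  set p := Nat.find hex
  obtain ⟨m1, m2, m3⟩ := mult_ge hp.1 hp.2 hmin
  have hchain : ∀ k, ∃ l' : Lp, path l'.1 l'.2 = cy (W.rotate k) ∧ Cl l' ∧ wd l' = W.rotate k := by
    intro k; apply exists_lp
    · intro e; rw [List.rotate_eq_nil_iff] at e; exact γ.out.ne e
    · apply chain_of_hasE
      intro a b hab; rw [cy_rot] at hab; exact hasE_adj γ.out.adj hab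
  choose f hf1 hf2 hf3 using hchain
  have hlen : ∀ k, (f k).2.length = W.length := by intro k; rw [← wd_len, hf3, List.length_rotate]
  have hU : ∀ k, toU (f k) = γ := fun k => toU_of (hf2 k) (hf3 k)
  have hsub : (Finset.range p).image f ⊆ (LS L A).filter (fun l' => toU l' = γ) := by
    intro x hx; obtain ⟨k, hk, rfl⟩ := Finset.mem_image.1 hx; rw [Finset.mem_filter, mem_LS]; refine ⟨⟨(hf2 k).1, ?_, (hf2 k).2, ?_⟩, hU k⟩
    · rw [hlen]; have := toU_len hcl; rw [← hγ, ← hW] at this; rw [this]; exact hl.2.1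
    · intro v hv; exact hl.2.2.2 v (toU_mem (hf2 k) hcl (hU k) hv)
  have hinj : Set.InjOn f (Finset.range p) := by
    have key : ∀ i j, i < j → j < p → f i ≠ f j := by
      intro i j hij hj e; have e1 : W.rotate i = W.rotate j := by rw [← hf3, ← hf3, e]
      rw [show j = (j - i) + i by omega, ← List.rotate_rotate, List.rotate_eq_rotate] at e1
      exact hmin (j - i) (by omega) (by omega) e1.symm
    intro i hi j hj e; simp only [Finset.coe_range, mem_Iio] at hi hj; rcases lt_trichotomy i j with h | h | h
    · exact absurd e (key i j h hj)
    · exact h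
    · exact absurd e.symm (key j i h hi)
  refine le_trans ?_ (sum_le_sum_of_subset_of_nonneg hsub (fun x _ _ => wt_nonneg x))
  rw [sum_image hinj]
  have : ∀ k ∈ Finset.range p, wt (f k) = (1/4)^W.length / W.length := by intro k _; unfold wt; rw [hlen]
  rw [sum_congr rfl this, sum_const, card_range, nsmul_eq_mul]
  have e : (loopWeight γ : ℝ) = (1/4)^W.length / γ.mult := by unfold loopWeight ULoop.steps; push_cast; rw [one_div]
  rw [e, mul_div_assoc', div_le_div_iff₀ (by exact_mod_cast m2) (by exact_mod_cast hn)]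
  have m1' : (W.length : ℝ) ≤ p * γ.mult := by exact_mod_cast m1
  have : (0:ℝ) < (1/4)^W.length := by positivity
  nlinarith

/-! ### From the loop soup to finite Bernoulli families -/

lemma box_mass (s : FLp) (X : FLat) (hX : ∀ l ∈ s, l.1 ∈ X) (hs : ∀ l ∈ s, Cl l) :
    ∑ l ∈ s, wt l ≤ X.card := by
  refine (mass_split (fun _ => True) s X hX (fun l hl => ⟨(hs l hl).1, (hs l hl).2, trivial⟩)).trans ?_
  refine (Finset.sum_le_card_nsmul _ _ 1 ?_).trans (by simp)
  intro x _
  generalize s.sup (fun l => l.2.length) = L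
  have key : ∑ n ∈ Finset.Ioo 0 (L+1), EW n (fun w => ind (endp x w = x ∧ True)) / n ≤ 1 - 1/((L:ℝ)+1) := by
    induction L with
    | zero => rw [show Finset.Ioo 0 (0+1) = ∅ by rfl]; simp
    | succ L ih =>
      rw [show Finset.Ioo 0 (L+1+1) = insert (L+1) (Finset.Ioo 0 (L+1)) by grind, sum_insert (by simp)]
      have h := kernel (L+1) x x; simp only [and_true] at *; push_cast at *; have h0 : (0:ℝ) < (L:ℝ)+1 := by positivity
      have h2 : EW (L+1) (fun w => ind (endp x w = x)) / ((L:ℝ)+1) ≤ 1/((L:ℝ)+1+1)/((L:ℝ)+1) := by gcongr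
      have h3 : 1/((L:ℝ)+1+1)/((L:ℝ)+1) = 1/((L:ℝ)+1) - 1/((L:ℝ)+1+1) := by field_simp; ring
      linarith
  have : 0 < 1/((L:ℝ)+1) := by positivity
  linarith

lemma soup_meas (S : Finset ULoop) (G : Finset ULoop → Prop) :
    MeasurableSet {ω : Config | G (S.filter (fun γ => ω γ ≠ 0))} := by
  induction S using Finset.induction_on generalizing G with
  | empty => simp
  | insert i S hi ih =>
    have hm : MeasurableSet {ω : Config | ω i = 0} := measurable_pi_apply i (measurableSet_singleton 0)
    have : {ω : Config | G ((insert i S).filter (fun γ => ω γ ≠ 0))} = ({ω | ω i = 0} ∩ {ω | G (S.filter (fun γ => ω γ ≠ 0))}) ∪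
        ({ω | ω i = 0}ᶜ ∩ {ω | G (insert i (S.filter (fun γ => ω γ ≠ 0)))}) := by
      ext ω
      simp only [mem_setOf_eq, filter_insert, mem_union, mem_inter_iff, mem_compl_iff]; by_cases h : ω i = 0 <;> simp [h]
    rw [this]; exact (hm.inter (ih G)).union (hm.compl.inter (ih (fun T => G (insert i T))))

lemma soup_pr {D : Set Lat} {α : ℝ} {P : Measure Config} (hP : IsLoopSoup D α P) (S A : Finset ULoop) (hd : Disjoint A S) (G : Finset ULoop → Prop) : P.real {ω | (∀ γ ∈ A, ω γ = 0) ∧ G (S.filter (fun γ => ω γ ≠ 0))} =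
      (∏ γ ∈ A, exp (-(α.toNNReal * nuD D γ : ℝ≥0))) * Pr (fun γ => 1 - exp (-(α.toNNReal * nuD D γ : ℝ≥0))) S G := by
  have := hP.1
  have hA : ∀ A : Finset ULoop, MeasurableSet {ω : Config | ∀ γ ∈ A, ω γ = 0} := by
    intro A; have := soup_meas A (fun T => T = ∅)
    simpa [Finset.filter_eq_empty_iff] using this
  induction S using Finset.induction_on generalizing A G with
  | empty =>
    unfold Pr; rw [Ex_empty]; by_cases hG : G ∅
    · have h := hP.2 A (fun _ => 0)
      simp only [Finset.filter_empty, hG, and_true, ind_true, mul_one, Measure.real, h, ENNReal.toReal_prod]; apply prod_congr rfl; intro γ _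
      unfold poissonProb; rw [ENNReal.toReal_ofReal (by positivity)]
      simp
    · simp [hG, ind_false]
  | insert i S hi ih =>
    have e : {ω : Config | (∀ γ ∈ A, ω γ = 0) ∧ G ((insert i S).filter (fun γ => ω γ ≠ 0))} =
        {ω | (∀ γ ∈ insert i A, ω γ = 0) ∧ G (S.filter (fun γ => ω γ ≠ 0))} ∪
        ({ω | (∀ γ ∈ A, ω γ = 0) ∧ G (insert i (S.filter (fun γ => ω γ ≠ 0)))} \
          {ω | (∀ γ ∈ insert i A, ω γ = 0) ∧ G (insert i (S.filter (fun γ => ω γ ≠ 0)))}) := by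
      ext ω
      simp only [mem_setOf_eq, filter_insert, mem_union, Set.mem_diff, Finset.forall_mem_insert]; by_cases h : ω i = 0 <;> simp [h]
    have m : ∀ A (G : Finset ULoop → Prop), MeasurableSet {ω : Config | (∀ γ ∈ A, ω γ = 0) ∧ G (S.filter (fun γ => ω γ ≠ 0))} := fun A G => (hA A).inter (soup_meas S G)
    have m1 := m (insert i A) (fun T => G (insert i T))
    rw [Finset.disjoint_insert_right] at hd; have hd2 : Disjoint (insert i A) S := Finset.disjoint_insert_left.2 ⟨hi, hd.2⟩
    rw [e, measureReal_union _ ((m A (fun T => G (insert i T))).diff m1), measureReal_diff _ m1, ih _ hd2, ih A hd.2 (fun T => G (insert i T)),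
      ih (insert i A) hd2 (fun T => G (insert i T))]
    · unfold Pr; rw [Ex_insert hi]; rw [Finset.prod_insert hd.1]; ring
    · intro ω h; exact ⟨fun γ hγ => h.1 γ (Finset.mem_insert_of_mem hγ), h.2⟩
    · rw [Set.disjoint_left]; rintro ω h1 h2; exact h2.2 ⟨h1.1, h2.1.2⟩

lemma soup_ge {D : Set Lat} {α : ℝ} {P : Measure Config} (hP : IsLoopSoup D α P) (hα : α ≤ 1/2) (L : ℕ) (A : FLat)
    (F : FLp → Prop) (hF : ∀ T T' : FLp, (∀ l ∈ T, Cl l) → (∀ l ∈ T', Cl l ∧ ∃ l' ∈ T, toU l = toU l') → F T → F T') :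
    Pr pr (LS L A) F ≤ P.real {ω | F ((LS L A).filter (fun l => ω (toU l) ≠ 0))} := by
  have hC : ∀ l ∈ LS L A, Cl l := fun l hl => ⟨(mem_LS.1 hl).1, (mem_LS.1 hl).2.2.1⟩
  set G : Finset ULoop → Prop := fun U => F ((LS L A).filter (fun l => toU l ∈ U)) with hG
  have h1 := soup_pr hP ((LS L A).image toU) ∅ (Finset.disjoint_empty_left _) G
  have e : {ω : Config | F ((LS L A).filter (fun l => ω (toU l) ≠ 0))} =
      {ω | (∀ γ ∈ (∅ : Finset ULoop), ω γ = 0) ∧ G (((LS L A).image toU).filter (fun γ => ω γ ≠ 0))} := by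
    ext ω
    simp only [mem_setOf_eq, hG, Finset.mem_filter, Finset.notMem_empty, false_imp_iff, implies_true, true_and]
    apply iff_of_eq; congr 1; apply Finset.filter_congr
    intro l hl; simp only [Finset.mem_image_of_mem toU hl, true_and]
  rw [e, h1, Finset.prod_empty, one_mul]
  have hanti : Antitone (fun U => ind (G U)) := by
    intro U U' hU; apply ind_mono; apply hF
    · intro l hl; exact hC l (Finset.mem_filter.1 hl).1
    · intro l hl; rw [Finset.mem_filter] at hl; exact ⟨hC l hl.1, l, Finset.mem_filter.2 ⟨hl.1, hU hl.2⟩, rfl⟩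
  refine le_trans (Ex_mono pr_bd (g := fun T => ind (G (T.image toU))) ?_) (Ex_image toU pr_bd _ ?_ ?_ _ hanti)
  · intro T hT; apply ind_mono; apply hF
    · intro l hl; exact hC l (hT hl)
    · intro l hl; rw [Finset.mem_filter, Finset.mem_image] at hl; obtain ⟨hl, l', h', e'⟩ := hl; exact ⟨hC l hl, l', h', e'.symm⟩
  · intro γ; have h1 : exp (-(α.toNNReal * nuD D γ : ℝ≥0)) ≤ 1 := exp_le_one_iff.2 (neg_nonpos.2 (NNReal.coe_nonneg _))
    have h2 := exp_pos (-((α.toNNReal * nuD D γ : ℝ≥0) : ℝ)); constructor <;> linarith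
  · intro γ hγ; obtain ⟨l, hl, rfl⟩ := Finset.mem_image.1 hγ; rw [prod_none]; have h1 := weight_le hl
    have h2 : ((α.toNNReal * nuD D (toU l) : ℝ≥0) : ℝ) ≤ 1/2 * loopWeight (toU l) := by
      rw [NNReal.coe_mul]; apply mul_le_mul
      · rw [Real.coe_toNNReal']; exact max_le hα (by norm_num)
      · rw [NNReal.coe_le_coe]; unfold nuD; split_ifs <;> simp
      · exact NNReal.coe_nonneg _
      · norm_num
    have h3 := exp_le_exp.2 (show -((∑ l' ∈ (LS L A).filter (fun l' => toU l' = toU l), wt l')/2) ≤ -((α.toNNReal * nuD D (toU l) : ℝ≥0) : ℝ) by linarith)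
    linarith

lemma soup_lim {D : Set Lat} {α : ℝ} {P : Measure Config} (hP : IsLoopSoup D α P) (hα : α ≤ 1/2)
    (F : FLp → Prop) (hF : ∀ T T' : FLp, (∀ l ∈ T, Cl l) → (∀ l ∈ T', Cl l ∧ ∃ l' ∈ T, toU l = toU l') → F T → F T')
    (c : ℝ) (hc : ∀ L : ℕ, c ≤ Pr pr (LS L (Rc (-L) L (-L) L)) F) (E : Set Config)
    (hE : ∀ ω : Config, (∀ T : FLp, (∀ l ∈ T, Cl l ∧ ω (toU l) ≠ 0) → F T) → ω ∈ E) : ENNReal.ofReal c ≤ P E := by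
  have := hP.1
  set DL : ℕ → FLp := fun L => LS L (Rc (-L) L (-L) L) with hDL
  set EL : ℕ → Set Config := fun L => {ω | F ((DL L).filter (fun l => ω (toU l) ≠ 0))} with hEL
  have hC : ∀ L, ∀ l ∈ DL L, Cl l := fun L l hl => ⟨(mem_LS.1 hl).1, (mem_LS.1 hl).2.2.1⟩
  have hmono : ∀ L L', L ≤ L' → DL L ⊆ DL L' := by
    intro L L' h; apply LS_mono h; intro v; rw [mem_Rc, mem_Rc]; omega
  have hm : ∀ L, MeasurableSet (EL L) := by
    intro L; have := soup_meas ((DL L).image toU) (fun U => F ((DL L).filter (fun l => toU l ∈ U)))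
    convert this using 3
    apply iff_of_eq; congr 1; apply Finset.filter_congr
    intro l hl; simp only [Finset.mem_filter, Finset.mem_image_of_mem toU hl, true_and]
  have ha : Antitone EL := by
    intro L L' h ω hω; refine hF _ _ (fun l hl => hC L' l (Finset.mem_filter.1 hl).1) ?_ hω
    intro l hl; rw [Finset.mem_filter] at hl; exact ⟨hC L l hl.1, l, Finset.mem_filter.2 ⟨hmono _ _ h hl.1, hl.2⟩, rfl⟩
  have ht := tendsto_measure_iInter_atTop (μ := P) (fun L => (hm L).nullMeasurableSet) ha ⟨0, measure_ne_top _ _⟩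
  have h1 : ENNReal.ofReal c ≤ P (⋂ L, EL L) := by
    apply ge_of_tendsto' ht
    intro L; apply ENNReal.ofReal_le_of_le_toReal; exact (hc L).trans (soup_ge hP hα L _ F hF)
  refine h1.trans (measure_mono ?_)
  intro ω hω
  apply hE
  intro T hT
  rw [mem_iInter] at hω
  have hex : ∀ l : Lp, ∃ L : ℕ, Cl l → l ∈ DL L := by
    intro l
    obtain ⟨N, hN⟩ : ∃ N : ℕ, ∀ v ∈ path l.1 l.2, v ∈ Rc (-N) N (-N) N := by
      refine ⟨((path l.1 l.2).toFinset.sup (fun v => (linf v).toNat)), fun v hv => ?_⟩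
      have := le_sup (f := fun v => (linf v).toNat) (List.mem_toFinset.2 hv)
      rw [mem_Rc, ← linf_le]; omega
    refine ⟨max N l.2.length, fun h => mem_LS.2 ⟨h.1, le_max_right _ _, h.2, fun v hv => ?_⟩⟩
    have := hN v hv; rw [mem_Rc] at *; have := le_max_left N l.2.length; omega
  choose Lf hLf using hex
  refine hF _ _ (fun l hl => hC _ l (Finset.mem_filter.1 hl).1) ?_ (hω (T.sup Lf))
  intro l hl
  exact ⟨(hT l hl).1, l, Finset.mem_filter.2 ⟨hmono _ _ (le_sup hl) (hLf l (hT l hl).1), (hT l hl).2⟩, rfl⟩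

/-! ### The good event and the end of the proof -/

/-- loops of small extent -/
def Sm (m : ℕ) (l : Lp) : Prop := ∀ u ∈ path l.1 l.2, ∀ v ∈ path l.1 l.2, linf (u - v) ≤ 2*m

/-- an annulus around `z` is crossed by small loops -/
def AX (m : ℕ) (z : Lat) (T : FLp) : Prop := ∃ a b S, linf (a - z) ≤ m ∧ 3*m ≤ linf (b - z) ∧ Conn (T.filter (Sm m)) S a b

def ssg (z : Lat) (m : ℤ) (i : Bool × Bool) : Sy := (syT (-m, 3*m)).comp ((if i.1 then syX else syT 0).comp ((if i.2 then syS else syT 0).comp (syT (-z))))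

def SX (n : ℤ) (σ : Sy) (T : FLp) : Prop := XH ((T.filter (fun l => ∀ v ∈ path l.1 l.2, σ.f v ∈ Rc (-n) (2*n) (-n) (4*n))).image σ.act) 0 n 0 (3*n)

lemma SX_decr (n : ℤ) (σ : Sy) : Decr (fun T => ¬ SX n σ T) := fun _ _ h hn hs => hn (hs.mono (image_subset_image (filter_subset_filter _ h)))

lemma SX_pr {c : ℝ} {n : ℤ} {L : ℕ} (hc : c ≤ Pr pr (LS L (Rc (-n) (2*n) (-n) (4*n))) (fun T => ¬ XH T 0 n 0 (3*n))) (σ : Sy) (B : FLat) :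
    c ≤ Pr pr (LS L B) (fun T => ¬ SX n σ T) := by
  set A := (Rc (-n) (2*n) (-n) (4*n)).image σ.f.symm with hA
  have hA' : ∀ v, v ∈ A ↔ σ.f v ∈ Rc (-n) (2*n) (-n) (4*n) := by
    intro v; rw [hA, Finset.mem_image]; exact ⟨by rintro ⟨w, hw, rfl⟩; simpa using hw, fun h => ⟨_, h, by simp⟩⟩
  refine le_trans (le_trans hc (Pr_sy_not_le σ hA' (E := SX n σ) ?_)) (le_trans (le_of_eq ?_)
    (Pr_anti_s pr_bd (LS_mono le_rfl (Finset.subset_union_left (s₂ := A))) (SX_decr n σ)))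
  · intro T h; exact h.mono (image_subset_image (Finset.filter_subset _ _))
  · symm
    apply Pr_restrict (LS_mono le_rfl Finset.subset_union_right)
    intro T hT
    have : T.filter (fun l => ∀ v ∈ path l.1 l.2, σ.f v ∈ Rc (-n) (2*n) (-n) (4*n)) =
        (T ∩ LS L A).filter (fun l => ∀ v ∈ path l.1 l.2, σ.f v ∈ Rc (-n) (2*n) (-n) (4*n)) := by
      ext l
      rw [Finset.mem_filter, Finset.mem_filter, Finset.mem_inter]; refine ⟨fun h => ⟨⟨h.1, ?_⟩, h.2⟩, fun h => ⟨h.1.1, h.2⟩⟩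
      have := mem_LS.1 (hT h.1); exact mem_LS.2 ⟨this.1, this.2.1, this.2.2.1, fun v hv => (hA' v).2 (h.2 v hv)⟩
    unfold SX; rw [this]

lemma AX_SX {m : ℕ} {z : Lat} {T : FLp} (h : AX m z T) : ∃ i, SX (2*m) (ssg z m i) T := by
  obtain ⟨a, b, S, ha, hb, h⟩ := h
  obtain ⟨b', hb', hc⟩ := conn_cut (fun v => -linf (v - z)) (fun x y h => by
    have := adj_linf (show Adj (x - z) (y - z) by simpa [Adj] using h)
    rw [abs_le] at *; constructor <;> linarith) (-(3*m)) h.symm (by linarith) (by linarith)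
  have hc := hc.symm
  have h1 : linf (b' - z) ≤ 3*m := by linarith
  have h2 : 3*(m:ℤ) - 1 < linf (b' - z) := by linarith
  have key : ∀ i, 2*m ≤ ((ssg z m i).f b').1 → SX (2*m) (ssg z m i) T := by
    intro i hi
    have hbd : ∀ v (k : ℤ), linf (v - z) ≤ k → ((ssg z m i).f v).1 ≤ k - m ∧ -k ≤ ((ssg z m i).f v).2 - 3*m ∧ ((ssg z m i).f v).2 - 3*m ≤ k := by
      intro v k hv; rw [linf_le] at hv; simp only [Prod.fst_sub, Prod.snd_sub] at hv; obtain ⟨i1, i2⟩ := i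
      cases i1 <;> cases i2 <;> simp [ssg] <;> omega
    have hx := xh_of_conn (x0 := 0) (x1 := 2*m) (y0 := 0) (y1 := 3*(2*m)) ((ssg z m i).conn (fun v hv => Finset.mem_image_of_mem _ hv) hc)
      (by have := (hbd a m ha).1; omega) (by omega) hi (by
        intro v hv; obtain ⟨w, hw, rfl⟩ := Finset.mem_image.1 hv; have := hbd w (3*m) (by have := (Finset.mem_filter.1 hw).2; omega)
        omega)
    obtain ⟨a', b', e1, e2, e3⟩ := hx; refine ⟨a', b', e1, e2, e3.1, ReflTransGen.mono ?_ _ _ e3.2⟩; rintro x y ⟨⟨k, hk, hE⟩, hx, hy⟩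
    refine ⟨⟨k, ?_, hE⟩, hx, hy⟩
    obtain ⟨l, hl, rfl⟩ := Finset.mem_image.1 hk; rw [Finset.mem_filter] at hl
    refine Finset.mem_image_of_mem _ (Finset.mem_filter.2 ⟨hl.1, fun v hv => ?_⟩)
    have hxl := (hasE_mem hE).1
    rw [Sy.act, Sy.path_act, List.mem_map] at hxl; obtain ⟨x', hx', rfl⟩ := hxl; have h3 := hl.2 x' hx' v hv; rw [linf_le] at h3; rw [mem_Rc] at hx ⊢
    simp only [Prod.fst_sub, Prod.snd_sub] at h3; obtain ⟨i1, i2⟩ := i; cases i1 <;> cases i2 <;> simp [ssg] at hx ⊢ <;> omega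
  rw [lt_linf] at h2
  simp only [Prod.fst_sub, Prod.snd_sub] at h2
  rcases h2 with (h2 | h2) | (h2 | h2)
  · exact ⟨_, key (false, false) (by simp [ssg]; omega)⟩
  · exact ⟨_, key (true, false) (by simp [ssg]; omega)⟩
  · exact ⟨_, key (false, true) (by simp [ssg]; omega)⟩
  · exact ⟨_, key (true, true) (by simp [ssg]; omega)⟩

lemma AX_pr {c : ℝ} (h0 : 0 ≤ c) {m L : ℕ} (hc : c ≤ Pr pr (LS L (Rc (-(2*m)) (2*(2*m)) (-(2*m)) (4*(2*m)))) (fun T => ¬ XH T 0 (2*m) 0 (3*(2*m)))) (z : Lat) (B : FLat) :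
    c^4 ≤ Pr pr (LS L B) (fun T => ¬ AX m z T) := by
  have h := Pr_fkg_finset (s := LS L B) pr_bd Finset.univ (fun i T => ¬ SX (2*m) (ssg z m i) T) (fun i _ => SX_decr _ _)
  refine le_trans ?_ (h.trans (Pr_mono pr_bd (fun T _ hT hA => ?_)))
  · refine le_trans (le_of_eq ?_) (prod_le_prod (f := fun _ => c) (fun _ _ => h0) (fun i _ => SX_pr hc (ssg z m i) B))
    simp
  · obtain ⟨i, hi⟩ := AX_SX hA; exact hT i (Finset.mem_univ _) hi

lemma tr_mass {m : ℕ} (hm : 1 ≤ m) (z : Lat) (s : FLp) (hs : ∀ l ∈ s, Cl l ∧ Bad m (tr z l)) : ∑ l ∈ s, wt l ≤ C1 := by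
  have h := bad_mass m hm (s.image (tr z)) (by
    intro l0 hl0; obtain ⟨l, hl, rfl⟩ := Finset.mem_image.1 hl0; obtain ⟨⟨h1, h2⟩, h3⟩ := hs l hl; refine ⟨by simpa [tr, Sy.act] using h1, ?_, h3⟩
    unfold tr Sy.act; rw [Sy.endp_act, h2])
  rw [sum_image (fun a _ b _ h => Sy.act_inj _ h)] at h
  exact le_trans (le_of_eq (sum_congr rfl (fun l _ => by simp [wt, tr, Sy.act]))) h

lemma bad_congr {m : ℕ} {z : Lat} {l l' : Lp} (h : Cl l) (h' : Cl l') (e : toU l = toU l') (hb : Bad m (tr z l)) : Bad m (tr z l') := by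
  have hv : ∀ v, v ∈ path (tr z l).1 (tr z l).2 → v ∈ path (tr z l').1 (tr z l').2 := by intro v hv; rw [mem_path_tr] at *; exact toU_mem h h' e hv
  obtain ⟨⟨u, h1, h2⟩, ⟨a, h3, b, h4, h5⟩, h6⟩ := hb
  refine ⟨⟨u, hv u h1, h2⟩, ⟨a, hv a h3, b, hv b h4, h5⟩, fun g hg hs => h6 g hg (hs.mono fun a b hab => ?_)⟩
  rw [hasE_tr, toU_hasE h, e, ← toU_hasE h', ← hasE_tr]; exact hab

lemma big_avoid {m : ℕ} (hm : 1 ≤ m) {z : Lat} {l : Lp} (hb : ¬ Bad m (tr z l)) {p : Plane} (hp : p ∈ frontier (Fill (Tr l)))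
    (h0 : |p 0 - z.1| ≤ 40*m) (h1 : |p 1 - z.2| ≤ 40*m) : Sm m l := by
  by_contra hS
  unfold Sm at hS
  push Not at hS
  obtain ⟨u, hu, v, hv, huv⟩ := hS
  obtain ⟨w, hw, w0, w1⟩ := Tr_near (frontier_sub l hp)
  have hmr : (1:ℝ) ≤ m := by exact_mod_cast hm
  apply hb
  refine ⟨⟨w - z, mem_path_tr.2 (by simpa using hw), ?_⟩, ⟨u - z, mem_path_tr.2 (by simpa using hu), v - z, mem_path_tr.2 (by simpa using hv), by simpa using huv⟩, ?_⟩
  · rw [linf_le]; simp only [Prod.fst_sub, Prod.snd_sub]; rw [abs_le] at *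
    refine ⟨⟨?_, ?_⟩, ?_, ?_⟩ <;> rw [← Int.cast_le (R := ℝ)] <;> push_cast <;> linarith
  · intro g hg hs; have hgr : 4*(m:ℝ) ≤ g := by exact_mod_cast hg
    refine frontier_avoid (by omega) hs ?_ ?_ hp <;> push_cast <;> linarith

lemma fr_cases {ω : Config} {S : Set Plane} (h : S ∈ frontiers ω.loops) : ∃ l, Cl l ∧ ω (toU l) ≠ 0 ∧ S = frontier (Fill (Tr l)) := by
  obtain ⟨γ, hγ, rfl⟩ := h
  obtain ⟨l, hl, rfl, -⟩ := toU_surj γ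
  exact ⟨l, hl, hγ, by rw [loopFrontier, trace_eq hl]⟩

lemma linkedS_symm {F : Set (Set Plane)} {a b : Set Plane} (h : linkedS F a b) : linkedS F b a := by
  induction h with
  | refl => exact ReflTransGen.refl
  | tail _ h2 ih => exact ReflTransGen.head ⟨h2.2.1, h2.1, by rw [inter_comm]; exact h2.2.2⟩ ih

lemma det_near {m : ℕ} (hm : 1 ≤ m) {z v : Lat} (h : linf (v - z) < 3*m) {p : Plane} (h0 : |p 0 - v.1| ≤ 1) (h1 : |p 1 - v.2| ≤ 1) :
    |p 0 - z.1| ≤ 3*m ∧ |p 1 - z.2| ≤ 3*m := by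
  have h : linf (v - z) ≤ 3*m - 1 := by omega
  rw [linf_le] at h
  simp only [Prod.fst_sub, Prod.snd_sub] at h
  obtain ⟨⟨a, b⟩, c, d⟩ := h
  rw [← Int.cast_le (R := ℝ)] at a b c d
  push_cast at a b c d
  rw [abs_le] at h0 h1
  rw [abs_le, abs_le]
  refine ⟨⟨?_, ?_⟩, ?_, ?_⟩ <;> linarith

lemma det_ind {m : ℕ} (hm : 1 ≤ m) {ω : Config} {z q : Lat} (hq : linf (q - z) ≤ m)
    (hb : ∀ l, Cl l → ω (toU l) ≠ 0 → ¬ Bad m (tr z l)) (ha : ∀ T : FLp, (∀ l ∈ T, Cl l ∧ ω (toU l) ≠ 0) → ¬ AX m z T)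
    {S1 S' : Set Plane} (h1 : S1 ∈ frontiers ω.loops) (hqS : emb q ∈ S1) (h : linkedS (frontiers ω.loops) S1 S') :
    ∃ l, S' = frontier (Fill (Tr l)) ∧ ∃ T : FLp, (∀ l ∈ T, Cl l ∧ ω (toU l) ≠ 0) ∧ ∃ S, ∀ v ∈ path l.1 l.2, Conn (T.filter (Sm m)) S q v := by
  have hm1 : (1:ℝ) ≤ m := by exact_mod_cast hm
  induction h with
  | refl =>
    obtain ⟨l, hl, hω, rfl⟩ := fr_cases h1; have hql := Tr_lat (frontier_sub l hqS)
    have hqz : |emb q 0 - z.1| ≤ 3*m ∧ |emb q 1 - z.2| ≤ 3*m := det_near hm (v := q) (by omega) (by rw [emb_0]; simp) (by rw [emb_1]; simp)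
    have hS := big_avoid hm (hb l hl hω) hqS (by linarith) (by linarith)
    exact ⟨l, rfl, {l}, by simp [hl, hω], (path l.1 l.2).toFinset, fun v hv => path_conn (l := l) (by simp [hS]) (by simp) hql hv⟩
  | tail _ h2 ih =>
    obtain ⟨l, rfl, T, hT, S, hc⟩ := ih; obtain ⟨l', hl', hω', rfl⟩ := fr_cases h2.2.1; obtain ⟨p, hp, hp'⟩ := h2.2.2
    obtain ⟨v, hv, v0, v1⟩ := Tr_near (frontier_sub l hp)
    have hvz : linf (v - z) < 3*m := by
      by_contra hn
      exact ha T hT ⟨q, v, S, hq, by omega, hc v hv⟩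
    have hpz := det_near hm hvz v0 v1; have hS := big_avoid hm (hb l' hl' hω') hp' (by linarith) (by linarith)
    obtain ⟨w, hw, hw'⟩ := Tr_meet (frontier_sub l hp) (frontier_sub l' hp')
    refine ⟨l', rfl, insert l' T, ?_, S ∪ (path l'.1 l'.2).toFinset, fun u hu => ?_⟩
    · intro k hk; rcases Finset.mem_insert.1 hk with rfl | hk
      exacts [⟨hl', hω'⟩, hT k hk]
    · exact ((hc w hw).mono (filter_subset_filter _ (Finset.subset_insert _ _)) Finset.subset_union_left).trans
        (path_conn (l := l') (by simp [hS]) (by intro v hv; simp [hv]) hw' hu)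

lemma det_diam {m : ℕ} (hm : 1 ≤ m) {ω : Config} {z q : Lat} (hq : linf (q - z) ≤ m)
    (hb : ∀ l, Cl l → ω (toU l) ≠ 0 → ¬ Bad m (tr z l)) (ha : ∀ T : FLp, (∀ l ∈ T, Cl l ∧ ω (toU l) ≠ 0) → ¬ AX m z T)
    {C' : Set Plane} (hC : C' ∈ clustersS (frontiers ω.loops)) (hqC : emb q ∈ C') : diam C' ≤ 12*m := by
  obtain ⟨S0, h0, rfl⟩ := hC
  simp only [mem_setOf_eq, mem_iUnion, exists_prop] at hqC
  obtain ⟨S1, ⟨h1, h01⟩, hq1⟩ := hqC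
  have key : ∀ x ∈ (⋃ S' ∈ {S' | S' ∈ frontiers ω.loops ∧ linkedS (frontiers ω.loops) S0 S'}, S'), |x 0 - z.1| ≤ 3*m ∧ |x 1 - z.2| ≤ 3*m := by
    intro x hx; simp only [mem_setOf_eq, mem_iUnion, exists_prop] at hx; obtain ⟨S', ⟨h', h0'⟩, hx⟩ := hx
    obtain ⟨l, rfl, T, hT, S, hc⟩ := det_ind hm hq hb ha h1 hq1 ((linkedS_symm h01).trans h0'); obtain ⟨v, hv, v0, v1⟩ := Tr_near (frontier_sub l hx)
    refine det_near hm ?_ v0 v1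
    by_contra hn
    exact ha T hT ⟨q, v, S, hq, by omega, hc v hv⟩
  refine Metric.diam_le_of_forall_dist_le (by positivity) (fun x hx y hy => ?_)
  obtain ⟨x0, x1⟩ := key x hx
  obtain ⟨y0, y1⟩ := key y hy
  rw [EuclideanSpace.dist_eq, Real.sqrt_le_iff]
  refine ⟨by positivity, ?_⟩
  rw [Fin.sum_univ_two, Real.dist_eq, Real.dist_eq, sq_abs, sq_abs]
  rw [abs_le] at *
  have e0 : (x 0 - y 0)^2 ≤ (6*m)^2 := sq_le_sq' (by linarith) (by linarith)
  have e1 : (x 1 - y 1)^2 ≤ (6*m)^2 := sq_le_sq' (by linarith) (by linarith)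
  nlinarith [sq_nonneg (m:ℝ)]

lemma none_pr {κ : ℝ} (L : ℕ) (B : FLat) (A : Lp → Prop) (h : ∀ s : FLp, (∀ l ∈ s, Cl l ∧ A l) → ∑ l ∈ s, wt l ≤ κ) :
    exp (-(κ/2)) ≤ Pr pr (LS L B) (fun T => ∀ l ∈ T, ¬ A l) := by
  rw [Pr_none, prod_none, exp_le_exp]
  have := h ((LS L B).filter A) (fun l hl => by
    rw [Finset.mem_filter, mem_LS] at hl; exact ⟨⟨hl.1.1, hl.1.2.2.1⟩, hl.2⟩)
  linarith

/-- the good event at mesoscopic scale `m` -/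
def Gd (m : ℕ) (N : FLat) (T : FLp) : Prop := ∀ z ∈ N, (∀ l ∈ T, ¬ Bad m (tr z l)) ∧ ¬ AX m z T

lemma Gd_pr {c : ℝ} (h0 : 0 ≤ c) {m L : ℕ} (hm : 1 ≤ m) (hc : c ≤ Pr pr (LS L (Rc (-(2*m)) (2*(2*m)) (-(2*m)) (4*(2*m)))) (fun T => ¬ XH T 0 (2*m) 0 (3*(2*m)))) (N : FLat) (B : FLat) :
    (exp (-(C1/2)) * c^4)^N.card ≤ Pr pr (LS L B) (Gd m N) := by
  have d1 : ∀ z, Decr (fun T : FLp => ∀ l ∈ T, ¬ Bad m (tr z l)) := fun z T T' h h' l hl => h' l (h hl)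
  have d2 : ∀ z, Decr (fun T : FLp => ¬ AX m z T) := by
    rintro z T T' h h' ⟨a, b, S, e1, e2, e3⟩; exact h' ⟨a, b, S, e1, e2, e3.mono (filter_subset_filter _ h) subset_rfl⟩
  refine le_trans ?_ (Pr_fkg_finset (s := LS L B) pr_bd N (fun z T => (∀ l ∈ T, ¬ Bad m (tr z l)) ∧ ¬ AX m z T)
    (fun z _ T T' h h' => ⟨d1 z T T' h h'.1, d2 z T T' h h'.2⟩))
  rw [← prod_const]
  refine prod_le_prod (fun _ _ => by positivity) (fun z _ => ?_)
  refine le_trans (mul_le_mul (none_pr L B (fun l => Bad m (tr z l)) (fun s hs => tr_mass hm z s hs)) (AX_pr h0 hc z B) (by positivity) (Pr_nonneg pr_bd _)) ?_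
  exact Pr_fkg pr_bd (d1 z) (d2 z)

lemma Gd_congr {m : ℕ} {N : FLat} (T T' : FLp) (h : ∀ l ∈ T, Cl l) (h' : ∀ l ∈ T', Cl l ∧ ∃ l' ∈ T, toU l = toU l') (hG : Gd m N T) : Gd m N T' := by
  intro z hz
  refine ⟨fun l hl hb => ?_, ?_⟩
  · obtain ⟨hc, l', hl', e⟩ := h' l hl; exact (hG z hz).1 l' hl' (bad_congr hc (h l' hl') e hb)
  · rintro ⟨a, b, S, e1, e2, e3⟩; refine (hG z hz).2 ⟨a, b, S, e1, e2, e3.mono_op ?_⟩; rintro x y ⟨l, hl, hE⟩; rw [Finset.mem_filter] at hl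
    obtain ⟨hc, l', hl', e⟩ := h' l hl.1; refine ⟨l', Finset.mem_filter.2 ⟨hl', fun u hu v hv => ?_⟩, ?_⟩
    · exact hl.2 u (toU_mem (h l' hl') hc e.symm hu) v (toU_mem (h l' hl') hc e.symm hv)
    · rwa [toU_hasE (h l' hl'), ← e, ← toU_hasE hc]

def ssgE (δ : ℝ) (r : ℤ) : Set Config := {ω | ∀ C' ∈ clustersS (frontiers (Config.loops ω)),
              (C' ∩ embS (box 0 r)).Nonempty → diam C' < δ * (r : ℝ)}

lemma case_big {c : ℝ} (h0 : 0 ≤ c) {m k : ℕ} (hm : 1 ≤ m) (hc : ∀ L : ℕ, c ≤ Pr pr (LS L (Rc (-(2*m)) (2*(2*m)) (-(2*m)) (4*(2*m)))) (fun T => ¬ XH T 0 (2*m) 0 (3*(2*m))))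
    {δ : ℝ} {r : ℤ} (hr : r ≤ k*m) (hd : 12*m < δ*r) {D : Set Lat} {α : ℝ} {P : Measure Config} (hP : IsLoopSoup D α P) (hα : α ≤ 1/2) :
    ENNReal.ofReal ((exp (-(C1/2)) * c^4 / (1 + c^4))^((2*k+1)^2)) ≤ P (ssgE δ r) := by
  set N := (Rc (-k) k (-k) k).image (fun v => ((m*v.1, m*v.2) : Lat)) with hN
  have hcard : N.card ≤ (2*k+1)^2 := by
    refine Finset.card_image_le.trans ?_
    rw [card_Rc, show ((k:ℤ) + 1 - -k).toNat = 2*k+1 by omega, sq]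
  have hx : exp (-(C1/2)) ≤ 1 := exp_le_one_iff.2 (by linarith [C1_pos])
  refine soup_lim hP hα (Gd m N) Gd_congr _ (fun L => ?_) _ (fun ω hω => ?_)
  · have hle : exp (-(C1/2)) * c^4 / (1 + c^4) ≤ 1 := by
      rw [div_le_one (by positivity)]
      nlinarith [show 0 ≤ c^4 by positivity]
    refine le_trans (pow_le_pow_of_le_one (by positivity) hle hcard) (le_trans (pow_le_pow_left₀ (by positivity) ?_ _) (Gd_pr h0 hm (hc L) N _))
    exact div_le_self (by positivity) (by linarith [show 0 ≤ c^4 by positivity])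
  · rintro C' hC ⟨p, hp, q, hq, rfl⟩; refine lt_of_le_of_lt ?_ hd; have hm0 : (0:ℤ) < m := by omega
    have hq : linf (q - 0) ≤ r := hq
    rw [sub_zero, linf_le] at hq
    have hz : ((m*(q.1/m), m*(q.2/m)) : Lat) ∈ N := by
      refine Finset.mem_image.2 ⟨(q.1/m, q.2/m), mem_Rc.2 ?_, rfl⟩
      refine ⟨⟨Int.le_ediv_of_mul_le hm0 ?_, Int.ediv_le_of_le_mul hm0 ?_⟩, Int.le_ediv_of_mul_le hm0 ?_, Int.ediv_le_of_le_mul hm0 ?_⟩ <;> linarith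
    refine det_diam hm (z := (m*(q.1/m), m*(q.2/m))) (q := q) ?_ (fun l hl hω' => ?_) (fun T hT => (hω T hT _ hz).2) hC hp
    · rw [linf_le]; simp only [Prod.fst_sub, Prod.snd_sub]; have e1 := Int.emod_add_mul_ediv q.1 m; have e2 := Int.emod_add_mul_ediv q.2 m
      have e3 := Int.emod_nonneg q.1 hm0.ne'; have e4 := Int.emod_nonneg q.2 hm0.ne'; have e5 := Int.emod_lt_of_pos q.1 hm0
      have e6 := Int.emod_lt_of_pos q.2 hm0; refine ⟨⟨?_, ?_⟩, ?_, ?_⟩ <;> linarith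
    · exact (hω {l} (by simp [hl, hω']) _ hz).1 l (by simp)

lemma case_small {r : ℕ} (hr1 : 1 ≤ r) {r0 : ℕ} (hr : r ≤ r0) {δ : ℝ} {D : Set Lat} {α : ℝ} {P : Measure Config} (hP : IsLoopSoup D α P) (hα : α ≤ 1/2) :
    ENNReal.ofReal (exp (-((C1 + (6*r0+1)^2)/2))) ≤ P (ssgE δ r) := by
  have tr0 : ∀ l : Lp, ∀ v, v ∈ path (tr 0 l).1 (tr 0 l).2 ↔ v ∈ path l.1 l.2 := by intro l v; rw [mem_path_tr, add_zero]
  set A : Lp → Prop := fun l => Bad r (tr 0 l) ∨ ∀ v ∈ path l.1 l.2, linf v ≤ 3*r with hA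
  refine soup_lim hP hα (fun T => ∀ l ∈ T, ¬ A l) ?_ _ (fun L => none_pr L _ A (fun s hs => ?_)) _ (fun ω hω => ?_)
  · intro T T' h h' hG l hl hb; obtain ⟨hc, l', hl', e⟩ := h' l hl
    exact hG l' hl' (hb.imp (bad_congr hc (h l' hl') e) (fun hb v hv => hb v (toU_mem (h l' hl') hc e.symm hv)))
  · rw [← Finset.sum_filter_add_sum_filter_not s (fun l => Bad r (tr 0 l))]
    have a1 := tr_mass hr1 0 (s.filter (fun l => Bad r (tr 0 l))) (fun l hl => by rw [Finset.mem_filter] at hl; exact ⟨(hs l hl.1).1, hl.2⟩)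
    have a2 := box_mass (s.filter (fun l => ¬ Bad r (tr 0 l))) (Rc (-(3*r)) (3*r) (-(3*r)) (3*r)) (fun l hl => by
      rw [Finset.mem_filter] at hl; have := ((hs l hl.1).2.resolve_left hl.2) l.1 (by cases h : l.2 <;> simp [path])
      rw [linf_le] at this; rw [mem_Rc]; exact this) (fun l hl => by rw [Finset.mem_filter] at hl; exact (hs l hl.1).1)
    rw [card_Rc, show ((3*r:ℤ) + 1 - -(3*r)).toNat = 6*r+1 by omega] at a2
    push_cast at a2; have hrr : (r:ℝ) ≤ r0 := by exact_mod_cast hr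
    nlinarith [show (0:ℝ) ≤ r by positivity]
  · rintro C' ⟨S0, -, rfl⟩ ⟨p, hp, q, hq, rfl⟩; exfalso; simp only [mem_setOf_eq, mem_iUnion, exists_prop] at hp; obtain ⟨S1, ⟨h1, -⟩, hq1⟩ := hp
    obtain ⟨l, hl, hω', rfl⟩ := fr_cases h1; have hn := hω {l} (by simp [hl, hω']) l (by simp)
    have hql := Tr_lat (frontier_sub l hq1); have hq : linf (q - 0) ≤ r := hq
    have hqz : |emb q 0 - (0:Lat).1| ≤ 3*r ∧ |emb q 1 - (0:Lat).2| ≤ 3*r := det_near hr1 (v := q) (by omega) (by rw [emb_0]; simp) (by rw [emb_1]; simp)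
    have hrr : (1:ℝ) ≤ r := by exact_mod_cast hr1
    have hS := big_avoid hr1 (fun h => hn (Or.inl h)) hq1 (by linarith) (by linarith)
    refine hn (Or.inr fun v hv => ?_)
    have := linf_tri v q 0; have h2 := hS v hv q hql; rw [sub_zero] at this; omega

lemma main_aux : ∀ δ : ℝ, 0 < δ → ∃ C : ℝ, 0 < C ∧ ∀ (α : ℝ) (r R : ℤ) (P : Measure Config),
    0 < α → α ≤ 1 / 2 → 1 ≤ r → r < R → IsLoopSoup (box 0 R) α P → ENNReal.ofReal C ≤ P (ssgE δ r) := by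
  intro δ hδ
  obtain ⟨c, hc0, M, hM, hec⟩ := easy_cross one_arm
  obtain ⟨k, hk⟩ := exists_nat_ge (26/δ)
  obtain ⟨r0, hr0⟩ := exists_nat_ge (13*M/δ)
  have hM1 : (1:ℝ) ≤ M := by exact_mod_cast hM
  refine ⟨min ((exp (-(C1/2)) * c^4 / (1 + c^4))^((2*k+1)^2)) (exp (-((C1 + (6*r0+1)^2)/2))), lt_min (by positivity) (by positivity), ?_⟩
  intro α r R P _ hα hr1 _ hP
  rw [div_le_iff₀ hδ] at hk hr0
  have hrp : (1:ℝ) ≤ r := by exact_mod_cast hr1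
  by_cases h : 13*M ≤ δ*r
  · refine le_trans (ENNReal.ofReal_le_ofReal (min_le_left _ _)) ?_
    set b := ⌊δ*r/(13*M)⌋₊ with hb; have hb1 : 1 ≤ b := (Nat.one_le_floor_iff _).2 ((one_le_div (by positivity)).2 h)
    have hb2 : (b:ℝ) ≤ δ*r/(13*M) := Nat.floor_le (by positivity)
    have hb3 : δ*r/(13*M) < b + 1 := Nat.lt_floor_add_one _
    rw [le_div_iff₀ (by positivity)] at hb2
    rw [div_lt_iff₀ (by positivity)] at hb3
    have hb1' : (1:ℝ) ≤ b := by exact_mod_cast hb1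
    have hMb : 1 ≤ (M:ℝ)*b := by nlinarith
    refine case_big (m := M*b) (k := k) hc0.le (Nat.mul_pos hM hb1) (fun L => hec b hb1 L _ (by push_cast; ring)) ?_ ?_ hP hα
    · rw [← Int.cast_le (R := ℝ)]; push_cast; have e1 : δ*r ≤ 26*(M*b) := by nlinarith
      have e2 : 26*((M:ℝ)*b) ≤ (k*δ)*(M*b) := mul_le_mul_of_nonneg_right hk (by linarith)
      refine le_of_mul_le_mul_left ?_ hδ
      linarith
    · push_cast; linarith
  · refine le_trans (ENNReal.ofReal_le_ofReal (min_le_right _ _)) ?_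
    lift r to ℕ using (by omega)
    refine case_small (by omega) ?_ hP hα
    push_cast at h; have : (r:ℝ) ≤ r0 := by nlinarith
    exact_mod_cast this

end Aux

/-- For every `δ > 0` there is `C(δ) > 0` such that for every intensity
`α ∈ (0,1/2]` and all `1 ≤ r < R`, with probability at least `C(δ)` every cluster of the
frontier loop soup `𝓛^b_R` which meets `B_r` has (Euclidean) diameter smaller than
`δr`. -/
theorem frontier_clusters_small :
    ∀ δ : ℝ, 0 < δ →
    ∃ C : ℝ, 0 < C ∧
      ∀ (α : ℝ) (r R : ℤ) (P : Measure Config),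
        0 < α → α ≤ 1 / 2 → 1 ≤ r → r < R → IsLoopSoup (box 0 R) α P →
        ENNReal.ofReal C ≤
          P {ω | ∀ C' ∈ clustersS (frontiers (Config.loops ω)),
              (C' ∩ embS (box 0 r)).Nonempty → Metric.diam C' < δ * (r : ℝ)} := by
  exact main_aux

end RWLSPaper
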